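/- Assume additionally p < n/s. Let μ be a nonnegative Borel measure with finite total mass, g ∈ W^{s,p}_loc(ℝⁿ) ∩ L^{p−1}_{sp}(ℝⁿ), and let u be a SOLA of the Dirichlet problem −L_Φ u = μ in Ω, u = g on ℝⁿ∖Ω which is nonnegative in a ball B_r(x₀) ⊂ Ω and whose approximating sequence μ_j consists of nonnegative functions. If W^μ_{s,p}(x₀, r/8) is finite, then W^μ_{s,p}(x₀, r/8) ≤ c·u(x₀) + c·Tail(u₋; x₀, r/2) for a constant c depending only on n, s, p, Λ, where u(x₀) := lim_{ρ→0}(u)_{B_ρ(x₀)} is the precise representative and u₋ := max{−u, 0}. If instead W^μ_{s,p}(x₀, r/8) = ∞, then lim_{t→0}(u)_{B_t(x₀)} = ∞. Consequently every point of B_r(x₀) is a Lebesgue point of u. -/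

import Mathlib

noncomputable section

open MeasureTheory Metric Set Filter Topology
open scoped ENNReal NNReal

/-- Euclidean space `ℝⁿ`. -/
abbrev Rn (n : ℕ) : Type := EuclideanSpace ℝ (Fin n)

/-- `q_* = max {1, p-1}`. -/
def qStar (p : ℝ) : ℝ := max 1 (p - 1)

/-- `q̄ = min {n(p-1)/(n-s), p}`. -/
def qBar (n : ℕ) (s p : ℝ) : ℝ := min ((n : ℝ) * (p - 1) / ((n : ℝ) - s)) p

/-- Gagliardo seminorm raised to the power `p`, as an `ℝ≥0∞`-valued double integral. -/
def gagliardo (n : ℕ) (s p : ℝ) (O : Set (Rn n)) (v : Rn n → ℝ) : ℝ≥0∞ :=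
  ∫⁻ x in O, ∫⁻ y in O, ENNReal.ofReal (|v x - v y| ^ p / ‖x - y‖ ^ ((n : ℝ) + s * p))

/-- `v ∈ W^{s,p}(O)`. -/
def memWsp (n : ℕ) (s p : ℝ) (O : Set (Rn n)) (v : Rn n → ℝ) : Prop :=
  AEMeasurable v (volume.restrict O) ∧
    (∫⁻ x in O, ENNReal.ofReal (|v x| ^ p)) < ⊤ ∧ gagliardo n s p O v < ⊤

/-- `Tail(v; x₀, r)`. -/
def tailFn (n : ℕ) (s p : ℝ) (v : Rn n → ℝ) (x₀ : Rn n) (r : ℝ) : ℝ≥0∞ :=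
  (ENNReal.ofReal (r ^ (s * p)) *
      ∫⁻ x in (ball x₀ r)ᶜ,
        ENNReal.ofReal (|v x| ^ (p - 1) / ‖x - x₀‖ ^ ((n : ℝ) + s * p))) ^ (1 / (p - 1))

/-- `v ∈ L^{p-1}_{sp}(ℝⁿ)`. -/
def memTailSpace (n : ℕ) (s p : ℝ) (v : Rn n → ℝ) : Prop :=
  AEMeasurable v (volume : Measure (Rn n)) ∧
    (∀ R : ℝ, (∫⁻ x in ball (0 : Rn n) R, ENNReal.ofReal (|v x| ^ (p - 1))) < ⊤) ∧
    ∀ z : Rn n, ∀ r : ℝ, 0 < r → tailFn n s p v z r < ⊤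

/-- `φ ∈ C_0^∞(O)`. -/
def IsTestFun (n : ℕ) (O : Set (Rn n)) (φ : Rn n → ℝ) : Prop :=
  ContDiff ℝ (⊤ : ℕ∞) φ ∧ HasCompactSupport φ ∧ tsupport φ ⊆ O

/-- The nonlocal form `⟨-L_Φ u, φ⟩`. -/
def nonlocalForm (n : ℕ) (Φ : ℝ → ℝ) (K : Rn n → Rn n → ℝ) (u φ : Rn n → ℝ) : ℝ :=
  ∫ x : Rn n, ∫ y : Rn n, Φ (u x - u y) * (φ x - φ y) * K x y

/-- Ellipticity/coercivity bounds on the kernel `K`. -/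
def KernelBounds (n : ℕ) (Λ s p : ℝ) (K : Rn n → Rn n → ℝ) : Prop :=
  Measurable (Function.uncurry K) ∧
    ∀ x y : Rn n, x ≠ y →
      1 / (Λ * ‖x - y‖ ^ ((n : ℝ) + s * p)) ≤ K x y ∧
        K x y ≤ Λ / ‖x - y‖ ^ ((n : ℝ) + s * p)

/-- Structure conditions on `Φ`. -/
def PhiBounds (Λ p : ℝ) (Φ : ℝ → ℝ) : Prop :=
  Continuous Φ ∧ Φ 0 = 0 ∧
    ∀ t : ℝ, |t| ^ p / Λ ≤ Φ t * t ∧ Φ t * t ≤ Λ * |t| ^ p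

/-- `∫ φ dμ` for a signed measure `μ`. -/
def sintegral (n : ℕ) (μ : MeasureTheory.SignedMeasure (Rn n)) (φ : Rn n → ℝ) : ℝ :=
  (∫ x, φ x ∂μ.toJordanDecomposition.posPart) -
    ∫ x, φ x ∂μ.toJordanDecomposition.negPart

/-- Weak (energy) solution of `-L_Φ u = f` in `Ω`, `u = g` on `ℝⁿ ∖ Ω`. -/
def WeakSol (n : ℕ) (Φ : ℝ → ℝ) (K : Rn n → Rn n → ℝ) (s p : ℝ)
    (Ω : Set (Rn n)) (f g u : Rn n → ℝ) : Prop :=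
  memWsp n s p univ u ∧ (∀ᵐ x : Rn n, x ∉ Ω → u x = g x) ∧
    ∀ φ : Rn n → ℝ, IsTestFun n Ω φ → nonlocalForm n Φ K u φ = ∫ x : Rn n, φ x * f x

/-- Weak subsolution of the homogeneous equation `-L_Φ w = 0` in `Ω`. -/
def WeakSubSol (n : ℕ) (Φ : ℝ → ℝ) (K : Rn n → Rn n → ℝ) (s p : ℝ)
    (Ω : Set (Rn n)) (w : Rn n → ℝ) : Prop :=
  memWsp n s p univ w ∧
    ∀ φ : Rn n → ℝ, IsTestFun n Ω φ → (∀ x, 0 ≤ φ x) → nonlocalForm n Φ K w φ ≤ 0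

/-- The approximation properties required of a SOLA. -/
def SOLAApprox (n : ℕ) (Φ : ℝ → ℝ) (K : Rn n → Rn n → ℝ) (s p : ℝ)
    (Ω : Set (Rn n)) (μ : MeasureTheory.SignedMeasure (Rn n)) (g u : Rn n → ℝ)
    (uj μj gj : ℕ → Rn n → ℝ) : Prop :=
  (∀ j, ContDiff ℝ (⊤ : ℕ∞) (μj j) ∧ HasCompactSupport (μj j)) ∧
  (∀ j, ContDiff ℝ (⊤ : ℕ∞) (gj j) ∧ HasCompactSupport (gj j)) ∧
  (∀ j, WeakSol n Φ K s p Ω (μj j) (gj j) (uj j)) ∧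
  (∀ᵐ x : Rn n, Tendsto (fun j => uj j x) atTop (𝓝 (u x))) ∧
  (∀ q : ℝ, qStar p ≤ q → q < qBar n s p → ∀ z : Rn n, ∀ r : ℝ, 0 < r →
    Tendsto (fun j => ∫⁻ x in ball z r, ENNReal.ofReal (|uj j x - u x| ^ q)) atTop (𝓝 0)) ∧
  (∀ φ : Rn n → ℝ, Continuous φ → HasCompactSupport φ → tsupport φ ⊆ Ω →
    Tendsto (fun j => ∫ x : Rn n, φ x * μj j x) atTop (𝓝 (sintegral n μ φ))) ∧
  (∀ z : Rn n, ∀ r : ℝ, 0 < r →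
    Filter.limsup (fun j => ∫⁻ x in ball z r, ENNReal.ofReal |μj j x|) atTop
      ≤ μ.totalVariation (closedBall z r)) ∧
  (∀ z : Rn n, ∀ r : ℝ, 0 < r →
    Tendsto (fun j =>
        (∫⁻ x in ball z r, ENNReal.ofReal (|gj j x - g x| ^ p)) +
          gagliardo n s p (ball z r) (fun x => gj j x - g x)) atTop (𝓝 0) ∧
      Tendsto (fun j => tailFn n s p (fun x => gj j x - g x) z r) atTop (𝓝 0))

/-- SOLA of the Dirichlet problem `-L_Φ u = μ` in `Ω`, `u = g` on `ℝⁿ ∖ Ω`. -/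
def IsSOLA (n : ℕ) (Φ : ℝ → ℝ) (K : Rn n → Rn n → ℝ) (s p : ℝ)
    (Ω : Set (Rn n)) (μ : MeasureTheory.SignedMeasure (Rn n)) (g u : Rn n → ℝ) : Prop :=
  (∀ h q : ℝ, 0 < h → h < s → qStar p ≤ q → q < qBar n s p → memWsp n h q Ω u) ∧
  (∀ φ : Rn n → ℝ, IsTestFun n Ω φ → nonlocalForm n Φ K u φ = sintegral n μ φ) ∧
  (∀ᵐ x : Rn n, x ∉ Ω → u x = g x) ∧
  ∃ uj μj gj : ℕ → Rn n → ℝ, SOLAApprox n Φ K s p Ω μ g u uj μj gj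

/-- Truncated Wolff potential `W^ν_{s,p}(x₀, r)`. -/
def wolff (n : ℕ) (s p : ℝ) (ν : Measure (Rn n)) (x₀ : Rn n) (r : ℝ) : ℝ≥0∞ :=
  ∫⁻ ρ in Ioc (0 : ℝ) r,
    (ν (ball x₀ ρ) / ENNReal.ofReal (ρ ^ ((n : ℝ) - s * p))) ^ (1 / (p - 1)) /
      ENNReal.ofReal ρ

/-- Integral average of `u` over `B_r(x₀)`. -/
def ballAvg (n : ℕ) (u : Rn n → ℝ) (x₀ : Rn n) (r : ℝ) : ℝ :=
  ⨍ x in ball x₀ r, u x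

/-- Local excess `A(f; x₀, r)`. -/
def locExcess (n : ℕ) (p : ℝ) (f : Rn n → ℝ) (x₀ : Rn n) (r : ℝ) : ℝ≥0∞ :=
  ((volume (ball x₀ r))⁻¹ *
      ∫⁻ x in ball x₀ r, ENNReal.ofReal (|f x - ballAvg n f x₀ r| ^ qStar p)) ^ (1 / qStar p)

/-- Global excess `E(f; x₀, r)`. -/
def excess (n : ℕ) (s p : ℝ) (f : Rn n → ℝ) (x₀ : Rn n) (r : ℝ) : ℝ≥0∞ :=
  locExcess n p f x₀ r + tailFn n s p (fun x => f x - ballAvg n f x₀ r) x₀ r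

/-- `g ∈ W^{s,p}_loc(ℝⁿ) ∩ L^{p-1}_{sp}(ℝⁿ)`. -/
def BoundaryDatum (n : ℕ) (s p : ℝ) (g : Rn n → ℝ) : Prop :=
  (∀ z : Rn n, ∀ r : ℝ, 0 < r → memWsp n s p (ball z r) g) ∧ memTailSpace n s p g

/-- Symmetric measurable kernel with ellipticity bounds. -/
def SymKernel (n : ℕ) (Λ s p : ℝ) (Kt : Rn n → Rn n → ℝ) : Prop :=
  KernelBounds n Λ s p Kt ∧ ∀ x y : Rn n, Kt x y = Kt y x

/-- Weak solution of the kernel-`Kt` fractional `p`-Laplace equation with datum `f` in `O`. -/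
def WeakSolP (n : ℕ) (Kt : Rn n → Rn n → ℝ) (s p : ℝ) (O : Set (Rn n))
    (f u : Rn n → ℝ) : Prop :=
  memWsp n s p univ u ∧
    ∀ φ : Rn n → ℝ, IsTestFun n O φ →
      (∫ x : Rn n, ∫ y : Rn n,
          |u x - u y| ^ (p - 2) * (u x - u y) * (φ x - φ y) * Kt x y) =
        ∫ x : Rn n, φ x * f x

namespace NonlocalWolff

section Scalar

/-- The odd extension `t ↦ |t|^{p-2} t`. -/
def sg (p t : ℝ) : ℝ := if 0 ≤ t then t ^ (p - 1) else -(-t) ^ (p - 1)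

lemma sg_of_nonneg {p t : ℝ} (ht : 0 ≤ t) : sg p t = t ^ (p - 1) := if_pos ht

lemma sg_neg {p : ℝ} (hp : 1 < p) (t : ℝ) : sg p (-t) = -sg p t := by
  have hp' : p - 1 ≠ 0 := by linarith
  unfold sg
  rcases lt_trichotomy t 0 with h | h | h
  · rw [if_pos (by linarith), if_neg (by linarith), neg_neg]
  · subst h; simp [Real.zero_rpow hp']
  · rw [if_neg (by linarith), if_pos h.le, neg_neg]

lemma sg_zero {p : ℝ} (hp : 1 < p) : sg p 0 = 0 := by
  rw [sg_of_nonneg le_rfl, Real.zero_rpow (by linarith)]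

lemma abs_sg {p : ℝ} (hp : 1 < p) (t : ℝ) : |sg p t| = |t| ^ (p - 1) := by
  rcases le_total 0 t with h | h
  · rw [sg_of_nonneg h, abs_of_nonneg h, abs_of_nonneg (Real.rpow_nonneg h _)]
  · have : sg p t = -sg p (-t) := by rw [sg_neg hp, neg_neg]
    rw [this, abs_neg, sg_of_nonneg (by linarith), abs_of_nonpos h,
      abs_of_nonneg (Real.rpow_nonneg (by linarith) _)]

lemma sg_mul {p : ℝ} {c : ℝ} (hc : 0 < c) (t : ℝ) : sg p (c * t) = c ^ (p - 1) * sg p t := by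
  unfold sg
  by_cases h : 0 ≤ t
  · rw [if_pos h, if_pos (mul_nonneg hc.le h), Real.mul_rpow hc.le h]
  · rw [if_neg h, if_neg (by nlinarith), show -(c * t) = c * (-t) by ring,
      Real.mul_rpow hc.le (by linarith)]
    ring

lemma rpow_sub_rpow_le {p a b : ℝ} (hp : 1 ≤ p) (hb : 0 ≤ b) (hab : b ≤ a) :
    a ^ p - b ^ p ≤ p * a ^ (p - 1) * (a - b) := by
  rcases (hb.trans hab).eq_or_lt with h | ha
  · have : b = a := le_antisymm hab (h ▸ hb)
    simp [this]
  have h1 := one_add_mul_self_le_rpow_one_add (s := b / a - 1) (p := p)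
    (by have : 0 ≤ b / a := by positivity
        linarith) hp
  rw [add_sub_cancel, Real.div_rpow hb ha.le, le_div_iff₀ (by positivity)] at h1
  have h2 : a ^ p = a ^ (p - 1) * a := by
    rw [← Real.rpow_add_one ha.ne', sub_add_cancel]
  have h3 : (1 + p * (b / a - 1)) * a ^ p = a ^ p - p * a ^ (p - 1) * (a - b) := by
    rw [h2]; field_simp; ring
  linarith

/-- Tangent line inequality for `x ↦ x^{1-β}` with `β > 1`. -/
lemma rpow_one_sub_sub_ge {β x y : ℝ} (hβ : 1 < β) (hy : 0 < y) (hxy : y ≤ x) :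
    (β - 1) * (x - y) * x ^ (-β) ≤ y ^ (1 - β) - x ^ (1 - β) := by
  have hx : 0 < x := hy.trans_le hxy
  have h1 := one_add_mul_self_le_rpow_one_add (s := x / y - 1) (p := β)
    (by have : 0 ≤ x / y := by positivity
        linarith) hβ.le
  rw [add_sub_cancel, Real.div_rpow hx.le hy.le, le_div_iff₀ (by positivity)] at h1
  have ex : x ^ (1 - β) = x * x ^ (-β) := by
    rw [sub_eq_add_neg, Real.rpow_add hx, Real.rpow_one]
  have ey : y ^ (1 - β) = y * (y ^ β)⁻¹ := by
    rw [sub_eq_add_neg, Real.rpow_add hy, Real.rpow_one, Real.rpow_neg hy.le]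
  rw [ex, ey, Real.rpow_neg hx.le]
  have hxb : 0 < x ^ β := by positivity
  have hyb : 0 < y ^ β := by positivity
  have key : ((β - 1) * (x - y) + x) * y ^ β ≤ y * x ^ β := by
    have h4 : (1 + β * (x / y - 1)) * y ^ β * y ≤ x ^ β * y :=
      mul_le_mul_of_nonneg_right h1 hy.le
    have h5 : (1 + β * (x / y - 1)) * y ^ β * y = (y + β * (x - y)) * y ^ β := by
      field_simp
    nlinarith
  have : ((β - 1) * (x - y) + x) * (x ^ β)⁻¹ ≤ y * (y ^ β)⁻¹ := by
    rw [← div_eq_mul_inv, ← div_eq_mul_inv, div_le_div_iff₀ hxb hyb]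
    exact key
  nlinarith

lemma rpow_sub_rpow_le_of_le_one {α x y : ℝ} (hα1 : α ≤ 1) (hy : 0 < y)
    (hxy : y ≤ x) : x ^ α - y ^ α ≤ (x - y) * x ^ (α - 1) := by
  have hx : 0 < x := hy.trans_le hxy
  have h1 : y / x ≤ (y / x) ^ α := by
    have := Real.rpow_le_rpow_of_exponent_ge (x := y / x) (by positivity)
      ((div_le_one hx).2 hxy) hα1
    rwa [Real.rpow_one] at this
  rw [Real.div_rpow hy.le hx.le, div_le_div_iff₀ hx (by positivity)] at h1
  have h2 : x ^ α = x ^ (α - 1) * x := by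
    rw [← Real.rpow_add_one hx.ne', sub_add_cancel]
  rw [h2] at h1 ⊢
  have h3 : y * x ^ (α - 1) ≤ y ^ α := by
    have : (y * x ^ (α - 1)) * x ≤ y ^ α * x := by linarith
    exact le_of_mul_le_mul_right this hx
  nlinarith

/-- The cutoff absorption inequality. -/
lemma cutoff_absorb {p : ℝ} (hp : 1 < p) : ∃ C : ℝ, 0 < C ∧ ∀ A D h η₁ η₂ : ℝ,
    0 ≤ A → 0 ≤ D → 0 ≤ h → 0 ≤ η₁ → 0 ≤ η₂ → A ^ p ≤ h * D ^ (p - 1) →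
    A * (η₁ ^ p - η₂ ^ p) ≤ 1 / 2 * D * η₂ ^ p + C * |η₁ - η₂| ^ p * (A + h) := by
  set C1 : ℝ := p * 2 ^ (p - 1) with hC1
  have hC1p : 0 < C1 := by positivity
  refine ⟨C1 + C1 * (2 * C1) ^ (p - 1), by positivity, ?_⟩
  intro A D h η₁ η₂ hA hD hh h1 h2 hAD
  have hp0 : p - 1 ≠ 0 := by linarith
  have hpp : 0 ≤ p - 1 := by linarith
  rcases le_total η₁ η₂ with hle | hle
  · have : η₁ ^ p ≤ η₂ ^ p := Real.rpow_le_rpow h1 hle (by linarith)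
    have h3 : A * (η₁ ^ p - η₂ ^ p) ≤ 0 := mul_nonpos_of_nonneg_of_nonpos hA (by linarith)
    have : 0 ≤ 1 / 2 * D * η₂ ^ p + (C1 + C1 * (2 * C1) ^ (p - 1)) * |η₁ - η₂| ^ p * (A + h) := by
      positivity
    linarith
  obtain ⟨δ, hδ⟩ : ∃ δ, δ = η₁ - η₂ := ⟨_, rfl⟩
  have hδ0 : 0 ≤ δ := by linarith
  rw [← hδ, abs_of_nonneg hδ0]
  have hm := rpow_sub_rpow_le hp.le h2 hle
  rw [← hδ] at hm
  have hδp : 0 ≤ δ ^ p := by positivity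
  rcases le_or_gt η₂ δ with hc | hc
  · have h3 : η₁ ^ (p - 1) ≤ 2 ^ (p - 1) * δ ^ (p - 1) := by
      rw [← Real.mul_rpow (by norm_num) hδ0]
      exact Real.rpow_le_rpow h1 (by linarith) hpp
    have h4 : δ ^ p = δ ^ (p - 1) * δ := by
      rcases hδ0.eq_or_lt with h | h
      · rw [← h, Real.zero_rpow (by linarith)]; simp
      · rw [← Real.rpow_add_one h.ne', sub_add_cancel]
    have h5 : η₁ ^ p - η₂ ^ p ≤ C1 * δ ^ p := by
      rw [h4, hC1]
      calc _ ≤ p * η₁ ^ (p - 1) * δ := hm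
        _ ≤ p * (2 ^ (p - 1) * δ ^ (p - 1)) * δ := by gcongr
        _ = _ := by ring
    have h6 : A * (η₁ ^ p - η₂ ^ p) ≤ A * (C1 * δ ^ p) := by gcongr
    have h7 : 0 ≤ 1 / 2 * D * η₂ ^ p := by positivity
    have h8 : 0 ≤ C1 * (2 * C1) ^ (p - 1) * δ ^ p * (A + h) := by positivity
    have h9 : 0 ≤ C1 * δ ^ p * h := by positivity
    nlinarith
  · have hη2 : 0 < η₂ := lt_of_le_of_lt hδ0 hc
    have h3 : η₁ ^ (p - 1) ≤ 2 ^ (p - 1) * η₂ ^ (p - 1) := by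
      rw [← Real.mul_rpow (by norm_num) h2]
      exact Real.rpow_le_rpow h1 (by linarith) hpp
    have h5 : η₁ ^ p - η₂ ^ p ≤ C1 * η₂ ^ (p - 1) * δ := by
      rw [hC1]
      calc _ ≤ p * η₁ ^ (p - 1) * δ := hm
        _ ≤ p * (2 ^ (p - 1) * η₂ ^ (p - 1)) * δ := by gcongr
        _ = _ := by ring
    have h6 : A * (η₁ ^ p - η₂ ^ p) ≤ A * (C1 * η₂ ^ (p - 1) * δ) := by gcongr
    have h4 : η₂ ^ p = η₂ ^ (p - 1) * η₂ := by
      rw [← Real.rpow_add_one hη2.ne', sub_add_cancel]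
    rcases le_or_gt (2 * C1 * A * δ) (D * η₂) with hd | hd
    · have h7 : A * (C1 * η₂ ^ (p - 1) * δ) ≤ 1 / 2 * D * η₂ ^ p := by
        rw [h4]
        have : η₂ ^ (p - 1) * (2 * C1 * A * δ) ≤ η₂ ^ (p - 1) * (D * η₂) := by gcongr
        nlinarith
      have h8 : 0 ≤ (C1 + C1 * (2 * C1) ^ (p - 1)) * δ ^ p * (A + h) := by positivity
      linarith
    · have hApos : 0 < A := by
        rcases hA.eq_or_lt with h | h
        · rw [← h] at hd; simp at hd; nlinarith [mul_nonneg hD h2]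
        · exact h
      have hDpos : 0 < D := by
        rcases hD.eq_or_lt with h | h
        · rw [← h, Real.zero_rpow hp0] at hAD
          have : 0 < A ^ p := by positivity
          linarith
        · exact h
      have hδpos : 0 < δ := by
        rcases hδ0.eq_or_lt with h | h
        · rw [← h] at hd; simp at hd; nlinarith
        · exact h
      have h7 : (D * η₂) ^ (p - 1) ≤ (2 * C1 * A * δ) ^ (p - 1) :=
        Real.rpow_le_rpow (by positivity) hd.le hpp
      rw [Real.mul_rpow hD h2, Real.mul_rpow (by positivity) hδ0,
        Real.mul_rpow (by positivity) hA] at h7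
      have hAp : A ^ p = A ^ (p - 1) * A := by
        rw [← Real.rpow_add_one hApos.ne', sub_add_cancel]
      have hdp : δ ^ p = δ ^ (p - 1) * δ := by
        rw [← Real.rpow_add_one hδpos.ne', sub_add_cancel]
      have h8 : A * (C1 * η₂ ^ (p - 1) * δ) ≤ C1 * (2 * C1) ^ (p - 1) * δ ^ p * h := by
        have hDp : 0 < D ^ (p - 1) := by positivity
        refine le_of_mul_le_mul_left ?_ hDp
        calc D ^ (p - 1) * (A * (C1 * η₂ ^ (p - 1) * δ))
            = A * C1 * δ * (D ^ (p - 1) * η₂ ^ (p - 1)) := by ring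
          _ ≤ A * C1 * δ * ((2 * C1) ^ (p - 1) * A ^ (p - 1) * δ ^ (p - 1)) := by gcongr
          _ = C1 * (2 * C1) ^ (p - 1) * δ ^ p * A ^ p := by rw [hAp, hdp]; ring
          _ ≤ C1 * (2 * C1) ^ (p - 1) * δ ^ p * (h * D ^ (p - 1)) := by gcongr
          _ = _ := by ring
      have h9 : 0 ≤ 1 / 2 * D * η₂ ^ p := by positivity
      have h10 : 0 ≤ C1 * δ ^ p * (A + h) := by positivity
      have h11 : 0 ≤ C1 * (2 * C1) ^ (p - 1) * δ ^ p * A := by positivity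
      nlinarith

lemma rpow_pred_mul {p t : ℝ} (hp : 1 < p) (ht : 0 ≤ t) : t ^ (p - 1) * t = t ^ p := by
  rcases ht.eq_or_lt with h | h
  · rw [← h, Real.zero_rpow (by linarith : p ≠ 0)]; simp
  · rw [← Real.rpow_add_one h.ne', sub_add_cancel]

end Scalar

/-- Increments of the truncated power `(1 + a₊)^{1-β}`, bounded from below. -/
lemma one_add_rpow_sub_ge {p β a b : ℝ} (hβ : 1 < β) (hp : 1 < p) (hb : 0 ≤ b) (hab : b ≤ a) :
    (β - 1) ^ (p - 1) * ((a - b) ^ (p - 1)) ^ p * (1 + a) ^ (-(β * (p - 1))) ≤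
      ((a - b) ^ (p - 1) * ((1 + b) ^ (1 - β) - (1 + a) ^ (1 - β))) ^ (p - 1) := by
  have ha : 0 < 1 + a := by linarith
  have ht : 0 ≤ a - b := by linarith
  have h1 := rpow_one_sub_sub_ge (x := 1 + a) (y := 1 + b) hβ (by linarith) (by linarith)
  have hβ' : 0 < β - 1 := by linarith
  have h2 : (β - 1) * (a - b) ^ p * (1 + a) ^ (-β) ≤
      (a - b) ^ (p - 1) * ((1 + b) ^ (1 - β) - (1 + a) ^ (1 - β)) := by
    rw [← rpow_pred_mul hp ht]
    have : (a - b) ^ (p - 1) * ((β - 1) * (1 + a - (1 + b)) * (1 + a) ^ (-β)) ≤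
      (a - b) ^ (p - 1) * ((1 + b) ^ (1 - β) - (1 + a) ^ (1 - β)) := by gcongr
    refine le_trans (le_of_eq ?_) this
    ring
  have h3 := Real.rpow_le_rpow (by positivity) h2 (by linarith : 0 ≤ p - 1)
  refine le_trans (le_of_eq ?_) h3
  rw [Real.mul_rpow (by positivity) (by positivity), Real.mul_rpow (by positivity) (by positivity),
    ← Real.rpow_mul ht, ← Real.rpow_mul ht, ← Real.rpow_mul ha.le]
  ring_nf

lemma sg_mul_sub_comm {p : ℝ} (hp : 1 < p) (a b X Y : ℝ) :
    sg p (a - b) * (X - Y) = sg p (b - a) * (Y - X) := by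
  rw [show a - b = -(b - a) by ring, sg_neg hp]; ring

/-- The profile `1 - (1 + a₊)^{1-β}` used to bound subsolutions from above. -/
def upF (β a : ℝ) : ℝ := 1 - (1 + max a 0) ^ (1 - β)

lemma sub_rpow_abs_le {p β a b : ℝ} (hβ : 1 < β) (hβp : β < p) (hb : 0 ≤ b) (hab : b ≤ a) :
    |(1 + a) ^ ((p - β) / p) - (1 + b) ^ ((p - β) / p)| ^ p ≤ (a - b) ^ p * (1 + a) ^ (-β) := by
  have hp : 0 < p := by linarith
  have hm : (1 + b) ^ ((p - β) / p) ≤ (1 + a) ^ ((p - β) / p) :=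
    Real.rpow_le_rpow (by linarith) (by linarith) (by apply div_nonneg <;> linarith)
  rw [abs_of_nonneg (by linarith)]
  have h := rpow_sub_rpow_le_of_le_one (α := (p - β) / p) (x := 1 + a) (y := 1 + b)
    (by rw [div_le_one hp]; linarith) (by linarith) (by linarith)
  have h2 := Real.rpow_le_rpow (by linarith) h hp.le
  refine h2.trans (le_of_eq ?_)
  rw [Real.mul_rpow (by linarith) (by apply Real.rpow_nonneg; linarith),
    ← Real.rpow_mul (by linarith)]
  congr 2
  · ring
  · field_simp; ring

lemma upF_nonneg {β : ℝ} (hβ : 1 < β) (b : ℝ) : 0 ≤ upF β b := by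
  unfold upF
  have : (1 + max b 0) ^ (1 - β) ≤ 1 :=
    Real.rpow_le_one_of_one_le_of_nonpos (by linarith [le_max_right b 0]) (by linarith)
  linarith

lemma upF_le_one (β b : ℝ) : upF β b ≤ 1 := by
  unfold upF
  have : 0 ≤ (1 + max b 0) ^ (1 - β) :=
    Real.rpow_nonneg (by linarith [le_max_right b 0]) _
  linarith

lemma upF_of_nonpos {β b : ℝ} (hb : b ≤ 0) : upF β b = 0 := by
  unfold upF; rw [max_eq_right hb]; simp

lemma upF_cutoff {p β : ℝ} (hβ : 1 < β) (hβp : β < p) : ∃ C : ℝ, 0 < C ∧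
    ∀ a b η₁ η₂ : ℝ, 0 < b → b ≤ a → 0 ≤ η₁ → η₁ ≤ η₂ →
    (a - b) ^ (p - 1) * upF β b * (η₂ ^ p - η₁ ^ p) ≤
      1 / 2 * ((a - b) ^ (p - 1) * (upF β a - upF β b) * η₁ ^ p) +
        C * (|η₁ - η₂| ^ p * (1 + a) ^ (β * (p - 1))) := by
  have hp : 1 < p := hβ.trans hβp
  obtain ⟨C0, hC0, hC⟩ := cutoff_absorb hp
  have hβ' : 0 < β - 1 := by linarith
  obtain ⟨h0, hh0⟩ : ∃ h0, h0 = ((β - 1) ^ (p - 1))⁻¹ := ⟨_, rfl⟩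
  have hh0p : 0 < h0 := by rw [hh0]; positivity
  refine ⟨C0 * (1 + h0), by positivity, ?_⟩
  intro a b η₁ η₂ hb hab h1 hη
  have h2 := h1.trans hη
  have ht : 0 ≤ a - b := by linarith
  have ha1 : 0 < 1 + a := by linarith
  obtain ⟨D, hD⟩ : ∃ D, D = (a - b) ^ (p - 1) * (upF β a - upF β b) := ⟨_, rfl⟩
  have hDe : D = (a - b) ^ (p - 1) * ((1 + b) ^ (1 - β) - (1 + a) ^ (1 - β)) := by
    rw [hD]; unfold upF; rw [max_eq_left hb.le, max_eq_left (hb.le.trans hab)]; ring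
  have hmono : (1 + a) ^ (1 - β) ≤ (1 + b) ^ (1 - β) :=
    Real.rpow_le_rpow_of_nonpos (by linarith) (by linarith) (by linarith)
  have hD0 : 0 ≤ D := hDe ▸ mul_nonneg (by positivity) (by linarith)
  obtain ⟨X, hX⟩ : ∃ X, X = (1 + a) ^ (β * (p - 1)) := ⟨_, rfl⟩
  have hX0 : 0 < X := by rw [hX]; positivity
  obtain ⟨A, hAe⟩ : ∃ A, A = (a - b) ^ (p - 1) := ⟨_, rfl⟩
  have hA0 : 0 ≤ A := by rw [hAe]; positivity
  have hAD : A ^ p ≤ (h0 * X) * D ^ (p - 1) := by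
    have := one_add_rpow_sub_ge hβ hp hb.le hab
    rw [← hDe, Real.rpow_neg ha1.le, ← hX, ← hAe] at this
    have h3 : A ^ p = h0 * X * ((β - 1) ^ (p - 1) * A ^ p * X⁻¹) := by
      rw [hh0]; field_simp
    rw [h3]; gcongr
  have hcut := hC A D (h0 * X) η₂ η₁ hA0 hD0 (by positivity) h2 h1 hAD
  have hηp : 0 ≤ η₂ ^ p - η₁ ^ p := by
    have : η₁ ^ p ≤ η₂ ^ p := Real.rpow_le_rpow h1 hη (by linarith)
    linarith
  have hA : A ≤ X := by
    rw [hAe, hX]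
    calc (a - b) ^ (p - 1) ≤ (1 + a) ^ (p - 1) :=
          Real.rpow_le_rpow ht (by linarith) (by linarith)
      _ ≤ _ := Real.rpow_le_rpow_of_exponent_le (by linarith) (by nlinarith)
  rw [← hD, ← hAe, ← hX, abs_sub_comm]
  obtain ⟨δ, hδ⟩ : ∃ δ, δ = |η₂ - η₁| ^ p := ⟨_, rfl⟩
  have hδ0 : 0 ≤ δ := by rw [hδ]; positivity
  rw [← hδ] at hcut ⊢
  calc A * upF β b * (η₂ ^ p - η₁ ^ p) ≤ A * 1 * (η₂ ^ p - η₁ ^ p) := by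
        gcongr; exact upF_le_one β b
    _ ≤ 1 / 2 * D * η₁ ^ p + C0 * δ * (X + h0 * X) := by
        rw [mul_one]; refine hcut.trans ?_; gcongr
    _ = _ := by ring

lemma upF_energy {p β a b : ℝ} (hβ : 1 < β) (hβp : β < p) (hab : b ≤ a) :
    (β - 1) * |(1 + max a 0) ^ ((p - β) / p) - (1 + max b 0) ^ ((p - β) / p)| ^ p ≤
      (a - b) ^ (p - 1) * (upF β a - upF β b) := by
  have hp : 1 < p := hβ.trans hβp
  have hβ' : 0 < β - 1 := by linarith
  have hsub : max a 0 - max b 0 ≤ a - b := by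
    rcases le_total a 0 with h | h <;> rcases le_total b 0 with h' | h' <;>
      simp [h, h'] <;> linarith
  have hab' : max b 0 ≤ max a 0 := max_le_max_right 0 hab
  have hb0 : 0 ≤ max b 0 := le_max_right _ _
  unfold upF
  generalize max a 0 = a' at *
  generalize max b 0 = b' at *
  have ht : 0 ≤ a - b := by linarith
  have ht' : 0 ≤ a' - b' := by linarith
  have htan := rpow_one_sub_sub_ge (x := 1 + a') (y := 1 + b') hβ (by linarith) (by linarith)
  have hmono : 0 ≤ (1 + b') ^ (1 - β) - (1 + a') ^ (1 - β) := sub_nonneg.2 <|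
    Real.rpow_le_rpow_of_nonpos (by linarith) (by linarith) (by linarith)
  calc _ ≤ (β - 1) * ((a' - b') ^ p * (1 + a') ^ (-β)) := by
        gcongr; exact sub_rpow_abs_le hβ hβp hb0 hab'
    _ = (a' - b') ^ (p - 1) * ((β - 1) * (1 + a' - (1 + b')) * (1 + a') ^ (-β)) := by
        rw [← rpow_pred_mul hp ht']; ring
    _ ≤ (a' - b') ^ (p - 1) * ((1 + b') ^ (1 - β) - (1 + a') ^ (1 - β)) :=
        mul_le_mul_of_nonneg_left htan (by positivity)
    _ ≤ (a - b) ^ (p - 1) * ((1 + b') ^ (1 - β) - (1 + a') ^ (1 - β)) := by gcongr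
    _ = _ := by ring

lemma pointwise_up {p β : ℝ} (hβ : 1 < β) (hβp : β < p) : ∃ C : ℝ, 0 < C ∧
    ∀ a b η₁ η₂ : ℝ, 0 ≤ η₁ → 0 ≤ η₂ →
    (β - 1) / 2 * (|(1 + max a 0) ^ ((p - β) / p) - (1 + max b 0) ^ ((p - β) / p)| ^ p *
        min η₁ η₂ ^ p) ≤
      sg p (a - b) * (upF β a * η₁ ^ p - upF β b * η₂ ^ p) +
        C * (|η₁ - η₂| ^ p *
          (if 0 < min a b then (1 + max a b) ^ (β * (p - 1)) else 0)) := by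
  have hp : 1 < p := hβ.trans hβp
  obtain ⟨C, hC, hcut⟩ := upF_cutoff hβ hβp
  refine ⟨C, hC, ?_⟩
  intro a b η₁ η₂ h1 h2
  wlog hab : b ≤ a generalizing a b η₁ η₂ with H
  · have := H b a η₂ η₁ h2 h1 (by linarith)
    rw [sg_mul_sub_comm hp, min_comm η₁, max_comm a b, abs_sub_comm η₁, min_comm a, abs_sub_comm]
    exact this
  have hV := upF_energy hβ hβp hab
  have hm : 0 ≤ min η₁ η₂ := le_min h1 h2
  have hmin1 : min η₁ η₂ ^ p ≤ η₁ ^ p := Real.rpow_le_rpow hm (min_le_left _ _) (by linarith)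
  rw [sg_of_nonneg (by linarith)]
  generalize |(1 + max a 0) ^ ((p - β) / p) - (1 + max b 0) ^ ((p - β) / p)| ^ p = Y at *
  have hD0 : 0 ≤ (a - b) ^ (p - 1) * (upF β a - upF β b) := by
    refine mul_nonneg (Real.rpow_nonneg (by linarith) _) (sub_nonneg.2 ?_)
    unfold upF
    have := Real.rpow_le_rpow_of_nonpos (z := 1 - β) (x := 1 + max b 0) (y := 1 + max a 0)
      (by linarith [le_max_right b 0]) (by linarith [max_le_max_right 0 hab]) (by linarith)
    linarith
  have hdec : (a - b) ^ (p - 1) * (upF β a * η₁ ^ p - upF β b * η₂ ^ p) =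
      (a - b) ^ (p - 1) * (upF β a - upF β b) * η₁ ^ p -
        (a - b) ^ (p - 1) * upF β b * (η₂ ^ p - η₁ ^ p) := by ring
  rw [hdec]
  have hgood : (β - 1) * Y * min η₁ η₂ ^ p ≤
      (a - b) ^ (p - 1) * (upF β a - upF β b) * η₁ ^ p := by
    gcongr
  have hη0 : 0 ≤ (a - b) ^ (p - 1) * (upF β a - upF β b) * η₁ ^ p :=
    mul_nonneg hD0 (by positivity)
  by_cases hc : 0 < b ∧ η₁ ≤ η₂
  · rw [min_eq_right hab, if_pos hc.1, max_eq_left hab]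
    have := hcut a b η₁ η₂ hc.1 hab h1 hc.2
    linarith
  · have h4 : 0 ≤ C * (|η₁ - η₂| ^ p *
        (if 0 < min a b then (1 + max a b) ^ (β * (p - 1)) else 0)) := by
      refine mul_nonneg hC.le (mul_nonneg (by positivity) ?_)
      split_ifs with hh
      · refine Real.rpow_nonneg ?_ _
        linarith [le_max_left a b, (lt_min_iff.1 hh).1]
      · exact le_rfl
    have h5 : (a - b) ^ (p - 1) * upF β b * (η₂ ^ p - η₁ ^ p) ≤ 0 := by
      rcases le_or_gt b 0 with hb | hb
      · rw [upF_of_nonpos hb]; simp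
      · have : η₂ ^ p ≤ η₁ ^ p :=
          Real.rpow_le_rpow h2 (not_le.1 fun hh => hc ⟨hb, hh⟩).le (by linarith)
        exact mul_nonpos_of_nonneg_of_nonpos
          (mul_nonneg (Real.rpow_nonneg (by linarith) _) (upF_nonneg hβ b)) (by linarith)
    linarith

lemma pointwise_power {p β : ℝ} (hβ : 1 < β) (hβp : β < p) : ∃ C : ℝ, 0 < C ∧
    ∀ a b η₁ η₂ : ℝ, 0 ≤ a → 0 ≤ b → 0 ≤ η₁ → 0 ≤ η₂ →
    sg p (a - b) * ((1 + a) ^ (1 - β) * η₁ ^ p - (1 + b) ^ (1 - β) * η₂ ^ p) ≤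
      C * (|η₁ - η₂| ^ p * (1 + max a b) ^ (p - β)) -
        (β - 1) / 2 * (|a - b| ^ p * (1 + max a b) ^ (-β) * min η₁ η₂ ^ p) := by
  have hp : 1 < p := hβ.trans hβp
  obtain ⟨C0, hC0, hC⟩ := cutoff_absorb hp
  have hβ' : 0 < β - 1 := by linarith
  obtain ⟨h0, hh0⟩ : ∃ h0, h0 = ((β - 1) ^ (p - 1))⁻¹ := ⟨_, rfl⟩
  have hh0p : 0 < h0 := by rw [hh0]; positivity
  refine ⟨C0 * (1 + h0), by positivity, ?_⟩
  intro a b η₁ η₂ ha hb h1 h2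
  wlog hab : b ≤ a generalizing a b η₁ η₂ with H
  · have := H b a η₂ η₁ hb ha h2 h1 (by linarith)
    rw [sg_mul_sub_comm hp, min_comm, max_comm, abs_sub_comm η₁, abs_sub_comm a]
    exact this
  have ht : 0 ≤ a - b := by linarith
  have ha1 : 0 < 1 + a := by linarith
  have hb1 : 0 < 1 + b := by linarith
  have hm : 0 ≤ min η₁ η₂ := le_min h1 h2
  rw [sg_of_nonneg ht, max_eq_left hab, abs_of_nonneg ht]
  have htan := rpow_one_sub_sub_ge (x := 1 + a) (y := 1 + b) hβ hb1 (by linarith)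
  have htan0 : 0 ≤ (1 + b) ^ (1 - β) - (1 + a) ^ (1 - β) := by
    refine le_trans ?_ htan
    have : 0 ≤ 1 + a - (1 + b) := by linarith
    positivity
  set D : ℝ := (a - b) ^ (p - 1) * ((1 + b) ^ (1 - β) - (1 + a) ^ (1 - β)) with hD
  have hD0 : 0 ≤ D := by positivity
  have hDg : (β - 1) * ((a - b) ^ p * (1 + a) ^ (-β)) ≤ D := by
    calc _ = (a - b) ^ (p - 1) * ((β - 1) * (1 + a - (1 + b)) * (1 + a) ^ (-β)) := by
          rw [← rpow_pred_mul hp ht]; ring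
      _ ≤ D := mul_le_mul_of_nonneg_left htan (by positivity)
  have hAD : ((a - b) ^ (p - 1) * (1 + a) ^ (1 - β)) ^ p ≤
      (h0 * (1 + a) ^ (p - β)) * D ^ (p - 1) := by
    have := one_add_rpow_sub_ge hβ hp hb hab
    have h3 : ((a - b) ^ (p - 1) * (1 + a) ^ (1 - β)) ^ p = h0 * (1 + a) ^ (p - β) *
        ((β - 1) ^ (p - 1) * ((a - b) ^ (p - 1)) ^ p * (1 + a) ^ (-(β * (p - 1)))) := by
      have hx : ((1 + a) ^ (1 - β)) ^ p = (1 + a) ^ (p - β) * (1 + a) ^ (-(β * (p - 1))) := by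
        rw [← Real.rpow_mul ha1.le, ← Real.rpow_add ha1]; ring_nf
      rw [Real.mul_rpow (by positivity) (by positivity), hx, hh0]
      field_simp
    rw [h3]; gcongr
  have hcut := hC ((a - b) ^ (p - 1) * (1 + a) ^ (1 - β)) D (h0 * (1 + a) ^ (p - β)) η₁ η₂
    (by positivity) hD0 (by positivity) h1 h2 hAD
  have hA : (a - b) ^ (p - 1) * (1 + a) ^ (1 - β) ≤ (1 + a) ^ (p - β) := by
    calc _ ≤ (1 + a) ^ (p - 1) * (1 + a) ^ (1 - β) := by
          refine mul_le_mul_of_nonneg_right ?_ (by positivity)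
          exact Real.rpow_le_rpow ht (by linarith) (by linarith)
      _ = _ := by rw [← Real.rpow_add ha1]; ring_nf
  have hmin2 : min η₁ η₂ ^ p ≤ η₂ ^ p := Real.rpow_le_rpow hm (min_le_right _ _) (by linarith)
  have hg : (β - 1) * ((a - b) ^ p * (1 + a) ^ (-β)) * min η₁ η₂ ^ p ≤ D * η₂ ^ p := by
    gcongr
  have hA2 : C0 * |η₁ - η₂| ^ p * ((a - b) ^ (p - 1) * (1 + a) ^ (1 - β) +
      h0 * (1 + a) ^ (p - β)) ≤ C0 * (1 + h0) * (|η₁ - η₂| ^ p * (1 + a) ^ (p - β)) := by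
    calc _ ≤ C0 * |η₁ - η₂| ^ p * ((1 + a) ^ (p - β) + h0 * (1 + a) ^ (p - β)) := by gcongr
      _ = _ := by ring
  have hdec : (a - b) ^ (p - 1) * ((1 + a) ^ (1 - β) * η₁ ^ p - (1 + b) ^ (1 - β) * η₂ ^ p) =
      (a - b) ^ (p - 1) * (1 + a) ^ (1 - β) * (η₁ ^ p - η₂ ^ p) - D * η₂ ^ p := by
    rw [hD]; ring
  rw [hdec]
  nlinarith

lemma pointwise_mass {p β : ℝ} (hβ : 1 < β) (hβp : β < p) : ∃ C : ℝ, 0 < C ∧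
    ∀ a b η₁ η₂ : ℝ, 0 ≤ a → 0 ≤ b → 0 ≤ η₁ → 0 ≤ η₂ →
    sg p (a - b) * (η₁ ^ p - η₂ ^ p) ≤
      |a - b| ^ p * (1 + max a b) ^ (-β) * min η₁ η₂ ^ p +
        C * (|η₁ - η₂| ^ p * (1 + max a b) ^ (β * (p - 1))) := by
  have hp : 1 < p := hβ.trans hβp
  obtain ⟨C0, hC0, hC⟩ := cutoff_absorb hp
  refine ⟨C0 * 2, by positivity, ?_⟩
  intro a b η₁ η₂ ha hb h1 h2
  wlog hab : b ≤ a generalizing a b η₁ η₂ with H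
  · have := H b a η₂ η₁ hb ha h2 h1 (by linarith)
    rw [sg_mul_sub_comm hp, min_comm, max_comm, abs_sub_comm η₁, abs_sub_comm a]
    exact this
  have ht : 0 ≤ a - b := by linarith
  have ha1 : 0 < 1 + a := by linarith
  have hm : 0 ≤ min η₁ η₂ := le_min h1 h2
  rw [sg_of_nonneg ht, max_eq_left hab, abs_of_nonneg ht]
  rcases le_total η₁ η₂ with hle | hle
  · have : η₁ ^ p ≤ η₂ ^ p := Real.rpow_le_rpow h1 hle (by linarith)
    have h3 : (a - b) ^ (p - 1) * (η₁ ^ p - η₂ ^ p) ≤ 0 :=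
      mul_nonpos_of_nonneg_of_nonpos (by positivity) (by linarith)
    refine h3.trans ?_
    positivity
  rw [min_eq_right hle]
  have hAD : ((a - b) ^ (p - 1)) ^ p ≤ (1 + a) ^ (β * (p - 1)) *
      (2 * ((a - b) ^ p * (1 + a) ^ (-β))) ^ (p - 1) := by
    rw [Real.mul_rpow (by norm_num) (by positivity), Real.mul_rpow (by positivity) (by positivity),
      ← Real.rpow_mul ht, ← Real.rpow_mul ht, ← Real.rpow_mul ha1.le]
    have h2' : (1 : ℝ) ≤ 2 ^ (p - 1) := Real.one_le_rpow (by norm_num) (by linarith)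
    have e1 : (1 + a) ^ (β * (p - 1)) * (2 ^ (p - 1) * ((a - b) ^ (p * (p - 1)) *
        (1 + a) ^ (-β * (p - 1)))) = 2 ^ (p - 1) * (a - b) ^ (p * (p - 1)) *
        ((1 + a) ^ (β * (p - 1)) * (1 + a) ^ (-β * (p - 1))) := by ring
    rw [e1, ← Real.rpow_add ha1, show β * (p - 1) + -β * (p - 1) = 0 by ring, Real.rpow_zero,
      mul_one, mul_comm (p - 1) p]
    have : 0 ≤ (a - b) ^ (p * (p - 1)) := by positivity
    nlinarith
  have hcut := hC ((a - b) ^ (p - 1)) (2 * ((a - b) ^ p * (1 + a) ^ (-β)))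
    ((1 + a) ^ (β * (p - 1))) η₁ η₂ (by positivity) (by positivity) (by positivity) h1 h2 hAD
  have hA : (a - b) ^ (p - 1) ≤ (1 + a) ^ (β * (p - 1)) := by
    calc (a - b) ^ (p - 1) ≤ (1 + a) ^ (p - 1) :=
          Real.rpow_le_rpow ht (by linarith) (by linarith)
      _ ≤ _ := Real.rpow_le_rpow_of_exponent_le (by linarith) (by nlinarith)
  have hA2 : C0 * |η₁ - η₂| ^ p * ((a - b) ^ (p - 1) + (1 + a) ^ (β * (p - 1))) ≤
      C0 * 2 * (|η₁ - η₂| ^ p * (1 + a) ^ (β * (p - 1))) := by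
    calc _ ≤ C0 * |η₁ - η₂| ^ p * ((1 + a) ^ (β * (p - 1)) + (1 + a) ^ (β * (p - 1))) := by
          gcongr
      _ = _ := by ring
  linarith

lemma pointwise_down {p : ℝ} (hp : 1 < p) : ∃ C : ℝ, 0 < C ∧
    ∀ k a b η₁ η₂ : ℝ, 0 ≤ η₁ → 0 ≤ η₂ →
    sg p (a - b) * (max (k - a) 0 * η₁ ^ p - max (k - b) 0 * η₂ ^ p) ≤
      C * (|η₁ - η₂| ^ p * (min (max (k - a) 0) (max (k - b) 0) *
        max (max (k - a) 0) (max (k - b) 0) ^ (p - 1))) -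
        1 / 2 * (|a - b| ^ (p - 1) * |max (k - a) 0 - max (k - b) 0| * min η₁ η₂ ^ p) := by
  obtain ⟨C0, hC0, hC⟩ := cutoff_absorb hp
  refine ⟨C0 * 2, by positivity, ?_⟩
  intro k a b η₁ η₂ h1 h2
  wlog hab : b ≤ a generalizing a b η₁ η₂ with H
  · have := H b a η₂ η₁ h2 h1 (by linarith)
    rw [sg_mul_sub_comm hp, min_comm (max (k - a) 0), max_comm (max (k - a) 0) (max (k - b) 0),
      abs_sub_comm η₁, abs_sub_comm a, min_comm η₁, abs_sub_comm (max (k - a) 0)]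
    exact this
  have ht : 0 ≤ a - b := by linarith
  have hm : 0 ≤ min η₁ η₂ := le_min h1 h2
  set A := max (k - a) 0 with hA
  set B := max (k - b) 0 with hB
  have hA0 : 0 ≤ A := le_max_right _ _
  have hAB : A ≤ B := max_le_max_right 0 (by linarith)
  have hB0 : 0 ≤ B := hA0.trans hAB
  have hmin2 : min η₁ η₂ ^ p ≤ η₂ ^ p := Real.rpow_le_rpow hm (min_le_right _ _) (by linarith)
  rw [sg_of_nonneg ht, abs_of_nonneg ht, min_eq_left hAB, max_eq_right hAB,
    abs_of_nonpos (by linarith : A - B ≤ 0), neg_sub]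
  set t := a - b with ht'
  have hg : t ^ (p - 1) * (B - A) * min η₁ η₂ ^ p ≤ t ^ (p - 1) * (B - A) * η₂ ^ p := by
    have : 0 ≤ B - A := by linarith
    gcongr
  have hg0 : 0 ≤ t ^ (p - 1) * (B - A) * min η₁ η₂ ^ p := by
    have : 0 ≤ B - A := by linarith
    positivity
  have hdec : t ^ (p - 1) * (A * η₁ ^ p - B * η₂ ^ p) =
      t ^ (p - 1) * A * (η₁ ^ p - η₂ ^ p) - t ^ (p - 1) * (B - A) * η₂ ^ p := by ring
  rw [hdec]
  rcases hA0.eq_or_lt with h0 | hpos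
  · rw [← h0] at hg hg0 ⊢
    simp only [mul_zero, zero_mul, zero_sub]
    linarith
  have ea : A = k - a := by
    rcases max_choice (k - a) 0 with h | h
    · exact h
    · rw [← hA] at h; linarith
  have eb : B = k - b := max_eq_left (by linarith)
  have hBA : B - A = t := by rw [ea, eb]; ring
  have hAD : (t ^ (p - 1) * A) ^ p ≤ A ^ p * (t ^ (p - 1) * t) ^ (p - 1) := by
    rw [Real.mul_rpow (by positivity) hA0, rpow_pred_mul hp ht, ← Real.rpow_mul ht,
      ← Real.rpow_mul ht, mul_comm (p - 1) p, mul_comm]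
  have hcut := hC (t ^ (p - 1) * A) (t ^ (p - 1) * t) (A ^ p) η₁ η₂ (by positivity) (by positivity)
    (by positivity) h1 h2 hAD
  have h3 : t ^ (p - 1) ≤ B ^ (p - 1) := Real.rpow_le_rpow ht (by linarith) (by linarith)
  have h4 : A ^ p ≤ A * B ^ (p - 1) := by
    rw [← rpow_pred_mul hp hA0, mul_comm]
    gcongr
  have hA2 : C0 * |η₁ - η₂| ^ p * (t ^ (p - 1) * A + A ^ p) ≤
      C0 * 2 * (|η₁ - η₂| ^ p * (A * B ^ (p - 1))) := by
    calc _ ≤ C0 * |η₁ - η₂| ^ p * (B ^ (p - 1) * A + A * B ^ (p - 1)) := by gcongr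
      _ = _ := by ring
  rw [hBA] at hg ⊢
  linarith

lemma abs_mul_sub_mul_le {x y η₁ η₂ : ℝ} (h1 : 0 ≤ η₁) (h2 : 0 ≤ η₂) :
    |x * η₁ - y * η₂| ≤ |x - y| * min η₁ η₂ +
      (if η₂ ≤ η₁ then |x| else |y|) * |η₁ - η₂| := by
  split_ifs with h
  · rw [min_eq_right h, show x * η₁ - y * η₂ = (x - y) * η₂ + x * (η₁ - η₂) by ring]
    refine (abs_add_le _ _).trans ?_
    rw [abs_mul, abs_mul, abs_of_nonneg h2]
  · rw [min_eq_left (by linarith), show x * η₁ - y * η₂ = (x - y) * η₁ + y * (η₁ - η₂) by ring]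
    refine (abs_add_le _ _).trans ?_
    rw [abs_mul, abs_mul, abs_of_nonneg h1]

lemma add_rpow_le {p a b : ℝ} (hp : 0 ≤ p) (ha : 0 ≤ a) (hb : 0 ≤ b) :
    (a + b) ^ p ≤ 2 ^ p * (a ^ p + b ^ p) := by
  have h : a + b ≤ 2 * max a b := by
    have := le_max_left a b; have := le_max_right a b; linarith
  calc (a + b) ^ p ≤ (2 * max a b) ^ p := Real.rpow_le_rpow (by positivity) h hp
    _ = 2 ^ p * max a b ^ p := Real.mul_rpow (by norm_num) (le_max_of_le_left ha)
    _ ≤ 2 ^ p * (a ^ p + b ^ p) := by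
        gcongr
        have : 0 ≤ a ^ p := by positivity
        have : 0 ≤ b ^ p := by positivity
        rcases max_choice a b with h | h <;> rw [h] <;> linarith

section Kernel

/-- The model kernel `|x-y|^{-(n+sp)}`. -/
def J (n : ℕ) (s p : ℝ) (x y : Rn n) : ℝ≥0∞ :=
  ENNReal.ofReal (‖x - y‖ ^ (-((n : ℝ) + s * p)))

lemma J_comm (n : ℕ) (s p : ℝ) (x y : Rn n) : J n s p x y = J n s p y x := by
  unfold J; rw [norm_sub_rev]

@[fun_prop]
lemma measurable_J_comp {α : Type*} [MeasurableSpace α] (n : ℕ) (s p : ℝ) {f g : α → Rn n}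
    (hf : Measurable f) (hg : Measurable g) : Measurable fun a => J n s p (f a) (g a) := by
  unfold J; fun_prop

lemma nontrivial_Rn {n : ℕ} (hn : 2 ≤ n) : Nontrivial (Rn n) := by
  have : Nonempty (Fin n) := ⟨⟨0, by omega⟩⟩
  infer_instance

/-- Volume of the unit ball. -/
def omega (n : ℕ) : ℝ := (volume (ball (0 : Rn n) 1)).toReal

lemma omega_pos (n : ℕ) : 0 < omega n :=
  ENNReal.toReal_pos (measure_ball_pos _ _ one_pos).ne' measure_ball_lt_top.ne

lemma volume_ball_eq {n : ℕ} (hn : 2 ≤ n) (x : Rn n) {r : ℝ} (hr : 0 ≤ r) :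
    volume (ball x r) = ENNReal.ofReal (omega n * r ^ n) := by
  have := nontrivial_Rn hn
  rw [Measure.addHaar_ball _ _ hr, finrank_euclideanSpace_fin, mul_comm (omega n),
    ENNReal.ofReal_mul (by positivity), omega, ENNReal.ofReal_toReal measure_ball_lt_top.ne]

lemma J_le_J {n : ℕ} {s p : ℝ} (hsp : 0 ≤ s * p) {x y z : Rn n} {γ : ℝ} (hγ : 0 ≤ γ)
    (hxy : x ≠ y) (hzy : z ≠ y) (h : ‖z - y‖ ≤ γ * ‖x - y‖) :
    J n s p x y ≤ ENNReal.ofReal (γ ^ ((n : ℝ) + s * p)) * J n s p z y := by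
  have h1 : 0 < ‖x - y‖ := norm_pos_iff.2 (sub_ne_zero.2 hxy)
  have h2 : 0 < ‖z - y‖ := norm_pos_iff.2 (sub_ne_zero.2 hzy)
  unfold J
  rw [← ENNReal.ofReal_mul (by positivity)]
  apply ENNReal.ofReal_le_ofReal
  rw [Real.rpow_neg h1.le, Real.rpow_neg h2.le, ← div_eq_mul_inv, inv_eq_one_div,
    div_le_div_iff₀ (by positivity) (by positivity), one_mul,
    ← Real.mul_rpow hγ h1.le]
  exact Real.rpow_le_rpow h2.le h (by positivity)

/-- Comparison of kernels when one variable is away from a ball. -/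
lemma J_le_far {n : ℕ} {s p : ℝ} (hsp : 0 ≤ s * p) {z x y : Rn n} {r₁ r₂ : ℝ}
    (hr : r₁ < r₂) (h0 : 0 ≤ r₁) (hx : ‖x - z‖ ≤ r₁) (hy : r₂ ≤ ‖y - z‖) :
    J n s p x y ≤ ENNReal.ofReal ((r₂ / (r₂ - r₁)) ^ ((n : ℝ) + s * p)) * J n s p z y := by
  have hd : 0 < r₂ - r₁ := by linarith
  have htri : ‖y - z‖ - ‖x - z‖ ≤ ‖x - y‖ := by
    have := norm_sub_norm_le (y - z) (x - z)
    rwa [sub_sub_sub_cancel_right, norm_sub_rev y x] at this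
  apply J_le_J hsp (by apply div_nonneg <;> linarith)
  · rintro rfl; linarith
  · rintro rfl; simp at hy; linarith
  · rw [norm_sub_rev z y, div_mul_eq_mul_div, le_div_iff₀ hd]
    have h1 : r₂ * (‖y - z‖ - r₁) ≤ r₂ * ‖x - y‖ := by
      apply mul_le_mul_of_nonneg_left _ (by linarith); linarith
    nlinarith

lemma lintegral_min_lt_top {n : ℕ} {s p : ℝ} (hn : 2 ≤ n) (hs : 0 < s) (hs1 : s < 1)
    (hp : 0 < p) : ∫⁻ h : Rn n, ENNReal.ofReal (min 1 ‖h‖ ^ p * ‖h‖ ^ (-((n : ℝ) + s * p))) < ⊤ := by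
  have := nontrivial_Rn hn
  apply Integrable.lintegral_lt_top
  rw [integrable_fun_norm_addHaar (E := Rn n) volume
    (f := fun t : ℝ => min 1 t ^ p * t ^ (-((n : ℝ) + s * p))), finrank_euclideanSpace_fin]
  have e : ∀ t : ℝ, 0 < t → t ^ (n - 1) * t ^ (-((n : ℝ) + s * p)) = t ^ (-1 - s * p) := by
    intro t ht
    rw [← Real.rpow_natCast, Nat.cast_sub (by omega), ← Real.rpow_add ht]
    congr 1; push_cast; ring
  rw [← Ioc_union_Ioi_eq_Ioi (zero_le_one' ℝ)]
  refine IntegrableOn.union ?_ ?_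
  · have h1 : IntegrableOn (fun t : ℝ => t ^ (p - 1 - s * p)) (Ioc 0 1) := by
      rw [integrableOn_Ioc_iff_integrableOn_Ioo (by simp),
        intervalIntegral.integrableOn_Ioo_rpow_iff one_pos]
      nlinarith
    refine h1.congr_fun (fun t ht => ?_) measurableSet_Ioc
    simp only [smul_eq_mul]
    rw [min_eq_right ht.2, mul_left_comm, e t ht.1, ← Real.rpow_add ht.1]
    ring_nf
  · have h1 : IntegrableOn (fun t : ℝ => t ^ (-1 - s * p)) (Ioi 1) :=
      integrableOn_Ioi_rpow_of_lt (by nlinarith [mul_pos hs hp]) one_pos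
    refine h1.congr_fun (fun t ht => ?_) measurableSet_Ioi
    have ht' : 1 < t := ht
    simp only [smul_eq_mul]
    rw [min_eq_left ht'.le, Real.one_rpow, one_mul, e t (by linarith)]

lemma exists_lintegral_min_le {n : ℕ} {s p : ℝ} (hn : 2 ≤ n) (hs : 0 < s) (hs1 : s < 1)
    (hp : 0 < p) : ∃ C : ℝ, 0 < C ∧ ∀ L : ℝ, 1 ≤ L → ∀ x : Rn n,
      ∫⁻ y, ENNReal.ofReal (min 1 (L * ‖x - y‖) ^ p) * J n s p x y ≤
        ENNReal.ofReal (C * L ^ p) := by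
  have hfin := lintegral_min_lt_top (n := n) hn hs hs1 hp
  set I := ∫⁻ h : Rn n, ENNReal.ofReal (min 1 ‖h‖ ^ p * ‖h‖ ^ (-((n : ℝ) + s * p))) with hI
  refine ⟨I.toReal + 1, by positivity, ?_⟩
  intro L hL x
  have hm : ∀ y : Rn n, min 1 (L * ‖x - y‖) ≤ L * min 1 ‖x - y‖ := by
    intro y
    rw [mul_min_of_nonneg _ _ (by linarith)]
    exact min_le_min_right _ (by linarith)
  calc _ ≤ ∫⁻ y, ENNReal.ofReal (L ^ p) * ENNReal.ofReal (min 1 ‖x - y‖ ^ p *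
          ‖x - y‖ ^ (-((n : ℝ) + s * p))) := by
        apply lintegral_mono
        intro y
        dsimp only
        unfold J
        have h1 : min 1 (L * ‖x - y‖) ^ p ≤ L ^ p * min 1 ‖x - y‖ ^ p := by
          rw [← Real.mul_rpow (by linarith) (by positivity)]
          exact Real.rpow_le_rpow (by positivity) (hm y) hp.le
        rw [← ENNReal.ofReal_mul (by positivity), ← ENNReal.ofReal_mul (by positivity)]
        apply ENNReal.ofReal_le_ofReal
        rw [← mul_assoc]
        gcongr
    _ = ENNReal.ofReal (L ^ p) * I := by
        rw [lintegral_const_mul' _ _ ENNReal.ofReal_ne_top]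
        congr 1
        exact lintegral_sub_left_eq_self
          (fun h : Rn n => ENNReal.ofReal (min 1 ‖h‖ ^ p * ‖h‖ ^ (-((n : ℝ) + s * p)))) x
    _ ≤ ENNReal.ofReal (L ^ p) * ENNReal.ofReal (I.toReal + 1) := by
        gcongr
        rw [← ENNReal.ofReal_toReal hfin.ne]
        exact ENNReal.ofReal_le_ofReal (by rw [ENNReal.toReal_ofReal (by positivity)]; linarith)
    _ = _ := by rw [← ENNReal.ofReal_mul (by positivity), mul_comm]

/-- The nonlocal isoperimetric (Faber–Krahn) inequality for the kernel. -/
lemma exists_le_lintegral_compl {n : ℕ} {s p : ℝ} (hn : 2 ≤ n) (hsp : 0 < s * p) :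
    ∃ c : ℝ, 0 < c ∧ ∀ (S : Set (Rn n)) (σ : ℝ) (x : Rn n), MeasurableSet S → 0 < σ →
      volume S ≤ ENNReal.ofReal σ →
      ENNReal.ofReal (c * σ ^ (-(s * p / n))) ≤ ∫⁻ y in Sᶜ, J n s p x y := by
  have hω := omega_pos n
  have hn0 : (0 : ℝ) < n := by positivity
  refine ⟨(2 / omega n) ^ (-(1 + s * p / n)), by positivity, ?_⟩
  intro S σ x hS hσ hvol
  set τ : ℝ := (2 * σ / omega n) ^ (1 / (n : ℝ)) with hτ
  have hτ0 : 0 < τ := by positivity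
  have hτn : omega n * τ ^ n = 2 * σ := by
    rw [hτ, ← Real.rpow_natCast, ← Real.rpow_mul (by positivity), one_div,
      inv_mul_cancel₀ hn0.ne', Real.rpow_one]
    field_simp
  have hball : ENNReal.ofReal σ ≤ volume ((ball x τ \ {x}) \ S) := by
    have h1 := le_measure_sdiff (μ := volume) (s₁ := ball x τ \ {x}) (s₂ := S)
    refine le_trans ?_ h1
    have := nontrivial_Rn hn
    rw [measure_sdiff_null (measure_singleton x), volume_ball_eq hn x hτ0.le, hτn, two_mul,
      ENNReal.ofReal_add hσ.le hσ.le]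
    refine le_trans (le_of_eq ?_) (tsub_le_tsub_left hvol _)
    rw [ENNReal.add_sub_cancel_right ENNReal.ofReal_ne_top]
  calc ENNReal.ofReal ((2 / omega n) ^ (-(1 + s * p / n)) * σ ^ (-(s * p / n)))
      = ENNReal.ofReal (τ ^ (-((n : ℝ) + s * p))) * ENNReal.ofReal σ := by
        rw [← ENNReal.ofReal_mul (by positivity)]
        congr 1
        rw [hτ, ← Real.rpow_mul (by positivity), show 2 * σ / omega n = (2 / omega n) * σ by ring,
          Real.mul_rpow (by positivity) hσ.le, mul_assoc, ← Real.rpow_add_one hσ.ne']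
        congr 2 <;> (field_simp; try ring)
    _ ≤ ENNReal.ofReal (τ ^ (-((n : ℝ) + s * p))) * volume ((ball x τ \ {x}) \ S) := by gcongr
    _ = ∫⁻ y in (ball x τ \ {x}) \ S, ENNReal.ofReal (τ ^ (-((n : ℝ) + s * p))) := by
        rw [setLIntegral_const]
    _ ≤ ∫⁻ y in (ball x τ \ {x}) \ S, J n s p x y := by
        apply setLIntegral_mono' ((measurableSet_ball.diff (measurableSet_singleton x)).diff hS)
        rintro y ⟨⟨hy, hyx⟩, -⟩
        unfold J
        apply ENNReal.ofReal_le_ofReal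
        have hpos : 0 < ‖x - y‖ := norm_pos_iff.2 (sub_ne_zero.2 (Ne.symm hyx))
        apply Real.rpow_le_rpow_of_nonpos hpos _ (by linarith)
        rw [mem_ball', dist_eq_norm] at hy
        exact hy.le
    _ ≤ _ := lintegral_mono_set (fun y hy => hy.2)

end Kernel

section Cutoff

/-- `η` is a Lipschitz cutoff with values in `[0,1]` vanishing outside `B_ρ(z)`. -/
structure Cutoff {n : ℕ} (z : Rn n) (ρ : ℝ) (η : Rn n → ℝ) : Prop where
  lip : ∃ L : ℝ≥0, LipschitzWith L η
  nonneg : ∀ x, 0 ≤ η x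
  le_one : ∀ x, η x ≤ 1
  zero : ∀ x, ρ ≤ ‖x - z‖ → η x = 0

lemma exists_cutoff {n : ℕ} (z : Rn n) {r₁ r₂ : ℝ} (h : r₁ < r₂) :
    ∃ η : Rn n → ℝ, Cutoff z r₂ η ∧ (∀ x, ‖x - z‖ ≤ r₁ → η x = 1) ∧
      ∀ x y, |η x - η y| ≤ min 1 ((r₂ - r₁)⁻¹ * ‖x - y‖) := by
  have hd : 0 < r₂ - r₁ := by linarith
  have hL : LipschitzWith (Real.toNNReal (r₂ - r₁)⁻¹)
      (fun x : Rn n => (r₂ - r₁)⁻¹ * (r₂ - ‖x - z‖)) := by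
    apply LipschitzWith.of_dist_le_mul
    intro x y
    rw [Real.dist_eq, Real.coe_toNNReal _ (by positivity), dist_eq_norm, ← mul_sub, abs_mul,
      abs_of_pos (inv_pos.2 hd)]
    gcongr
    rw [show r₂ - ‖x - z‖ - (r₂ - ‖y - z‖) = ‖y - z‖ - ‖x - z‖ by ring]
    refine (abs_norm_sub_norm_le _ _).trans ?_
    rw [sub_sub_sub_cancel_right, norm_sub_rev]
  have hL2 := (hL.const_min 1).const_max 0
  refine ⟨fun x => max 0 (min 1 ((r₂ - r₁)⁻¹ * (r₂ - ‖x - z‖))), ⟨⟨_, hL2⟩, fun x => le_max_left _ _,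
    fun x => max_le zero_le_one (min_le_left _ _), ?_⟩, ?_, ?_⟩
  · intro x hx
    have : (r₂ - r₁)⁻¹ * (r₂ - ‖x - z‖) ≤ 0 :=
      mul_nonpos_of_nonneg_of_nonpos (by positivity) (by linarith)
    exact max_eq_left ((min_le_right _ _).trans this)
  · intro x hx
    have : 1 ≤ (r₂ - r₁)⁻¹ * (r₂ - ‖x - z‖) := by
      rw [← div_eq_inv_mul, le_div_iff₀ hd]; linarith
    dsimp only
    rw [min_eq_left this]; simp
  · intro x y
    apply le_min
    · rw [abs_sub_le_iff]
      have h1 : ∀ t : ℝ, 0 ≤ max 0 (min 1 t) := fun t => le_max_left _ _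
      have h2 : ∀ t : ℝ, max 0 (min 1 t) ≤ 1 := fun t => max_le zero_le_one (min_le_left _ _)
      constructor <;> linarith [h1 ((r₂ - r₁)⁻¹ * (r₂ - ‖x - z‖)), h2 ((r₂ - r₁)⁻¹ * (r₂ - ‖x - z‖)),
        h1 ((r₂ - r₁)⁻¹ * (r₂ - ‖y - z‖)), h2 ((r₂ - r₁)⁻¹ * (r₂ - ‖y - z‖))]
    · have := hL2.dist_le_mul x y
      rwa [Real.dist_eq, Real.coe_toNNReal _ (by positivity), dist_eq_norm] at this

end Cutoff

section WeakSobolev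

lemma level_step {n : ℕ} {s p : ℝ} (hp : 0 < p) {c : ℝ} (hc : 0 < c)
    (hFK : ∀ (S : Set (Rn n)) (σ : ℝ) (x : Rn n), MeasurableSet S → 0 < σ →
      volume S ≤ ENNReal.ofReal σ →
      ENNReal.ofReal (c * σ ^ (-(s * p / n))) ≤ ∫⁻ y in Sᶜ, J n s p x y)
    {W : Rn n → ℝ} (hW : Measurable W) {M : ℝ}
    (hM : ∫⁻ x, ∫⁻ y, ENNReal.ofReal (|W x - W y| ^ p) * J n s p x y ≤ ENNReal.ofReal M)
    {t σ : ℝ} (ht : 0 < t) (hσ : 0 < σ) (hvol : volume {x | t < W x} ≤ ENNReal.ofReal σ) :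
    volume {x | 2 * t < W x} ≤ ENNReal.ofReal (M / c * t ^ (-p) * σ ^ (s * p / n)) := by
  have hmt : MeasurableSet {x | t < W x} := measurableSet_lt measurable_const hW
  have hm2 : MeasurableSet {x | 2 * t < W x} := measurableSet_lt measurable_const hW
  have h1 : ENNReal.ofReal (t ^ p * (c * σ ^ (-(s * p / n)))) * volume {x | 2 * t < W x} ≤
      ENNReal.ofReal M := by
    refine le_trans ?_ hM
    rw [← setLIntegral_const]
    refine le_trans ?_ (setLIntegral_le_lintegral {x | 2 * t < W x} _)
    apply setLIntegral_mono' hm2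
    intro x hx
    rw [ENNReal.ofReal_mul (by positivity)]
    calc _ ≤ ENNReal.ofReal (t ^ p) * ∫⁻ y in {x | t < W x}ᶜ, J n s p x y := by
          gcongr; exact hFK _ σ x hmt hσ hvol
      _ = ∫⁻ y in {x | t < W x}ᶜ, ENNReal.ofReal (t ^ p) * J n s p x y := by
          rw [lintegral_const_mul' _ _ ENNReal.ofReal_ne_top]
      _ ≤ ∫⁻ y in {x | t < W x}ᶜ, ENNReal.ofReal (|W x - W y| ^ p) * J n s p x y := by
          apply setLIntegral_mono' hmt.compl
          intro y hy
          have hx' : 2 * t < W x := hx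
          have hy' : ¬ t < W y := hy
          gcongr
          exact le_trans (by linarith) (le_abs_self _)
      _ ≤ _ := setLIntegral_le_lintegral _ _
  have hpos : 0 < t ^ p * (c * σ ^ (-(s * p / n))) := by positivity
  rw [mul_comm, ← ENNReal.le_div_iff_mul_le (by left; simpa using hpos)
    (by left; exact ENNReal.ofReal_ne_top), ← ENNReal.ofReal_div_of_pos hpos] at h1
  refine h1.trans (le_of_eq ?_)
  congr 1
  rw [Real.rpow_neg hσ.le, Real.rpow_neg ht.le]
  field_simp

lemma level_decay {n : ℕ} {s p : ℝ} (hn : 2 ≤ n) (hp : 0 < p) (hspn : s * p < n) {c : ℝ}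
    (hc : 0 < c)
    (hFK : ∀ (S : Set (Rn n)) (σ : ℝ) (x : Rn n), MeasurableSet S → 0 < σ →
      volume S ≤ ENNReal.ofReal σ →
      ENNReal.ofReal (c * σ ^ (-(s * p / n))) ≤ ∫⁻ y in Sᶜ, J n s p x y)
    {W : Rn n → ℝ} (hW : Measurable W) (hW1 : ∀ x, 1 ≤ ‖x‖ → W x = 0) {M : ℝ} (hM0 : 0 < M)
    (hM : ∫⁻ x, ∫⁻ y, ENNReal.ofReal (|W x - W y| ^ p) * J n s p x y ≤ ENNReal.ofReal M)
    {t : ℝ} (ht : 0 < t) :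
    volume {x | t < W x} ≤ ENNReal.ofReal ((2 ^ (p * n / (n - s * p)) * (M / c)) ^
      ((n : ℝ) / (n - s * p)) * t ^ (-(p * n / (n - s * p)))) := by
  have hn0 : (0 : ℝ) < n := by positivity
  have hd : 0 < (n : ℝ) - s * p := by linarith
  obtain ⟨P, hP⟩ : ∃ P : ℝ, P = p * n / (n - s * p) := ⟨_, rfl⟩
  obtain ⟨B, hB⟩ : ∃ B : ℝ, B = (2 ^ P * (M / c)) ^ ((n : ℝ) / (n - s * p)) := ⟨_, rfl⟩
  rw [← hP, ← hB]
  have hP0 : 0 < P := by rw [hP]; positivity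
  have hB0 : 0 < B := by rw [hB]; positivity
  have hBB : B ^ (1 - s * p / n) = 2 ^ P * (M / c) := by
    rw [hB, ← Real.rpow_mul (by positivity),
      show (n : ℝ) / (n - s * p) * (1 - s * p / n) = 1 by field_simp, Real.rpow_one]
  have step : ∀ t : ℝ, 0 < t → volume {x | t < W x} ≤ ENNReal.ofReal (B * t ^ (-P)) →
      volume {x | 2 * t < W x} ≤ ENNReal.ofReal (B * (2 * t) ^ (-P)) := by
    intro t ht h
    refine (level_step hp hc hFK hW hM ht (by positivity) h).trans (le_of_eq ?_)
    congr 1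
    have e1 : B = B ^ (1 - s * p / n) * B ^ (s * p / n) := by
      rw [← Real.rpow_add hB0]; simp
    have e2 : t ^ (-P) = t ^ (-p) * t ^ (-P * (s * p / n)) := by
      rw [← Real.rpow_add ht]
      congr 1
      have hd' : P * (n - s * p) = p * n := by rw [hP, div_mul_cancel₀ _ hd.ne']
      field_simp
      linarith
    have e3 : (2 : ℝ) ^ P * 2 ^ (-P) = 1 := by rw [← Real.rpow_add two_pos]; simp
    rw [Real.mul_rpow hB0.le (by positivity), ← Real.rpow_mul ht.le,
      Real.mul_rpow two_pos.le ht.le]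
    calc _ = M / c * B ^ (s * p / n) * (t ^ (-p) * t ^ (-P * (s * p / n))) := by ring
      _ = M / c * B ^ (s * p / n) * t ^ (-P) * (2 ^ P * 2 ^ (-P)) := by rw [← e2, e3, mul_one]
      _ = (2 ^ P * (M / c)) * B ^ (s * p / n) * (2 ^ (-P) * t ^ (-P)) := by ring
      _ = _ := by rw [← hBB, ← e1]
  have small : ∀ k : ℕ, ∀ t : ℝ, 0 < t →
      volume {x | t / 2 ^ k < W x} ≤ ENNReal.ofReal (B * (t / 2 ^ k) ^ (-P)) →
      volume {x | t < W x} ≤ ENNReal.ofReal (B * t ^ (-P)) := by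
    intro k
    induction k with
    | zero => intro t _ h; simpa using h
    | succ k ih =>
      intro t ht h
      apply ih t ht
      have := step (t / 2 ^ (k + 1)) (by positivity) h
      rwa [show 2 * (t / 2 ^ (k + 1)) = t / 2 ^ k by rw [pow_succ]; field_simp] at this
  have hlim : Tendsto (fun k : ℕ => (t / 2 ^ k) ^ P) atTop (𝓝 0) := by
    have h1 : Tendsto (fun k : ℕ => t / 2 ^ k) atTop (𝓝 0) :=
      tendsto_const_nhds.div_atTop (tendsto_pow_atTop_atTop_of_one_lt one_lt_two)
    have := h1.rpow_const (p := P) (Or.inr hP0.le)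
    rwa [Real.zero_rpow hP0.ne'] at this
  obtain ⟨k, hk⟩ := ((tendsto_order.1 hlim).2 (B / omega n) (div_pos hB0 (omega_pos n))).exists
  apply small k t ht
  calc volume {x | t / 2 ^ k < W x} ≤ volume (ball (0 : Rn n) 1) := by
        apply measure_mono
        intro x hx
        have hx' : t / 2 ^ k < W x := hx
        rw [mem_ball_zero_iff]
        by_contra hcon
        rw [hW1 x (not_lt.1 hcon)] at hx'
        have : 0 < t / 2 ^ k := by positivity
        linarith
    _ = ENNReal.ofReal (omega n) := by rw [volume_ball_eq hn 0 zero_le_one]; simp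
    _ ≤ _ := by
        apply ENNReal.ofReal_le_ofReal
        rw [Real.rpow_neg (by positivity), ← div_eq_mul_inv, le_div_iff₀ (by positivity)]
        rw [lt_div_iff₀ (omega_pos n)] at hk
        linarith

lemma lintegral_max_rpow_lt_top {m P : ℝ} (hm : 0 < m) (hmP : m < P) :
    ∫⁻ t in Ioi (0 : ℝ), ENNReal.ofReal (max t 1 ^ (-P)) * ENNReal.ofReal (t ^ (m - 1)) < ⊤ := by
  have h1 : ∫⁻ t in Ioc (0 : ℝ) 1, ENNReal.ofReal (max t 1 ^ (-P)) * ENNReal.ofReal (t ^ (m - 1))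
      < ⊤ := by
    have h : IntegrableOn (fun t : ℝ => t ^ (m - 1)) (Ioc 0 1) := by
      rw [integrableOn_Ioc_iff_integrableOn_Ioo (by simp),
        intervalIntegral.integrableOn_Ioo_rpow_iff one_pos]
      linarith
    refine lt_of_le_of_lt ?_ h.lintegral_lt_top
    apply setLIntegral_mono' measurableSet_Ioc
    intro t ht
    rw [max_eq_right ht.2]; simp
  have h2 : ∫⁻ t in Ioi (1 : ℝ), ENNReal.ofReal (max t 1 ^ (-P)) * ENNReal.ofReal (t ^ (m - 1))
      < ⊤ := by
    have h : IntegrableOn (fun t : ℝ => t ^ (m - 1 - P)) (Ioi 1) :=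
      integrableOn_Ioi_rpow_of_lt (by linarith) one_pos
    refine lt_of_le_of_lt ?_ h.lintegral_lt_top
    apply setLIntegral_mono' measurableSet_Ioi
    intro t ht
    have ht' : 1 < t := ht
    have ht0 : 0 < t := by linarith
    rw [max_eq_left ht'.le, ← ENNReal.ofReal_mul (by positivity), ← Real.rpow_add ht0]
    apply le_of_eq; congr 2; ring
  rw [← Ioc_union_Ioi_eq_Ioi (zero_le_one' ℝ)]
  exact lt_of_le_of_lt (lintegral_union_le _ _ _) (ENNReal.add_lt_top.2 ⟨h1, h2⟩)

/-- Weak-type fractional Sobolev inequality, integrated above height one. -/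
lemma exists_weak_sobolev {n : ℕ} {s p : ℝ} (hn : 2 ≤ n) (hs : 0 < s) (hp : 0 < p)
    (hspn : s * p < n) {m : ℝ} (hm : 0 < m) (hmP : m < p * n / (n - s * p)) :
    ∃ C : ℝ, 0 < C ∧ ∀ W : Rn n → ℝ, Measurable W → (∀ x, 0 ≤ W x) →
      (∀ x, 1 ≤ ‖x‖ → W x = 0) → ∀ M : ℝ, 0 < M →
      ∫⁻ x, ∫⁻ y, ENNReal.ofReal (|W x - W y| ^ p) * J n s p x y ≤ ENNReal.ofReal M →
      ∫⁻ x in {x | 1 < W x}, ENNReal.ofReal (W x ^ m) ≤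
        ENNReal.ofReal (C * M ^ ((n : ℝ) / (n - s * p))) := by
  obtain ⟨c, hc, hFK⟩ := exists_le_lintegral_compl (n := n) hn (mul_pos hs hp)
  have hI := lintegral_max_rpow_lt_top hm hmP
  obtain ⟨I, hIdef⟩ : ∃ I, I = ∫⁻ t in Ioi (0 : ℝ),
    ENNReal.ofReal (max t 1 ^ (-(p * n / (n - s * p)))) * ENNReal.ofReal (t ^ (m - 1)) := ⟨_, rfl⟩
  rw [← hIdef] at hI
  obtain ⟨θ, hθ⟩ : ∃ θ : ℝ, θ = (n : ℝ) / (n - s * p) := ⟨_, rfl⟩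
  obtain ⟨D, hD⟩ : ∃ D : ℝ, D = (2 : ℝ) ^ (p * n / (n - s * p)) / c := ⟨_, rfl⟩
  have hD0 : 0 < D := by rw [hD]; positivity
  refine ⟨m * (D ^ θ * (I.toReal + 1)), by positivity, ?_⟩
  intro W hW hW0 hW1 M hM0 hM
  have hms : MeasurableSet {x | 1 < W x} := measurableSet_lt measurable_const hW
  rw [lintegral_rpow_eq_lintegral_meas_lt_mul (volume.restrict {x | 1 < W x})
    (ae_of_all _ hW0) hW.aemeasurable hm]
  have key : ∀ t : ℝ, 0 < t → (volume.restrict {x | 1 < W x}) {x | t < W x} ≤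
      ENNReal.ofReal (D ^ θ * M ^ θ) * ENNReal.ofReal (max t 1 ^ (-(p * n / (n - s * p)))) := by
    intro t ht
    have hmax : (0 : ℝ) < max t 1 := by positivity
    rw [Measure.restrict_apply (measurableSet_lt measurable_const hW)]
    refine (measure_mono (t := {x | max t 1 < W x}) ?_).trans
      ((level_decay hn hp hspn hc hFK hW hW1 hM0 hM hmax).trans (le_of_eq ?_))
    · rintro x ⟨h1, h2⟩
      have h1' : t < W x := h1
      have h2' : 1 < W x := h2
      exact max_lt h1' h2'
    · rw [← ENNReal.ofReal_mul (by positivity), ← Real.mul_rpow hD0.le hM0.le, hθ, hD]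
      congr 3; ring
  calc _ ≤ ENNReal.ofReal m * ∫⁻ t in Ioi (0 : ℝ), ENNReal.ofReal (D ^ θ * M ^ θ) *
        (ENNReal.ofReal (max t 1 ^ (-(p * n / (n - s * p)))) * ENNReal.ofReal (t ^ (m - 1))) := by
        apply mul_le_mul_right
        apply setLIntegral_mono' measurableSet_Ioi
        intro t ht
        rw [← mul_assoc]
        gcongr
        exact key t ht
    _ = ENNReal.ofReal m * (ENNReal.ofReal (D ^ θ * M ^ θ) * I) := by
        rw [lintegral_const_mul' _ _ ENNReal.ofReal_ne_top, hIdef]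
    _ ≤ ENNReal.ofReal m * (ENNReal.ofReal (D ^ θ * M ^ θ) * ENNReal.ofReal (I.toReal + 1)) := by
        gcongr
        rw [← ENNReal.ofReal_toReal hI.ne]
        exact ENNReal.ofReal_le_ofReal (by rw [ENNReal.toReal_ofReal (by positivity)]; linarith)
    _ = _ := by
        rw [← ENNReal.ofReal_mul (by positivity), ← ENNReal.ofReal_mul (by positivity), hθ]
        congr 1; ring

end WeakSobolev

section Sub

/-- Caccioppoli-type formulation of `(-Δ_p)^s w + f₂ ≤ f₁` in `B_R(z)`: the form is only tested
through one-sided pointwise bounds of the integrand, for test functions `F(w) η^p`. -/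
structure IsSub (n : ℕ) (s p L : ℝ) (z : Rn n) (R : ℝ) (w f₁ f₂ : Rn n → ℝ) : Prop where
  meas : Measurable w
  ineq : ∀ (F : ℝ → ℝ) (K : ℝ≥0), LipschitzWith K F → (∀ t, 0 ≤ F t) →
    ∀ ρ < R, ∀ η, Cutoff z ρ η → ∀ b g : Rn n → Rn n → ℝ,
    (∀ x y, 0 ≤ b x y) → (∀ x y, 0 ≤ g x y) →
    (∀ᵐ x : Rn n, ∀ᵐ y : Rn n,
      g x y ≤ sg p (w x - w y) * (F (w x) * η x ^ p - F (w y) * η y ^ p) + b x y) →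
    (∫⁻ x, ∫⁻ y, ENNReal.ofReal (g x y) * J n s p x y) +
        ∫⁻ x, ENNReal.ofReal (f₂ x * (F (w x) * η x ^ p)) ≤
      ENNReal.ofReal L * ((∫⁻ x, ∫⁻ y, ENNReal.ofReal (b x y) * J n s p x y) +
        ∫⁻ x, ENNReal.ofReal (f₁ x * (F (w x) * η x ^ p)))

/-- Formulation of `(-Δ_p)^s u ≥ f` in `B_R(z)`. -/
def IsSup (n : ℕ) (s p L : ℝ) (z : Rn n) (R : ℝ) (u f : Rn n → ℝ) : Prop :=
  IsSub n s p L z R (fun x => -u x) (fun _ => 0) f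

variable {n : ℕ} {s p L R : ℝ} {z : Rn n}

lemma IsSup.measurable {u f : Rn n → ℝ} (h : IsSup n s p L z R u f) : Measurable u := by
  have := h.meas.neg
  simpa [Pi.neg_def] using this

lemma IsSup.ineq (hp : 1 < p) {u f : Rn n → ℝ} (h : IsSup n s p L z R u f)
    (F : ℝ → ℝ) (K : ℝ≥0) (hF : LipschitzWith K F) (hF0 : ∀ t, 0 ≤ F t) (ρ : ℝ) (hρ : ρ < R)
    (η : Rn n → ℝ) (hη : Cutoff z ρ η) (b g : Rn n → Rn n → ℝ)
    (hb : ∀ x y, 0 ≤ b x y) (hg : ∀ x y, 0 ≤ g x y)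
    (hN : ∀ᵐ x : Rn n, ∀ᵐ y : Rn n,
      sg p (u x - u y) * (F (u x) * η x ^ p - F (u y) * η y ^ p) ≤ b x y - g x y) :
    (∫⁻ x, ∫⁻ y, ENNReal.ofReal (g x y) * J n s p x y) +
        ∫⁻ x, ENNReal.ofReal (f x * (F (u x) * η x ^ p)) ≤
      ENNReal.ofReal L * ∫⁻ x, ∫⁻ y, ENNReal.ofReal (b x y) * J n s p x y := by
  have hF' : LipschitzWith K (fun t => F (-t)) := by
    have := hF.comp (f := F) (g := fun t : ℝ => -t) LipschitzWith.id.neg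
    rwa [mul_one] at this
  have := IsSub.ineq h (fun t => F (-t)) K hF' (fun t => hF0 _) ρ hρ η hη b g hb hg ?_
  · simpa using this
  · filter_upwards [hN] with x hx
    filter_upwards [hx] with y hy
    rw [show -u x - -u y = -(u x - u y) by ring, sg_neg hp, neg_neg, neg_neg]
    linarith

lemma IsSub.mono {w f₁ f₂ : Rn n → ℝ} (h : IsSub n s p L z R w f₁ f₂) {z' : Rn n} {R' : ℝ}
    (hR : ‖z' - z‖ + R' ≤ R) : IsSub n s p L z' R' w f₁ f₂ := by
  refine ⟨h.meas, ?_⟩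
  intro F K hF hF0 ρ hρ η hη
  refine h.ineq F K hF hF0 (‖z' - z‖ + ρ) (by linarith) η ⟨hη.lip, hη.nonneg, hη.le_one, ?_⟩
  intro x hx
  apply hη.zero
  have := norm_add_le (x - z') (z' - z)
  rw [sub_add_sub_cancel] at this
  linarith

lemma IsSub.congr {w w' f₁ f₂ : Rn n → ℝ} (h : IsSub n s p L z R w f₁ f₂) (hw' : Measurable w')
    (he : w' =ᵐ[volume] w) : IsSub n s p L z R w' f₁ f₂ := by
  refine ⟨hw', ?_⟩
  intro F K hF hF0 ρ hρ η hη b g hb hg hN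
  have e : ∀ f : Rn n → ℝ, ∫⁻ x, ENNReal.ofReal (f x * (F (w' x) * η x ^ p)) =
      ∫⁻ x, ENNReal.ofReal (f x * (F (w x) * η x ^ p)) := by
    intro f
    apply lintegral_congr_ae
    filter_upwards [he] with x hx
    rw [hx]
  rw [e, e]
  apply h.ineq F K hF hF0 ρ hρ η hη b g hb hg
  filter_upwards [hN, he] with x hx hex
  filter_upwards [hx, he] with y hy hey
  rwa [← hex, ← hey]

/-- Forgetting the lower-order gain. -/
lemma IsSub.drop {w f₁ f₂ : Rn n → ℝ} (h : IsSub n s p L z R w f₁ f₂) :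
    IsSub n s p L z R w f₁ (fun _ => 0) := by
  refine ⟨h.meas, ?_⟩
  intro F K hF hF0 ρ hρ η hη b g hb hg hN
  refine le_trans ?_ (h.ineq F K hF hF0 ρ hρ η hη b g hb hg hN)
  simp

section Scaling

lemma map_affine_volume (z : Rn n) (hR : 0 < R) :
    Measure.map (fun x : Rn n => z + R • x) volume = ENNReal.ofReal ((R ^ n)⁻¹) • volume := by
  have h1 : (fun x : Rn n => z + R • x) = (fun x => z + x) ∘ (fun x => R • x) := rfl
  rw [h1, ← Measure.map_map (measurable_const_add z) (measurable_const_smul R),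
    Measure.map_addHaar_smul volume hR.ne', Measure.map_smul,
    (measurePreserving_add_left volume z).map_eq, finrank_euclideanSpace_fin,
    abs_of_pos (by positivity)]

/-- The map `x ↦ z + R x` as a measurable equivalence. -/
def affineEquiv (z : Rn n) (hR : 0 < R) : Rn n ≃ᵐ Rn n :=
  ((Homeomorph.smulOfNeZero R hR.ne').trans (Homeomorph.addLeft z)).toMeasurableEquiv

lemma lintegral_affine (z : Rn n) (hR : 0 < R) (G : Rn n → ℝ≥0∞) :
    ∫⁻ x, G x = ENNReal.ofReal (R ^ n) * ∫⁻ x, G (z + R • x) := by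
  have h := lintegral_map_equiv (μ := (volume : Measure (Rn n))) G (affineEquiv z hR)
  have e : (⇑(affineEquiv z hR) : Rn n → Rn n) = fun x => z + R • x := rfl
  rw [e, map_affine_volume z hR, lintegral_smul_measure] at h
  rw [← h, smul_eq_mul, ← mul_assoc, ← ENNReal.ofReal_mul (by positivity),
    mul_inv_cancel₀ (by positivity)]
  simp

lemma ae_affine (z : Rn n) (hR : 0 < R) {P : Rn n → Prop} :
    (∀ᵐ x : Rn n, P (z + R • x)) ↔ ∀ᵐ x : Rn n, P x := by
  have e : (⇑(affineEquiv z hR) : Rn n → Rn n) = fun x => z + R • x := rfl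
  have h1 : (∀ᵐ x ∂(Measure.map (fun x : Rn n => z + R • x) volume), P x) ↔
      ∀ᵐ x : Rn n, P (z + R • x) := by
    rw [← e]
    exact (affineEquiv z hR).measurableEmbedding.ae_map_iff
  rw [← h1, map_affine_volume z hR]
  rw [Measure.ae_ennreal_smul_measure_iff (by simpa using pow_pos hR n)]

lemma J_affine (z x y : Rn n) (hR : 0 < R) :
    J n s p (z + R • x) (z + R • y) = ENNReal.ofReal (R ^ (-((n : ℝ) + s * p))) * J n s p x y := by
  unfold J
  rw [← ENNReal.ofReal_mul (by positivity), ← Real.mul_rpow hR.le (norm_nonneg _),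
    add_sub_add_left_eq_sub, ← smul_sub, norm_smul, Real.norm_of_nonneg hR.le]

lemma lintegral_lintegral_affine (z : Rn n) (hR : 0 < R) (G : Rn n → Rn n → ℝ≥0∞) :
    ∫⁻ x, ∫⁻ y, G x y * J n s p x y = ENNReal.ofReal (R ^ ((n : ℝ) - s * p)) *
      ∫⁻ x, ∫⁻ y, G (z + R • x) (z + R • y) * J n s p x y := by
  rw [lintegral_affine z hR]
  simp_rw [fun x : Rn n => lintegral_affine z hR (fun y => G (z + R • x) y * J n s p (z + R • x) y),
    J_affine z _ _ hR, mul_left_comm _ (ENNReal.ofReal (R ^ (-((n : ℝ) + s * p)))),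
    lintegral_const_mul' _ _ ENNReal.ofReal_ne_top]
  rw [← mul_assoc, ← mul_assoc, ← ENNReal.ofReal_mul (by positivity),
    ← ENNReal.ofReal_mul (by positivity)]
  congr 2
  rw [← Real.rpow_natCast, ← Real.rpow_add hR, ← Real.rpow_add hR]
  congr 1; ring

/-- Rescaling to the unit ball. -/
lemma IsSub.affine {w f₁ f₂ : Rn n → ℝ} (h : IsSub n s p L z R w f₁ f₂) (hR : 0 < R)
    (a : ℝ) {d : ℝ} (hd : 0 < d) :
    IsSub n s p L 0 1 (fun x => (w (z + R • x) - a) / d)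
      (fun x => R ^ (s * p) / d ^ (p - 1) * f₁ (z + R • x))
      (fun x => R ^ (s * p) / d ^ (p - 1) * f₂ (z + R • x)) := by
  have hmz : Measurable fun x : Rn n => z + R • x := by fun_prop
  refine ⟨((h.meas.comp hmz).sub_const a).div_const d, ?_⟩
  intro F K hF hF0 ρ hρ η hη b g hb hg hN
  obtain ⟨T, hT⟩ : ∃ T : Rn n → Rn n, T = fun y => R⁻¹ • (y - z) := ⟨_, rfl⟩
  have hT1 : ∀ x, T (z + R • x) = x := by
    intro x; rw [hT]; simp [smul_smul, inv_mul_cancel₀ hR.ne']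
  have hTn : ∀ y, ‖y - z‖ = R * ‖T y‖ := by
    intro y; rw [hT]; simp only [norm_smul, norm_inv, Real.norm_of_nonneg hR.le]
    field_simp
  have hdp : 0 < d ^ (p - 1) := by positivity
  obtain ⟨Kη, hKη⟩ := hη.lip
  have hTL : LipschitzWith (Real.toNNReal R⁻¹) T := by
    apply LipschitzWith.of_dist_le_mul
    intro x y
    rw [hT, dist_eq_norm, dist_eq_norm, ← smul_sub, norm_smul, sub_sub_sub_cancel_right,
      Real.coe_toNNReal _ (by positivity), Real.norm_of_nonneg (by positivity)]
  have hcut : Cutoff z (R * ρ) (fun y => η (T y)) := by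
    refine ⟨⟨_, hKη.comp hTL⟩, fun x => hη.nonneg _, fun x => hη.le_one _, ?_⟩
    intro x hx
    apply hη.zero
    rw [hTn] at hx
    rw [sub_zero]
    exact le_of_mul_le_mul_left hx hR
  have hFL : LipschitzWith (K * Real.toNNReal d⁻¹) (fun t => F ((t - a) / d)) := by
    apply hF.comp
    apply LipschitzWith.of_dist_le_mul
    intro x y
    rw [Real.coe_toNNReal _ (by positivity), Real.dist_eq, Real.dist_eq, ← sub_div,
      sub_sub_sub_cancel_right, abs_div, abs_of_pos hd, div_eq_inv_mul]
  have key := h.ineq (fun t => F ((t - a) / d)) _ hFL (fun t => hF0 _) (R * ρ) (by nlinarith)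
    (fun y => η (T y)) hcut (fun x y => d ^ (p - 1) * b (T x) (T y))
    (fun x y => d ^ (p - 1) * g (T x) (T y)) (fun x y => mul_nonneg hdp.le (hb _ _))
    (fun x y => mul_nonneg hdp.le (hg _ _)) ?_
  · rw [lintegral_lintegral_affine z hR (fun x y => ENNReal.ofReal (d ^ (p - 1) * g (T x) (T y))),
      lintegral_lintegral_affine z hR (fun x y => ENNReal.ofReal (d ^ (p - 1) * b (T x) (T y))),
      lintegral_affine z hR (fun x => ENNReal.ofReal (f₁ x * _)),
      lintegral_affine z hR (fun x => ENNReal.ofReal (f₂ x * _))] at key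
    simp only [hT1, ENNReal.ofReal_mul hdp.le, mul_assoc] at key
    simp_rw [lintegral_const_mul' _ _ (ENNReal.ofReal_ne_top (r := d ^ (p - 1)))] at key
    have e : ∀ f : Rn n → ℝ, ENNReal.ofReal (R ^ n) * ∫⁻ x, ENNReal.ofReal (f (z + R • x) *
        (F ((w (z + R • x) - a) / d) * η x ^ p)) =
        ENNReal.ofReal (R ^ ((n : ℝ) - s * p)) * (ENNReal.ofReal (d ^ (p - 1)) *
        ∫⁻ x, ENNReal.ofReal (R ^ (s * p) / d ^ (p - 1) * f (z + R • x) *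
          (F ((w (z + R • x) - a) / d) * η x ^ p))) := by
      intro f
      rw [← mul_assoc, ← ENNReal.ofReal_mul (by positivity)]
      simp_rw [mul_assoc (R ^ (s * p) / d ^ (p - 1)), ENNReal.ofReal_mul
        (show 0 ≤ R ^ (s * p) / d ^ (p - 1) by positivity)]
      rw [lintegral_const_mul' _ _ ENNReal.ofReal_ne_top, ← mul_assoc,
        ← ENNReal.ofReal_mul (by positivity)]
      congr 2
      rw [← Real.rpow_natCast, show R ^ (n : ℝ) = R ^ ((n : ℝ) - s * p) * R ^ (s * p) by
        rw [← Real.rpow_add hR]; congr 1; ring]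
      field_simp
    rw [e, e, ← mul_add, ← mul_add, ← mul_add, ← mul_add, mul_left_comm (ENNReal.ofReal L),
      mul_left_comm (ENNReal.ofReal L)] at key
    have hp1 : 0 < R ^ ((n : ℝ) - s * p) := by positivity
    rw [ENNReal.mul_le_mul_iff_right (by simpa using hp1) ENNReal.ofReal_ne_top,
      ENNReal.mul_le_mul_iff_right (by simpa using hdp) ENNReal.ofReal_ne_top] at key
    exact key
  · rw [← ae_affine z hR]
    filter_upwards [hN] with x hx
    rw [← ae_affine z hR]
    filter_upwards [hx] with y hy
    simp only [hT1]
    have e : sg p (w (z + R • x) - w (z + R • y)) = d ^ (p - 1) *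
        sg p ((w (z + R • x) - a) / d - (w (z + R • y) - a) / d) := by
      rw [← sg_mul hd]
      congr 1; field_simp; ring
    rw [e, mul_assoc, ← mul_add]
    exact mul_le_mul_of_nonneg_left hy hdp.le

end Scaling

end Sub

/-- Admissible exponents for the energy method. -/
structure Par (n : ℕ) (s p β Q : ℝ) : Prop where
  hn : 2 ≤ n
  hs : 0 < s
  hs1 : s < 1
  hp : 1 < p
  hspn : s * p < n
  hβ : 1 < β
  hβp : β < p
  hQ1 : 1 ≤ Q
  hQp : p - 1 ≤ Q
  hQβ : β * (p - 1) ≤ Q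
  hQ : Q * (n - s * p) < (p - β) * n

section Budget

variable {n : ℕ} {s p : ℝ}

lemma exists_budget (hn : 2 ≤ n) (hs : 0 < s) (hs1 : s < 1) (hp : 0 < p) {l r₁ r₂ : ℝ}
    (hl : 1 ≤ l) (hr₁ : 0 ≤ r₁) (hr : r₁ < r₂) :
    ∃ C : ℝ, 0 < C ∧ ∀ h A k : Rn n → ℝ, Measurable h → Measurable A → Measurable k →
      (∀ x, 0 ≤ h x) → (∀ x, 0 ≤ A x) → (∀ x, 0 ≤ k x) → (∀ x, r₁ ≤ ‖x‖ → A x = 0) →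
      (∀ y, ‖y‖ < r₂ → k y = 0) → ∀ b : Rn n → Rn n → ℝ,
      (∀ᵐ x : Rn n, ∀ᵐ y : Rn n, b x y ≤ (h x + h y) * min 1 (l * ‖x - y‖) ^ p +
        (A x * k y + A y * k x)) →
      ∫⁻ x, ∫⁻ y, ENNReal.ofReal (b x y) * J n s p x y ≤ ENNReal.ofReal C *
        ((∫⁻ x, ENNReal.ofReal (h x)) +
          (∫⁻ x, ENNReal.ofReal (A x)) * ∫⁻ y, ENNReal.ofReal (k y) * J n s p 0 y) := by
  obtain ⟨C, hC, hCm⟩ := exists_lintegral_min_le (n := n) hn hs hs1 hp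
  have hsp : 0 ≤ s * p := by positivity
  obtain ⟨γ, hγ⟩ : ∃ γ : ℝ, γ = (r₂ / (r₂ - r₁)) ^ ((n : ℝ) + s * p) := ⟨_, rfl⟩
  have hd : 0 < r₂ - r₁ := by linarith
  have hr₂ : 0 < r₂ := by linarith
  have hγ0 : 0 < γ := by rw [hγ]; positivity
  refine ⟨2 * (C * l ^ p) + 2 * γ, by positivity, ?_⟩
  intro h A k hh hA hk hh0 hA0 hk0 hA1 hk1 b hb
  obtain ⟨H, hH⟩ : ∃ H : Rn n → Rn n → ℝ≥0∞, H = fun x y =>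
    ENNReal.ofReal (h x) * (ENNReal.ofReal (min 1 (l * ‖x - y‖) ^ p) * J n s p x y) := ⟨_, rfl⟩
  obtain ⟨T, hT⟩ : ∃ T : Rn n → Rn n → ℝ≥0∞, T = fun x y =>
    ENNReal.ofReal (A x) * (ENNReal.ofReal (k y) * J n s p x y) := ⟨_, rfl⟩
  have hHm : Measurable (Function.uncurry H) := by
    rw [hH]; unfold Function.uncurry; fun_prop
  have hTm : Measurable (Function.uncurry T) := by
    rw [hT]; unfold Function.uncurry; fun_prop
  have hHI : ∫⁻ x, ∫⁻ y, H x y ≤ ENNReal.ofReal (C * l ^ p) * ∫⁻ x, ENNReal.ofReal (h x) := by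
    rw [← lintegral_const_mul' _ _ ENNReal.ofReal_ne_top]
    apply lintegral_mono
    intro x
    dsimp only
    rw [hH, lintegral_const_mul' _ _ ENNReal.ofReal_ne_top, mul_comm (ENNReal.ofReal (h x))]
    gcongr
    exact hCm l hl x
  have hTI : ∫⁻ x, ∫⁻ y, T x y ≤ ENNReal.ofReal γ *
      ((∫⁻ x, ENNReal.ofReal (A x)) * ∫⁻ y, ENNReal.ofReal (k y) * J n s p 0 y) := by
    rw [mul_left_comm, ← lintegral_mul_const _ (by fun_prop)]
    apply lintegral_mono
    intro x
    rw [hT]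
    dsimp only
    rw [lintegral_const_mul' _ _ ENNReal.ofReal_ne_top]
    by_cases hx : r₁ ≤ ‖x‖
    · simp [hA1 x hx]
    gcongr
    rw [← lintegral_const_mul' _ _ ENNReal.ofReal_ne_top]
    apply lintegral_mono
    intro y
    dsimp only
    by_cases hy : ‖y‖ < r₂
    · simp [hk1 y hy]
    rw [mul_left_comm]
    gcongr
    rw [hγ]
    exact J_le_far hsp hr hr₁ (by simpa using (not_le.1 hx).le) (by simpa using not_lt.1 hy)
  have hsw : ∀ G : Rn n → Rn n → ℝ≥0∞, Measurable (Function.uncurry G) →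
      ∫⁻ x, ∫⁻ y, G y x = ∫⁻ x, ∫⁻ y, G x y := by
    intro G hG
    rw [lintegral_lintegral_swap (f := fun x y => G y x)]
    exact (hG.comp measurable_swap).aemeasurable
  have hsum : ∫⁻ x, ∫⁻ y, (H x y + H y x + (T x y + T y x)) =
      2 * (∫⁻ x, ∫⁻ y, H x y) + 2 * ∫⁻ x, ∫⁻ y, T x y := by
    have m1 : ∀ G : Rn n → Rn n → ℝ≥0∞, Measurable (Function.uncurry G) →
        ∀ x, Measurable fun y => G x y := fun G hG x => hG.comp measurable_prodMk_left
    have m2 : ∀ G : Rn n → Rn n → ℝ≥0∞, Measurable (Function.uncurry G) →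
        ∀ x, Measurable fun y => G y x := fun G hG x => hG.comp measurable_prodMk_right
    have m3 : ∀ G : Rn n → Rn n → ℝ≥0∞, Measurable (Function.uncurry G) →
        Measurable fun x => ∫⁻ y, G x y := fun G hG => hG.lintegral_prod_right'
    have m4 : ∀ G : Rn n → Rn n → ℝ≥0∞, Measurable (Function.uncurry G) →
        Measurable fun x => ∫⁻ y, G y x := fun G hG =>
          (hG.comp measurable_swap).lintegral_prod_right'
    have e1 : ∀ x, ∫⁻ y, (H x y + H y x + (T x y + T y x)) =
        (∫⁻ y, H x y) + (∫⁻ y, H y x) + ((∫⁻ y, T x y) + ∫⁻ y, T y x) := by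
      intro x
      have h0 : Measurable fun y => H x y + H y x := (m1 H hHm x).add (m2 H hHm x)
      rw [lintegral_add_left h0, lintegral_add_left (m1 H hHm x),
        lintegral_add_left (m1 T hTm x)]
    simp_rw [e1]
    have h0 : Measurable fun x => (∫⁻ y, H x y) + ∫⁻ y, H y x := (m3 H hHm).add (m4 H hHm)
    rw [lintegral_add_left h0, lintegral_add_left (m3 H hHm),
      lintegral_add_left (m3 T hTm), hsw H hHm, hsw T hTm, two_mul, two_mul]
  calc _ ≤ ∫⁻ x, ∫⁻ y, (H x y + H y x + (T x y + T y x)) := by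
        apply lintegral_mono_ae
        filter_upwards [hb] with x hx
        apply lintegral_mono_ae
        filter_upwards [hx] with y hy
        have := ENNReal.ofReal_le_ofReal hy
        rw [ENNReal.ofReal_add (mul_nonneg (add_nonneg (hh0 _) (hh0 _)) (by positivity))
          (add_nonneg (mul_nonneg (hA0 _) (hk0 _)) (mul_nonneg (hA0 _) (hk0 _))),
          ENNReal.ofReal_add (mul_nonneg (hA0 _) (hk0 _)) (mul_nonneg (hA0 _) (hk0 _)),
          ENNReal.ofReal_mul (add_nonneg (hh0 _) (hh0 _)), ENNReal.ofReal_add (hh0 _) (hh0 _),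
          ENNReal.ofReal_mul (hA0 _), ENNReal.ofReal_mul (hA0 _)] at this
        refine (mul_le_mul_left this _).trans (le_of_eq ?_)
        rw [hH, hT]
        dsimp only
        rw [J_comm n s p y x, norm_sub_rev y x]
        ring
    _ = _ := hsum
    _ ≤ 2 * (ENNReal.ofReal (C * l ^ p) * ∫⁻ x, ENNReal.ofReal (h x)) +
        2 * (ENNReal.ofReal γ *
      ((∫⁻ x, ENNReal.ofReal (A x)) * ∫⁻ y, ENNReal.ofReal (k y) * J n s p 0 y)) := by gcongr
    _ ≤ _ := by
        have e : ∀ t : ℝ, 2 * ENNReal.ofReal t = ENNReal.ofReal (2 * t) := by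
          intro t; rw [ENNReal.ofReal_mul (by norm_num)]; simp
        rw [mul_add, ← mul_assoc, ← mul_assoc 2 (ENNReal.ofReal γ), e, e]
        gcongr
        · linarith
        · have : 0 < C * l ^ p := by positivity
          linarith

end Budget

section UpStep

lemma one_add_rpow_lipschitz {β : ℝ} (hβ : 1 < β) :
    LipschitzWith (Real.toNNReal (β - 1)) (fun t : ℝ => (1 + max t 0) ^ (1 - β)) := by
  have key : ∀ x y : ℝ, 1 ≤ y → y ≤ x → y ^ (1 - β) - x ^ (1 - β) ≤ (β - 1) * (x - y) := by
    intro x y hy hxy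
    have hy0 : 0 < y := by linarith
    have hx0 : 0 < x := by linarith
    have h1 : x ^ (1 - β) = y ^ (1 - β) * (x / y) ^ (1 - β) := by
      rw [← Real.mul_rpow hy0.le (by positivity), mul_div_cancel₀ _ hy0.ne']
    have h2 : 1 - (β - 1) * (x / y - 1) ≤ (x / y) ^ (1 - β) := by
      rw [Real.rpow_def_of_pos (by positivity)]
      have := Real.add_one_le_exp (Real.log (x / y) * (1 - β))
      have h3 := Real.log_le_sub_one_of_pos (show 0 < x / y by positivity)
      nlinarith
    have h4 : y ^ (1 - β) ≤ 1 := Real.rpow_le_one_of_one_le_of_nonpos hy (by linarith)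
    have h5 : 0 ≤ y ^ (1 - β) := by positivity
    have h6 : x / y - 1 ≤ x - y := by
      rw [div_sub_one hy0.ne', div_le_iff₀ hy0]; nlinarith
    have h7 : 0 ≤ x / y - 1 := by
      rw [div_sub_one hy0.ne']; apply div_nonneg <;> linarith
    calc y ^ (1 - β) - x ^ (1 - β) = y ^ (1 - β) * (1 - (x / y) ^ (1 - β)) := by rw [h1]; ring
      _ ≤ y ^ (1 - β) * ((β - 1) * (x / y - 1)) := by gcongr; linarith
      _ ≤ 1 * ((β - 1) * (x / y - 1)) := by
          apply mul_le_mul_of_nonneg_right h4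
          apply mul_nonneg <;> linarith
      _ ≤ _ := by rw [one_mul]; gcongr
  apply LipschitzWith.of_dist_le_mul
  have key2 : ∀ a b : ℝ, a ≤ b → |(1 + max a 0) ^ (1 - β) - (1 + max b 0) ^ (1 - β)| ≤
      (β - 1) * |a - b| := by
    intro a b hab
    have h1 : max a 0 ≤ max b 0 := max_le_max_right _ hab
    have h2 := key (1 + max b 0) (1 + max a 0) (by linarith [le_max_right a 0]) (by linarith)
    have h3 : (1 + max b 0) ^ (1 - β) ≤ (1 + max a 0) ^ (1 - β) :=
      Real.rpow_le_rpow_of_nonpos (by linarith [le_max_right a 0]) (by linarith) (by linarith)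
    rw [abs_of_nonneg (by linarith), abs_of_nonpos (by linarith)]
    refine h2.trans ?_
    gcongr
    have h4 : max b 0 - max a 0 ≤ b - a := by
      have : max b 0 ≤ max a 0 + (b - a) :=
        max_le (by linarith [le_max_left a 0]) (by linarith [le_max_right a 0])
      linarith
    linarith
  intro a b
  rw [Real.coe_toNNReal _ (by linarith), Real.dist_eq, Real.dist_eq]
  rcases le_total a b with h | h
  · exact key2 a b h
  · rw [abs_sub_comm, abs_sub_comm a b]; exact key2 b a h

lemma upF_lipschitz {β : ℝ} (hβ : 1 < β) : LipschitzWith (Real.toNNReal (β - 1)) (upF β) := by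
  apply LipschitzWith.of_dist_le_mul
  intro a b
  have := (one_add_rpow_lipschitz hβ).dist_le_mul a b
  unfold upF
  rwa [dist_sub_left]

lemma neg_sg_sub_le {p a b : ℝ} (hp : 1 < p) (ha : 0 ≤ a) :
    -sg p (a - b) ≤ max b 0 ^ (p - 1) := by
  rcases le_total b a with h | h
  · rw [sg_of_nonneg (by linarith)]
    have h1 : 0 ≤ (a - b) ^ (p - 1) := Real.rpow_nonneg (by linarith) _
    have h2 : 0 ≤ max b 0 ^ (p - 1) := by positivity
    linarith
  · rw [← sg_neg hp, neg_sub, sg_of_nonneg (by linarith), max_eq_left (by linarith)]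
    exact Real.rpow_le_rpow (by linarith) (by linarith) (by linarith)

variable {n : ℕ} {s p β Q : ℝ}

lemma Par.hpβ (P : Par n s p β Q) : p - β ≤ Q := by
  have := P.hQβ; have := P.hβ; have := P.hβp; nlinarith

/-- `(1+w)^Q` on the positivity set of `w` in the unit ball. -/
def posPow (n : ℕ) (Q : ℝ) (w : Rn n → ℝ) (x : Rn n) : ℝ :=
  ({x | ‖x‖ < 1 ∧ 0 < w x}).indicator (fun x => (1 + w x) ^ Q) x

lemma posPow_nonneg (w : Rn n → ℝ) (x : Rn n) : 0 ≤ posPow n Q w x := by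
  apply indicator_nonneg
  rintro x ⟨-, hx⟩
  exact Real.rpow_nonneg (by linarith) _

lemma measurable_posPow {w : Rn n → ℝ} (hw : Measurable w) : Measurable (posPow n Q w) := by
  apply Measurable.indicator (f := fun x => (1 + w x) ^ Q) (by fun_prop)
  exact (measurableSet_lt (f := fun x : Rn n => ‖x‖) (by fun_prop) measurable_const).inter
    (measurableSet_lt measurable_const hw)

lemma posPow_of {w : Rn n → ℝ} {x : Rn n} (hx : ‖x‖ < 1) (hw : 0 < w x) :
    posPow n Q w x = (1 + w x) ^ Q := indicator_of_mem (s := {x | ‖x‖ < 1 ∧ 0 < w x}) ⟨hx, hw⟩ _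

lemma up_pointwise_far (hβ : 1 < β) (hp : 1 < p) {w η : Rn n → ℝ} (hη : Cutoff 0 (3 / 4) η)
    {x y : Rn n} (hy : 1 ≤ ‖y‖) :
    0 ≤ sg p (w x - w y) * (upF β (w x) * η x ^ p - upF β (w y) * η y ^ p) +
      ({x : Rn n | ‖x‖ < 3 / 4 ∧ 0 < w x}).indicator (fun _ => (1 : ℝ)) x *
        max (w y) 0 ^ (p - 1) := by
  have hp0 : p ≠ 0 := by linarith
  have hk : 0 ≤ max (w y) 0 ^ (p - 1) := by positivity
  rw [hη.zero y (by rw [sub_zero]; linarith), Real.zero_rpow hp0, mul_zero, sub_zero]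
  by_cases hx : ‖x‖ < 3 / 4 ∧ 0 < w x
  · rw [indicator_of_mem (by exact hx), one_mul]
    have h1 := neg_sg_sub_le (b := w y) hp hx.2.le
    have h2 : 0 ≤ upF β (w x) * η x ^ p :=
      mul_nonneg (upF_nonneg hβ _) (Real.rpow_nonneg (hη.nonneg x) _)
    have h3 : upF β (w x) * η x ^ p ≤ 1 :=
      mul_le_one₀ (upF_le_one _ _) (Real.rpow_nonneg (hη.nonneg x) _)
        (Real.rpow_le_one (hη.nonneg x) (hη.le_one x) (by linarith))
    nlinarith
  · rw [indicator_of_notMem (by exact hx), zero_mul, add_zero]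
    apply le_of_eq
    rw [not_and_or, not_lt, not_lt] at hx
    rcases hx with h | h
    · rw [hη.zero x (by rw [sub_zero]; linarith), Real.zero_rpow hp0]; ring
    · rw [upF_of_nonpos h]; ring

lemma up_pointwise (P : Par n s p β Q) : ∃ C : ℝ, 0 < C ∧ ∀ (w η : Rn n → ℝ) (l : ℝ),
    Cutoff 0 (3 / 4) η → 0 ≤ l → (∀ x y, |η x - η y| ≤ min 1 (l * ‖x - y‖)) → ∀ x y : Rn n,
    (β - 1) / 2 * (|(1 + max (w x) 0) ^ ((p - β) / p) - (1 + max (w y) 0) ^ ((p - β) / p)| ^ p *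
        min (η x) (η y) ^ p) ≤
      sg p (w x - w y) * (upF β (w x) * η x ^ p - upF β (w y) * η y ^ p) +
      ((C * posPow n Q w x + C * posPow n Q w y) * min 1 (l * ‖x - y‖) ^ p +
        (({x : Rn n | ‖x‖ < 3 / 4 ∧ 0 < w x}).indicator (fun _ => (1 : ℝ)) x *
          ({y : Rn n | 1 ≤ ‖y‖}).indicator (fun y => max (w y) 0 ^ (p - 1)) y +
        ({x : Rn n | ‖x‖ < 3 / 4 ∧ 0 < w x}).indicator (fun _ => (1 : ℝ)) y *
          ({y : Rn n | 1 ≤ ‖y‖}).indicator (fun y => max (w y) 0 ^ (p - 1)) x)) := by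
  have hp := P.hp
  have hβ := P.hβ
  have hp0 : p ≠ 0 := by linarith
  obtain ⟨C, hC, hup⟩ := pointwise_up P.hβ P.hβp
  refine ⟨C, hC, ?_⟩
  intro w η l hη hl hηl x y
  obtain ⟨A, hA⟩ : ∃ A : Rn n → ℝ, A = ({x : Rn n | ‖x‖ < 3 / 4 ∧ 0 < w x}).indicator
    (fun _ => (1 : ℝ)) := ⟨_, rfl⟩
  obtain ⟨k, hk⟩ : ∃ k : Rn n → ℝ, k = ({y : Rn n | 1 ≤ ‖y‖}).indicator
    (fun y => max (w y) 0 ^ (p - 1)) := ⟨_, rfl⟩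
  have hA0 : ∀ x, 0 ≤ A x := by
    intro x; rw [hA]; exact indicator_nonneg (fun _ _ => zero_le_one) _
  have hk0 : ∀ x, 0 ≤ k x := by
    intro x; rw [hk]; exact indicator_nonneg (fun _ _ => by positivity) _
  have hfar : ∀ x y : Rn n, 1 ≤ ‖y‖ →
      0 ≤ sg p (w x - w y) * (upF β (w x) * η x ^ p - upF β (w y) * η y ^ p) + A x * k y := by
    intro x y hy
    have := up_pointwise_far (w := w) (x := x) hβ hp hη hy
    rw [hA, hk, indicator_of_mem (s := {y : Rn n | 1 ≤ ‖y‖}) hy]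
    exact this
  rw [← hA, ← hk]
  have hq : 0 ≤ (C * posPow n Q w x + C * posPow n Q w y) * min 1 (l * ‖x - y‖) ^ p :=
    mul_nonneg (add_nonneg (mul_nonneg hC.le (posPow_nonneg _ _))
      (mul_nonneg hC.le (posPow_nonneg _ _))) (by positivity)
  have hAk : 0 ≤ A x * k y := mul_nonneg (hA0 _) (hk0 _)
  have hAk' : 0 ≤ A y * k x := mul_nonneg (hA0 _) (hk0 _)
  rcases le_or_gt 1 ‖y‖ with hy | hy
  · rw [hη.zero y (by rw [sub_zero]; linarith), min_eq_right (hη.nonneg x), Real.zero_rpow hp0,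
      mul_zero, mul_zero]
    have := hfar x y hy
    rw [hη.zero y (by rw [sub_zero]; linarith), Real.zero_rpow hp0] at this
    linarith
  rcases le_or_gt 1 ‖x‖ with hx | hx
  · have := hfar y x hx
    rw [sg_mul_sub_comm hp] at this
    rw [hη.zero x (by rw [sub_zero]; linarith), min_eq_left (hη.nonneg y), Real.zero_rpow hp0,
      mul_zero, mul_zero]
    rw [hη.zero x (by rw [sub_zero]; linarith), Real.zero_rpow hp0] at this
    linarith
  refine (hup (w x) (w y) (η x) (η y) (hη.nonneg x) (hη.nonneg y)).trans ?_
  have h1 : (if 0 < min (w x) (w y) then (1 + max (w x) (w y)) ^ (β * (p - 1)) else 0) ≤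
      posPow n Q w x + posPow n Q w y := by
    split_ifs with h
    · rw [posPow_of hx (lt_min_iff.1 h).1, posPow_of hy (lt_min_iff.1 h).2]
      have hwx := (lt_min_iff.1 h).1
      have hwy := (lt_min_iff.1 h).2
      have e1 : 0 ≤ (1 + w x) ^ Q := by positivity
      have e2 : 0 ≤ (1 + w y) ^ Q := by positivity
      rcases le_total (w x) (w y) with h' | h'
      · rw [max_eq_right h']
        have := Real.rpow_le_rpow_of_exponent_le (show 1 ≤ 1 + w y by linarith) P.hQβ
        linarith
      · rw [max_eq_left h']
        have := Real.rpow_le_rpow_of_exponent_le (show 1 ≤ 1 + w x by linarith) P.hQβ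
        linarith
    · exact add_nonneg (posPow_nonneg _ _) (posPow_nonneg _ _)
  have h2 : |η x - η y| ^ p ≤ min 1 (l * ‖x - y‖) ^ p :=
    Real.rpow_le_rpow (abs_nonneg _) (hηl x y) (by linarith)
  have h3 : |η x - η y| ^ p *
      (if 0 < min (w x) (w y) then (1 + max (w x) (w y)) ^ (β * (p - 1)) else 0) ≤
      min 1 (l * ‖x - y‖) ^ p * (posPow n Q w x + posPow n Q w y) :=
    mul_le_mul h2 h1 (by split_ifs with h
                         · have := le_max_left (w x) (w y); have := (lt_min_iff.1 h).1; positivity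
                         · exact le_rfl) (by positivity)
  have h4 := mul_le_mul_of_nonneg_left h3 hC.le
  have h5 : (C * posPow n Q w x + C * posPow n Q w y) * min 1 (l * ‖x - y‖) ^ p =
      C * (min 1 (l * ‖x - y‖) ^ p * (posPow n Q w x + posPow n Q w y)) := by ring
  rw [h5]
  linarith

/-- Cutting off the power profile. -/
lemma cutoff_pointwise (hp : 1 < p) (hβp : β < p) (hpβ : p - β ≤ Q) {w η : Rn n → ℝ} {l : ℝ} {ρ : ℝ} (hρ : ρ ≤ 1)
    (hη : Cutoff 0 ρ η) (hl : 0 ≤ l) (hηl : ∀ x y, |η x - η y| ≤ min 1 (l * ‖x - y‖))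
    (x y : Rn n) :
    |((1 + max (w x) 0) ^ ((p - β) / p) - 1) * η x -
        ((1 + max (w y) 0) ^ ((p - β) / p) - 1) * η y| ^ p ≤
      2 ^ p * (|(1 + max (w x) 0) ^ ((p - β) / p) - (1 + max (w y) 0) ^ ((p - β) / p)| ^ p *
        min (η x) (η y) ^ p) +
      (2 ^ p * posPow n Q w x + 2 ^ p * posPow n Q w y) * min 1 (l * ‖x - y‖) ^ p := by
  have hp0 : p ≠ 0 := by linarith
  have hα : 0 < (p - β) / p := div_pos (by linarith [hβp]) (by linarith)
  obtain ⟨V, hV⟩ : ∃ V : Rn n → ℝ, V = fun x => (1 + max (w x) 0) ^ ((p - β) / p) - 1 := ⟨_, rfl⟩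
  have hV0 : ∀ x, 0 ≤ V x := by
    intro x; rw [hV]
    have : 1 ≤ (1 + max (w x) 0) ^ ((p - β) / p) :=
      Real.one_le_rpow (by linarith [le_max_right (w x) 0]) hα.le
    dsimp only; linarith
  have hVp : ∀ x, ‖x‖ < 1 → V x ^ p ≤ posPow n Q w x := by
    intro x hx
    rcases le_or_gt (w x) 0 with h | h
    · have : V x = 0 := by rw [hV]; simp [max_eq_right h]
      rw [this, Real.zero_rpow hp0]; exact posPow_nonneg _ _
    · rw [posPow_of hx h]
      calc V x ^ p ≤ ((1 + w x) ^ ((p - β) / p)) ^ p := by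
            apply Real.rpow_le_rpow (hV0 x) _ (by linarith)
            rw [hV]; dsimp only; rw [max_eq_left h.le]; linarith
        _ = (1 + w x) ^ (p - β) := by
            rw [← Real.rpow_mul (by linarith), div_mul_cancel₀ _ hp0]
        _ ≤ _ := Real.rpow_le_rpow_of_exponent_le (by linarith) hpβ
  have e1 : (1 + max (w x) 0) ^ ((p - β) / p) - (1 + max (w y) 0) ^ ((p - β) / p) =
    V x - V y := by rw [hV]; ring
  have e2 : ∀ x, (1 + max (w x) 0) ^ ((p - β) / p) - 1 = V x := by intro x; rw [hV]
  rw [e1, e2, e2]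
  have h1 := abs_mul_sub_mul_le (x := V x) (y := V y) (hη.nonneg x) (hη.nonneg y)
  have hmin : 0 ≤ min (η x) (η y) := le_min (hη.nonneg x) (hη.nonneg y)
  have h2 : 0 ≤ (if η y ≤ η x then |V x| else |V y|) := by split_ifs <;> exact abs_nonneg _
  have h3 := Real.rpow_le_rpow (abs_nonneg _) h1 (show 0 ≤ p by linarith)
  have h4 := h3.trans (add_rpow_le (p := p) (by linarith) (mul_nonneg (abs_nonneg (V x - V y)) hmin)
    (mul_nonneg h2 (abs_nonneg (η x - η y))))
  rw [Real.mul_rpow (abs_nonneg _) hmin, Real.mul_rpow h2 (abs_nonneg _)] at h4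
  have h5 : |η x - η y| ^ p ≤ min 1 (l * ‖x - y‖) ^ p :=
    Real.rpow_le_rpow (abs_nonneg _) (hηl x y) (by linarith)
  have hm0 : 0 ≤ min 1 (l * ‖x - y‖) ^ p := by positivity
  have h6 : (if η y ≤ η x then |V x| else |V y|) ^ p * |η x - η y| ^ p ≤
      (posPow n Q w x + posPow n Q w y) * min 1 (l * ‖x - y‖) ^ p := by
    by_cases h0 : η x - η y = 0
    · rw [h0, abs_zero, Real.zero_rpow hp0, mul_zero]
      exact mul_nonneg (add_nonneg (posPow_nonneg _ _) (posPow_nonneg _ _)) hm0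
    apply mul_le_mul _ h5 (by positivity) (add_nonneg (posPow_nonneg _ _) (posPow_nonneg _ _))
    split_ifs with h
    · rw [abs_of_nonneg (hV0 x)]
      have hx : ‖x‖ < 1 := by
        by_contra hc
        have := hη.zero x (by rw [sub_zero]; linarith)
        have := hη.nonneg y
        apply h0; linarith
      linarith [hVp x hx, posPow_nonneg (Q := Q) w y]
    · rw [abs_of_nonneg (hV0 y)]
      have hy : ‖y‖ < 1 := by
        by_contra hc
        have := hη.zero y (by rw [sub_zero]; linarith)
        have := hη.nonneg x
        apply h0; linarith
      linarith [hVp y hy, posPow_nonneg (Q := Q) w x]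
  have h2p : (0 : ℝ) < 2 ^ p := by positivity
  have h7 := mul_le_mul_of_nonneg_left h6 h2p.le
  calc _ ≤ _ := h4
    _ ≤ _ := by
      rw [mul_add, show (2 ^ p * posPow n Q w x + 2 ^ p * posPow n Q w y) *
        min 1 (l * ‖x - y‖) ^ p = 2 ^ p * ((posPow n Q w x + posPow n Q w y) *
        min 1 (l * ‖x - y‖) ^ p) by ring]
      linarith

end UpStep

section UpEnergy

variable {n : ℕ} {s p β Q : ℝ}

/-- The truncated power profile driving the upper estimates. -/
def upW (p β : ℝ) (w : Rn n → ℝ) (x : Rn n) : ℝ := (1 + max (w x) 0) ^ ((p - β) / p) - 1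

lemma upW_nonneg (P : Par n s p β Q) (w : Rn n → ℝ) (x : Rn n) : 0 ≤ upW p β w x := by
  have hα : 0 < (p - β) / p := div_pos (by linarith [P.hβp]) (by linarith [P.hp])
  have : 1 ≤ (1 + max (w x) 0) ^ ((p - β) / p) :=
    Real.one_le_rpow (by linarith [le_max_right (w x) 0]) hα.le
  unfold upW; linarith

lemma measurable_upW {w : Rn n → ℝ} (hw : Measurable w) : Measurable (upW p β w) := by
  unfold upW; fun_prop

lemma ofReal_mul_le_of_le_one {a t : ℝ} (ht0 : 0 ≤ t) (ht : t ≤ 1) :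
    ENNReal.ofReal (a * t) ≤ ENNReal.ofReal a := by
  rcases le_total 0 a with h | h
  · exact ENNReal.ofReal_le_ofReal (mul_le_of_le_one_right h ht)
  · rw [ENNReal.ofReal_of_nonpos (mul_nonpos_of_nonpos_of_nonneg h ht0)]; exact zero_le

/-- The energy of a cut-off profile is controlled by the energy inside the cutoff plus mass. -/
lemma exists_cutoff_energy (P : Par n s p β Q) {q : ℝ} (hq : p - β ≤ q) {l : ℝ} (hl : 1 ≤ l) :
    ∃ C : ℝ, 0 < C ∧ ∀ (w η : Rn n → ℝ) (ρ : ℝ), Measurable w → ρ ≤ 1 → Cutoff 0 ρ η →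
      (∀ x y, |η x - η y| ≤ min 1 (l * ‖x - y‖)) →
      ∫⁻ x, ∫⁻ y, ENNReal.ofReal (|upW p β w x * η x - upW p β w y * η y| ^ p) * J n s p x y ≤
        ENNReal.ofReal C * ((∫⁻ x, ∫⁻ y, ENNReal.ofReal
          (|(1 + max (w x) 0) ^ ((p - β) / p) - (1 + max (w y) 0) ^ ((p - β) / p)| ^ p *
            min (η x) (η y) ^ p) * J n s p x y) + ∫⁻ x, ENNReal.ofReal (posPow n q w x)) := by
  have hp := P.hp
  obtain ⟨Cb, hCb, hbud⟩ := exists_budget (n := n) P.hn P.hs P.hs1 (p := p) (by linarith)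
    hl (zero_le_one) (one_lt_two)
  refine ⟨2 ^ p * (1 + Cb), by positivity, ?_⟩
  intro w η ρ hw hρ hη hηl
  obtain ⟨E, hE⟩ : ∃ E : Rn n → Rn n → ℝ, E = fun x y =>
    |(1 + max (w x) 0) ^ ((p - β) / p) - (1 + max (w y) 0) ^ ((p - β) / p)| ^ p *
            min (η x) (η y) ^ p := ⟨_, rfl⟩
  obtain ⟨b, hb⟩ : ∃ b : Rn n → Rn n → ℝ, b = fun x y =>
    (2 ^ p * posPow n q w x + 2 ^ p * posPow n q w y) * min 1 (l * ‖x - y‖) ^ p := ⟨_, rfl⟩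
  have hpm := measurable_posPow (Q := q) hw
  have hbm : Measurable (Function.uncurry b) := by
    rw [hb]; unfold Function.uncurry; fun_prop
  have hbI : ∫⁻ x, ∫⁻ y, ENNReal.ofReal (b x y) * J n s p x y ≤
      ENNReal.ofReal Cb * (ENNReal.ofReal (2 ^ p) * ∫⁻ x, ENNReal.ofReal (posPow n q w x)) := by
    have := hbud (fun x => 2 ^ p * posPow n q w x) (fun _ => 0) (fun _ => 0)
      (hpm.const_mul _) measurable_const measurable_const
      (fun x => mul_nonneg (by positivity) (posPow_nonneg _ _)) (fun _ => le_rfl) (fun _ => le_rfl)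
      (fun _ _ => rfl) (fun _ _ => rfl) b (ae_of_all _ fun x => ae_of_all _ fun y => by
        rw [hb]; simp)
    refine this.trans ?_
    gcongr
    rw [← lintegral_const_mul' _ _ ENNReal.ofReal_ne_top]
    simp only [ENNReal.ofReal_zero, lintegral_zero, zero_mul, add_zero]
    exact lintegral_mono fun x => (ENNReal.ofReal_mul (by positivity)).le
  have hpt : ∀ x y, ENNReal.ofReal (|upW p β w x * η x - upW p β w y * η y| ^ p) * J n s p x y ≤
      ENNReal.ofReal (2 ^ p) * (ENNReal.ofReal (E x y) * J n s p x y) +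
        ENNReal.ofReal (b x y) * J n s p x y := by
    intro x y
    rw [← mul_assoc, ← ENNReal.ofReal_mul (by positivity), ← add_mul]
    gcongr
    refine le_trans (ENNReal.ofReal_le_ofReal ?_) ENNReal.ofReal_add_le
    rw [hE, hb]
    exact cutoff_pointwise hp P.hβp hq hρ hη (by linarith) hηl x y
  have h1 : ∫⁻ x, ∫⁻ y, ENNReal.ofReal (|upW p β w x * η x - upW p β w y * η y| ^ p) *
      J n s p x y ≤ ENNReal.ofReal (2 ^ p) * (∫⁻ x, ∫⁻ y, ENNReal.ofReal (E x y) * J n s p x y) +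
        ∫⁻ x, ∫⁻ y, ENNReal.ofReal (b x y) * J n s p x y := by
    rw [← lintegral_const_mul' _ _ ENNReal.ofReal_ne_top]
    have hm : Measurable fun x => ∫⁻ y, ENNReal.ofReal (b x y) * J n s p x y := by
      apply Measurable.lintegral_prod_right' (f := fun z : Rn n × Rn n =>
        ENNReal.ofReal (b z.1 z.2) * J n s p z.1 z.2)
      have : Measurable fun z : Rn n × Rn n => b z.1 z.2 := hbm
      fun_prop
    rw [← lintegral_add_right _ hm]
    apply lintegral_mono
    intro x
    dsimp only
    rw [← lintegral_const_mul' _ _ ENNReal.ofReal_ne_top]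
    have hm2 : Measurable fun y => ENNReal.ofReal (b x y) * J n s p x y := by
      have : Measurable fun y => b x y := hbm.comp measurable_prodMk_left
      fun_prop
    rw [← lintegral_add_right _ hm2]
    exact lintegral_mono fun y => hpt x y
  refine h1.trans ?_
  have e : (fun x y => ENNReal.ofReal
          (|(1 + max (w x) 0) ^ ((p - β) / p) - (1 + max (w y) 0) ^ ((p - β) / p)| ^ p *
            min (η x) (η y) ^ p) * J n s p x y) =
      fun x y => ENNReal.ofReal (E x y) * J n s p x y := by rw [hE]
  simp only [funext_iff] at e
  simp_rw [e]
  generalize (∫⁻ x, ∫⁻ y, ENNReal.ofReal (E x y) * J n s p x y) = I at *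
  generalize (∫⁻ x, ENNReal.ofReal (posPow n q w x)) = I' at *
  calc _ ≤ ENNReal.ofReal (2 ^ p) * I + ENNReal.ofReal Cb * (ENNReal.ofReal (2 ^ p) * I') := by
        gcongr
    _ = ENNReal.ofReal (2 ^ p * 1) * I + ENNReal.ofReal (2 ^ p * Cb) * I' := by
        rw [mul_one, ENNReal.ofReal_mul (by positivity)]; ring
    _ ≤ ENNReal.ofReal (2 ^ p * (1 + Cb)) * I + ENNReal.ofReal (2 ^ p * (1 + Cb)) * I' := by
        gcongr <;> linarith
    _ = _ := (mul_add _ _ _).symm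

lemma up_energy (P : Par n s p β Q) {L Θ : ℝ} (hL : 0 < L) (hΘ : 0 ≤ Θ) :
    ∃ C : ℝ, 0 < C ∧ ∀ (w f : Rn n → ℝ) (κ : ℝ), 0 ≤ κ → IsSub n s p L 0 1 w f (fun _ => 0) →
      ∫⁻ x, ENNReal.ofReal (posPow n Q w x) ≤ ENNReal.ofReal κ →
      ∫⁻ x in ball 0 1, ENNReal.ofReal (f x) ≤ ENNReal.ofReal κ →
      ∫⁻ y in (ball 0 1)ᶜ, ENNReal.ofReal (max (w y) 0 ^ (p - 1)) * J n s p 0 y ≤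
        ENNReal.ofReal Θ →
      ∃ η : Rn n → ℝ, Cutoff 0 (3 / 4) η ∧ (∀ x, ‖x‖ ≤ 1 / 2 → η x = 1) ∧
        ∫⁻ x, ∫⁻ y, ENNReal.ofReal (|upW p β w x * η x - upW p β w y * η y| ^ p) *
          J n s p x y ≤ ENNReal.ofReal (C * κ) := by
  have hp := P.hp
  have hβ := P.hβ
  obtain ⟨Cp, hCp, hup⟩ := up_pointwise P
  obtain ⟨Cc, hCc, hcut⟩ := exists_cutoff_energy P P.hpβ (l := 4) (by norm_num)
  obtain ⟨Cb, hCb, hbud⟩ := exists_budget (n := n) P.hn P.hs P.hs1 (p := p) (by linarith)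
    (l := 4) (by norm_num) (show (0 : ℝ) ≤ 3 / 4 by norm_num) (show (3 / 4 : ℝ) < 1 by norm_num)
  have hβ1 : 0 < (β - 1) / 2 := by linarith
  refine ⟨Cc * (((β - 1) / 2)⁻¹ * (L * (Cb * (Cp + Θ) + 1)) + 1), by positivity, ?_⟩
  intro w f κ hκ hw hκ1 hκ2 hΘ1
  obtain ⟨η, hη, hη1, hηl⟩ := exists_cutoff (0 : Rn n) (show (1 / 2 : ℝ) < 3 / 4 by norm_num)
  have hηl' : ∀ x y, |η x - η y| ≤ min 1 (4 * ‖x - y‖) := by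
    intro x y; convert hηl x y using 3; norm_num
  refine ⟨η, hη, fun x hx => hη1 x (by rwa [sub_zero]), ?_⟩
  have hwm := hw.meas
  have hpm := measurable_posPow (Q := Q) hwm
  refine (hcut w η (3 / 4) hwm (by norm_num) hη hηl').trans ?_
  obtain ⟨A, hA⟩ : ∃ A : Rn n → ℝ, A = ({x : Rn n | ‖x‖ < 3 / 4 ∧ 0 < w x}).indicator
    (fun _ => (1 : ℝ)) := ⟨_, rfl⟩
  obtain ⟨k, hk⟩ : ∃ k : Rn n → ℝ, k = ({y : Rn n | 1 ≤ ‖y‖}).indicator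
    (fun y => max (w y) 0 ^ (p - 1)) := ⟨_, rfl⟩
  have hup' := hup w η 4 hη (by norm_num) hηl'
  rw [← hA, ← hk] at hup'
  have hA0 : ∀ x, 0 ≤ A x := by
    intro x; rw [hA]; exact indicator_nonneg (fun _ _ => zero_le_one) _
  have hk0 : ∀ x, 0 ≤ k x := by
    intro x; rw [hk]; exact indicator_nonneg (fun _ _ => by positivity) _
  have hAm : Measurable A := by
    rw [hA]
    apply measurable_const.indicator
    exact (measurableSet_lt (f := fun x : Rn n => ‖x‖) (by fun_prop) measurable_const).inter
      (measurableSet_lt measurable_const hwm)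
  have hkm : Measurable k := by
    rw [hk]
    apply Measurable.indicator (by fun_prop)
    exact measurableSet_le measurable_const (by fun_prop)
  obtain ⟨E, hE⟩ : ∃ E : Rn n → Rn n → ℝ, E = fun x y =>
    |(1 + max (w x) 0) ^ ((p - β) / p) - (1 + max (w y) 0) ^ ((p - β) / p)| ^ p *
            min (η x) (η y) ^ p := ⟨_, rfl⟩
  have hE0 : ∀ x y, 0 ≤ E x y := by
    intro x y; rw [hE]
    have : 0 ≤ min (η x) (η y) := le_min (hη.nonneg x) (hη.nonneg y)
    positivity
  obtain ⟨b, hb⟩ : ∃ b : Rn n → Rn n → ℝ, b = fun x y =>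
    (Cp * posPow n Q w x + Cp * posPow n Q w y) * min 1 (4 * ‖x - y‖) ^ p +
      (A x * k y + A y * k x) := ⟨_, rfl⟩
  have hb0 : ∀ x y, 0 ≤ b x y := by
    intro x y; rw [hb]
    have := posPow_nonneg (Q := Q) w x
    have := posPow_nonneg (Q := Q) w y
    have := hA0 x; have := hA0 y; have := hk0 x; have := hk0 y
    positivity
  have hmain := hw.ineq (upF β) _ (upF_lipschitz hβ) (fun t => upF_nonneg hβ t) (3 / 4)
    (by norm_num) η hη b (fun x y => (β - 1) / 2 * E x y) hb0
    (fun x y => mul_nonneg hβ1.le (hE0 x y))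
    (ae_of_all _ fun x => ae_of_all _ fun y => by
      rw [hE, hb]; exact hup' x y)
  have hbI := hbud (fun x => Cp * posPow n Q w x) A k (hpm.const_mul _) hAm hkm
    (fun x => mul_nonneg hCp.le (posPow_nonneg _ _)) hA0 hk0
    (by intro x hx; rw [hA]; exact indicator_of_notMem (fun h => absurd h.1 (not_lt.2 hx)) _)
    (by intro y hy; rw [hk]; exact indicator_of_notMem (s := {y : Rn n | 1 ≤ ‖y‖}) (fun h => absurd hy (not_lt.2 h)) _)
    b (ae_of_all _ fun x => ae_of_all _ fun y => by rw [hb])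
  have hAI : ∫⁻ x, ENNReal.ofReal (A x) ≤ ENNReal.ofReal κ := by
    refine le_trans (lintegral_mono fun x => ENNReal.ofReal_le_ofReal ?_) hκ1
    rw [hA]
    by_cases h : ‖x‖ < 3 / 4 ∧ 0 < w x
    · rw [indicator_of_mem (by exact h), posPow_of (by linarith [h.1]) h.2]
      exact Real.one_le_rpow (by linarith [h.2]) (by linarith [P.hQ1])
    · rw [indicator_of_notMem (by exact h)]; exact posPow_nonneg _ _
  have hkI : ∫⁻ y, ENNReal.ofReal (k y) * J n s p 0 y ≤ ENNReal.ofReal Θ := by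
    refine le_trans (le_of_eq ?_) hΘ1
    rw [← lintegral_indicator measurableSet_ball.compl]
    congr 1
    ext y
    rw [hk]
    by_cases h : 1 ≤ ‖y‖
    · rw [indicator_of_mem (by exact h), indicator_of_mem (by simpa using h)]
    · rw [indicator_of_notMem (by exact h), indicator_of_notMem (by simpa using h)]; simp
  have hfI : ∫⁻ x, ENNReal.ofReal (f x * (upF β (w x) * η x ^ p)) ≤ ENNReal.ofReal κ := by
    refine le_trans ?_ hκ2
    rw [← lintegral_indicator measurableSet_ball]
    apply lintegral_mono
    intro x
    by_cases h : x ∈ ball (0 : Rn n) 1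
    · rw [indicator_of_mem h]
      apply ofReal_mul_le_of_le_one
      · exact mul_nonneg (upF_nonneg hβ _) (Real.rpow_nonneg (hη.nonneg x) _)
      · exact mul_le_one₀ (upF_le_one _ _) (Real.rpow_nonneg (hη.nonneg x) _)
          (Real.rpow_le_one (hη.nonneg x) (hη.le_one x) (by linarith))
    · rw [indicator_of_notMem h]
      have : 1 ≤ ‖x‖ := by simpa using h
      dsimp only
      rw [hη.zero x (by rw [sub_zero]; linarith), Real.zero_rpow (by linarith)]
      simp
  have hhI : ∫⁻ x, ENNReal.ofReal (Cp * posPow n Q w x) ≤ ENNReal.ofReal (Cp * κ) := by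
    rw [ENNReal.ofReal_mul hCp.le]
    refine le_trans (le_of_eq ?_) (mul_le_mul_right hκ1 _)
    rw [← lintegral_const_mul' _ _ ENNReal.ofReal_ne_top]
    congr 1; ext x; exact ENNReal.ofReal_mul hCp.le
  have hEI : ENNReal.ofReal ((β - 1) / 2) *
      ∫⁻ x, ∫⁻ y, ENNReal.ofReal (E x y) * J n s p x y ≤
      ENNReal.ofReal (L * (Cb * (Cp + Θ) + 1) * κ) := by
    have h1 : ENNReal.ofReal ((β - 1) / 2) *
        ∫⁻ x, ∫⁻ y, ENNReal.ofReal (E x y) * J n s p x y =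
        ∫⁻ x, ∫⁻ y, ENNReal.ofReal ((β - 1) / 2 * E x y) * J n s p x y := by
      simp_rw [ENNReal.ofReal_mul hβ1.le, mul_assoc]
      simp_rw [lintegral_const_mul' _ _ ENNReal.ofReal_ne_top]
    rw [h1]
    refine le_trans (le_trans le_self_add hmain) ?_
    calc _ ≤ ENNReal.ofReal L * (ENNReal.ofReal Cb * (ENNReal.ofReal (Cp * κ) +
          ENNReal.ofReal κ * ENNReal.ofReal Θ) + ENNReal.ofReal κ) := by
          gcongr
          exact hbI.trans (by gcongr)
      _ = _ := by
          rw [← ENNReal.ofReal_mul hκ, ← ENNReal.ofReal_add (by positivity) (by positivity),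
            ← ENNReal.ofReal_mul hCb.le, ← ENNReal.ofReal_add (by positivity) (by positivity),
            ← ENNReal.ofReal_mul hL.le]
          congr 1; ring
  have hEI2 : ∫⁻ x, ∫⁻ y, ENNReal.ofReal (E x y) * J n s p x y ≤
      ENNReal.ofReal (((β - 1) / 2)⁻¹ * (L * (Cb * (Cp + Θ) + 1)) * κ) := by
    have h2 := mul_le_mul_right hEI (ENNReal.ofReal ((β - 1) / 2)⁻¹)
    rw [← mul_assoc, ← ENNReal.ofReal_mul (by positivity), inv_mul_cancel₀ hβ1.ne',
      ENNReal.ofReal_one, one_mul, ← ENNReal.ofReal_mul (by positivity)] at h2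
    rwa [mul_assoc]
  rw [mul_assoc, ENNReal.ofReal_mul hCc.le]
  gcongr
  rw [add_mul, one_mul, ENNReal.ofReal_add (by positivity) (by positivity)]
  rw [hE] at hEI2
  exact add_le_add hEI2 hκ1

lemma upW_lower (P : Par n s p β Q) {w : Rn n → ℝ} {x : Rn n} (h : 1 ≤ w x) :
    (1 - 2 ^ (-((p - β) / p))) * w x ^ ((p - β) / p) ≤ upW p β w x := by
  have hα : 0 < (p - β) / p := div_pos (by linarith [P.hβp]) (by linarith [P.hp])
  unfold upW
  generalize (p - β) / p = α at *
  rw [max_eq_left (by linarith)]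
  have h1 : w x ^ α ≤ (1 + w x) ^ α := Real.rpow_le_rpow (by linarith) (by linarith) hα.le
  have h2 : (2 : ℝ) ^ α ≤ (1 + w x) ^ α := Real.rpow_le_rpow (by linarith) (by linarith) hα.le
  have h3 : (2 : ℝ) ^ (-α) ≤ 1 := Real.rpow_le_one_of_one_le_of_nonpos (by norm_num) (by linarith)
  have h4 : (2 : ℝ) ^ (-α) * 2 ^ α = 1 := by
    rw [← Real.rpow_add (by norm_num)]; simp
  have h5 : 0 < (2 : ℝ) ^ (-α) := by positivity
  nlinarith

/-- Higher integrability from the energy of the cut-off power profile. -/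
lemma exists_power_of_energy (P : Par n s p β Q) :
    ∃ C : ℝ, 0 < C ∧ ∀ (w η : Rn n → ℝ) (ρ M : ℝ), Measurable w → ρ ≤ 1 → Cutoff 0 ρ η →
      (∀ x, ‖x‖ ≤ 1 / 2 → η x = 1) → 0 < M →
      ∫⁻ x, ∫⁻ y, ENNReal.ofReal (|upW p β w x * η x - upW p β w y * η y| ^ p) * J n s p x y ≤
        ENNReal.ofReal M →
      ∫⁻ x in {x : Rn n | ‖x‖ < 1 / 2 ∧ 1 ≤ w x}, ENNReal.ofReal (w x ^ Q) ≤
        ENNReal.ofReal (C * M ^ ((n : ℝ) / (n - s * p))) := by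
  have hp := P.hp
  obtain ⟨α, hα⟩ : ∃ α : ℝ, α = (p - β) / p := ⟨_, rfl⟩
  have hα0 : 0 < α := by rw [hα]; exact div_pos (by linarith [P.hβp]) (by linarith)
  have hQ0 : 0 < Q := by linarith [P.hQ1]
  have hnsp : 0 < n - s * p := by linarith [P.hspn]
  have hαp : α * p = p - β := by rw [hα, div_mul_cancel₀ _ (by linarith)]
  have hm : Q / α < p * n / (n - s * p) := by
    rw [div_lt_div_iff₀ hα0 hnsp]
    have := P.hQ
    nlinarith
  obtain ⟨Cw, hCw, hws⟩ := exists_weak_sobolev P.hn P.hs (by linarith : 0 < p) P.hspn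
    (div_pos hQ0 hα0) hm
  obtain ⟨c, hc⟩ : ∃ c : ℝ, c = (1 - 2 ^ (-α)) / 2 := ⟨_, rfl⟩
  have hc0 : 0 < c := by
    rw [hc]
    have : (2 : ℝ) ^ (-α) < 1 := Real.rpow_lt_one_of_one_lt_of_neg (by norm_num) (by linarith)
    linarith
  refine ⟨Cw * (c⁻¹ ^ p) ^ ((n : ℝ) / (n - s * p)), by positivity, ?_⟩
  intro w η ρ M hwm hρ hη hη1 hM hE
  have hηm : Measurable η := by
    obtain ⟨l, hl⟩ := hη.lip
    exact hl.continuous.measurable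
  have hum : Measurable (upW p β w) := measurable_upW hwm
  obtain ⟨W, hW⟩ : ∃ W : Rn n → ℝ, W = fun x => c⁻¹ * (upW p β w x * η x) := ⟨_, rfl⟩
  have hWm : Measurable W := by rw [hW]; fun_prop
  have hW0 : ∀ x, 0 ≤ W x := by
    intro x; rw [hW]
    exact mul_nonneg (by positivity) (mul_nonneg (upW_nonneg P w x) (hη.nonneg x))
  have hWz : ∀ x, 1 ≤ ‖x‖ → W x = 0 := by
    intro x hx; rw [hW]; dsimp only
    rw [hη.zero x (by rw [sub_zero]; linarith)]; ring
  have hWE : ∫⁻ x, ∫⁻ y, ENNReal.ofReal (|W x - W y| ^ p) * J n s p x y ≤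
      ENNReal.ofReal (c⁻¹ ^ p * M) := by
    have e : ∀ x y, ENNReal.ofReal (|W x - W y| ^ p) * J n s p x y =
        ENNReal.ofReal (c⁻¹ ^ p) * (ENNReal.ofReal (|upW p β w x * η x - upW p β w y * η y| ^ p) *
          J n s p x y) := by
      intro x y
      rw [← mul_assoc, ← ENNReal.ofReal_mul (by positivity), hW]
      dsimp only
      rw [← mul_sub, abs_mul, abs_of_pos (inv_pos.2 hc0), Real.mul_rpow (by positivity)
        (abs_nonneg _)]
    simp_rw [e, lintegral_const_mul' _ _ ENNReal.ofReal_ne_top]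
    rw [ENNReal.ofReal_mul (by positivity)]
    gcongr
  have hres := hws W hWm hW0 hWz (c⁻¹ ^ p * M) (by positivity) hWE
  have hkey : ∀ x : Rn n, ‖x‖ < 1 / 2 → 1 ≤ w x → 2 * w x ^ α ≤ W x := by
    intro x hx hwx
    have h4 := upW_lower P hwx
    rw [← hα] at h4
    rw [hW]; dsimp only
    rw [hη1 x hx.le, mul_one, ← div_eq_inv_mul, le_div_iff₀ hc0, hc]
    linarith
  calc _ ≤ ∫⁻ x in {x : Rn n | ‖x‖ < 1 / 2 ∧ 1 ≤ w x}, ENNReal.ofReal (W x ^ (Q / α)) := by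
        apply setLIntegral_mono' ((measurableSet_lt (f := fun x : Rn n => ‖x‖) (by fun_prop)
          measurable_const).inter (measurableSet_le measurable_const hwm))
        rintro x ⟨hx, hwx⟩
        have hwx' : 0 ≤ w x := le_trans zero_le_one hwx
        apply ENNReal.ofReal_le_ofReal
        have h5 := hkey x hx hwx
        have h6 : 0 ≤ w x ^ α := by positivity
        calc w x ^ Q = (w x ^ α) ^ (Q / α) := by
              rw [← Real.rpow_mul hwx', mul_div_cancel₀ _ hα0.ne']
          _ ≤ _ := Real.rpow_le_rpow h6 (by linarith) (by positivity)
    _ ≤ ∫⁻ x in {x | 1 < W x}, ENNReal.ofReal (W x ^ (Q / α)) := by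
        apply lintegral_mono_set
        rintro x ⟨hx, hwx⟩
        have h5 := hkey x hx hwx
        have h6 : 1 ≤ w x ^ α := Real.one_le_rpow hwx hα0.le
        show 1 < W x
        linarith
    _ ≤ _ := hres
    _ = _ := by
        rw [Real.mul_rpow (by positivity) hM.le, mul_assoc]

/-- One step of the upper iteration: self-improvement of the level-set mass. -/
lemma ustep (P : Par n s p β Q) {L Θ : ℝ} (hL : 0 < L) (hΘ : 0 ≤ Θ) :
    ∃ C : ℝ, 0 < C ∧ ∀ (w f : Rn n → ℝ) (κ : ℝ), 0 < κ → IsSub n s p L 0 1 w f (fun _ => 0) →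
      ∫⁻ x, ENNReal.ofReal (posPow n Q w x) ≤ ENNReal.ofReal κ →
      ∫⁻ x in ball 0 1, ENNReal.ofReal (f x) ≤ ENNReal.ofReal κ →
      ∫⁻ y in (ball 0 1)ᶜ, ENNReal.ofReal (max (w y) 0 ^ (p - 1)) * J n s p 0 y ≤
        ENNReal.ofReal Θ →
      ∫⁻ x in {x : Rn n | ‖x‖ < 1 / 2 ∧ 1 ≤ w x}, ENNReal.ofReal (w x ^ Q) ≤
        ENNReal.ofReal (C * κ ^ ((n : ℝ) / (n - s * p))) := by
  obtain ⟨Ce, hCe, hen⟩ := up_energy P hL hΘ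
  obtain ⟨Cw, hCw, hpw⟩ := exists_power_of_energy P
  refine ⟨Cw * Ce ^ ((n : ℝ) / (n - s * p)), by positivity, ?_⟩
  intro w f κ hκ hw h1 h2 h3
  obtain ⟨η, hη, hη1, hE⟩ := hen w f κ hκ.le hw h1 h2 h3
  have := hpw w η (3 / 4) (Ce * κ) hw.meas (by norm_num) hη hη1 (by positivity) hE
  rwa [Real.mul_rpow hCe.le hκ.le, ← mul_assoc] at this

end UpEnergy

section UpIter

variable {n : ℕ} {s p β Q : ℝ}

lemma setLIntegral_affine (z : Rn n) {R : ℝ} (hR : 0 < R) {S : Set (Rn n)} (hS : MeasurableSet S)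
    (G : Rn n → ℝ≥0∞) :
    ∫⁻ x in S, G x = ENNReal.ofReal (R ^ n) * ∫⁻ x in {x | z + R • x ∈ S}, G (z + R • x) := by
  have hS' : MeasurableSet {x : Rn n | z + R • x ∈ S} :=
    (show Measurable fun x : Rn n => z + R • x by fun_prop) hS
  rw [← lintegral_indicator hS, lintegral_affine z hR, ← lintegral_indicator hS']
  rfl

lemma affine_mem_ball {z x : Rn n} {R r : ℝ} (hR : 0 < R) :
    z + R • x ∈ ball z (R * r) ↔ x ∈ ball (0 : Rn n) r := by
  rw [mem_ball_iff_norm, mem_ball_zero_iff, add_sub_cancel_left, norm_smul, Real.norm_of_nonneg hR.le]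
  exact mul_lt_mul_iff_right₀ hR

lemma affine_ball {z : Rn n} {R : ℝ} (hR : 0 < R) :
    {x | z + R • x ∈ ball z R} = ball (0 : Rn n) 1 := by
  ext x
  have := affine_mem_ball (z := z) (x := x) (r := 1) hR
  rw [mul_one] at this
  exact this

/-- The contraction factor of the upper iteration. -/
def lam (s p : ℝ) : ℝ := 2 ^ (-(s * p / (2 * (p - 1))))

lemma lam_pos : 0 < lam s p := by unfold lam; positivity

lemma lam_lt_one (P : Par n s p β Q) : lam s p < 1 := by
  have := P.hp; have := P.hs
  apply Real.rpow_lt_one_of_one_lt_of_neg (by norm_num)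
  have : 0 < s * p / (2 * (p - 1)) := div_pos (by positivity) (by linarith)
  linarith

lemma lam_rpow (hp : 1 < p) : (lam s p)⁻¹ ^ (p - 1) = 2 ^ (s * p / 2) := by
  unfold lam
  rw [← Real.rpow_neg (by norm_num), neg_neg, ← Real.rpow_mul (by norm_num)]
  congr 1
  have : p - 1 ≠ 0 := by linarith
  field_simp

lemma up_iter_mass (P : Par n s p β Q) {w : Rn n → ℝ} (hw : Measurable w) {θ : ℝ} (hθ : 0 < θ)
    (hθ' : θ ≤ (lam s p)⁻¹) :
    ∫⁻ x, ENNReal.ofReal (posPow n Q (fun x => θ * (w ((1 / 2 : ℝ) • x) - 1)) x) ≤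
      ENNReal.ofReal (2 ^ n * (lam s p)⁻¹ ^ Q) *
        ∫⁻ x in {x : Rn n | ‖x‖ < 1 / 2 ∧ 1 ≤ w x}, ENNReal.ofReal (w x ^ Q) := by
  have hQ0 : 0 < Q := by linarith [P.hQ1]
  have hl0 := lam_pos (s := s) (p := p)
  have hl1 := lam_lt_one P
  have hl2 : 1 < (lam s p)⁻¹ := (one_lt_inv₀ hl0).2 hl1
  have hS : MeasurableSet {x : Rn n | ‖x‖ < 1 / 2 ∧ 1 ≤ w x} :=
    (measurableSet_lt (f := fun x : Rn n => ‖x‖) (by fun_prop)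
          measurable_const).inter (measurableSet_le measurable_const hw)
  rw [lintegral_affine 0 (show (0 : ℝ) < 2 by norm_num), ENNReal.ofReal_mul (by positivity),
    mul_assoc]
  gcongr
  rw [← lintegral_const_mul' _ _ ENNReal.ofReal_ne_top, ← lintegral_indicator hS]
  apply lintegral_mono
  intro x
  dsimp only
  unfold posPow
  by_cases h : ‖(0 : Rn n) + (2 : ℝ) • x‖ < 1 ∧
    0 < θ * (w ((1 / 2 : ℝ) • ((0 : Rn n) + (2 : ℝ) • x)) - 1)
  · rw [indicator_of_mem (by exact h)]
    rw [zero_add, norm_smul, smul_smul] at h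
    rw [zero_add]
    dsimp only
    rw [smul_smul]
    norm_num at h ⊢
    have hw1 : 1 < w x := by have := (mul_pos_iff_of_pos_left hθ).1 h.2; linarith
    rw [indicator_of_mem (by exact ⟨by linarith [h.1], hw1.le⟩),
      ← ENNReal.ofReal_mul (by positivity)]
    apply ENNReal.ofReal_le_ofReal
    rw [← Real.mul_rpow (by positivity) (by linarith)]
    apply Real.rpow_le_rpow (by linarith [h.2]) _ hQ0.le
    have : θ * (w x - 1) ≤ (lam s p)⁻¹ * (w x - 1) :=
      mul_le_mul_of_nonneg_right hθ' (by linarith)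
    nlinarith
  · rw [indicator_of_notMem (by exact h)]
    simp

lemma posPow_ge_tail (P : Par n s p β Q) {w : Rn n → ℝ} {x : Rn n} (hx : ‖x‖ < 1) :
    max (w x) 0 ^ (p - 1) ≤ posPow n Q w x := by
  have hp := P.hp
  rcases le_or_gt (w x) 0 with h | h
  · rw [max_eq_right h, Real.zero_rpow (by linarith)]; exact posPow_nonneg _ _
  · rw [posPow_of hx h, max_eq_left h.le]
    exact (Real.rpow_le_rpow h.le (by linarith) (by linarith)).trans
      (Real.rpow_le_rpow_of_exponent_le (by linarith) P.hQp)

lemma up_iter_tail (P : Par n s p β Q) {w : Rn n → ℝ} (hw : Measurable w) {θ : ℝ} (hθ : 0 < θ)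
    (hθ' : θ ≤ (lam s p)⁻¹) :
    ∫⁻ y in (ball 0 1)ᶜ, ENNReal.ofReal (max (θ * (w ((1 / 2 : ℝ) • y) - 1)) 0 ^ (p - 1)) *
        J n s p 0 y ≤
      ENNReal.ofReal (2 ^ (-(s * p / 2))) *
        ((∫⁻ y in (ball 0 1)ᶜ, ENNReal.ofReal (max (w y) 0 ^ (p - 1)) * J n s p 0 y) +
        ENNReal.ofReal (2 ^ ((n : ℝ) + s * p)) * ∫⁻ x, ENNReal.ofReal (posPow n Q w x)) := by
  have hp := P.hp
  have hsp : 0 < s * p := mul_pos P.hs (by linarith)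
  have hl0 := lam_pos (s := s) (p := p)
  have hset : {x : Rn n | (0 : Rn n) + (2 : ℝ) • x ∈ (ball (0 : Rn n) 1)ᶜ} =
      (ball (0 : Rn n) (1 / 2))ᶜ := by
    ext x
    simp only [zero_add, mem_compl_iff, mem_ball_zero_iff, norm_smul, mem_ofPred_eq, not_lt]
    norm_num
    constructor <;> intro h <;> linarith
  rw [setLIntegral_affine 0 (show (0 : ℝ) < 2 by norm_num) measurableSet_ball.compl, hset]
  have h1 : ∀ y : Rn n, ENNReal.ofReal
      (max (θ * (w ((1 / 2 : ℝ) • ((0 : Rn n) + (2 : ℝ) • y)) - 1)) 0 ^ (p - 1)) *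
      J n s p 0 ((0 : Rn n) + (2 : ℝ) • y) ≤ ENNReal.ofReal (2 ^ (s * p / 2)) *
        (ENNReal.ofReal (2 ^ (-((n : ℝ) + s * p))) *
        (ENNReal.ofReal (max (w y) 0 ^ (p - 1)) * J n s p 0 y)) := by
    intro y
    have hJ := J_affine (n := n) (s := s) (p := p) 0 0 y (show (0 : ℝ) < 2 by norm_num)
    rw [smul_zero, add_zero] at hJ
    rw [hJ, zero_add, smul_smul]
    norm_num only
    rw [one_smul, mul_left_comm, mul_left_comm (ENNReal.ofReal (2 ^ (s * p / 2))),
      ← mul_assoc (ENNReal.ofReal (2 ^ (s * p / 2)))]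
    gcongr
    rw [← ENNReal.ofReal_mul (by positivity)]
    apply ENNReal.ofReal_le_ofReal
    rw [← lam_rpow hp, ← Real.mul_rpow (by positivity) (by positivity)]
    apply Real.rpow_le_rpow (by positivity) _ (by linarith)
    apply max_le _ (by positivity)
    rcases le_or_gt (w y) 1 with h | h
    · exact (mul_nonpos_of_nonneg_of_nonpos hθ.le (by linarith)).trans (by positivity)
    · rw [max_eq_left (by linarith)]
      calc θ * (w y - 1) ≤ (lam s p)⁻¹ * (w y - 1) := mul_le_mul_of_nonneg_right hθ' (by linarith)
        _ ≤ _ := by gcongr; linarith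
  have h2 : ∫⁻ y in (ball (0 : Rn n) (1 / 2))ᶜ,
      ENNReal.ofReal (max (w y) 0 ^ (p - 1)) * J n s p 0 y ≤
      (∫⁻ y in (ball 0 1)ᶜ, ENNReal.ofReal (max (w y) 0 ^ (p - 1)) * J n s p 0 y) +
        ENNReal.ofReal (2 ^ ((n : ℝ) + s * p)) * ∫⁻ x, ENNReal.ofReal (posPow n Q w x) := by
    rw [← lintegral_const_mul' _ _ ENNReal.ofReal_ne_top,
      ← lintegral_indicator measurableSet_ball.compl,
      ← lintegral_indicator measurableSet_ball.compl]
    have hm : Measurable fun x => ENNReal.ofReal (2 ^ ((n : ℝ) + s * p)) *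
        ENNReal.ofReal (posPow n Q w x) := by
      have := measurable_posPow (Q := Q) hw
      fun_prop
    rw [← lintegral_add_right _ hm]
    apply lintegral_mono
    intro y
    dsimp only
    by_cases hy : 1 ≤ ‖y‖
    · rw [indicator_of_mem (by simp; linarith), indicator_of_mem (by simpa using hy)]
      exact le_self_add
    by_cases hy2 : 1 / 2 ≤ ‖y‖
    · rw [indicator_of_mem (by simpa using hy2)]
      refine le_trans ?_ le_add_self
      rw [mul_comm]
      gcongr
      · unfold J
        apply ENNReal.ofReal_le_ofReal
        rw [zero_sub, norm_neg]
        calc ‖y‖ ^ (-((n : ℝ) + s * p)) ≤ (1 / 2) ^ (-((n : ℝ) + s * p)) :=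
              Real.rpow_le_rpow_of_nonpos (by norm_num) hy2 (by
                have : (0 : ℝ) ≤ n := Nat.cast_nonneg n
                linarith)
          _ = _ := by
              rw [one_div, Real.inv_rpow (by norm_num), ← Real.rpow_neg (by norm_num), neg_neg]
      · exact posPow_ge_tail P (not_le.1 hy)
    · rw [indicator_of_notMem (by simp; linarith)]
      exact zero_le
  calc _ ≤ ENNReal.ofReal (2 ^ n) * ∫⁻ y in (ball (0 : Rn n) (1 / 2))ᶜ,
        ENNReal.ofReal (2 ^ (s * p / 2)) * (ENNReal.ofReal (2 ^ (-((n : ℝ) + s * p))) *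
        (ENNReal.ofReal (max (w y) 0 ^ (p - 1)) * J n s p 0 y)) := by
        exact mul_le_mul_right (lintegral_mono h1) _
    _ = ENNReal.ofReal (2 ^ (-(s * p / 2))) * ∫⁻ y in (ball (0 : Rn n) (1 / 2))ᶜ,
        (ENNReal.ofReal (max (w y) 0 ^ (p - 1)) * J n s p 0 y) := by
        rw [lintegral_const_mul' _ _ ENNReal.ofReal_ne_top,
          lintegral_const_mul' _ _ ENNReal.ofReal_ne_top, ← mul_assoc, ← mul_assoc,
          ← ENNReal.ofReal_mul (by positivity), ← ENNReal.ofReal_mul (by positivity)]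
        congr 2
        rw [← Real.rpow_natCast, ← Real.rpow_add (by norm_num), ← Real.rpow_add (by norm_num)]
        congr 1; ring
    _ ≤ _ := by gcongr

/-- Propagation of the level-set and tail bounds from one scale to the next. -/
lemma up_iter_step (P : Par n s p β Q) {L Θ : ℝ} (hL : 0 < L) (hΘ : 0 < Θ) :
    ∃ κ₀ : ℝ, 0 < κ₀ ∧ ∀ (w f : Rn n → ℝ) (κ θ : ℝ), 0 < κ → κ ≤ κ₀ → 0 < θ → θ ≤ (lam s p)⁻¹ →
      IsSub n s p L 0 1 w f (fun _ => 0) →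
      ∫⁻ x, ENNReal.ofReal (posPow n Q w x) ≤ ENNReal.ofReal κ →
      ∫⁻ x in ball 0 1, ENNReal.ofReal (f x) ≤ ENNReal.ofReal κ →
      ∫⁻ y in (ball 0 1)ᶜ, ENNReal.ofReal (max (w y) 0 ^ (p - 1)) * J n s p 0 y ≤
        ENNReal.ofReal Θ →
      ∫⁻ x, ENNReal.ofReal (posPow n Q (fun x => θ * (w ((1 / 2 : ℝ) • x) - 1)) x) ≤
        ENNReal.ofReal κ ∧
      ∫⁻ y in (ball 0 1)ᶜ, ENNReal.ofReal (max (θ * (w ((1 / 2 : ℝ) • y) - 1)) 0 ^ (p - 1)) *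
        J n s p 0 y ≤ ENNReal.ofReal Θ := by
  have hp := P.hp
  have hsp : 0 < s * p := mul_pos P.hs (by linarith)
  have hnsp : 0 < n - s * p := by linarith [P.hspn]
  obtain ⟨C, hC, hstep⟩ := ustep P hL hΘ.le
  have hl0 := lam_pos (s := s) (p := p)
  obtain ⟨ν, hν⟩ : ∃ ν : ℝ, ν = s * p / (n - s * p) := ⟨_, rfl⟩
  have hν0 : 0 < ν := by rw [hν]; positivity
  have hν1 : (n : ℝ) / (n - s * p) = 1 + ν := by
    rw [hν, eq_comm, ← div_self hnsp.ne', ← add_div]; congr 1; ring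
  obtain ⟨D, hD⟩ : ∃ D : ℝ, D = 2 ^ n * (lam s p)⁻¹ ^ Q * C := ⟨_, rfl⟩
  have hD0 : 0 < D := by rw [hD]; positivity
  have h2 : (1 : ℝ) < 2 ^ (s * p / 2) := Real.one_lt_rpow (by norm_num) (by positivity)
  refine ⟨min (D⁻¹ ^ (ν⁻¹)) ((2 ^ (s * p / 2) - 1) * Θ / 2 ^ ((n : ℝ) + s * p)),
    lt_min (by positivity) (div_pos (mul_pos (by linarith) hΘ) (by positivity)), ?_⟩
  intro w f κ θ hκ hκ₀ hθ hθ' hw hI hf hT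
  constructor
  · refine (up_iter_mass P hw.meas hθ hθ').trans ?_
    refine (mul_le_mul_right (hstep w f κ hκ hw hI hf hT) _).trans ?_
    rw [← ENNReal.ofReal_mul (by positivity)]
    apply ENNReal.ofReal_le_ofReal
    rw [← mul_assoc, ← hD, hν1, Real.rpow_add hκ, Real.rpow_one]
    have h3 : κ ^ ν ≤ D⁻¹ := by
      calc κ ^ ν ≤ (D⁻¹ ^ (ν⁻¹)) ^ ν :=
            Real.rpow_le_rpow hκ.le (hκ₀.trans (min_le_left _ _)) hν0.le
        _ = _ := by rw [← Real.rpow_mul (by positivity), inv_mul_cancel₀ hν0.ne', Real.rpow_one]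
    calc D * (κ * κ ^ ν) ≤ D * (κ * D⁻¹) := by gcongr
      _ = κ := by field_simp
  · refine (up_iter_tail P hw.meas hθ hθ').trans ?_
    have h4 : κ * 2 ^ ((n : ℝ) + s * p) ≤ (2 ^ (s * p / 2) - 1) * Θ :=
      (le_div_iff₀ (by positivity)).1 (hκ₀.trans (min_le_right _ _))
    calc _ ≤ ENNReal.ofReal (2 ^ (-(s * p / 2))) * (ENNReal.ofReal Θ +
          ENNReal.ofReal (2 ^ ((n : ℝ) + s * p)) * ENNReal.ofReal κ) := by gcongr
      _ = ENNReal.ofReal (2 ^ (-(s * p / 2)) * (Θ + 2 ^ ((n : ℝ) + s * p) * κ)) := by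
          rw [← ENNReal.ofReal_mul (by positivity), ← ENNReal.ofReal_add (by positivity)
            (by positivity), ← ENNReal.ofReal_mul (by positivity)]
      _ ≤ _ := by
          apply ENNReal.ofReal_le_ofReal
          calc (2 : ℝ) ^ (-(s * p / 2)) * (Θ + 2 ^ ((n : ℝ) + s * p) * κ) ≤
                2 ^ (-(s * p / 2)) * (2 ^ (s * p / 2) * Θ) := by gcongr; linarith
            _ = Θ := by rw [← mul_assoc, ← Real.rpow_add (by norm_num)]; simp

lemma lintegral_posPow_affine {w : Rn n → ℝ} (hw : Measurable w) (z : Rn n)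
    {R : ℝ} (hR : 0 < R) (a : ℝ) {d : ℝ} (hd : 0 < d) :
    ∫⁻ x in ball z R ∩ {x | a < w x}, ENNReal.ofReal ((1 + (w x - a) / d) ^ Q) =
      ENNReal.ofReal (R ^ n) *
        ∫⁻ x, ENNReal.ofReal (posPow n Q (fun x => (w (z + R • x) - a) / d) x) := by
  have hm : Measurable fun x : Rn n => z + R • x := by fun_prop
  have hS : MeasurableSet {x : Rn n | ‖x‖ < 1 ∧ 0 < (w (z + R • x) - a) / d} :=
    (measurableSet_lt (f := fun x : Rn n => ‖x‖) (by fun_prop)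
      measurable_const).inter (measurableSet_lt measurable_const
        (((hw.comp hm).sub_const a).div_const d))
  rw [setLIntegral_affine z hR (measurableSet_ball.inter (measurableSet_lt measurable_const hw))]
  congr 1
  have hset : {x : Rn n | z + R • x ∈ ball z R ∩ {x | a < w x}} =
      {x : Rn n | ‖x‖ < 1 ∧ 0 < (w (z + R • x) - a) / d} := by
    ext x
    have := affine_mem_ball (z := z) (x := x) (r := 1) hR
    rw [mul_one] at this
    simp only [mem_ofPred_eq, mem_inter_iff, this, mem_ball_zero_iff]
    rw [div_pos_iff_of_pos_right hd, sub_pos]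
  rw [hset, ← lintegral_indicator hS]
  congr 1
  ext x
  unfold posPow
  by_cases h : ‖x‖ < 1 ∧ 0 < (w (z + R • x) - a) / d
  · rw [indicator_of_mem (by exact h), indicator_of_mem (by exact h)]
  · rw [indicator_of_notMem (by exact h), indicator_of_notMem (by exact h), ENNReal.ofReal_zero]

lemma lintegral_tail_affine (w : Rn n → ℝ) (z : Rn n)
    {R : ℝ} (hR : 0 < R) (a : ℝ) {d : ℝ} (hd : 0 < d) :
    ∫⁻ y in (ball z R)ᶜ, ENNReal.ofReal (max (w y - a) 0 ^ (p - 1)) * J n s p z y =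
      ENNReal.ofReal (R ^ (-(s * p)) * d ^ (p - 1)) *
        ∫⁻ y in (ball 0 1)ᶜ, ENNReal.ofReal (max ((w (z + R • y) - a) / d) 0 ^ (p - 1)) *
          J n s p 0 y := by
  rw [setLIntegral_affine z hR measurableSet_ball.compl]
  have hset : {x : Rn n | z + R • x ∈ (ball z R)ᶜ} = (ball (0 : Rn n) 1)ᶜ := by
    rw [← affine_ball (z := z) hR]; rfl
  rw [hset, ← lintegral_const_mul' _ _ ENNReal.ofReal_ne_top,
    ← lintegral_const_mul' _ _ ENNReal.ofReal_ne_top]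
  congr 1
  ext y
  have hJ := J_affine (n := n) (s := s) (p := p) z 0 y hR
  rw [smul_zero, add_zero] at hJ
  rw [hJ]
  have h1 : max (w (z + R • y) - a) 0 ^ (p - 1) =
      d ^ (p - 1) * max ((w (z + R • y) - a) / d) 0 ^ (p - 1) := by
    rw [← Real.mul_rpow hd.le (le_max_right _ _), mul_max_of_nonneg _ _ hd.le, mul_zero,
      mul_div_cancel₀ _ hd.ne']
  have h2 : R ^ (-(s * p)) = R ^ n * R ^ (-((n : ℝ) + s * p)) := by
    rw [← Real.rpow_natCast, ← Real.rpow_add hR]; congr 1; ring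
  rw [h1, h2, ENNReal.ofReal_mul (p := d ^ (p - 1)) (by positivity),
    ENNReal.ofReal_mul (p := R ^ n * _) (by positivity),
    ENNReal.ofReal_mul (p := R ^ n) (by positivity)]
  ring

lemma setLIntegral_rhs_affine (f : Rn n → ℝ) (z : Rn n) {R c : ℝ} (hR : 0 < R) (hc : 0 ≤ c) :
    ENNReal.ofReal (R ^ n) * ∫⁻ x in ball 0 1, ENNReal.ofReal (c * f (z + R • x)) =
      ENNReal.ofReal c * ∫⁻ x in ball z R, ENNReal.ofReal (f x) := by
  rw [setLIntegral_affine z hR (S := ball z R) measurableSet_ball, affine_ball hR, mul_left_comm,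
    ← lintegral_const_mul' (ENNReal.ofReal c) _ ENNReal.ofReal_ne_top]
  congr 1
  apply lintegral_congr
  intro x
  rw [ENNReal.ofReal_mul hc]

/-- The upper iteration: level-set masses stay small along shrinking balls. -/
lemma up_iter (P : Par n s p β Q) {L Θ : ℝ} (hL : 0 < L) (hΘ : 0 < Θ) :
    ∃ κ₀ : ℝ, 0 < κ₀ ∧ ∀ (z : Rn n) (R : ℝ) (w f : Rn n → ℝ) (κ : ℝ) (a d : ℕ → ℝ) (N : ℕ),
      0 < R → 0 < κ → κ ≤ κ₀ → IsSub n s p L z R w f (fun _ => 0) →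
      (∀ k, 0 < d k) → (∀ k, lam s p * d k ≤ d (k + 1)) → (∀ k, a (k + 1) = a k + d k) →
      ∫⁻ x in ball z R ∩ {x | a 0 < w x}, ENNReal.ofReal ((1 + (w x - a 0) / d 0) ^ Q) ≤
        ENNReal.ofReal (κ * R ^ n) →
      ∫⁻ y in (ball z R)ᶜ, ENNReal.ofReal (max (w y - a 0) 0 ^ (p - 1)) * J n s p z y ≤
        ENNReal.ofReal (Θ * (R ^ (-(s * p)) * d 0 ^ (p - 1))) →
      (∀ k < N, ∫⁻ x in ball z (R / 2 ^ k), ENNReal.ofReal (f x) ≤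
        ENNReal.ofReal (κ * ((R / 2 ^ k) ^ ((n : ℝ) - s * p) * d k ^ (p - 1)))) →
      ∀ k ≤ N, ∫⁻ x in ball z (R / 2 ^ k) ∩ {x | a k < w x},
        ENNReal.ofReal ((1 + (w x - a k) / d k) ^ Q) ≤ ENNReal.ofReal (κ * (R / 2 ^ k) ^ n) := by
  have hp := P.hp
  obtain ⟨κ₀, hκ₀, hstep⟩ := up_iter_step P hL hΘ
  refine ⟨κ₀, hκ₀, ?_⟩
  intro z R w f κ a d N hR hκ hκκ hw hd hdl ha hI hT hf
  have hwm := hw.meas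
  have key : ∀ k ≤ N, (∫⁻ x, ENNReal.ofReal
      (posPow n Q (fun x => (w (z + (R / 2 ^ k) • x) - a k) / d k) x) ≤ ENNReal.ofReal κ) ∧
      ∫⁻ y in (ball 0 1)ᶜ, ENNReal.ofReal
        (max ((w (z + (R / 2 ^ k) • y) - a k) / d k) 0 ^ (p - 1)) * J n s p 0 y ≤
          ENNReal.ofReal Θ := by
    intro k
    induction k with
    | zero =>
      intro _
      rw [pow_zero, div_one]
      constructor
      · rw [lintegral_posPow_affine hwm z hR (a 0) (hd 0), mul_comm κ,
          ENNReal.ofReal_mul (by positivity)] at hI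
        exact (ENNReal.mul_le_mul_iff_right (by simpa using pow_pos hR n) ENNReal.ofReal_ne_top).1 hI
      · have h0 := hd 0
        rw [lintegral_tail_affine w z hR (a 0) h0, mul_comm Θ,
          ENNReal.ofReal_mul (p := _ * _) (by positivity)] at hT
        exact (ENNReal.mul_le_mul_iff_right (by simp; positivity) ENNReal.ofReal_ne_top).1 hT
    | succ k ih =>
      intro hk
      obtain ⟨ih1, ih2⟩ := ih (by omega)
      have hRk : 0 < R / 2 ^ k := by positivity
      have hdk := hd k
      have hdk1 := hd (k + 1)
      have hsub := (hw.mono (z' := z) (R' := R / 2 ^ k) (by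
        rw [sub_self, norm_zero, zero_add]
        exact div_le_self hR.le (one_le_pow₀ (by norm_num)))).affine hRk (a k) hdk
      simp only [mul_zero] at hsub
      have hθ : d k / d (k + 1) ≤ (lam s p)⁻¹ := by
        rw [div_le_iff₀ hdk1, ← div_eq_inv_mul, le_div_iff₀ lam_pos, mul_comm]
        exact hdl k
      have hfk : ∫⁻ x in ball 0 1, ENNReal.ofReal
          ((R / 2 ^ k) ^ (s * p) / d k ^ (p - 1) * f (z + (R / 2 ^ k) • x)) ≤
          ENNReal.ofReal κ := by
        have h1 := setLIntegral_rhs_affine f z hRk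
          (c := (R / 2 ^ k) ^ (s * p) / d k ^ (p - 1)) (by positivity)
        have h2 := hf k (by omega)
        rw [← ENNReal.mul_le_mul_iff_right (a := ENNReal.ofReal ((R / 2 ^ k) ^ n))
          (by simpa using pow_pos hRk n) ENNReal.ofReal_ne_top, h1]
        refine (mul_le_mul_right h2 _).trans ?_
        rw [← ENNReal.ofReal_mul (by positivity), ← ENNReal.ofReal_mul (by positivity)]
        apply ENNReal.ofReal_le_ofReal
        apply le_of_eq
        rw [Real.rpow_sub hRk, Real.rpow_natCast]
        field_simp
      obtain ⟨h1, h2⟩ := hstep _ _ κ (d k / d (k + 1)) hκ hκκ (by positivity) hθ hsub ih1 hfk ih2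
      have e : ∀ x : Rn n, d k / d (k + 1) *
          ((w (z + (R / 2 ^ k) • (1 / 2 : ℝ) • x) - a k) / d k - 1) =
          (w (z + (R / 2 ^ (k + 1)) • x) - a (k + 1)) / d (k + 1) := by
        intro x
        rw [smul_smul, show R / 2 ^ k * (1 / 2) = R / 2 ^ (k + 1) by rw [pow_succ]; field_simp, ha]
        field_simp
        ring
      simp only [e] at h1 h2
      exact ⟨h1, h2⟩
  intro k hk
  have hRk : 0 < R / 2 ^ k := by positivity
  rw [lintegral_posPow_affine hwm z hRk (a k) (hd k), mul_comm κ,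
    ENNReal.ofReal_mul (by positivity)]
  exact mul_le_mul_right (key k hk).1 _

lemma volume_le_of_posPow (P : Par n s p β Q) {w : Rn n → ℝ} (hw : Measurable w) {z : Rn n}
    {R a d : ℝ} (hd : 0 < d) {M : ℝ≥0∞}
    (h : ∫⁻ x in ball z R ∩ {x | a < w x}, ENNReal.ofReal ((1 + (w x - a) / d) ^ Q) ≤ M) :
    volume (ball z R ∩ {x | a < w x}) ≤ M := by
  refine le_trans ?_ h
  rw [← setLIntegral_one]
  apply setLIntegral_mono' (measurableSet_ball.inter (measurableSet_lt measurable_const hw))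
  rintro x ⟨-, hx⟩
  rw [← ENNReal.ofReal_one]
  apply ENNReal.ofReal_le_ofReal
  apply Real.one_le_rpow _ (by linarith [P.hQ1])
  have : 0 < (w x - a) / d := div_pos (sub_pos.2 hx) hd
  linarith

end UpIter

section Small

variable {n : ℕ} {s p β Q : ℝ}

lemma ae_notMem_of_density (hn : 2 ≤ n) {S U : Set (Rn n)} (hS : MeasurableSet S) {R κ : ℝ}
    (hR : 0 < R) (hκ : κ * 2 ^ n ≤ omega n / 2)
    (h : ∀ z ∈ U, ∀ k : ℕ, volume (ball z (R / 2 ^ k) ∩ S) ≤ ENNReal.ofReal (κ * (R / 2 ^ k) ^ n)) :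
    ∀ᵐ x, x ∈ U → x ∉ S := by
  have hω := omega_pos n
  filter_upwards [Besicovitch.ae_tendsto_measure_inter_div_of_measurableSet volume hS] with x hx hxU hxS
  rw [indicator_of_mem hxS, Pi.one_apply] at hx
  have hr : Tendsto (fun k : ℕ => R / 2 ^ (k + 1)) atTop (𝓝[>] 0) := by
    rw [tendsto_nhdsWithin_iff]
    refine ⟨?_, Eventually.of_forall fun k => by simp only [mem_Ioi]; positivity⟩
    have : Tendsto (fun k : ℕ => R * (1 / 2 : ℝ) ^ (k + 1)) atTop (𝓝 (R * 0)) :=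
      ((tendsto_pow_atTop_nhds_zero_of_lt_one (by norm_num) (by norm_num)).comp
        (tendsto_add_atTop_nat 1)).const_mul R
    rw [mul_zero] at this
    refine this.congr fun k => ?_
    rw [one_div, inv_pow]; rfl
  have hlim := hx.comp hr
  have hle : (1 : ℝ≥0∞) ≤ ENNReal.ofReal (1 / 2) := by
    refine le_of_tendsto hlim (Eventually.of_forall fun k => ?_)
    have hρ : 0 < R / 2 ^ (k + 1) := by positivity
    simp only [Function.comp]
    apply ENNReal.div_le_of_le_mul
    calc volume (S ∩ closedBall x (R / 2 ^ (k + 1))) ≤ volume (ball x (R / 2 ^ k) ∩ S) := by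
          rw [inter_comm]
          apply measure_mono
          apply inter_subset_inter_left
          apply closedBall_subset_ball
          rw [pow_succ]
          exact div_lt_div_of_pos_left hR (by positivity) (by
            have : (0:ℝ) < 2 ^ k := by positivity
            linarith)
      _ ≤ _ := h x hxU k
      _ ≤ ENNReal.ofReal (1 / 2) * volume (ball x (R / 2 ^ (k + 1))) := by
          rw [volume_ball_eq hn x hρ.le, ← ENNReal.ofReal_mul (by norm_num)]
          apply ENNReal.ofReal_le_ofReal
          rw [show R / 2 ^ k = 2 * (R / 2 ^ (k + 1)) by rw [pow_succ]; field_simp, mul_pow]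
          have := mul_le_mul_of_nonneg_right hκ (pow_pos hρ n).le
          linarith
      _ ≤ _ := by gcongr; exact ball_subset_closedBall
  rw [← ENNReal.ofReal_one, ENNReal.ofReal_le_ofReal_iff (by norm_num)] at hle
  norm_num at hle

lemma rpow_pred_le_of_half (hp : 1 < p) (hQ : p - 1 ≤ Q) (t : ℝ) :
    max (t - 1 / 2) 0 ^ (p - 1) ≤ 2 ^ (Q - (p - 1)) * max t 0 ^ Q := by
  rcases le_or_gt t (1 / 2) with h | h
  · rw [max_eq_right (by linarith), Real.zero_rpow (by linarith)]; positivity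
  have ht : 0 < t := by linarith
  rw [max_eq_left (by linarith), max_eq_left ht.le]
  calc (t - 1 / 2) ^ (p - 1) ≤ t ^ (p - 1) :=
        Real.rpow_le_rpow (by linarith) (by linarith) (by linarith)
    _ = 1 * t ^ (p - 1) := (one_mul _).symm
    _ ≤ (2 * t) ^ (Q - (p - 1)) * t ^ (p - 1) := by
        gcongr
        exact Real.one_le_rpow (by linarith) (by linarith)
    _ = _ := by
        rw [Real.mul_rpow (by norm_num) ht.le, mul_assoc, ← Real.rpow_add ht]
        congr 2; ring

lemma small_tail (P : Par n s p β Q) {T : ℝ} (hT : 0 ≤ T) {w : Rn n → ℝ} (hw : Measurable w)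
    (h1 : ∫⁻ x in ball 0 1, ENNReal.ofReal (max (w x) 0 ^ Q) ≤ ENNReal.ofReal 1)
    (h2 : ∫⁻ y in (ball 0 1)ᶜ, ENNReal.ofReal (max (w y) 0 ^ (p - 1)) * J n s p 0 y ≤
      ENNReal.ofReal T) {z : Rn n} (hz : z ∈ ball (0 : Rn n) (3 / 4)) :
    ∫⁻ y in (ball z (1 / 8))ᶜ, ENNReal.ofReal (max (w y - 1 / 2) 0 ^ (p - 1)) * J n s p z y ≤
      ENNReal.ofReal (8 ^ ((n : ℝ) + s * p) * 2 ^ (Q - (p - 1)) + 4 ^ ((n : ℝ) + s * p) * T) := by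
  have hp := P.hp
  have hsp : 0 < s * p := mul_pos P.hs (by linarith)
  rw [mem_ball_zero_iff] at hz
  rw [← lintegral_indicator measurableSet_ball.compl]
  rw [← lintegral_indicator measurableSet_ball] at h1
  rw [← lintegral_indicator measurableSet_ball.compl] at h2
  have hm : Measurable fun x : Rn n => ENNReal.ofReal (8 ^ ((n : ℝ) + s * p) * 2 ^ (Q - (p - 1))) *
      (ball (0 : Rn n) 1).indicator (fun x => ENNReal.ofReal (max (w x) 0 ^ Q)) x := by
    apply Measurable.const_mul
    apply Measurable.indicator _ measurableSet_ball
    fun_prop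
  calc _ ≤ ∫⁻ y, ENNReal.ofReal (8 ^ ((n : ℝ) + s * p) * 2 ^ (Q - (p - 1))) *
        (ball (0 : Rn n) 1).indicator (fun x => ENNReal.ofReal (max (w x) 0 ^ Q)) y +
        ENNReal.ofReal (4 ^ ((n : ℝ) + s * p)) * (ball (0 : Rn n) 1)ᶜ.indicator (fun y =>
          ENNReal.ofReal (max (w y) 0 ^ (p - 1)) * J n s p 0 y) y := by
        apply lintegral_mono
        intro y
        dsimp only
        by_cases hyz : y ∈ (ball z (1 / 8))ᶜ
        swap
        · rw [indicator_of_notMem hyz]; exact zero_le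
        rw [indicator_of_mem hyz]
        rw [mem_compl_iff, mem_ball_iff_norm, not_lt] at hyz
        by_cases hy : y ∈ ball (0 : Rn n) 1
        · rw [indicator_of_mem hy]
          refine le_trans ?_ le_self_add
          unfold J
          rw [← ENNReal.ofReal_mul (by positivity), ← ENNReal.ofReal_mul (by positivity)]
          apply ENNReal.ofReal_le_ofReal
          rw [mul_comm, mul_assoc]
          gcongr
          · rw [norm_sub_rev]
            calc ‖y - z‖ ^ (-((n : ℝ) + s * p)) ≤ (1 / 8) ^ (-((n : ℝ) + s * p)) :=
                  Real.rpow_le_rpow_of_nonpos (by norm_num) hyz (by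
                    have : (0 : ℝ) ≤ n := Nat.cast_nonneg n
                    linarith)
              _ = _ := by
                  rw [one_div, Real.inv_rpow (by norm_num), ← Real.rpow_neg (by norm_num), neg_neg]
          · exact rpow_pred_le_of_half hp P.hQp _
        · rw [indicator_of_mem (s := (ball (0 : Rn n) 1)ᶜ) hy]
          refine le_trans ?_ le_add_self
          rw [mul_left_comm]
          rw [mem_ball_zero_iff, not_lt] at hy
          have hJ := J_le_far (n := n) hsp.le (z := 0) (x := z) (y := y) (r₁ := 3 / 4) (r₂ := 1)
            (by norm_num) (by norm_num) (by rw [sub_zero]; exact hz.le) (by rwa [sub_zero])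
          norm_num only at hJ
          gcongr
          linarith
    _ = ENNReal.ofReal (8 ^ ((n : ℝ) + s * p) * 2 ^ (Q - (p - 1))) *
        (∫⁻ y, (ball (0 : Rn n) 1).indicator (fun x => ENNReal.ofReal (max (w x) 0 ^ Q)) y) +
        ENNReal.ofReal (4 ^ ((n : ℝ) + s * p)) * ∫⁻ y, (ball (0 : Rn n) 1)ᶜ.indicator (fun y =>
          ENNReal.ofReal (max (w y) 0 ^ (p - 1)) * J n s p 0 y) y := by
        rw [lintegral_add_left hm, lintegral_const_mul' _ _ ENNReal.ofReal_ne_top,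
          lintegral_const_mul' _ _ ENNReal.ofReal_ne_top]
    _ ≤ ENNReal.ofReal (8 ^ ((n : ℝ) + s * p) * 2 ^ (Q - (p - 1))) * ENNReal.ofReal 1 +
        ENNReal.ofReal (4 ^ ((n : ℝ) + s * p)) * ENNReal.ofReal T := by gcongr
    _ = _ := by
        rw [ENNReal.ofReal_one, mul_one, ← ENNReal.ofReal_mul (by positivity),
          ← ENNReal.ofReal_add (by positivity) (by positivity)]

/-- Local boundedness: small mass forces `w ≤ 1`. -/
lemma ae_le_of_small (P : Par n s p β Q) {L T : ℝ} (hL : 0 < L) (hT : 0 ≤ T) :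
    ∃ κ₁ : ℝ, 0 < κ₁ ∧ ∀ w : Rn n → ℝ, IsSub n s p L 0 1 w (fun _ => 0) (fun _ => 0) →
      ∫⁻ x in ball 0 1, ENNReal.ofReal (max (w x) 0 ^ Q) ≤ ENNReal.ofReal κ₁ →
      ∫⁻ y in (ball 0 1)ᶜ, ENNReal.ofReal (max (w y) 0 ^ (p - 1)) * J n s p 0 y ≤
        ENNReal.ofReal T →
      ∀ᵐ x, x ∈ ball (0 : Rn n) (3 / 4) → w x ≤ 1 := by
  have hp := P.hp
  have hω := omega_pos n
  have hQ0 : 0 < Q := by linarith [P.hQ1]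
  have hl0 := lam_pos (s := s) (p := p)
  have hl1 := lam_lt_one P
  generalize hlam : lam s p = l at hl0 hl1
  obtain ⟨d₀, hd₀⟩ : ∃ d₀ : ℝ, d₀ = (1 - l) / 2 := ⟨_, rfl⟩
  have hd0 : 0 < d₀ := by rw [hd₀]; linarith
  obtain ⟨Θ', hΘ'⟩ : ∃ Θ' : ℝ, Θ' = 8 ^ ((n : ℝ) + s * p) * 2 ^ (Q - (p - 1)) +
    4 ^ ((n : ℝ) + s * p) * T := ⟨_, rfl⟩
  have hΘ0 : 0 < Θ' := by rw [hΘ']; positivity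
  obtain ⟨E, hE⟩ : ∃ E : ℝ, E = (1 / 8 : ℝ) ^ (-(s * p)) * d₀ ^ (p - 1) := ⟨_, rfl⟩
  have hE0 : 0 < E := by rw [hE]; positivity
  obtain ⟨κ₀, hκ₀, hup⟩ := up_iter P (L := L) (Θ := Θ' / E) hL (by positivity)
  obtain ⟨κ, hκ⟩ : ∃ κ : ℝ, κ = min κ₀ (omega n / 2 / 2 ^ n) := ⟨_, rfl⟩
  have hκ0 : 0 < κ := by rw [hκ]; exact lt_min hκ₀ (by positivity)
  refine ⟨min 1 (d₀ ^ Q * (κ * (1 / 8 : ℝ) ^ n)), lt_min one_pos (by positivity), ?_⟩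
  intro w hw h1 h2
  have hwm := hw.meas
  have hden : ∀ᵐ x, x ∈ ball (0 : Rn n) (3 / 4) → x ∉ {x | 1 < w x} := by
    refine ae_notMem_of_density P.hn (measurableSet_lt measurable_const hwm) (R := 1 / 8) (κ := κ)
      (by norm_num) ?_ ?_
    · rw [← le_div_iff₀ (by positivity), hκ]; exact min_le_right _ _
    intro z hz k
    have hz' := hz
    rw [mem_ball_zero_iff] at hz'
    have htail := small_tail P hT hwm (h1.trans (ENNReal.ofReal_le_ofReal (min_le_left _ _))) h2 hz
    rw [← hΘ'] at htail
    have hd : ∀ k : ℕ, 0 < l ^ k * d₀ := fun k => by positivity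
    have := hup z (1 / 8) w (fun _ => 0) κ (fun k => 1 - l ^ k / 2) (fun k => l ^ k * d₀) k
      (by norm_num) hκ0 (by rw [hκ]; exact min_le_left _ _)
      (hw.mono (by rw [sub_zero]; linarith)) hd
      (fun k => by rw [hlam, pow_succ]; apply le_of_eq; ring)
      (fun k => by rw [pow_succ, hd₀]; ring) ?_ ?_ ?_ k le_rfl
    · refine le_trans (measure_mono ?_) (volume_le_of_posPow P hwm (hd k) this)
      rintro x ⟨hx, hx1⟩
      refine ⟨hx, ?_⟩
      have : 0 < l ^ k := by positivity
      simp only [mem_ofPred_eq] at hx1 ⊢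
      linarith
    · simp only [pow_zero, one_mul]
      have hsub : ball z (1 / 8) ⊆ ball (0 : Rn n) 1 := by
        apply ball_subset_ball'
        rw [dist_zero_right]; linarith
      calc ∫⁻ x in ball z (1 / 8) ∩ {x | 1 - 1 / 2 < w x},
            ENNReal.ofReal ((1 + (w x - (1 - 1 / 2)) / d₀) ^ Q) ≤
            ∫⁻ x in ball z (1 / 8) ∩ {x | 1 - 1 / 2 < w x},
              ENNReal.ofReal (d₀⁻¹ ^ Q) * ENNReal.ofReal (max (w x) 0 ^ Q) := by
            apply setLIntegral_mono' (measurableSet_ball.inter (measurableSet_lt measurable_const hwm))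
            rintro x ⟨-, hx⟩
            simp only [mem_ofPred_eq] at hx
            rw [← ENNReal.ofReal_mul (by positivity), ← Real.mul_rpow (by positivity)
              (le_max_right _ _), max_eq_left (by linarith)]
            apply ENNReal.ofReal_le_ofReal
            have hge : 0 ≤ (w x - (1 - 1 / 2)) / d₀ := div_nonneg (by linarith) hd0.le
            apply Real.rpow_le_rpow (by linarith) _ hQ0.le
            rw [← div_eq_inv_mul, le_div_iff₀ hd0, add_mul, div_mul_cancel₀ _ hd0.ne']
            rw [hd₀]; linarith
        _ ≤ ENNReal.ofReal (d₀⁻¹ ^ Q) * ENNReal.ofReal (d₀ ^ Q * (κ * (1 / 8 : ℝ) ^ n)) := by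
            rw [lintegral_const_mul' _ _ ENNReal.ofReal_ne_top]
            gcongr
            refine le_trans (lintegral_mono_set (inter_subset_left.trans hsub)) (h1.trans ?_)
            exact ENNReal.ofReal_le_ofReal (min_le_right _ _)
        _ = _ := by
            rw [← ENNReal.ofReal_mul (by positivity), ← mul_assoc,
              ← Real.mul_rpow (by positivity) hd0.le, inv_mul_cancel₀ hd0.ne', Real.one_rpow,
              one_mul]
    · simp only [pow_zero, one_mul]
      norm_num only at htail hE ⊢
      rw [← hE, div_mul_cancel₀ _ hE0.ne']
      exact htail
    · intro k _
      simp
  filter_upwards [hden] with x hx hxb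
  exact not_lt.1 (hx hxb)

end Small

section SupBudget

variable {n : ℕ} {s p : ℝ}

/-- `(1 + u₋)^{p-1}` outside the ball of radius `r`. -/
def negTail (n : ℕ) (p r : ℝ) (u : Rn n → ℝ) (y : Rn n) : ℝ :=
  ({y : Rn n | r ≤ ‖y‖}).indicator (fun y => (1 + max (-u y) 0) ^ (p - 1)) y

lemma measurableSet_norm_ge (r : ℝ) : MeasurableSet {y : Rn n | r ≤ ‖y‖} :=
  measurableSet_le (g := fun x : Rn n => ‖x‖) measurable_const (by fun_prop)

lemma measurableSet_norm_lt (r : ℝ) : MeasurableSet {y : Rn n | ‖y‖ < r} :=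
  measurableSet_lt (f := fun x : Rn n => ‖x‖) (by fun_prop) measurable_const

lemma negTail_nonneg (r : ℝ) (u : Rn n → ℝ) (y : Rn n) : 0 ≤ negTail n p r u y :=
  indicator_nonneg (fun _ _ => by positivity) _

lemma measurable_negTail (r : ℝ) {u : Rn n → ℝ} (hu : Measurable u) :
    Measurable (negTail n p r u) := by
  apply Measurable.indicator _ (measurableSet_norm_ge r)
  fun_prop

lemma lintegral_compl_J_le (hn : 2 ≤ n) (hs : 0 < s) (hs1 : s < 1) (hp : 0 < p) :
    ∃ C : ℝ, 0 < C ∧ ∀ r : ℝ, 0 < r → r ≤ 1 →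
      ∫⁻ y in {y : Rn n | r ≤ ‖y‖}, J n s p 0 y ≤ ENNReal.ofReal (C * r⁻¹ ^ p) := by
  obtain ⟨C, hC, h⟩ := exists_lintegral_min_le (n := n) hn hs hs1 hp
  refine ⟨C, hC, fun r hr hr1 => ?_⟩
  refine le_trans ?_ (h r⁻¹ ((one_le_inv₀ hr).2 hr1) 0)
  rw [← lintegral_indicator (measurableSet_norm_ge r)]
  apply lintegral_mono
  intro y
  dsimp only
  by_cases hy : r ≤ ‖y‖
  · rw [indicator_of_mem (by exact hy), zero_sub, norm_neg, min_eq_left, Real.one_rpow,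
      ENNReal.ofReal_one, one_mul]
    rwa [← div_eq_inv_mul, one_le_div hr]
  · rw [indicator_of_notMem (by exact hy)]
    exact zero_le

lemma lintegral_negTail_le (hn : 2 ≤ n) (hs : 0 < s) (hs1 : s < 1) (hp : 1 < p) {r : ℝ}
    (hr : 0 < r) (hr1 : r ≤ 1) :
    ∃ C : ℝ, 0 < C ∧ ∀ u : Rn n → ℝ, Measurable u → (∀ x ∈ ball (0 : Rn n) 1, 0 ≤ u x) →
      ∫⁻ y in (ball 0 1)ᶜ, ENNReal.ofReal (max (-u y) 0 ^ (p - 1)) * J n s p 0 y ≤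
        ENNReal.ofReal 1 →
      ∫⁻ y, ENNReal.ofReal (negTail n p r u y) * J n s p 0 y ≤ ENNReal.ofReal C := by
  obtain ⟨C, hC, h⟩ := lintegral_compl_J_le (n := n) hn hs hs1 (by linarith : 0 < p)
  refine ⟨2 ^ (p - 1) * (C * r⁻¹ ^ p + 1), by positivity, ?_⟩
  intro u hu hu0 hT
  have hm : Measurable fun y : Rn n => ({y : Rn n | r ≤ ‖y‖}).indicator (J n s p 0) y :=
    Measurable.indicator (by fun_prop) (measurableSet_norm_ge r)
  calc _ ≤ ∫⁻ y, ENNReal.ofReal (2 ^ (p - 1)) * (({y : Rn n | r ≤ ‖y‖}).indicator (J n s p 0) y +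
        (ball (0 : Rn n) 1)ᶜ.indicator
          (fun y => ENNReal.ofReal (max (-u y) 0 ^ (p - 1)) * J n s p 0 y) y) := by
        apply lintegral_mono
        intro y
        dsimp only
        unfold negTail
        by_cases hy : r ≤ ‖y‖
        swap
        · rw [indicator_of_notMem (by exact hy)]; simp
        rw [indicator_of_mem (by exact hy), indicator_of_mem (by exact hy)]
        have h1 := add_rpow_le (p := p - 1) (by linarith) zero_le_one (le_max_right (-u y) 0)
        rw [Real.one_rpow] at h1
        refine (mul_le_mul_left (ENNReal.ofReal_le_ofReal h1) _).trans ?_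
        rw [ENNReal.ofReal_mul (by positivity), mul_assoc, ENNReal.ofReal_add (by norm_num)
          (by positivity), ENNReal.ofReal_one, add_mul, one_mul]
        gcongr
        by_cases hy1 : y ∈ ball (0 : Rn n) 1
        · rw [max_eq_right (by linarith [hu0 y hy1]), Real.zero_rpow (by linarith)]
          simp
        · rw [indicator_of_mem (s := (ball (0 : Rn n) 1)ᶜ) hy1]
    _ = ENNReal.ofReal (2 ^ (p - 1)) * ((∫⁻ y in {y : Rn n | r ≤ ‖y‖}, J n s p 0 y) +
        ∫⁻ y in (ball 0 1)ᶜ, ENNReal.ofReal (max (-u y) 0 ^ (p - 1)) * J n s p 0 y) := by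
        rw [lintegral_const_mul' _ _ ENNReal.ofReal_ne_top, lintegral_add_left hm,
          lintegral_indicator (measurableSet_norm_ge r), lintegral_indicator measurableSet_ball.compl]
    _ ≤ ENNReal.ofReal (2 ^ (p - 1)) * (ENNReal.ofReal (C * r⁻¹ ^ p) + ENNReal.ofReal 1) := by
        gcongr
        exact h r hr hr1
    _ = _ := by
        rw [← ENNReal.ofReal_add (by positivity) (by norm_num), ← ENNReal.ofReal_mul (by positivity)]

lemma sg_sub_le {a b : ℝ} (hp : 1 < p) (ha : 0 ≤ a) :
    sg p (a - b) ≤ (1 + a) ^ (p - 1) * (1 + max (-b) 0) ^ (p - 1) := by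
  rcases le_total b a with h | h
  · rw [sg_of_nonneg (by linarith), ← Real.mul_rpow (by positivity) (by positivity)]
    apply Real.rpow_le_rpow (by linarith) _ (by linarith)
    have h1 := le_max_left (-b) 0
    have h2 := le_max_right (-b) 0
    nlinarith
  · rw [← neg_sub, sg_neg hp, sg_of_nonneg (by linarith)]
    have h1 : 0 ≤ (b - a) ^ (p - 1) := Real.rpow_nonneg (by linarith) _
    have h2 : 0 ≤ (1 + a) ^ (p - 1) * (1 + max (-b) 0) ^ (p - 1) := by positivity
    linarith

/-- The weight of the near variable in the long-range interaction. -/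
def nearWt (n : ℕ) (p ρ : ℝ) (F : ℝ → ℝ) (u : Rn n → ℝ) (x : Rn n) : ℝ :=
  ({x : Rn n | ‖x‖ < ρ}).indicator (fun x => F (u x) * (1 + |u x|) ^ (p - 1)) x

lemma nearWt_nonneg {ρ : ℝ} {F : ℝ → ℝ} (hF : ∀ t, 0 ≤ F t) (u : Rn n → ℝ) (x : Rn n) :
    0 ≤ nearWt n p ρ F u x :=
  indicator_nonneg (fun x _ => mul_nonneg (hF _) (by positivity)) _

lemma far_pointwise (hp : 1 < p) {ρ r : ℝ} (hρ : ρ ≤ r) {F : ℝ → ℝ} (hF : ∀ t, 0 ≤ F t)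
    {u η : Rn n → ℝ} (hη : Cutoff 0 ρ η) (hu : ∀ x ∈ ball (0 : Rn n) ρ, 0 ≤ u x) {x y : Rn n}
    (hy : r ≤ ‖y‖) :
    sg p (u x - u y) * (F (u x) * η x ^ p - F (u y) * η y ^ p) ≤
      nearWt n p ρ F u x * negTail n p r u y := by
  have hp0 : p ≠ 0 := by linarith
  rw [hη.zero y (by rw [sub_zero]; linarith), Real.zero_rpow hp0, mul_zero, sub_zero]
  by_cases hx : ‖x‖ < ρ
  · unfold nearWt negTail
    have hux := hu x (by simpa using hx)
    rw [indicator_of_mem (by exact hx), indicator_of_mem (by exact hy), abs_of_nonneg hux]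
    have h1 := sg_sub_le (b := u y) hp hux
    have h2 : η x ^ p ≤ 1 := Real.rpow_le_one (hη.nonneg x) (hη.le_one x) (by linarith)
    have h3 : 0 ≤ η x ^ p := Real.rpow_nonneg (hη.nonneg x) _
    have h4 := hF (u x)
    have h5 : 0 ≤ (1 + u x) ^ (p - 1) * (1 + max (-u y) 0) ^ (p - 1) := by positivity
    calc _ ≤ (1 + u x) ^ (p - 1) * (1 + max (-u y) 0) ^ (p - 1) * (F (u x) * η x ^ p) :=
          mul_le_mul_of_nonneg_right h1 (mul_nonneg h4 h3)
      _ ≤ (1 + u x) ^ (p - 1) * (1 + max (-u y) 0) ^ (p - 1) * (F (u x) * 1) := by gcongr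
      _ = _ := by ring
  · rw [hη.zero x (by rw [sub_zero]; linarith), Real.zero_rpow hp0, mul_zero, mul_zero]
    exact mul_nonneg (nearWt_nonneg hF _ _) (negTail_nonneg _ _ _)

/-- Testing a supersolution, nonnegative in the unit ball, with all error terms estimated. -/
lemma sup_budget (hn : 2 ≤ n) (hs : 0 < s) (hs1 : s < 1) (hp : 1 < p) {L l ρ r : ℝ}
    (hL : 0 < L) (hl : 1 ≤ l) (hρ0 : 0 ≤ ρ) (hρ : ρ < r) (hr : r ≤ 1) :
    ∃ C : ℝ, 0 < C ∧ ∀ u f : Rn n → ℝ, IsSup n s p L 0 1 u f →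
      (∀ x ∈ ball (0 : Rn n) 1, 0 ≤ u x) →
      ∫⁻ y in (ball 0 1)ᶜ, ENNReal.ofReal (max (-u y) 0 ^ (p - 1)) * J n s p 0 y ≤
        ENNReal.ofReal 1 →
      ∀ (F : ℝ → ℝ) (K : ℝ≥0), LipschitzWith K F → (∀ t, 0 ≤ F t) → ∀ η : Rn n → ℝ,
      Cutoff 0 ρ η → ∀ (h : Rn n → ℝ) (e g : Rn n → Rn n → ℝ), Measurable h → (∀ x, 0 ≤ h x) →
      (∀ x y, 0 ≤ e x y) → (∀ x y, 0 ≤ g x y) →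
      (∀ x y, (r ≤ ‖x‖ ∨ r ≤ ‖y‖) → g x y = 0) →
      (∀ x y, ‖x‖ < r → ‖y‖ < r →
        sg p (u x - u y) * (F (u x) * η x ^ p - F (u y) * η y ^ p) ≤
          e x y + (h x + h y) * min 1 (l * ‖x - y‖) ^ p - g x y) →
      (∫⁻ x, ∫⁻ y, ENNReal.ofReal (g x y) * J n s p x y) +
        ∫⁻ x, ENNReal.ofReal (f x * (F (u x) * η x ^ p)) ≤
      ENNReal.ofReal C * ((∫⁻ x, ∫⁻ y, ENNReal.ofReal (e x y) * J n s p x y) +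
        (∫⁻ x, ENNReal.ofReal (h x)) + ∫⁻ x, ENNReal.ofReal (nearWt n p ρ F u x)) := by
  have hr0 : 0 < r := by linarith
  obtain ⟨C₁, hC₁, hbud⟩ := exists_budget (n := n) hn hs hs1 (by linarith : 0 < p) hl hρ0 hρ
  obtain ⟨C₂, hC₂, htail⟩ := lintegral_negTail_le (n := n) hn hs hs1 hp hr0 hr
  refine ⟨L * (1 + C₁ * (1 + C₂)), by positivity, ?_⟩
  intro u f hsup hu0 hT F K hF hF0 η hη h e g hhm hh0 he0 hg0 hgz hN
  have hum := hsup.measurable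
  have hFm : Measurable F := hF.continuous.measurable
  have hAm : Measurable (nearWt n p ρ F u) := by
    apply Measurable.indicator _ (measurableSet_norm_lt ρ)
    fun_prop
  have hkm : Measurable (negTail n p r u) := measurable_negTail r hum
  have hA0 := nearWt_nonneg (n := n) (p := p) (ρ := ρ) hF0 u
  have hk0 := negTail_nonneg (n := n) (p := p) r u
  have hAz : ∀ x, ρ ≤ ‖x‖ → nearWt n p ρ F u x = 0 := fun x hx =>
    indicator_of_notMem (by simp only [mem_ofPred_eq]; linarith) _
  have hkz : ∀ y, ‖y‖ < r → negTail n p r u y = 0 := fun y hy =>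
    indicator_of_notMem (by simp only [mem_ofPred_eq]; linarith) _
  obtain ⟨b, hb⟩ : ∃ b : Rn n → Rn n → ℝ, b = fun x y => (h x + h y) * min 1 (l * ‖x - y‖) ^ p +
    (nearWt n p ρ F u x * negTail n p r u y + nearWt n p ρ F u y * negTail n p r u x) := ⟨_, rfl⟩
  have hb0 : ∀ x y, 0 ≤ b x y := by
    intro x y
    rw [hb]
    have := hh0 x; have := hh0 y; have := hA0 x; have := hA0 y; have := hk0 x; have := hk0 y
    positivity
  have hbm : Measurable (Function.uncurry b) := by
    rw [hb]; unfold Function.uncurry; fun_prop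
  have hbb := hbud h _ _ hhm hAm hkm hh0 hA0 hk0 hAz hkz b
    (Eventually.of_forall fun x => Eventually.of_forall fun y => by rw [hb])
  have hu0' : ∀ x ∈ ball (0 : Rn n) ρ, 0 ≤ u x := fun x hx =>
    hu0 x (ball_subset_ball (by linarith) hx)
  refine (hsup.ineq hp F K hF hF0 ρ (by linarith) η hη (fun x y => e x y + b x y) g
    (fun x y => add_nonneg (he0 x y) (hb0 x y)) hg0 ?_).trans ?_
  · refine Eventually.of_forall fun x => Eventually.of_forall fun y => ?_
    have hex := he0 x y
    have hm : 0 ≤ (h x + h y) * min 1 (l * ‖x - y‖) ^ p := by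
      have := hh0 x; have := hh0 y; positivity
    have hAk := mul_nonneg (hA0 x) (hk0 y)
    have hAk' := mul_nonneg (hA0 y) (hk0 x)
    rw [hb]
    by_cases hy : r ≤ ‖y‖
    · rw [hgz x y (Or.inr hy)]
      have := far_pointwise hp hρ.le hF0 hη hu0' (x := x) hy
      linarith
    by_cases hx : r ≤ ‖x‖
    · rw [hgz x y (Or.inl hx), sg_mul_sub_comm hp]
      have := far_pointwise hp hρ.le hF0 hη hu0' (x := y) hx
      linarith
    rw [not_le] at hx hy
    have := hN x y hx hy
    linarith
  · have hbJ : Measurable fun z : Rn n × Rn n => ENNReal.ofReal (b z.1 z.2) * J n s p z.1 z.2 := by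
      have : Measurable fun z : Rn n × Rn n => b z.1 z.2 := hbm
      fun_prop
    have hbJ' : Measurable fun x => ∫⁻ y, ENNReal.ofReal (b x y) * J n s p x y :=
      Measurable.lintegral_prod_right' (f := fun z : Rn n × Rn n =>
        ENNReal.ofReal (b z.1 z.2) * J n s p z.1 z.2) hbJ
    have e1 : ∫⁻ x, ∫⁻ y, ENNReal.ofReal (e x y + b x y) * J n s p x y =
        (∫⁻ x, ∫⁻ y, ENNReal.ofReal (e x y) * J n s p x y) +
          ∫⁻ x, ∫⁻ y, ENNReal.ofReal (b x y) * J n s p x y := by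
      rw [← lintegral_add_right _ hbJ']
      apply lintegral_congr
      intro x
      have hm : Measurable fun y => ENNReal.ofReal (b x y) * J n s p x y :=
        hbJ.comp measurable_prodMk_left
      rw [← lintegral_add_right _ hm]
      apply lintegral_congr
      intro y
      rw [ENNReal.ofReal_add (he0 x y) (hb0 x y), add_mul]
    rw [e1]
    generalize (∫⁻ x, ∫⁻ y, ENNReal.ofReal (e x y) * J n s p x y) = E
    have ht := htail u hum hu0 hT
    generalize (∫⁻ x, ENNReal.ofReal (h x)) = H at hbb ⊢
    generalize (∫⁻ x, ENNReal.ofReal (nearWt n p ρ F u x)) = A at hbb ⊢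
    generalize (∫⁻ y, ENNReal.ofReal (negTail n p r u y) * J n s p 0 y) = Tk at hbb ht
    calc _ ≤ ENNReal.ofReal L * (E + ENNReal.ofReal C₁ * (H + A * ENNReal.ofReal C₂)) := by
          gcongr
          exact hbb.trans (by gcongr)
      _ ≤ ENNReal.ofReal L * ((1 + ENNReal.ofReal C₁ * (1 + ENNReal.ofReal C₂)) * (E + H + A)) := by
          gcongr
          calc _ ≤ E + H + A + ENNReal.ofReal C₁ * ((E + H + A) + (E + H + A) * ENNReal.ofReal C₂) := by
                gcongr
                · exact le_self_add.trans le_self_add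
                · exact le_add_self.trans le_self_add
                · exact le_add_self
            _ = _ := by ring
      _ = _ := by
          rw [← mul_assoc, ENNReal.ofReal_mul hL.le, ENNReal.ofReal_add (by norm_num) (by positivity),
            ENNReal.ofReal_mul hC₁.le, ENNReal.ofReal_add (by norm_num) hC₂.le, ENNReal.ofReal_one]

end SupBudget

section LowMass

variable {n : ℕ} {s p β Q : ℝ}

/-- A supersolution in the unit ball, nonnegative there and with normalized negative tail. -/
structure NormSup (n : ℕ) (s p L : ℝ) (u f : Rn n → ℝ) : Prop where
  sup : IsSup n s p L 0 1 u f
  nonneg : ∀ x ∈ ball (0 : Rn n) 1, 0 ≤ u x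
  tail : ∫⁻ y in (ball 0 1)ᶜ, ENNReal.ofReal (max (-u y) 0 ^ (p - 1)) * J n s p 0 y ≤
    ENNReal.ofReal 1

lemma cutoff_le_min_rpow {η : Rn n → ℝ} {l : ℝ} (hp : 0 ≤ p)
    (hη : ∀ x y, |η x - η y| ≤ min 1 (l * ‖x - y‖)) (x y : Rn n) :
    |η x - η y| ^ p ≤ min 1 (l * ‖x - y‖) ^ p :=
  Real.rpow_le_rpow (abs_nonneg _) (hη x y) hp

lemma J_ge_of_le (hsp : 0 < s * p) {x y : Rn n} (hxy : x ≠ y) {d : ℝ} (h : ‖x - y‖ ≤ d) :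
    ENNReal.ofReal (d ^ (-((n : ℝ) + s * p))) ≤ J n s p x y := by
  have h0 : 0 < ‖x - y‖ := norm_pos_iff.2 (sub_ne_zero.2 hxy)
  unfold J
  apply ENNReal.ofReal_le_ofReal
  exact Real.rpow_le_rpow_of_nonpos h0 h (by
    have : (0 : ℝ) ≤ n := Nat.cast_nonneg n
    linarith)

lemma setLIntegral_mul_setLIntegral_le {S T : Set (Rn n)} (hS : MeasurableSet S)
    (hT : MeasurableSet T) {v : Rn n → ℝ} {G : Rn n → Rn n → ℝ≥0∞} {c : ℝ}
    (h : ∀ x ∈ S, ∀ y ∈ T, ENNReal.ofReal c * ENNReal.ofReal (v y) ≤ G x y) :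
    ENNReal.ofReal c * (volume S * ∫⁻ y in T, ENNReal.ofReal (v y)) ≤ ∫⁻ x, ∫⁻ y, G x y := by
  calc _ = ∫⁻ x in S, ENNReal.ofReal c * ∫⁻ y in T, ENNReal.ofReal (v y) := by
        rw [setLIntegral_const]; ring
    _ ≤ ∫⁻ x in S, ∫⁻ y, G x y := by
        apply setLIntegral_mono' hS
        intro x hx
        rw [← lintegral_const_mul' _ _ ENNReal.ofReal_ne_top]
        exact (setLIntegral_mono' hT fun y hy => h x hx y hy).trans (setLIntegral_le_lintegral _ _)
    _ ≤ _ := setLIntegral_le_lintegral _ _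

lemma down_pointwise_good {a b η₁ η₂ : ℝ} (hp : 1 < p) (ha : a ≤ 3 / 2) (hb : 2 ≤ b)
    (h1 : η₁ = 1) (h2 : η₂ = 1) :
    1 / 4 * (1 / 4) ^ (p - 1) * b ^ (p - 1) ≤
      1 / 2 * (|a - b| ^ (p - 1) * |max (2 - a) 0 - max (2 - b) 0| * min η₁ η₂ ^ p) := by
  rw [h1, h2, min_self, Real.one_rpow, mul_one, max_eq_left (by linarith : 0 ≤ 2 - a),
    max_eq_right (by linarith : 2 - b ≤ 0), sub_zero, abs_of_nonneg (by linarith : 0 ≤ 2 - a),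
    mul_assoc, ← Real.mul_rpow (by norm_num) (by linarith), abs_sub_comm, abs_of_nonneg (by linarith)]
  have h3 : (1 / 4 * b) ^ (p - 1) ≤ (b - a) ^ (p - 1) :=
    Real.rpow_le_rpow (by linarith) (by linarith) (by linarith)
  have h4 : 0 ≤ (1 / 4 * b) ^ (p - 1) := Real.rpow_nonneg (by linarith) _
  nlinarith

lemma down_measure (hn : 2 ≤ n) (hs : 0 < s) (hs1 : s < 1) (hp : 1 < p) {L : ℝ} (hL : 0 < L) :
    ∃ C : ℝ, 0 < C ∧ ∀ u f : Rn n → ℝ, NormSup n s p L u f →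
      volume {x : Rn n | ‖x‖ < 5 / 8 ∧ u x ≤ 3 / 2} *
        ∫⁻ y in {y : Rn n | ‖y‖ < 5 / 8 ∧ 2 ≤ u y}, ENNReal.ofReal (u y ^ (p - 1)) ≤
          ENNReal.ofReal C := by
  have hsp : 0 < s * p := by positivity
  have hω := omega_pos n
  obtain ⟨C₁, hC₁, hbud⟩ := sup_budget (n := n) hn hs hs1 hp (L := L) (l := 8) (ρ := 3 / 4) (r := 1)
    hL (by norm_num) (by norm_num) (by norm_num) le_rfl
  obtain ⟨C₀, hC₀, hdown⟩ := pointwise_down hp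
  obtain ⟨η, hη, hη1, hηl⟩ := exists_cutoff (0 : Rn n) (show (5 / 8 : ℝ) < 3 / 4 by norm_num)
  norm_num only at hηl
  obtain ⟨c, hc⟩ : ∃ c : ℝ, c = 1 / 4 * (1 / 4) ^ (p - 1) := ⟨_, rfl⟩
  have hc0 : 0 < c := by rw [hc]; positivity
  obtain ⟨d, hd⟩ : ∃ d : ℝ, d = (5 / 4 : ℝ) ^ (-((n : ℝ) + s * p)) := ⟨_, rfl⟩
  have hd0 : 0 < d := by rw [hd]; positivity
  refine ⟨(c * d)⁻¹ * (C₁ * (C₀ * 2 ^ p * omega n + 2 * 3 ^ (p - 1) * omega n)), by positivity, ?_⟩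
  intro u f hu
  have hum := hu.sup.measurable
  have hSm : MeasurableSet {x : Rn n | ‖x‖ < 5 / 8 ∧ u x ≤ 3 / 2} :=
    (measurableSet_norm_lt _).inter (measurableSet_le hum measurable_const)
  have hTm : MeasurableSet {y : Rn n | ‖y‖ < 5 / 8 ∧ 2 ≤ u y} :=
    (measurableSet_norm_lt _).inter (measurableSet_le measurable_const hum)
  obtain ⟨S, hS⟩ : ∃ S, S = {x : Rn n | ‖x‖ < 5 / 8 ∧ u x ≤ 3 / 2} := ⟨_, rfl⟩
  obtain ⟨T, hT⟩ : ∃ T, T = {y : Rn n | ‖y‖ < 5 / 8 ∧ 2 ≤ u y} := ⟨_, rfl⟩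
  rw [← hS] at hSm ⊢
  rw [← hT] at hTm ⊢
  have hS' : ∀ x, x ∈ S ↔ ‖x‖ < 5 / 8 ∧ u x ≤ 3 / 2 := fun x => by rw [hS]; rfl
  have hT' : ∀ x, x ∈ T ↔ ‖x‖ < 5 / 8 ∧ 2 ≤ u x := fun x => by rw [hT]; rfl
  obtain ⟨g, hg⟩ : ∃ g : Rn n → Rn n → ℝ, g = fun x y =>
    S.indicator (fun _ => T.indicator (fun y => c * u y ^ (p - 1)) y) x := ⟨_, rfl⟩
  have hg0 : ∀ x y, 0 ≤ g x y := by
    intro x y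
    rw [hg]
    refine indicator_nonneg (fun x _ => indicator_nonneg (fun y hy => ?_) _) _
    have := ((hT' y).1 hy).2
    have : 0 ≤ u y ^ (p - 1) := Real.rpow_nonneg (by linarith) _
    positivity
  have hgz : ∀ x y, (x ∉ S ∨ y ∉ T) → g x y = 0 := by
    intro x y h
    rw [hg]
    rcases h with h | h
    · exact indicator_of_notMem h _
    · by_cases hx : x ∈ S
      · beta_reduce
        rw [indicator_of_mem hx]
        exact indicator_of_notMem h _
      · exact indicator_of_notMem hx _
  have hgS : ∀ x ∈ S, ∀ y ∈ T, g x y = c * u y ^ (p - 1) := by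
    intro x hx y hy
    rw [hg]; simp only [indicator_of_mem hx, indicator_of_mem hy]
  have main := hbud u f hu.sup hu.nonneg hu.tail (fun t => max (2 - t) 0) 1 ?_ (fun t => le_max_right _ _)
    η hη ((ball (0 : Rn n) 1).indicator fun _ => C₀ * 2 ^ p) (fun _ _ => 0) g
    (measurable_const.indicator measurableSet_ball) (fun x => indicator_nonneg (fun _ _ => by positivity) _)
    (fun _ _ => le_rfl) hg0 ?_ ?_
  · have h1 := setLIntegral_mul_setLIntegral_le hSm hTm (v := fun y => u y ^ (p - 1))
      (G := fun x y => ENNReal.ofReal (g x y) * J n s p x y) (c := c * d) (by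
        intro x hx y hy
        rw [hgS x hx y hy, ENNReal.ofReal_mul hc0.le, ENNReal.ofReal_mul hc0.le, mul_assoc, mul_assoc,
          mul_comm (ENNReal.ofReal d)]
        gcongr
        rw [hd]
        have h3 := (hS' x).1 hx
        have h4 := (hT' y).1 hy
        apply J_ge_of_le hsp
        · rintro rfl; linarith [h3.2, h4.2]
        · have := norm_sub_le x y
          linarith [h3.1, h4.1])
    have h2 : ∫⁻ x, ENNReal.ofReal ((ball (0 : Rn n) 1).indicator (fun _ => C₀ * 2 ^ p) x) ≤
        ENNReal.ofReal (C₀ * 2 ^ p * omega n) := by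
      calc _ = ∫⁻ x in ball (0 : Rn n) 1, ENNReal.ofReal (C₀ * 2 ^ p) := by
            rw [← lintegral_indicator measurableSet_ball]
            apply lintegral_congr
            intro x
            by_cases hx : x ∈ ball (0 : Rn n) 1
            · rw [indicator_of_mem hx, indicator_of_mem hx]
            · rw [indicator_of_notMem hx, indicator_of_notMem hx, ENNReal.ofReal_zero]
        _ ≤ _ := by
            rw [setLIntegral_const, volume_ball_eq hn 0 zero_le_one,
              ← ENNReal.ofReal_mul (by positivity), one_pow, mul_one]
    have h3 : ∫⁻ x, ENNReal.ofReal (nearWt n p (3 / 4) (fun t => max (2 - t) 0) u x) ≤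
        ENNReal.ofReal (2 * 3 ^ (p - 1) * omega n) := by
      calc _ ≤ ∫⁻ x in ball (0 : Rn n) 1, ENNReal.ofReal (2 * 3 ^ (p - 1)) := by
            rw [← lintegral_indicator measurableSet_ball]
            apply lintegral_mono
            intro x
            dsimp only
            unfold nearWt
            by_cases hx : ‖x‖ < 3 / 4
            · have hx1 : x ∈ ball (0 : Rn n) 1 := by rw [mem_ball_zero_iff]; linarith
              have hux := hu.nonneg x hx1
              rw [indicator_of_mem (by exact hx), indicator_of_mem hx1, abs_of_nonneg hux]
              apply ENNReal.ofReal_le_ofReal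
              rcases le_or_gt (u x) 2 with h | h
              · have : (1 + u x) ^ (p - 1) ≤ 3 ^ (p - 1) :=
                  Real.rpow_le_rpow (by linarith) (by linarith) (by linarith)
                have h5 : max (2 - u x) 0 ≤ 2 := max_le (by linarith) (by norm_num)
                gcongr
              · beta_reduce
                rw [max_eq_right (by linarith), zero_mul]; positivity
            · rw [indicator_of_notMem (by exact hx)]; simp
        _ ≤ _ := by
            rw [setLIntegral_const, volume_ball_eq hn 0 zero_le_one,
              ← ENNReal.ofReal_mul (by positivity), one_pow, mul_one]
    have h4 := h1.trans (le_self_add.trans main)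
    rw [mul_comm, ← ENNReal.le_div_iff_mul_le (Or.inl (by simp; positivity))
      (Or.inl ENNReal.ofReal_ne_top)] at h4
    refine h4.trans ?_
    rw [ENNReal.ofReal_mul (p := (c * d)⁻¹) (by positivity), ENNReal.ofReal_inv_of_pos (by positivity),
      ENNReal.div_eq_inv_mul]
    gcongr
    rw [ENNReal.ofReal_mul hC₁.le, ENNReal.ofReal_add (by positivity) (by positivity)]
    gcongr
    simp only [ENNReal.ofReal_zero, zero_mul, lintegral_zero, zero_add]
    exact h2
  · have h1 : LipschitzWith 1 fun t : ℝ => 2 - t := by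
      apply LipschitzWith.of_dist_le_mul
      intro a b
      rw [dist_sub_left]; simp
    simpa using h1.max_const 0
  · intro x y h
    apply hgz
    rcases h with h | h
    · left; intro hx; linarith [((hS' x).1 hx).1]
    · right; intro hx; linarith [((hT' y).1 hx).1]
  · intro x y hx hy
    have hx1 : x ∈ ball (0 : Rn n) 1 := by simpa using hx
    have hy1 : y ∈ ball (0 : Rn n) 1 := by simpa using hy
    have hux := hu.nonneg x hx1
    have huy := hu.nonneg y hy1
    rw [indicator_of_mem hx1, indicator_of_mem hy1, zero_add]
    have h1 := hdown 2 (u x) (u y) (η x) (η y) (hη.nonneg x) (hη.nonneg y)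
    have h2 : g x y ≤ 1 / 2 * (|u x - u y| ^ (p - 1) *
        |max (2 - u x) 0 - max (2 - u y) 0| * min (η x) (η y) ^ p) := by
      by_cases h : x ∈ S ∧ y ∈ T
      · rw [hgS x h.1 y h.2, hc]
        have h3 := (hS' x).1 h.1
        have h4 := (hT' y).1 h.2
        exact down_pointwise_good hp h3.2 h4.2 (hη1 x (by rw [sub_zero]; exact h3.1.le))
          (hη1 y (by rw [sub_zero]; exact h4.1.le))
      · rw [hgz x y (by tauto)]
        have := hη.nonneg x; have := hη.nonneg y
        positivity
    have h5 : min (max (2 - u x) 0) (max (2 - u y) 0) *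
        max (max (2 - u x) 0) (max (2 - u y) 0) ^ (p - 1) ≤ 2 ^ p := by
      have e1 : max (2 - u x) 0 ≤ 2 := max_le (by linarith) (by norm_num)
      have e2 : max (2 - u y) 0 ≤ 2 := max_le (by linarith) (by norm_num)
      have e3 : (0 : ℝ) ≤ max (2 - u x) 0 := le_max_right _ _
      calc _ ≤ (2 : ℝ) * 2 ^ (p - 1) := by
            gcongr
            · exact (min_le_left _ _).trans e1
            · exact max_le e1 e2
        _ = 2 ^ p := by rw [mul_comm, ← Real.rpow_add_one (by norm_num)]; congr 1; ring
    have h6 := cutoff_le_min_rpow (by linarith : 0 ≤ p) hηl x y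
    have h7 : C₀ * (|η x - η y| ^ p * (min (max (2 - u x) 0) (max (2 - u y) 0) *
        max (max (2 - u x) 0) (max (2 - u y) 0) ^ (p - 1))) ≤
        C₀ * (min 1 (8 * ‖x - y‖) ^ p * 2 ^ p) := by gcongr
    have h8 : 0 ≤ C₀ * (min 1 (8 * ‖x - y‖) ^ p * 2 ^ p) := by positivity
    linarith

end LowMass

section LowMass

variable {n : ℕ} {s p β Q : ℝ}

lemma ae_one_le_of_volume_small (P : Par n s p β Q) {L : ℝ} (hL : 0 < L) :
    ∃ v : ℝ, 0 < v ∧ ∀ u f : Rn n → ℝ, NormSup n s p L u f →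
      volume {x : Rn n | ‖x‖ < 5 / 8 ∧ u x ≤ 3 / 2} ≤ ENNReal.ofReal v →
      ∀ᵐ x, x ∈ ball (0 : Rn n) (1 / 3) → 1 ≤ u x := by
  have hp := P.hp
  obtain ⟨C₂, hC₂, htail⟩ := lintegral_negTail_le (n := n) P.hn P.hs P.hs1 hp
    (show (0 : ℝ) < 5 / 8 by norm_num) (by norm_num)
  obtain ⟨τ, hτ⟩ : ∃ τ : ℝ, τ = (5 / 8 : ℝ) ^ (-(s * p)) * (1 / 2) ^ (p - 1) := ⟨_, rfl⟩
  have hτ0 : 0 < τ := by rw [hτ]; positivity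
  obtain ⟨κ, hκ, hsm⟩ := ae_le_of_small P hL (T := τ⁻¹ * (2 ^ (p - 1) * C₂)) (by positivity)
  refine ⟨(3 ^ Q)⁻¹ * ((5 / 8) ^ n * κ), by positivity, ?_⟩
  intro u f hu hV
  have hum := hu.sup.measurable
  have h58 : (0 : ℝ) < 5 / 8 := by norm_num
  have h12 : (0 : ℝ) < 1 / 2 := by norm_num
  have h1 := ((IsSub.drop hu.sup).mono (z' := 0) (R' := 5 / 8) (by simp; norm_num)).affine h58
    (-(3 / 2)) h12
  simp only [mul_zero] at h1
  have h2 := hsm _ h1 ?_ ?_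
  · rw [← ae_affine 0 h58]
    filter_upwards [h2] with x hx hxb
    rw [zero_add] at hxb hx ⊢
    rw [mem_ball_zero_iff, norm_smul, Real.norm_of_nonneg h58.le] at hxb
    have := hx (by rw [mem_ball_zero_iff]; linarith)
    rw [div_le_one h12] at this
    linarith
  · have h3 := setLIntegral_affine (0 : Rn n) h58 (measurableSet_ball (x := (0 : Rn n)) (ε := 5 / 8))
      (fun y => ENNReal.ofReal (max ((-u y - -(3 / 2)) / (1 / 2)) 0 ^ Q))
    have hset : {x : Rn n | (0 : Rn n) + (5 / 8 : ℝ) • x ∈ ball (0 : Rn n) (5 / 8)} =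
        ball (0 : Rn n) 1 := by
      rw [← affine_ball (z := 0) h58]
    rw [hset] at h3
    have h4 : ∫⁻ y in ball (0 : Rn n) (5 / 8),
        ENNReal.ofReal (max ((-u y - -(3 / 2)) / (1 / 2)) 0 ^ Q) ≤
        ENNReal.ofReal ((5 / 8) ^ n) * ENNReal.ofReal κ := by
      have hVm : MeasurableSet {x : Rn n | ‖x‖ < 5 / 8 ∧ u x ≤ 3 / 2} :=
        (measurableSet_norm_lt _).inter (measurableSet_le hum measurable_const)
      calc _ ≤ ∫⁻ y in {x : Rn n | ‖x‖ < 5 / 8 ∧ u x ≤ 3 / 2}, ENNReal.ofReal (3 ^ Q) := by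
            rw [← lintegral_indicator measurableSet_ball, ← lintegral_indicator hVm]
            apply lintegral_mono
            intro y
            dsimp only
            by_cases hy : ‖y‖ < 5 / 8
            swap
            · rw [indicator_of_notMem (by simpa using hy)]; exact zero_le
            rw [indicator_of_mem (by simpa using hy)]
            have huy := hu.nonneg y (by rw [mem_ball_zero_iff]; linarith)
            by_cases hy2 : u y ≤ 3 / 2
            · rw [indicator_of_mem (by exact ⟨hy, hy2⟩)]
              apply ENNReal.ofReal_le_ofReal
              apply Real.rpow_le_rpow (le_max_right _ _) _ (by linarith [P.hQ1])
              apply max_le _ (by norm_num)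
              rw [div_le_iff₀ h12]; linarith
            · have : max ((-u y - -(3 / 2)) / (1 / 2)) 0 = 0 := by
                apply max_eq_right
                apply div_nonpos_of_nonpos_of_nonneg _ h12.le
                push Not at hy2
                linarith
              rw [this, Real.zero_rpow (by linarith [P.hQ1]), ENNReal.ofReal_zero]
              exact zero_le
        _ ≤ ENNReal.ofReal (3 ^ Q) * ENNReal.ofReal ((3 ^ Q)⁻¹ * ((5 / 8) ^ n * κ)) := by
            rw [setLIntegral_const]; gcongr
        _ = _ := by
            rw [← ENNReal.ofReal_mul (by positivity), ← ENNReal.ofReal_mul (by positivity)]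
            congr 1
            have : (0 : ℝ) < 3 ^ Q := by positivity
            field_simp
    rw [h3, ENNReal.mul_le_mul_iff_right (by simp) ENNReal.ofReal_ne_top] at h4
    exact h4
  · have h3 := lintegral_tail_affine (s := s) (p := p) (fun x => -u x) (0 : Rn n) h58 (-(3 / 2)) h12
    have h4 : ∫⁻ y in (ball (0 : Rn n) (5 / 8))ᶜ,
        ENNReal.ofReal (max (-u y - -(3 / 2)) 0 ^ (p - 1)) * J n s p 0 y ≤
        ENNReal.ofReal τ * ENNReal.ofReal (τ⁻¹ * (2 ^ (p - 1) * C₂)) := by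
      calc _ ≤ ∫⁻ y, ENNReal.ofReal (2 ^ (p - 1)) *
            (ENNReal.ofReal (negTail n p (5 / 8) u y) * J n s p 0 y) := by
            rw [← lintegral_indicator measurableSet_ball.compl]
            apply lintegral_mono
            intro y
            dsimp only
            by_cases hy : ‖y‖ < 5 / 8
            · rw [indicator_of_notMem (by simpa using hy)]; exact zero_le
            have hy' := not_lt.1 hy
            rw [indicator_of_mem (by simpa using hy'), ← mul_assoc,
              ← ENNReal.ofReal_mul (by positivity)]
            unfold negTail
            rw [indicator_of_mem (by exact hy'), ← Real.mul_rpow (by norm_num) (by positivity)]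
            gcongr
            · apply max_le
              · have := le_max_left (-u y) 0
                have := le_max_right (-u y) 0
                linarith
              · positivity
        _ ≤ ENNReal.ofReal (2 ^ (p - 1)) * ENNReal.ofReal C₂ := by
            rw [lintegral_const_mul' _ _ ENNReal.ofReal_ne_top]
            gcongr
            exact htail u hum hu.nonneg hu.tail
        _ = _ := by
            rw [← ENNReal.ofReal_mul (by positivity), ← ENNReal.ofReal_mul hτ0.le,
              mul_inv_cancel_left₀ hτ0.ne']
    rw [h3, ← hτ, ENNReal.mul_le_mul_iff_right (by simpa using hτ0) ENNReal.ofReal_ne_top] at h4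
    exact h4

lemma low_or_mass (P : Par n s p β Q) {L : ℝ} (hL : 0 < L) :
    ∃ C : ℝ, 0 < C ∧ ∀ u f : Rn n → ℝ, NormSup n s p L u f →
      (∀ᵐ x, x ∈ ball (0 : Rn n) (1 / 3) → 1 ≤ u x) ∨
      ∫⁻ x in ball (0 : Rn n) (5 / 8), ENNReal.ofReal ((1 + u x) ^ (p - 1)) ≤ ENNReal.ofReal C := by
  have hp := P.hp
  have hω := omega_pos n
  obtain ⟨C₁, hC₁, hdown⟩ := down_measure (n := n) P.hn P.hs P.hs1 hp hL
  obtain ⟨v, hv, hsm⟩ := ae_one_le_of_volume_small P hL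
  refine ⟨3 ^ (p - 1) * (omega n * (5 / 8) ^ n) + (3 / 2) ^ (p - 1) * (C₁ / v), by positivity, ?_⟩
  intro u f hu
  have hum := hu.sup.measurable
  have hTm : MeasurableSet {y : Rn n | ‖y‖ < 5 / 8 ∧ 2 ≤ u y} :=
    (measurableSet_norm_lt _).inter (measurableSet_le measurable_const hum)
  have hd := hdown u f hu
  rcases le_or_gt (∫⁻ y in {y : Rn n | ‖y‖ < 5 / 8 ∧ 2 ≤ u y}, ENNReal.ofReal (u y ^ (p - 1)))
    (ENNReal.ofReal (C₁ / v)) with h | h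
  · right
    calc _ ≤ ∫⁻ x, ((ball (0 : Rn n) (5 / 8)).indicator (fun _ => ENNReal.ofReal (3 ^ (p - 1))) x +
          ENNReal.ofReal ((3 / 2) ^ (p - 1)) * ({y : Rn n | ‖y‖ < 5 / 8 ∧ 2 ≤ u y}).indicator
            (fun y => ENNReal.ofReal (u y ^ (p - 1))) x) := by
          rw [← lintegral_indicator measurableSet_ball]
          apply lintegral_mono
          intro y
          dsimp only
          by_cases hy : ‖y‖ < 5 / 8
          swap
          · rw [indicator_of_notMem (by simpa using hy)]; exact zero_le
          rw [indicator_of_mem (by simpa using hy), indicator_of_mem (by simpa using hy)]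
          have huy := hu.nonneg y (by rw [mem_ball_zero_iff]; linarith)
          by_cases hy2 : 2 ≤ u y
          · rw [indicator_of_mem (by exact ⟨hy, hy2⟩), ← ENNReal.ofReal_mul (by positivity),
              ← Real.mul_rpow (by norm_num) huy]
            refine le_trans (ENNReal.ofReal_le_ofReal ?_) le_add_self
            exact Real.rpow_le_rpow (by linarith) (by linarith) (by linarith)
          · refine le_trans (ENNReal.ofReal_le_ofReal ?_) le_self_add
            push Not at hy2
            exact Real.rpow_le_rpow (by linarith) (by linarith) (by linarith)
      _ ≤ _ := by
          rw [lintegral_add_left (measurable_const.indicator measurableSet_ball),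
            lintegral_const_mul' _ _ ENNReal.ofReal_ne_top, lintegral_indicator hTm,
            lintegral_indicator measurableSet_ball, setLIntegral_const,
            volume_ball_eq P.hn 0 (by norm_num), ← ENNReal.ofReal_mul (by positivity),
            ENNReal.ofReal_add (by positivity) (by positivity)]
          gcongr
          rw [ENNReal.ofReal_mul (p := (3 / 2) ^ (p - 1)) (by positivity)]
          gcongr
  · left
    apply hsm u f hu
    by_contra! hV
    have h1 := (ENNReal.mul_lt_mul hV h).trans_le hd
    rw [← ENNReal.ofReal_mul hv.le, mul_div_cancel₀ _ hv.ne'] at h1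
    exact lt_irrefl _ h1

end LowMass

section PowerMass

variable {n : ℕ} {s p β Q : ℝ}

lemma one_add_max_rpow_le {a b : ℝ} (ha : 0 ≤ a) (hb : 0 ≤ b) (r : ℝ) :
    (1 + max a b) ^ r ≤ (1 + a) ^ r + (1 + b) ^ r := by
  have h1 : 0 ≤ (1 + a) ^ r := by positivity
  have h2 : 0 ≤ (1 + b) ^ r := by positivity
  rcases max_choice a b with h | h <;> rw [h] <;> linarith

/-- The weighted energy density of `u` in the ball of radius `r`. -/
def locEnergy (n : ℕ) (p β r : ℝ) (u : Rn n → ℝ) (x y : Rn n) : ℝ :=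
  if ‖x‖ < r ∧ ‖y‖ < r then |u x - u y| ^ p * (1 + max (u x) (u y)) ^ (-β) else 0

lemma locEnergy_nonneg {u : Rn n → ℝ} {r : ℝ} (hr : r ≤ 1) (hu : ∀ x ∈ ball (0 : Rn n) 1, 0 ≤ u x)
    (x y : Rn n) : 0 ≤ locEnergy n p β r u x y := by
  unfold locEnergy
  split_ifs with h
  · have := hu x (by rw [mem_ball_zero_iff]; linarith [h.1])
    positivity
  · exact le_rfl

lemma power_energy (P : Par n s p β Q) {L : ℝ} (hL : 0 < L) :
    ∃ C : ℝ, 0 < C ∧ ∀ u f : Rn n → ℝ, NormSup n s p L u f → ∀ η : Rn n → ℝ,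
      Cutoff 0 (9 / 16) η → (∀ x y, |η x - η y| ≤ min 1 (16 * ‖x - y‖)) →
      ∫⁻ x, ∫⁻ y, ENNReal.ofReal (locEnergy n p β (5 / 8) u x y * min (η x) (η y) ^ p) *
        J n s p x y ≤
      ENNReal.ofReal C * ∫⁻ x in ball (0 : Rn n) (5 / 8), ENNReal.ofReal ((1 + u x) ^ (p - 1)) := by
  have hp := P.hp
  have hβ := P.hβ
  have hβ' : 0 < β - 1 := by linarith
  obtain ⟨C₀, hC₀, hpow⟩ := pointwise_power P.hβ P.hβp
  obtain ⟨C₁, hC₁, hbud⟩ := sup_budget (n := n) P.hn P.hs P.hs1 hp (L := L) (l := 16) (ρ := 9 / 16)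
    (r := 5 / 8) hL (by norm_num) (by norm_num) (by norm_num) (by norm_num)
  refine ⟨((β - 1) / 2)⁻¹ * (C₁ * (C₀ + 1)), by positivity, ?_⟩
  intro u f hu η hη hηl
  have hum := hu.sup.measurable
  obtain ⟨k, hk⟩ : ∃ k : Rn n → ℝ, k = (ball (0 : Rn n) (5 / 8)).indicator
    fun x => (1 + u x) ^ (p - 1) := ⟨_, rfl⟩
  have hkm : Measurable k := by
    rw [hk]
    exact Measurable.indicator (by fun_prop) measurableSet_ball
  have hub : ∀ x : Rn n, ‖x‖ < 5 / 8 → 0 ≤ u x := fun x hx =>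
    hu.nonneg x (by rw [mem_ball_zero_iff]; linarith)
  have hk0 : ∀ x, 0 ≤ k x := by
    intro x
    rw [hk]
    apply indicator_nonneg
    intro x hx
    have := hub x (by simpa using hx)
    positivity
  have hk1 : ∀ x : Rn n, ‖x‖ < 5 / 8 → k x = (1 + u x) ^ (p - 1) := by
    intro x hx
    rw [hk]
    exact indicator_of_mem (by simpa using hx) _
  have hkint : ∫⁻ x, ENNReal.ofReal (k x) =
      ∫⁻ x in ball (0 : Rn n) (5 / 8), ENNReal.ofReal ((1 + u x) ^ (p - 1)) := by
    rw [← lintegral_indicator measurableSet_ball]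
    apply lintegral_congr
    intro x
    rw [hk]
    by_cases hx : x ∈ ball (0 : Rn n) (5 / 8)
    · rw [indicator_of_mem hx, indicator_of_mem hx]
    · rw [indicator_of_notMem hx, indicator_of_notMem hx, ENNReal.ofReal_zero]
  have main := hbud u f hu.sup hu.nonneg hu.tail (fun t => (1 + max t 0) ^ (1 - β)) _
    (one_add_rpow_lipschitz hβ) (fun t => by positivity) η hη (fun x => C₀ * k x) (fun _ _ => 0)
    (fun x y => (β - 1) / 2 * (locEnergy n p β (5 / 8) u x y * min (η x) (η y) ^ p))
    (by fun_prop) (fun x => mul_nonneg hC₀.le (hk0 x)) (fun _ _ => le_rfl)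
    (fun x y => by
      have := locEnergy_nonneg (p := p) (β := β) (by norm_num : (5 / 8 : ℝ) ≤ 1) hu.nonneg x y
      have h1 := hη.nonneg x
      have h2 := hη.nonneg y
      positivity) ?_ ?_
  · have h3 : ∫⁻ x, ENNReal.ofReal (nearWt n p (9 / 16) (fun t => (1 + max t 0) ^ (1 - β)) u x) ≤
        ∫⁻ x, ENNReal.ofReal (k x) := by
      apply lintegral_mono
      intro x
      apply ENNReal.ofReal_le_ofReal
      unfold nearWt
      by_cases hx : ‖x‖ < 9 / 16
      · have hux := hub x (by linarith)
        rw [indicator_of_mem (by exact hx), hk1 x (by linarith), abs_of_nonneg hux]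
        have h4 : (1 + max (u x) 0) ^ (1 - β) ≤ 1 :=
          Real.rpow_le_one_of_one_le_of_nonpos (by linarith [le_max_right (u x) 0]) (by linarith)
        have h5 : 0 ≤ (1 + u x) ^ (p - 1) := by positivity
        exact mul_le_of_le_one_left h5 h4
      · rw [indicator_of_notMem (by exact hx)]
        exact hk0 x
    have h4 := le_self_add.trans main
    simp only [ENNReal.ofReal_zero, zero_mul, lintegral_zero, zero_add,
      ENNReal.ofReal_mul hC₀.le, ENNReal.ofReal_mul (p := (β - 1) / 2) (by positivity : 0 ≤ (β - 1) / 2),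
      mul_assoc, lintegral_const_mul' _ _ ENNReal.ofReal_ne_top] at h4
    rw [← ENNReal.mul_le_mul_iff_right (a := ENNReal.ofReal ((β - 1) / 2)) (by simp; linarith)
      ENNReal.ofReal_ne_top]
    refine h4.trans ?_
    rw [← hkint, ← mul_assoc, ← ENNReal.ofReal_mul (by positivity),
      mul_inv_cancel_left₀ (by positivity), ENNReal.ofReal_mul hC₁.le, mul_assoc,
      ENNReal.ofReal_add hC₀.le zero_le_one, add_mul, ENNReal.ofReal_one, one_mul]
    gcongr
  · intro x y h
    unfold locEnergy
    rw [if_neg (by rintro ⟨h1, h2⟩; rcases h with h | h <;> linarith)]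
    simp
  · intro x y hx hy
    have hux := hub x hx
    have huy := hub y hy
    have h1 := hpow (u x) (u y) (η x) (η y) hux huy (hη.nonneg x) (hη.nonneg y)
    rw [max_eq_left hux, max_eq_left huy, zero_add]
    refine h1.trans ?_
    unfold locEnergy
    rw [if_pos ⟨hx, hy⟩]
    refine sub_le_sub_right ?_ _
    have h2 := cutoff_le_min_rpow (by linarith : 0 ≤ p) hηl x y
    have hm : 0 ≤ max (u x) (u y) := hux.trans (le_max_left _ _)
    have h3 : (1 + max (u x) (u y)) ^ (p - β) ≤ k x + k y := by
      rw [hk1 x hx, hk1 y hy]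
      refine le_trans ?_ (one_add_max_rpow_le hux huy _)
      exact Real.rpow_le_rpow_of_exponent_le (by linarith) (by linarith)
    have h4 : 0 ≤ min 1 (16 * ‖x - y‖) := by positivity
    calc _ ≤ C₀ * (min 1 (16 * ‖x - y‖) ^ p * (k x + k y)) := by gcongr
      _ = _ := by ring

lemma power_mass (P : Par n s p β Q) {L B : ℝ} (hL : 0 < L) (hB : 0 < B) :
    ∃ C : ℝ, 0 < C ∧ ∀ u f : Rn n → ℝ, NormSup n s p L u f →
      ∫⁻ x in ball (0 : Rn n) (5 / 8), ENNReal.ofReal ((1 + u x) ^ (p - 1)) ≤ ENNReal.ofReal B →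
      ∫⁻ x, ∫⁻ y, ENNReal.ofReal (locEnergy n p β (1 / 2) u x y) * J n s p x y ≤ ENNReal.ofReal C ∧
      ∫⁻ x in ball (0 : Rn n) (1 / 2), ENNReal.ofReal ((1 + u x) ^ Q) ≤ ENNReal.ofReal C := by
  have hp := P.hp
  have hβ := P.hβ
  have hβp := P.hβp
  have hω := omega_pos n
  have hQ0 : 0 < Q := by linarith [P.hQ1]
  obtain ⟨C₁, hC₁, hen⟩ := power_energy P hL
  obtain ⟨η, hη, hη1, hηl⟩ := exists_cutoff (0 : Rn n) (show (1 / 2 : ℝ) < 9 / 16 by norm_num)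
  norm_num only at hηl
  obtain ⟨C₂, hC₂, hcut⟩ := exists_cutoff_energy P (q := p - 1) (by linarith) (l := 16) (by norm_num)
  obtain ⟨C₃, hC₃, hpow⟩ := exists_power_of_energy P
  obtain ⟨D, hD⟩ : ∃ D : ℝ, D = C₃ * (C₂ * (C₁ * B + B)) ^ ((n : ℝ) / (n - s * p)) := ⟨_, rfl⟩
  have hD0 : 0 ≤ D := by rw [hD]; positivity
  refine ⟨C₁ * B + (2 ^ Q * (omega n * (1 / 2) ^ n) + 2 ^ Q * D), by positivity, ?_⟩
  intro u f hu hmass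
  have hum := hu.sup.measurable
  have hub : ∀ x : Rn n, ‖x‖ < 5 / 8 → 0 ≤ u x := fun x hx =>
    hu.nonneg x (by rw [mem_ball_zero_iff]; linarith)
  have hE : ∫⁻ x, ∫⁻ y, ENNReal.ofReal (locEnergy n p β (5 / 8) u x y * min (η x) (η y) ^ p) *
        J n s p x y ≤ ENNReal.ofReal (C₁ * B) := by
    refine (hen u f hu η hη hηl).trans ?_
    rw [ENNReal.ofReal_mul hC₁.le]
    gcongr
  constructor
  · refine le_trans ?_ (hE.trans (ENNReal.ofReal_le_ofReal (le_add_of_nonneg_right (by positivity))))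
    apply lintegral_mono
    intro x
    apply lintegral_mono
    intro y
    refine mul_le_mul_left (ENNReal.ofReal_le_ofReal ?_) _
    unfold locEnergy
    split_ifs with h1 h2 h2
    · rw [hη1 x (by rw [sub_zero]; exact h1.1.le), hη1 y (by rw [sub_zero]; exact h1.2.le)]
      simp
    · exact absurd ⟨by linarith [h1.1], by linarith [h1.2]⟩ h2
    · have := hub x h2.1
      have h1 := hη.nonneg x
      have h2 := hη.nonneg y
      positivity
    · simp
  · obtain ⟨U, hU⟩ : ∃ U : Rn n → ℝ, U = (ball (0 : Rn n) (5 / 8)).indicator u := ⟨_, rfl⟩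
    have hUm : Measurable U := by rw [hU]; exact hum.indicator measurableSet_ball
    have hU1 : ∀ x : Rn n, ‖x‖ < 5 / 8 → U x = u x := by
      intro x hx; rw [hU]; exact indicator_of_mem (by simpa using hx) _
    have hU2 : ∀ x : Rn n, ¬‖x‖ < 5 / 8 → U x = 0 := by
      intro x hx; rw [hU]; exact indicator_of_notMem (by simpa using hx) _
    have h1 : ∫⁻ x, ∫⁻ y, ENNReal.ofReal
          (|(1 + max (U x) 0) ^ ((p - β) / p) - (1 + max (U y) 0) ^ ((p - β) / p)| ^ p *
            min (η x) (η y) ^ p) * J n s p x y ≤ ENNReal.ofReal (C₁ * B) := by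
      refine le_trans ?_ hE
      apply lintegral_mono
      intro x
      apply lintegral_mono
      intro y
      refine mul_le_mul_left (ENNReal.ofReal_le_ofReal ?_) _
      have e1 := hη.nonneg x
      have e2 := hη.nonneg y
      unfold locEnergy
      split_ifs with h
      · have hux := hub x h.1
        have huy := hub y h.2
        rw [hU1 x h.1, hU1 y h.2, max_eq_left hux, max_eq_left huy]
        gcongr
        rcases le_total (u y) (u x) with h3 | h3
        · rw [max_eq_left h3, abs_of_nonneg (sub_nonneg.2 h3)]
          exact sub_rpow_abs_le hβ hβp huy h3
        · rw [max_eq_right h3, abs_sub_comm, abs_sub_comm (u x), abs_of_nonneg (sub_nonneg.2 h3)]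
          exact sub_rpow_abs_le hβ hβp hux h3
      · have : min (η x) (η y) = 0 := by
          rw [not_and_or, not_lt, not_lt] at h
          rcases h with h | h
          · rw [hη.zero x (by rw [sub_zero]; linarith), min_eq_left e2]
          · rw [hη.zero y (by rw [sub_zero]; linarith), min_eq_right e1]
        rw [this, Real.zero_rpow (by linarith), mul_zero, mul_zero]
    have h2 : ∫⁻ x, ENNReal.ofReal (posPow n (p - 1) U x) ≤ ENNReal.ofReal B := by
      refine le_trans ?_ hmass
      rw [← lintegral_indicator measurableSet_ball]
      apply lintegral_mono
      intro x
      dsimp only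
      unfold posPow
      by_cases hx : ‖x‖ < 5 / 8
      · rw [indicator_of_mem (s := ball (0 : Rn n) (5 / 8)) (by simpa using hx)]
        apply ENNReal.ofReal_le_ofReal
        have := hub x hx
        rw [← hU1 x hx] at this ⊢
        rw [indicator_apply]
        split_ifs
        · exact le_rfl
        · positivity
      · rw [indicator_of_notMem (by rintro ⟨-, h⟩; rw [hU2 x hx] at h; exact lt_irrefl _ h)]
        simp
    have h3 := hcut U η (9 / 16) hUm (by norm_num) hη hηl
    have h4 := hpow U η (9 / 16) (C₂ * (C₁ * B + B)) hUm (by norm_num) hη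
      (fun x hx => hη1 x (by rwa [sub_zero])) (by positivity) (h3.trans (by
        rw [ENNReal.ofReal_mul hC₂.le, ENNReal.ofReal_add (by positivity) hB.le]
        gcongr))
    rw [← hD] at h4
    have hTm : MeasurableSet {x : Rn n | ‖x‖ < 1 / 2 ∧ 1 ≤ U x} :=
      (measurableSet_norm_lt _).inter (measurableSet_le measurable_const hUm)
    calc _ ≤ ∫⁻ x, ((ball (0 : Rn n) (1 / 2)).indicator (fun _ => ENNReal.ofReal (2 ^ Q)) x +
          ENNReal.ofReal (2 ^ Q) * ({x : Rn n | ‖x‖ < 1 / 2 ∧ 1 ≤ U x}).indicator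
            (fun x => ENNReal.ofReal (U x ^ Q)) x) := by
          rw [← lintegral_indicator measurableSet_ball]
          apply lintegral_mono
          intro x
          dsimp only
          by_cases hx : ‖x‖ < 1 / 2
          swap
          · rw [indicator_of_notMem (by simpa using hx)]; exact zero_le
          rw [indicator_of_mem (by simpa using hx), indicator_of_mem (by simpa using hx)]
          have hux := hub x (by linarith)
          rw [← hU1 x (by linarith)] at hux ⊢
          by_cases hx2 : 1 ≤ U x
          · rw [indicator_of_mem (by exact ⟨hx, hx2⟩), ← ENNReal.ofReal_mul (by positivity),
              ← Real.mul_rpow (by norm_num) hux]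
            refine le_trans (ENNReal.ofReal_le_ofReal ?_) le_add_self
            exact Real.rpow_le_rpow (by linarith) (by linarith) hQ0.le
          · refine le_trans (ENNReal.ofReal_le_ofReal ?_) le_self_add
            push Not at hx2
            exact Real.rpow_le_rpow (by linarith) (by linarith) hQ0.le
      _ ≤ ENNReal.ofReal (2 ^ Q * (omega n * (1 / 2) ^ n) + 2 ^ Q * D) := by
          rw [lintegral_add_left (measurable_const.indicator measurableSet_ball),
            lintegral_const_mul' _ _ ENNReal.ofReal_ne_top, lintegral_indicator hTm,
            lintegral_indicator measurableSet_ball, setLIntegral_const,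
            volume_ball_eq P.hn 0 (by norm_num), ← ENNReal.ofReal_mul (by positivity),
            ENNReal.ofReal_add (by positivity) (by positivity)]
          gcongr
          rw [ENNReal.ofReal_mul (p := 2 ^ Q) (by positivity)]
          gcongr
      _ ≤ _ := ENNReal.ofReal_le_ofReal (by
          have : 0 < C₁ * B := by positivity
          linarith)

lemma data_mass (P : Par n s p β Q) {L B : ℝ} (hL : 0 < L) (hB : 0 < B) :
    ∃ C : ℝ, 0 < C ∧ ∀ u f : Rn n → ℝ, NormSup n s p L u f →
      ∫⁻ x, ∫⁻ y, ENNReal.ofReal (locEnergy n p β (1 / 2) u x y) * J n s p x y ≤ ENNReal.ofReal B →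
      ∫⁻ x in ball (0 : Rn n) (1 / 2), ENNReal.ofReal ((1 + u x) ^ Q) ≤ ENNReal.ofReal B →
      ∫⁻ x in ball (0 : Rn n) (3 / 8), ENNReal.ofReal (f x) ≤ ENNReal.ofReal C := by
  have hp := P.hp
  obtain ⟨C₀, hC₀, hmass⟩ := pointwise_mass P.hβ P.hβp
  obtain ⟨C₁, hC₁, hbud⟩ := sup_budget (n := n) P.hn P.hs P.hs1 hp (L := L) (l := 16) (ρ := 7 / 16)
    (r := 1 / 2) hL (by norm_num) (by norm_num) (by norm_num) (by norm_num)
  obtain ⟨η, hη, hη1, hηl⟩ := exists_cutoff (0 : Rn n) (show (3 / 8 : ℝ) < 7 / 16 by norm_num)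
  norm_num only at hηl
  refine ⟨C₁ * (B + C₀ * B + B), by positivity, ?_⟩
  intro u f hu hE hM
  have hum := hu.sup.measurable
  obtain ⟨k, hk⟩ : ∃ k : Rn n → ℝ, k = (ball (0 : Rn n) (1 / 2)).indicator
    fun x => (1 + u x) ^ Q := ⟨_, rfl⟩
  have hkm : Measurable k := by
    rw [hk]
    exact Measurable.indicator (by fun_prop) measurableSet_ball
  have hub : ∀ x : Rn n, ‖x‖ < 1 / 2 → 0 ≤ u x := fun x hx =>
    hu.nonneg x (by rw [mem_ball_zero_iff]; linarith)
  have hk0 : ∀ x, 0 ≤ k x := by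
    intro x
    rw [hk]
    apply indicator_nonneg
    intro x hx
    have := hub x (by simpa using hx)
    positivity
  have hk1 : ∀ x : Rn n, ‖x‖ < 1 / 2 → k x = (1 + u x) ^ Q := by
    intro x hx
    rw [hk]
    exact indicator_of_mem (by simpa using hx) _
  have hkint : ∫⁻ x, ENNReal.ofReal (k x) ≤ ENNReal.ofReal B := by
    refine le_trans (le_of_eq ?_) hM
    rw [← lintegral_indicator measurableSet_ball]
    apply lintegral_congr
    intro x
    rw [hk]
    by_cases hx : x ∈ ball (0 : Rn n) (1 / 2)
    · rw [indicator_of_mem hx, indicator_of_mem hx]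
    · rw [indicator_of_notMem hx, indicator_of_notMem hx, ENNReal.ofReal_zero]
  have main := hbud u f hu.sup hu.nonneg hu.tail (fun _ => 1) 0 (LipschitzWith.const 1)
    (fun _ => zero_le_one) η hη (fun x => C₀ * k x) (locEnergy n p β (1 / 2) u) (fun _ _ => 0)
    (by fun_prop) (fun x => mul_nonneg hC₀.le (hk0 x))
    (locEnergy_nonneg (by norm_num) hu.nonneg) (fun _ _ => le_rfl) (fun _ _ _ => rfl) ?_
  · have h1 : ∫⁻ x in ball (0 : Rn n) (3 / 8), ENNReal.ofReal (f x) ≤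
        ∫⁻ x, ENNReal.ofReal (f x * (1 * η x ^ p)) := by
      rw [← lintegral_indicator measurableSet_ball]
      apply lintegral_mono
      intro x
      dsimp only
      by_cases hx : x ∈ ball (0 : Rn n) (3 / 8)
      · rw [indicator_of_mem hx, hη1 x (by rw [sub_zero]; exact (mem_ball_zero_iff.1 hx).le)]
        simp
      · rw [indicator_of_notMem hx]; exact zero_le
    have h3 : ∫⁻ x, ENNReal.ofReal (nearWt n p (7 / 16) (fun _ => 1) u x) ≤ ENNReal.ofReal B := by
      refine le_trans (lintegral_mono fun x => ENNReal.ofReal_le_ofReal ?_) hkint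
      unfold nearWt
      by_cases hx : ‖x‖ < 7 / 16
      · have hux := hub x (by linarith)
        rw [indicator_of_mem (by exact hx), hk1 x (by linarith), abs_of_nonneg hux, one_mul]
        exact Real.rpow_le_rpow_of_exponent_le (by linarith) P.hQp
      · rw [indicator_of_notMem (by exact hx)]
        exact hk0 x
    refine h1.trans ((le_add_self.trans main).trans ?_)
    simp only [ENNReal.ofReal_mul hC₀.le, lintegral_const_mul' _ _ ENNReal.ofReal_ne_top]
    rw [ENNReal.ofReal_mul hC₁.le, ENNReal.ofReal_add (by positivity) hB.le,
      ENNReal.ofReal_add hB.le (by positivity), ENNReal.ofReal_mul hC₀.le]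
    gcongr
  · intro x y hx hy
    have hux := hub x hx
    have huy := hub y hy
    have h1 := hmass (u x) (u y) (η x) (η y) hux huy (hη.nonneg x) (hη.nonneg y)
    rw [one_mul, one_mul, sub_zero]
    refine h1.trans ?_
    unfold locEnergy
    rw [if_pos ⟨hx, hy⟩]
    have hm : 0 ≤ max (u x) (u y) := hux.trans (le_max_left _ _)
    apply add_le_add
    · have e1 : min (η x) (η y) ^ p ≤ 1 := Real.rpow_le_one (le_min (hη.nonneg x) (hη.nonneg y))
        ((min_le_left _ _).trans (hη.le_one x)) (by linarith)
      exact mul_le_of_le_one_right (by positivity) e1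
    · have h2 := cutoff_le_min_rpow (by linarith : 0 ≤ p) hηl x y
      have h3 : (1 + max (u x) (u y)) ^ (β * (p - 1)) ≤ k x + k y := by
        rw [hk1 x hx, hk1 y hy]
        refine le_trans ?_ (one_add_max_rpow_le hux huy _)
        exact Real.rpow_le_rpow_of_exponent_le (by linarith) P.hQβ
      have h4 : 0 ≤ min 1 (16 * ‖x - y‖) := by positivity
      calc _ ≤ C₀ * (min 1 (16 * ‖x - y‖) ^ p * (k x + k y)) := by gcongr
        _ = _ := by ring

/-- Either a nonnegative supersolution is large, or its average and its datum are controlled. -/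
lemma low_unit (P : Par n s p β Q) {L : ℝ} (hL : 0 < L) :
    ∃ C : ℝ, 0 < C ∧ ∀ u f : Rn n → ℝ, NormSup n s p L u f →
      (∀ᵐ x, x ∈ ball (0 : Rn n) (1 / 3) → 1 ≤ u x) ∨
      (∫⁻ x in ball (0 : Rn n) (1 / 2), ENNReal.ofReal (u x) ≤ ENNReal.ofReal C ∧
        ∫⁻ x in ball (0 : Rn n) (3 / 8), ENNReal.ofReal (f x) ≤ ENNReal.ofReal C) := by
  obtain ⟨C₁, hC₁, h1⟩ := low_or_mass P hL
  obtain ⟨C₂, hC₂, h2⟩ := power_mass P hL hC₁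
  obtain ⟨C₃, hC₃, h3⟩ := data_mass P hL hC₂
  refine ⟨C₂ + C₃, by positivity, fun u f hu => (h1 u f hu).imp_right fun h => ?_⟩
  obtain ⟨h4, h5⟩ := h2 u f hu h
  refine ⟨?_, (h3 u f hu h4 h5).trans (ENNReal.ofReal_le_ofReal (by linarith))⟩
  refine le_trans (setLIntegral_mono' measurableSet_ball fun x hx => ?_)
    (h5.trans (ENNReal.ofReal_le_ofReal (by linarith)))
  have hux := hu.nonneg x (ball_subset_ball (by norm_num) hx)
  apply ENNReal.ofReal_le_ofReal
  calc u x ≤ (1 + u x) ^ (1 : ℝ) := by rw [Real.rpow_one]; linarith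
    _ ≤ _ := Real.rpow_le_rpow_of_exponent_le (by linarith) P.hQ1

end PowerMass

section Mollify

variable {n : ℕ} {X : Type*} [NormedAddCommGroup X] [NormedSpace ℝ X]
  [MeasurableSpace X] [BorelSpace X] [LocallyCompactSpace X]
  {ν : Measure X} [ν.IsAddHaarMeasure] [ν.InnerRegularCompactLTTop]
  {a b : ℝ} {G H : X → ℝ}

/-- Correlation of two functions along a subgroup of translations is continuous. -/
lemma continuous_pairing_shift (hab : a.HolderConjugate b) (ι : Rn n →L[ℝ] X)
    (hG : MemLp G (ENNReal.ofReal a) ν) (hH : MemLp H (ENNReal.ofReal b) ν) :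
    Continuous fun h : Rn n => ∫ z, G z * H (z + ι h) ∂ν := by
  have : ENNReal.HolderConjugate (ENNReal.ofReal a) (ENNReal.ofReal b) := hab.ennrealOfReal
  have : Fact (1 ≤ ENNReal.ofReal a) := ⟨by simpa using hab.lt.le⟩
  have : Fact (1 ≤ ENNReal.ofReal b) := ⟨by simpa using hab.symm.lt.le⟩
  let T : C(Rn n, C(X, X)) := ContinuousMap.curry ⟨fun z => z.2 + ι z.1, by fun_prop⟩
  have hT : ∀ h, MeasurePreserving (T h) ν ν := fun h => measurePreserving_add_right ν (ι h)
  have h1 := (continuous_const (y := hH.toLp H)).compMeasurePreservingLp T.continuous hT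
    ENNReal.ofReal_ne_top
  have h2 := ((ContinuousLinearMap.mul ℝ ℝ).lpPairing ν (ENNReal.ofReal a) (ENNReal.ofReal b)
    (hG.toLp G)).continuous.comp h1
  convert h2 using 2 with h
  rw [Function.comp_apply, ContinuousLinearMap.lpPairing_eq_integral]
  apply integral_congr_ae
  filter_upwards [hG.coeFn_toLp, Lp.coeFn_compMeasurePreserving (hH.toLp H) (hT h),
    (hT h).quasiMeasurePreserving.ae hH.coeFn_toLp] with z h1 h2 h3
  rw [h1, h2, Function.comp_apply, h3]
  rfl

variable [SecondCountableTopology X] [SigmaFinite ν]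

lemma integral_pairing_shift (hab : a.HolderConjugate b) (ι : Rn n →L[ℝ] X)
    (hG : MemLp G (ENNReal.ofReal a) ν) (hH : MemLp H (ENNReal.ofReal b) ν) {ρ : Rn n → ℝ}
    (hGm : Measurable G) (hHm : Measurable H) (hρ : Continuous ρ) (hρc : HasCompactSupport ρ) :
    Integrable (fun z => G z * (∫ t, ρ t * H (z - ι t))) ν ∧
    ∫ t, ρ t * (∫ z, G z * H (z - ι t) ∂ν) = ∫ z, G z * (∫ t, ρ t * H (z - ι t)) ∂ν := by
  have : ENNReal.HolderConjugate (ENNReal.ofReal a) (ENNReal.ofReal b) := hab.ennrealOfReal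
  have hsh : ∀ t, MemLp (fun z => H (z - ι t)) (ENNReal.ofReal b) ν := fun t =>
    hH.comp_measurePreserving (measurePreserving_sub_right ν (ι t))
  have hc := (continuous_pairing_shift hab ι hG.norm hH.norm).comp continuous_neg
  have h_int : Integrable (Function.uncurry fun (t : Rn n) (z : X) => ρ t * (G z * H (z - ι t)))
      (volume.prod ν) := by
    rw [integrable_prod_iff (Measurable.aestronglyMeasurable (by
      unfold Function.uncurry; fun_prop))]
    refine ⟨Eventually.of_forall fun t =>
      (show Integrable (fun z => G z * H (z - ι t)) ν from hG.integrable_mul (hsh t)).const_mul (ρ t), ?_⟩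
    have : (fun t => ∫ z, ‖Function.uncurry (fun (t : Rn n) (z : X) =>
        ρ t * (G z * H (z - ι t))) (t, z)‖ ∂ν) =
        fun t => ‖ρ t‖ * ((fun h : Rn n => ∫ z, ‖G z‖ * ‖H (z + ι h)‖ ∂ν) ∘ fun x => -x) t := by
      ext t
      simp only [Function.uncurry, norm_mul, Function.comp_apply, map_neg, ← sub_eq_add_neg]
      rw [integral_const_mul]
    rw [this]
    exact (hρ.norm.mul hc).integrable_of_hasCompactSupport hρc.norm.mul_right
  have he : ∀ z, ∫ t, ρ t * (G z * H (z - ι t)) = G z * (∫ t, ρ t * H (z - ι t)) := by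
    intro z
    rw [← integral_const_mul]
    exact integral_congr_ae (Eventually.of_forall fun t => by ring)
  constructor
  · refine h_int.integral_prod_right.congr (Eventually.of_forall fun z => ?_)
    exact he z
  · calc ∫ t, ρ t * (∫ z, G z * H (z - ι t) ∂ν)
        = ∫ t, ∫ z, ρ t * (G z * H (z - ι t)) ∂ν := by simp_rw [integral_const_mul]
      _ = ∫ z, (∫ t, ρ t * (G z * H (z - ι t))) ∂ν := integral_integral_swap h_int
      _ = _ := integral_congr_ae (Eventually.of_forall he)

/-- The weak formulation extends from smooth test functions to compactly supported functions of
finite energy. -/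
lemma weak_extend {s p C ρ R : ℝ} (hp : 1 < p) (hnsp : 0 < (n : ℝ) + s * p) {z₀ : Rn n}
    (hρ : ρ < R)
    {Ψ : Rn n × Rn n → ℝ} {v φ f : Rn n → ℝ} (hΨm : Measurable Ψ)
    (hΨ : ∀ z, z.1 ≠ z.2 →
      |Ψ z| ≤ C * (|v z.1 - v z.2| ^ (p - 1) * ‖z.1 - z.2‖ ^ (-((n : ℝ) + s * p))))
    (hφ : Measurable φ)
    (hvE : ∫⁻ z : Rn n × Rn n, ENNReal.ofReal
      (|v z.1 - v z.2| ^ p * ‖z.1 - z.2‖ ^ (-((n : ℝ) + s * p))) < ⊤)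
    (hφE : ∫⁻ z : Rn n × Rn n, ENNReal.ofReal
      (|φ z.1 - φ z.2| ^ p * ‖z.1 - z.2‖ ^ (-((n : ℝ) + s * p))) < ⊤)
    (hφp : ∫⁻ x, ENNReal.ofReal (|φ x| ^ p) < ⊤)
    (hφ0 : ∀ x, ρ ≤ ‖x - z₀‖ → φ x = 0)
    (hf : Continuous f) (hfc : HasCompactSupport f)
    (htest : ∀ ψ, IsTestFun n (ball z₀ R) ψ →
      ∫ x, ∫ y, Ψ (x, y) * (ψ x - ψ y) = ∫ x, ψ x * f x) :
    Integrable (fun z : Rn n × Rn n => Ψ z * (φ z.1 - φ z.2)) ∧ Integrable (fun x => φ x * f x) ∧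
      ∫ z : Rn n × Rn n, Ψ z * (φ z.1 - φ z.2) = ∫ x, φ x * f x := by
  have hp0 : 0 < p := by linarith
  obtain ⟨e, he⟩ : ∃ e, e = ((n : ℝ) + s * p) / p := ⟨_, rfl⟩
  have he0 : 0 < e := by rw [he]; positivity
  have hep : e * p = (n : ℝ) + s * p := by rw [he]; field_simp
  have hconj : (Real.conjExponent p).HolderConjugate p :=
    (Real.HolderConjugate.conjExponent hp).symm
  obtain ⟨G, hG⟩ : ∃ G : Rn n × Rn n → ℝ, G = fun z => Ψ z * ‖z.1 - z.2‖ ^ e := ⟨_, rfl⟩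
  obtain ⟨H, hH⟩ : ∃ H : Rn n × Rn n → ℝ,
    H = fun z => (φ z.1 - φ z.2) * ‖z.1 - z.2‖ ^ (-e) := ⟨_, rfl⟩
  have hGm : Measurable G := by rw [hG]; fun_prop
  have hHm : Measurable H := by rw [hH]; fun_prop
  have hHL : MemLp H (ENNReal.ofReal p) := by
    refine ⟨hHm.aestronglyMeasurable, ?_⟩
    rw [eLpNorm_lt_top_iff_lintegral_rpow_enorm_lt_top (by simpa using hp0) ENNReal.ofReal_ne_top]
    refine lt_of_le_of_lt (lintegral_mono fun z => ?_) hφE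
    rw [ENNReal.toReal_ofReal hp0.le, Real.enorm_eq_ofReal_abs,
      ENNReal.ofReal_rpow_of_nonneg (abs_nonneg _) hp0.le]
    apply ENNReal.ofReal_le_ofReal
    rw [hH, abs_mul, abs_of_nonneg (Real.rpow_nonneg (norm_nonneg _) _),
      Real.mul_rpow (abs_nonneg _) (Real.rpow_nonneg (norm_nonneg _) _),
      ← Real.rpow_mul (norm_nonneg _), neg_mul, hep]
  have hGL : MemLp G (ENNReal.ofReal (Real.conjExponent p)) := by
    have hq : 0 < Real.conjExponent p := hconj.pos
    refine ⟨hGm.aestronglyMeasurable, ?_⟩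
    rw [eLpNorm_lt_top_iff_lintegral_rpow_enorm_lt_top (by simpa using hq) ENNReal.ofReal_ne_top]
    refine lt_of_le_of_lt (b := ENNReal.ofReal (|C| ^ Real.conjExponent p) *
      ∫⁻ z : Rn n × Rn n, ENNReal.ofReal
        (|v z.1 - v z.2| ^ p * ‖z.1 - z.2‖ ^ (-((n : ℝ) + s * p)))) ?_
      (ENNReal.mul_lt_top ENNReal.ofReal_lt_top hvE)
    rw [← lintegral_const_mul' _ _ ENNReal.ofReal_ne_top]
    refine lintegral_mono fun z => ?_
    rw [ENNReal.toReal_ofReal hq.le, Real.enorm_eq_ofReal_abs,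
      ENNReal.ofReal_rpow_of_nonneg (abs_nonneg _) hq.le,
      ← ENNReal.ofReal_mul (by positivity)]
    apply ENNReal.ofReal_le_ofReal
    by_cases hz : z.1 = z.2
    · rw [hG]
      simp only [hz, sub_self, norm_zero, Real.zero_rpow he0.ne', mul_zero, abs_zero,
        Real.zero_rpow hq.ne', Real.zero_rpow hp0.ne', zero_mul]
      exact le_rfl
    · have hd : 0 < ‖z.1 - z.2‖ := norm_pos_iff.2 (sub_ne_zero.2 hz)
      have h1 : |G z| ≤ |C| * (|v z.1 - v z.2| ^ (p - 1) *
          ‖z.1 - z.2‖ ^ (-((n : ℝ) + s * p) + e)) := by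
        rw [hG, abs_mul, abs_of_nonneg (Real.rpow_nonneg (norm_nonneg _) e), Real.rpow_add hd,
          ← mul_assoc (|v z.1 - v z.2| ^ (p - 1)), ← mul_assoc |C|]
        apply mul_le_mul_of_nonneg_right _ (by positivity)
        refine (hΨ z hz).trans ?_
        gcongr
        exact le_abs_self C
      refine (Real.rpow_le_rpow (abs_nonneg _) h1 hq.le).trans (le_of_eq ?_)
      have hq' : (p - 1) * Real.conjExponent p = p := by
        rw [Real.conjExponent]; field_simp [(by linarith : p - 1 ≠ 0)]
      rw [Real.mul_rpow (abs_nonneg _) (by positivity), Real.mul_rpow (by positivity)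
        (by positivity), ← Real.rpow_mul (abs_nonneg _), ← Real.rpow_mul hd.le, hq',
        show (-((n : ℝ) + s * p) + e) * Real.conjExponent p = -((n : ℝ) + s * p) by
          rw [← hep]; linear_combination (-e) * hq']
  obtain ⟨ι, hι⟩ : ∃ ι : Rn n →L[ℝ] Rn n × Rn n, ∀ h, ι h = (h, h) :=
    ⟨(ContinuousLinearMap.id ℝ (Rn n)).prod (ContinuousLinearMap.id ℝ (Rn n)), fun h => rfl⟩
  have hGH : ∀ z a b, (Ψ z * ‖z.1 - z.2‖ ^ e) * ((a - b) * ‖z.1 - z.2‖ ^ (-e)) =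
      Ψ z * (a - b) ∨ z.1 = z.2 := by
    intro z a b
    by_cases hz : z.1 = z.2
    · exact Or.inr hz
    · left
      have hd : 0 < ‖z.1 - z.2‖ := norm_pos_iff.2 (sub_ne_zero.2 hz)
      rw [Real.rpow_neg hd.le]
      have : ‖z.1 - z.2‖ ^ e ≠ 0 := (Real.rpow_pos_of_pos hd e).ne'
      field_simp
  have hGH0 : ∀ z, G z * H z = Ψ z * (φ z.1 - φ z.2) := by
    intro z
    rw [hG, hH]
    rcases hGH z (φ z.1) (φ z.2) with h | h
    · exact h
    · simp [h]
  have hfL : MemLp f (ENNReal.ofReal (Real.conjExponent p)) := hf.memLp_of_hasCompactSupport hfc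
  have hφL : MemLp φ (ENNReal.ofReal p) := by
    refine ⟨hφ.aestronglyMeasurable, ?_⟩
    rw [eLpNorm_lt_top_iff_lintegral_rpow_enorm_lt_top (by simpa using hp0) ENNReal.ofReal_ne_top]
    refine lt_of_le_of_lt (lintegral_mono fun z => ?_) hφp
    rw [ENNReal.toReal_ofReal hp0.le, Real.enorm_eq_ofReal_abs,
      ENNReal.ofReal_rpow_of_nonneg (abs_nonneg _) hp0.le]
  have hφloc : LocallyIntegrable φ :=
    hφL.locallyIntegrable (by simpa using hp.le)
  have : ENNReal.HolderConjugate (ENNReal.ofReal (Real.conjExponent p)) (ENNReal.ofReal p) :=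
    hconj.ennrealOfReal
  have hi : Integrable (fun z : Rn n × Rn n => Ψ z * (φ z.1 - φ z.2)) :=
    (hGL.integrable_mul hHL).congr (Eventually.of_forall hGH0)
  have hif : Integrable (fun x => φ x * f x) :=
    (hfL.integrable_mul hφL).congr (Eventually.of_forall fun x => mul_comm _ _)
  refine ⟨hi, hif, ?_⟩
  have : (volume : Measure (Rn n × Rn n)).IsAddHaarMeasure :=
    inferInstanceAs (Measure.IsAddHaarMeasure (volume.prod volume))
  obtain ⟨c, hc⟩ : ∃ c : Rn n → ℝ, c = fun h => (∫ z, G z * H (z + ι h)) -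
      ∫ x, f x * φ (x + ContinuousLinearMap.id ℝ (Rn n) h) := ⟨_, rfl⟩
  have hcc : Continuous c := by
    rw [hc]
    exact (continuous_pairing_shift hconj ι hGL hHL).sub
      (continuous_pairing_shift hconj (ContinuousLinearMap.id ℝ (Rn n)) hfL hφL)
  have hc0 : c 0 = (∫ z : Rn n × Rn n, Ψ z * (φ z.1 - φ z.2)) - ∫ x, φ x * f x := by
    rw [hc]
    simp only [map_zero, add_zero, hGH0, mul_comm (f _)]
  rw [← sub_eq_zero, ← hc0, ← abs_eq_zero]
  refine le_antisymm (le_of_forall_pos_le_add fun ε hε => ?_) (abs_nonneg _)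
  obtain ⟨δ, hδ, hcδ⟩ := Metric.continuousAt_iff.1 hcc.continuousAt ε hε
  obtain ⟨r, hr⟩ : ∃ r, r = min (δ / 2) ((R - ρ) / 2) := ⟨_, rfl⟩
  have hr0 : 0 < r := by rw [hr]; exact lt_min (by linarith) (by linarith)
  have hrδ : r ≤ δ / 2 := hr ▸ min_le_left _ _
  have hrR : r ≤ (R - ρ) / 2 := hr ▸ min_le_right _ _
  let B : ContDiffBump (0 : Rn n) := ⟨r / 2, r, by linarith, by linarith⟩
  have hd := B.dist_normed_convolution_le (μ := volume) (x₀ := (0 : Rn n)) (ε := ε)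
    hcc.aestronglyMeasurable (fun x hx => (hcδ (lt_of_lt_of_le hx (by
      change r ≤ δ; linarith))).le)
  obtain ⟨k, hk⟩ : ∃ k : Rn n → ℝ, k = B.normed volume := ⟨_, rfl⟩
  rw [← hk] at hd
  have hkc : Continuous k := hk ▸ B.continuous_normed
  have hkC : HasCompactSupport k := hk ▸ B.hasCompactSupport_normed
  have hks : ContDiff ℝ (⊤ : ℕ∞) k := hk ▸ B.contDiff_normed
  have hksupp : Function.support k = ball 0 r := by rw [hk, B.support_normed_eq]
  obtain ⟨ψ, hψ⟩ : ∃ ψ : Rn n → ℝ, ∀ x, ψ x = ∫ t, k t * φ (x - t) := ⟨_, fun x => rfl⟩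
  have hψc : ψ = convolution k φ (ContinuousLinearMap.lsmul ℝ ℝ) volume := by
    ext x; rw [hψ, convolution_def]; rfl
  have hψsupp : Function.support ψ ⊆ closedBall z₀ (ρ + r) := by
    rw [hψc]
    refine (support_convolution_subset _).trans ?_
    rintro _ ⟨x, hx, y, hy, rfl⟩
    rw [hksupp, mem_ball_zero_iff] at hx
    have hy' : ‖y - z₀‖ < ρ := by
      by_contra h
      exact hy (hφ0 y (not_lt.1 h))
    rw [mem_closedBall, dist_eq_norm, add_sub_assoc]
    exact (norm_add_le _ _).trans (by linarith)
  have hψtest : IsTestFun n (ball z₀ R) ψ := by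
    refine ⟨?_, ?_, ?_⟩
    · rw [hψc]
      exact hkC.contDiff_convolution_left _ hks hφloc
    · exact HasCompactSupport.of_support_subset_isCompact (isCompact_closedBall _ _) hψsupp
    · refine (closure_minimal hψsupp isClosed_closedBall).trans ?_
      exact closedBall_subset_ball (by linarith)
  have hconv : ∀ x, Integrable fun t => k t * φ (x - t) := fun x =>
    hkC.convolutionExists_left (ContinuousLinearMap.lsmul ℝ ℝ) hkc hφloc x
  have hGz : ∀ z, G z * (∫ t, k t * H (z - ι t)) = Ψ z * (ψ z.1 - ψ z.2) := by
    intro z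
    have h1 : ∀ t, k t * H (z - ι t) =
        (k t * φ (z.1 - t) - k t * φ (z.2 - t)) * ‖z.1 - z.2‖ ^ (-e) := by
      intro t
      rw [hH, hι]
      simp only [Prod.fst_sub, Prod.snd_sub, sub_sub_sub_cancel_right]
      ring
    simp_rw [h1]
    rw [integral_mul_const, integral_sub (hconv _) (hconv _), ← hψ, ← hψ, hG]
    rcases hGH z (ψ z.1) (ψ z.2) with h | h
    · exact h
    · simp [h]
  obtain ⟨hi1, hp1⟩ := integral_pairing_shift hconj ι hGL hHL hGm hHm hkc hkC
  obtain ⟨-, hp2⟩ := integral_pairing_shift hconj (ContinuousLinearMap.id ℝ (Rn n)) hfL hφL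
    hf.measurable hφ hkc hkC
  simp only [hGz] at hi1 hp1
  simp only [ContinuousLinearMap.id_apply, ← hψ] at hp2
  have ht := htest ψ hψtest
  rw [← integral_prod _ hi1] at ht
  have hz : convolution k c (ContinuousLinearMap.lsmul ℝ ℝ) volume 0 = 0 := by
    have hc1 := ((continuous_pairing_shift hconj ι hGL hHL).comp continuous_neg)
    have hc2 := ((continuous_pairing_shift hconj (ContinuousLinearMap.id ℝ (Rn n)) hfL hφL).comp
      continuous_neg)
    have hi1 : Integrable fun t => k t * ∫ z, G z * H (z - ι t) :=
      ((hkc.mul hc1).integrable_of_hasCompactSupport hkC.mul_right).congr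
        (Eventually.of_forall fun t => by simp [sub_eq_add_neg])
    have hi2 : Integrable fun t => k t * ∫ x, f x * φ (x - t) :=
      ((hkc.mul hc2).integrable_of_hasCompactSupport hkC.mul_right).congr
        (Eventually.of_forall fun t => by simp [sub_eq_add_neg])
    rw [convolution_def]
    simp only [hc, ContinuousLinearMap.lsmul_apply, smul_eq_mul, zero_sub, map_neg,
      ← sub_eq_add_neg, ContinuousLinearMap.id_apply, mul_sub]
    rw [integral_sub hi1 hi2, hp1, hp2, sub_eq_zero]
    refine Eq.trans ?_ (ht.trans ?_)
    · rfl
    · simp only [mul_comm (f _)]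
  rwa [hz, dist_comm, dist_zero_right, Real.norm_eq_abs, ← zero_add ε] at hd

end Mollify

lemma lintegral_lintegral_add_left {α : Type*} [MeasurableSpace α] {ν : Measure α} [SFinite ν]
    {f : α → α → ℝ≥0∞} (hf : Measurable (Function.uncurry f)) (g : α → α → ℝ≥0∞) :
    ∫⁻ x, ∫⁻ y, (f x y + g x y) ∂ν ∂ν = (∫⁻ x, ∫⁻ y, f x y ∂ν ∂ν) + ∫⁻ x, ∫⁻ y, g x y ∂ν ∂ν := by
  have hm : Measurable fun x => ∫⁻ y, f x y ∂ν := Measurable.lintegral_prod_right' hf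
  rw [← lintegral_add_left hm]
  refine lintegral_congr fun x => ?_
  exact lintegral_add_left (hf.comp measurable_prodMk_left) _

lemma lintegral_lintegral_const_mul {α : Type*} [MeasurableSpace α] {ν : Measure α}
    (c : ℝ≥0∞) (hc : c ≠ ⊤) (f : α → α → ℝ≥0∞) :
    ∫⁻ x, ∫⁻ y, c * f x y ∂ν ∂ν = c * ∫⁻ x, ∫⁻ y, f x y ∂ν ∂ν := by
  rw [← lintegral_const_mul' _ _ hc]
  exact lintegral_congr fun x => lintegral_const_mul' _ _ hc

section EnergyOfTest

variable {n : ℕ} {s p : ℝ}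

lemma Cutoff.abs_rpow_sub_le {z : Rn n} {ρ : ℝ} {η : Rn n → ℝ} (hη : Cutoff z ρ η) (hp : 1 < p) :
    ∃ l : ℝ, 1 ≤ l ∧ ∀ x y, |η x ^ p - η y ^ p| ≤ min 1 (l * ‖x - y‖) := by
  obtain ⟨L, hL⟩ := hη.lip
  refine ⟨p * L + 1, by nlinarith [L.2, (L : ℝ≥0).coe_nonneg], ?_⟩
  have key : ∀ x y, η y ≤ η x → |η x ^ p - η y ^ p| ≤ min 1 ((p * L + 1) * ‖x - y‖) := by
    intro x y hxy
    have h0 := hη.nonneg y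
    have h1 := hη.nonneg x
    have hm : η y ^ p ≤ η x ^ p := Real.rpow_le_rpow h0 hxy (by linarith)
    rw [abs_of_nonneg (by linarith)]
    apply le_min
    · have := Real.rpow_le_one h1 (hη.le_one x) (by linarith : 0 ≤ p)
      have := Real.rpow_nonneg h0 p
      linarith
    · have h2 := rpow_sub_rpow_le hp.le h0 hxy
      have h3 : η x ^ (p - 1) ≤ 1 := Real.rpow_le_one h1 (hη.le_one x) (by linarith)
      have h4 : η x - η y ≤ L * ‖x - y‖ := by
        have := hL.dist_le_mul x y
        rw [Real.dist_eq, dist_eq_norm] at this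
        exact (le_abs_self _).trans this
      have h5 : 0 ≤ η x - η y := by linarith
      have h6 : p * (η x - η y) ≤ p * (L * ‖x - y‖) := by
        apply mul_le_mul_of_nonneg_left h4; linarith
      have h7 : 0 ≤ ‖x - y‖ := norm_nonneg _
      have h8 : p * (η x - η y) * η x ^ (p - 1) ≤ p * (η x - η y) * 1 :=
        mul_le_mul_of_nonneg_left h3 (mul_nonneg (by linarith) h5)
      nlinarith
  intro x y
  rcases le_total (η y) (η x) with h | h
  · exact key x y h
  · rw [abs_sub_comm, norm_sub_rev]; exact key y x h

/-- Test functions `F(w) η^p` inherit integrability and finite energy from `w`. -/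
lemma test_energy (hn : 2 ≤ n) (hs : 0 < s) (hs1 : s < 1) (hp : 1 < p) {w : Rn n → ℝ}
    (hw : Measurable w) (hwp : ∫⁻ x, ENNReal.ofReal (|w x| ^ p) < ⊤)
    (hwE : ∫⁻ x, ∫⁻ y, ENNReal.ofReal (|w x - w y| ^ p) * J n s p x y < ⊤)
    {F : ℝ → ℝ} {K : ℝ≥0} (hF : LipschitzWith K F) (hF0 : ∀ t, 0 ≤ F t)
    {z : Rn n} {ρ : ℝ} {η : Rn n → ℝ} (hη : Cutoff z ρ η) :
    ∫⁻ x, ENNReal.ofReal (|F (w x) * η x ^ p| ^ p) < ⊤ ∧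
    ∫⁻ x, ∫⁻ y, ENNReal.ofReal (|F (w x) * η x ^ p - F (w y) * η y ^ p| ^ p) * J n s p x y
      < ⊤ := by
  have hp0 : 0 ≤ p := by linarith
  obtain ⟨l, hl, hηl⟩ := hη.abs_rpow_sub_le hp
  obtain ⟨C, hC, hbud⟩ := exists_budget (n := n) hn hs hs1 (by linarith : 0 < p) hl le_rfl one_pos
  obtain ⟨h, hh⟩ : ∃ h : Rn n → ℝ, h = (ball z ρ).indicator fun x => F (w x) ^ p := ⟨_, rfl⟩
  have hhm : Measurable h := by
    rw [hh]
    exact Measurable.indicator ((hF.continuous.measurable.comp hw).pow_const p) measurableSet_ball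
  have hh0 : ∀ x, 0 ≤ h x := fun x => by
    rw [hh]; exact indicator_nonneg (fun x _ => Real.rpow_nonneg (hF0 _) _) x
  have hhi : ∫⁻ x, ENNReal.ofReal (h x) < ⊤ := by
    have hb : ∀ x, ENNReal.ofReal (h x) ≤
        ENNReal.ofReal (2 ^ p * F 0 ^ p) * (ball z ρ).indicator (fun _ => 1) x +
        ENNReal.ofReal (2 ^ p * (K : ℝ) ^ p) * ENNReal.ofReal (|w x| ^ p) := by
      intro x
      rw [hh]
      by_cases hx : x ∈ ball z ρ
      · rw [indicator_of_mem hx, indicator_of_mem hx, mul_one,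
          ← ENNReal.ofReal_mul (by positivity),
          ← ENNReal.ofReal_add (mul_nonneg (by positivity) (Real.rpow_nonneg (hF0 _) _))
            (by positivity)]
        apply ENNReal.ofReal_le_ofReal
        have h1 : F (w x) ≤ F 0 + K * |w x| := by
          have := hF.dist_le_mul (w x) 0
          rw [Real.dist_eq, Real.dist_eq, sub_zero] at this
          have := (le_abs_self _).trans this
          linarith
        have h2 := (Real.rpow_le_rpow (hF0 _) h1 hp0).trans
          (add_rpow_le hp0 (hF0 0) (by positivity))
        rw [Real.mul_rpow K.coe_nonneg (abs_nonneg _)] at h2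
        linarith
      · rw [indicator_of_notMem hx, ENNReal.ofReal_zero]; exact zero_le
    refine lt_of_le_of_lt (lintegral_mono hb) ?_
    rw [lintegral_add_left (by exact (measurable_const.indicator measurableSet_ball).const_mul _),
      lintegral_const_mul' _ _ ENNReal.ofReal_ne_top, lintegral_const_mul' _ _ ENNReal.ofReal_ne_top,
      lintegral_indicator measurableSet_ball]
    refine ENNReal.add_lt_top.2 ⟨ENNReal.mul_lt_top ENNReal.ofReal_lt_top ?_,
      ENNReal.mul_lt_top ENNReal.ofReal_lt_top hwp⟩
    simpa using measure_ball_lt_top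
  have hφh : ∀ x, |F (w x)| ^ p * |η x ^ p| ^ p ≤ h x := by
    intro x
    have h1 : |η x ^ p| ≤ 1 := by
      rw [abs_of_nonneg (Real.rpow_nonneg (hη.nonneg x) _)]
      exact Real.rpow_le_one (hη.nonneg x) (hη.le_one x) hp0
    by_cases hx : x ∈ ball z ρ
    · rw [hh, indicator_of_mem hx, abs_of_nonneg (hF0 _)]
      exact mul_le_of_le_one_right (Real.rpow_nonneg (hF0 _) _)
        (Real.rpow_le_one (abs_nonneg _) h1 hp0)
    · rw [mem_ball, dist_eq_norm, not_lt] at hx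
      rw [hη.zero x hx, Real.zero_rpow (by linarith), abs_zero, Real.zero_rpow (by linarith),
        mul_zero]
      exact hh0 x
  constructor
  · refine lt_of_le_of_lt (lintegral_mono fun x => ENNReal.ofReal_le_ofReal ?_) hhi
    rw [abs_mul, Real.mul_rpow (abs_nonneg _) (abs_nonneg _)]
    exact hφh x
  · have hb := hbud (fun x => 2 ^ p * h x) (fun _ => 0) (fun _ => 0) (hhm.const_mul _)
      measurable_const measurable_const (fun x => mul_nonneg (by positivity) (hh0 x))
      (fun _ => le_rfl) (fun _ => le_rfl) (fun _ _ => rfl) (fun _ _ => rfl)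
      (fun x y => (2 ^ p * h x + 2 ^ p * h y) * min 1 (l * ‖x - y‖) ^ p)
      (Eventually.of_forall fun x => Eventually.of_forall fun y => by simp)
    have hpt : ∀ x y, ENNReal.ofReal (|F (w x) * η x ^ p - F (w y) * η y ^ p| ^ p) * J n s p x y ≤
        ENNReal.ofReal (2 ^ p * (K : ℝ) ^ p) *
          (ENNReal.ofReal (|w x - w y| ^ p) * J n s p x y) +
        ENNReal.ofReal ((2 ^ p * h x + 2 ^ p * h y) * min 1 (l * ‖x - y‖) ^ p) *
          J n s p x y := by
      intro x y
      rw [← mul_assoc, ← ENNReal.ofReal_mul (by positivity), ← add_mul]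
      have hm0 : 0 ≤ min 1 (l * ‖x - y‖) := le_min zero_le_one (by positivity)
      rw [← ENNReal.ofReal_add (by positivity) (mul_nonneg (add_nonneg
        (mul_nonneg (by positivity) (hh0 x)) (mul_nonneg (by positivity) (hh0 y)))
        (Real.rpow_nonneg hm0 _))]
      refine mul_le_mul_left (ENNReal.ofReal_le_ofReal ?_) _
      have hηx := Real.rpow_nonneg (hη.nonneg x) p
      have hηy := Real.rpow_nonneg (hη.nonneg y) p
      have h1 := abs_mul_sub_mul_le (x := F (w x)) (y := F (w y)) hηx hηy
      have h2 : |F (w x) - F (w y)| * min (η x ^ p) (η y ^ p) ≤ K * |w x - w y| := by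
        have := hF.dist_le_mul (w x) (w y)
        rw [Real.dist_eq, Real.dist_eq] at this
        refine le_trans (mul_le_of_le_one_right (abs_nonneg _) ?_) this
        exact (min_le_left _ _).trans (Real.rpow_le_one (hη.nonneg x) (hη.le_one x) hp0)
      have h3 : ((if η y ^ p ≤ η x ^ p then |F (w x)| else |F (w y)|) *
          |η x ^ p - η y ^ p|) ^ p ≤ (h x + h y) * min 1 (l * ‖x - y‖) ^ p := by
        have key : ∀ x y, η y ^ p ≤ η x ^ p → (|F (w x)| * |η x ^ p - η y ^ p|) ^ p ≤
            h x * min 1 (l * ‖x - y‖) ^ p := by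
          intro x y hxy
          by_cases hx : x ∈ ball z ρ
          · rw [Real.mul_rpow (abs_nonneg _) (abs_nonneg _), hh, indicator_of_mem hx,
              abs_of_nonneg (hF0 _)]
            exact mul_le_mul_of_nonneg_left (Real.rpow_le_rpow (abs_nonneg _) (hηl x y) hp0)
              (Real.rpow_nonneg (hF0 _) _)
          · rw [mem_ball, dist_eq_norm, not_lt] at hx
            have h0 : η x ^ p = 0 := by rw [hη.zero x hx, Real.zero_rpow (by linarith)]
            have h1 : η y ^ p = 0 := le_antisymm (hxy.trans h0.le)
              (Real.rpow_nonneg (hη.nonneg y) p)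
            rw [h0, h1, sub_zero, abs_zero, mul_zero, Real.zero_rpow (by linarith)]
            exact mul_nonneg (hh0 x)
              (Real.rpow_nonneg (le_min zero_le_one (by positivity)) _)
        have hmp := Real.rpow_nonneg hm0 p
        split_ifs with hxy
        · refine (key x y hxy).trans ?_
          exact mul_le_mul_of_nonneg_right (by linarith [hh0 y]) hmp
        · have := key y x (not_le.1 hxy).le
          rw [abs_sub_comm, norm_sub_rev] at this
          refine this.trans ?_
          exact mul_le_mul_of_nonneg_right (by linarith [hh0 x]) hmp
      refine (Real.rpow_le_rpow (abs_nonneg _) h1 hp0).trans ?_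
      refine (add_rpow_le hp0 (by positivity) (by positivity)).trans ?_
      have h4 := Real.rpow_le_rpow (by positivity) h2 hp0
      rw [Real.mul_rpow K.coe_nonneg (abs_nonneg _)] at h4
      have h5 : (0 : ℝ) < 2 ^ p := by positivity
      nlinarith
    have hm : Measurable fun z : Rn n × Rn n => ENNReal.ofReal (2 ^ p * (K : ℝ) ^ p) *
          (ENNReal.ofReal (|w z.1 - w z.2| ^ p) * J n s p z.1 z.2) := by fun_prop
    refine lt_of_le_of_lt (lintegral_mono fun x => lintegral_mono fun y => hpt x y) ?_
    rw [lintegral_lintegral_add_left (f := fun x y => ENNReal.ofReal (2 ^ p * (K : ℝ) ^ p) *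
          (ENNReal.ofReal (|w x - w y| ^ p) * J n s p x y)) hm,
      lintegral_lintegral_const_mul _ ENNReal.ofReal_ne_top]
    refine ENNReal.add_lt_top.2 ⟨ENNReal.mul_lt_top ENNReal.ofReal_lt_top hwE,
      lt_of_le_of_lt hb ?_⟩
    refine ENNReal.mul_lt_top ENNReal.ofReal_lt_top (ENNReal.add_lt_top.2 ⟨?_, by simp⟩)
    simp_rw [ENNReal.ofReal_mul (by positivity : (0 : ℝ) ≤ 2 ^ p)]
    rw [lintegral_const_mul' _ _ ENNReal.ofReal_ne_top]
    exact ENNReal.mul_lt_top ENNReal.ofReal_lt_top hhi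

end EnergyOfTest

section WeakToSub

variable {n : ℕ} {s p Λ : ℝ}

lemma PhiBounds.eq_mul_sg {Φ : ℝ → ℝ} (hΦ : PhiBounds Λ p Φ) (hp : 1 < p) (hΛ : 1 ≤ Λ)
    {σ : ℝ} (hσ : σ = 1 ∨ σ = -1) (t : ℝ) :
    ∃ m : ℝ, 1 / Λ ≤ m ∧ m ≤ Λ ∧ σ * Φ (σ * t) = m * sg p t := by
  have hΛ0 : 0 < Λ := by linarith
  by_cases ht : t = 0
  · refine ⟨1, ?_, hΛ, ?_⟩
    · rw [div_le_one hΛ0]; exact hΛ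
    · rw [ht, mul_zero, hΦ.2.1, sg_zero hp]; ring
  · have h := hΦ.2.2 (σ * t)
    have hσt : |σ * t| = |t| := by rcases hσ with rfl | rfl <;> simp
    have hσ2 : σ * σ = 1 := by rcases hσ with rfl | rfl <;> norm_num
    have htp : 0 < |t| ^ p := Real.rpow_pos_of_pos (abs_pos.2 ht) _
    rw [hσt] at h
    have hsg : sg p t * t = |t| ^ p := by
      rcases le_total 0 t with h0 | h0
      · rw [sg_of_nonneg h0, abs_of_nonneg h0, ← Real.rpow_add_one' h0 (by linarith)]
        congr 1; ring
      · have : sg p t = -sg p (-t) := by rw [sg_neg hp, neg_neg]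
        rw [this, sg_of_nonneg (by linarith), abs_of_nonpos h0, neg_mul, ← mul_neg,
          ← Real.rpow_add_one' (by linarith) (by linarith)]
        congr 1; ring
    have hsg0 : sg p t ≠ 0 := by
      intro h; rw [h, zero_mul] at hsg; linarith
    refine ⟨Φ (σ * t) * (σ * t) / |t| ^ p, ?_, ?_, ?_⟩
    · rw [le_div_iff₀ htp]; linarith [h.1, (by ring : 1 / Λ * |t| ^ p = |t| ^ p / Λ)]
    · rw [div_le_iff₀ htp]; exact h.2
    · rw [← hsg]
      field_simp

lemma KernelBounds.eq_mul {K : Rn n → Rn n → ℝ} (hK : KernelBounds n Λ s p K) (hΛ : 1 ≤ Λ)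
    {x y : Rn n} (hxy : x ≠ y) :
    ∃ k : ℝ, 1 / Λ ≤ k ∧ k ≤ Λ ∧ K x y = k * ‖x - y‖ ^ (-((n : ℝ) + s * p)) := by
  have hΛ0 : 0 < Λ := by linarith
  have hd : 0 < ‖x - y‖ := norm_pos_iff.2 (sub_ne_zero.2 hxy)
  have h := hK.2 x y hxy
  have hj : 0 < ‖x - y‖ ^ ((n : ℝ) + s * p) := Real.rpow_pos_of_pos hd _
  refine ⟨K x y * ‖x - y‖ ^ ((n : ℝ) + s * p), ?_, ?_, ?_⟩
  · have := mul_le_mul_of_nonneg_right h.1 hj.le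
    refine le_trans (le_of_eq ?_) this
    field_simp
  · have := mul_le_mul_of_nonneg_right h.2 hj.le
    refine this.trans (le_of_eq ?_)
    field_simp
  · rw [Real.rpow_neg hd.le]
    field_simp

/-- One-sided bounds of the model integrand transfer to the integrand of `Φ` and `K`. -/
lemma form_pointwise {m k N b g j Λ : ℝ} (hΛ : 1 ≤ Λ) (hm : 1 / Λ ≤ m) (hm' : m ≤ Λ)
    (hk : 1 / Λ ≤ k) (hk' : k ≤ Λ) (hj : 0 ≤ j) (hb : 0 ≤ b) (hg : 0 ≤ g) (h : g ≤ N + b) :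
    g * j ≤ Λ ^ 2 * (m * k * N * j) + Λ ^ 4 * (b * j) := by
  have hΛ0 : 0 < Λ := by linarith
  have hi : 0 < 1 / Λ := by positivity
  have hmk : 1 ≤ Λ ^ 2 * (m * k) := by
    have h1 : 1 ≤ Λ * m := by rw [div_le_iff₀ hΛ0] at hm; linarith
    have h2 : 1 ≤ Λ * k := by rw [div_le_iff₀ hΛ0] at hk; linarith
    nlinarith
  have hmk' : Λ ^ 2 * (m * k) ≤ Λ ^ 4 := by
    have : m * k ≤ Λ * Λ := mul_le_mul hm' hk' (by linarith) hΛ0.le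
    nlinarith [sq_nonneg Λ]
  have h4 : 1 ≤ Λ ^ 4 := one_le_pow₀ hΛ
  have key : g ≤ Λ ^ 2 * (m * k) * N + Λ ^ 4 * b := by
    rcases le_total 0 N with hN | hN
    · nlinarith
    · have : Λ ^ 4 * N ≤ Λ ^ 2 * (m * k) * N := mul_le_mul_of_nonpos_right hmk' hN
      nlinarith
  nlinarith [mul_le_mul_of_nonneg_right key hj]

lemma memWsp_univ_energy {u v : Rn n → ℝ} (hu : memWsp n s p univ u) (he : v =ᵐ[volume] u) :
    ∫⁻ x, ENNReal.ofReal (|v x| ^ p) < ⊤ ∧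
    ∫⁻ x, ∫⁻ y, ENNReal.ofReal (|v x - v y| ^ p) * J n s p x y < ⊤ := by
  obtain ⟨-, h1, h2⟩ := hu
  unfold gagliardo at h2
  simp only [Measure.restrict_univ] at h1 h2
  constructor
  · refine lt_of_le_of_lt (le_of_eq (lintegral_congr_ae ?_)) h1
    filter_upwards [he] with x hx
    rw [hx]
  · refine lt_of_le_of_lt (le_of_eq (lintegral_congr_ae ?_)) h2
    filter_upwards [he] with x hx
    apply lintegral_congr_ae
    filter_upwards [he] with y hy
    rw [hx, hy, J, ← ENNReal.ofReal_mul (by positivity), Real.rpow_neg (norm_nonneg _),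
      div_eq_mul_inv]

lemma weak_test {Φ : ℝ → ℝ} {K : Rn n → Rn n → ℝ} {Ω : Set (Rn n)} {f g₀ u v : Rn n → ℝ}
    (hn : 2 ≤ n) (hs : 0 < s) (hs1 : s < 1) (hp : 1 < p) (hΛ : 1 ≤ Λ)
    (hK : KernelBounds n Λ s p K) (hΦ : PhiBounds Λ p Φ) (hfc : Continuous f)
    (hfs : HasCompactSupport f) (hu : WeakSol n Φ K s p Ω f g₀ u) (hv : Measurable v)
    (he : v =ᵐ[volume] u) {z : Rn n} {R : ℝ} (hΩ : ball z R ⊆ Ω) {σ : ℝ} (hσ : σ = 1 ∨ σ = -1)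
    {F : ℝ → ℝ} {k : ℝ≥0} (hF : LipschitzWith k F) (hF0 : ∀ t, 0 ≤ F t) {ρ : ℝ} (hρ : ρ < R)
    {η : Rn n → ℝ} (hη : Cutoff z ρ η) {φ : Rn n → ℝ}
    (hφ : ∀ x, φ x = F (σ * v x) * η x ^ p) :
    Integrable (fun z : Rn n × Rn n => Φ (v z.1 - v z.2) * K z.1 z.2 * (φ z.1 - φ z.2)) ∧
      Integrable (fun x => φ x * f x) ∧
      ∫ z : Rn n × Rn n, Φ (v z.1 - v z.2) * K z.1 z.2 * (φ z.1 - φ z.2) = ∫ x, φ x * f x := by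
  have hσa : |σ| = 1 := by rcases hσ with rfl | rfl <;> simp
  obtain ⟨hvp, hvE⟩ := memWsp_univ_energy hu.1 he
  have hw : Measurable fun x => σ * v x := hv.const_mul σ
  obtain ⟨hφp, hφE⟩ := test_energy hn hs hs1 hp hw (by simpa [abs_mul, hσa] using hvp)
    (by simpa [← mul_sub, abs_mul, hσa] using hvE) hF hF0 hη
  simp only [← hφ] at hφp hφE
  have hηm : Measurable η := hη.lip.choose_spec.continuous.measurable
  have hφm : Measurable φ := by
    rw [show φ = fun x => F (σ * v x) * η x ^ p from funext hφ]
    exact (hF.continuous.measurable.comp hw).mul (hηm.pow_const p)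
  have hsplit : ∀ ψ : Rn n → ℝ, Measurable ψ →
      ∫⁻ x, ∫⁻ y, ENNReal.ofReal (|ψ x - ψ y| ^ p) * J n s p x y < ⊤ →
      ∫⁻ z : Rn n × Rn n, ENNReal.ofReal
        (|ψ z.1 - ψ z.2| ^ p * ‖z.1 - z.2‖ ^ (-((n : ℝ) + s * p))) < ⊤ := by
    intro ψ hψ h
    refine lt_of_le_of_lt (le_of_eq ?_) h
    rw [Measure.volume_eq_prod, lintegral_prod _ (by fun_prop)]
    simp only [J, ENNReal.ofReal_mul (Real.rpow_nonneg (abs_nonneg _) p)]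
  have hKm := hK.1
  have hΦm := hΦ.1.measurable
  refine weak_extend (z₀ := z) (C := Λ ^ 2) hp (by positivity) hρ (Ψ := fun z => Φ (v z.1 - v z.2) * K z.1 z.2)
    ((hΦm.comp (by fun_prop)).mul hKm) ?_ hφm (hsplit v hv hvE) (hsplit φ hφm hφE) hφp ?_ hfc
    hfs ?_
  · intro z hz
    obtain ⟨m, hm, hm', hme⟩ := PhiBounds.eq_mul_sg hΦ hp hΛ (Or.inl rfl) (v z.1 - v z.2)
    obtain ⟨l, hl, hl', hle⟩ := KernelBounds.eq_mul hK hΛ hz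
    have hΛi : 0 ≤ 1 / Λ := by positivity
    rw [one_mul, one_mul] at hme
    rw [hme, hle, abs_mul, abs_mul, abs_mul, abs_sg hp, abs_of_nonneg (hΛi.trans hm),
      abs_of_nonneg (hΛi.trans hl), abs_of_nonneg (Real.rpow_nonneg (norm_nonneg _) _)]
    have h1 : m * l ≤ Λ * Λ := mul_le_mul hm' hl' (hΛi.trans hl) (by linarith)
    have h2 : 0 ≤ |v z.1 - v z.2| ^ (p - 1) * ‖z.1 - z.2‖ ^ (-((n : ℝ) + s * p)) := by
      positivity
    nlinarith [mul_le_mul_of_nonneg_right h1 h2]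
  · intro x hx
    rw [hφ, hη.zero x hx, Real.zero_rpow (by linarith), mul_zero]
  · intro ψ hψ
    rw [← hu.2.2 ψ ⟨hψ.1, hψ.2.1, hψ.2.2.trans hΩ⟩, nonlocalForm]
    apply integral_congr_ae
    filter_upwards [he] with x hx
    apply integral_congr_ae
    filter_upwards [he] with y hy
    simp only [hx, hy]
    ring

lemma weak_core {Φ : ℝ → ℝ} {K : Rn n → Rn n → ℝ} {Ω : Set (Rn n)} {f g₀ u v : Rn n → ℝ}
    (hn : 2 ≤ n) (hs : 0 < s) (hs1 : s < 1) (hp : 1 < p) (hΛ : 1 ≤ Λ)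
    (hK : KernelBounds n Λ s p K) (hΦ : PhiBounds Λ p Φ) (hfc : Continuous f)
    (hfs : HasCompactSupport f) (hu : WeakSol n Φ K s p Ω f g₀ u) (hv : Measurable v)
    (he : v =ᵐ[volume] u) {z : Rn n} {R : ℝ} (hΩ : ball z R ⊆ Ω) {σ : ℝ} (hσ : σ = 1 ∨ σ = -1)
    {F : ℝ → ℝ} {k : ℝ≥0} (hF : LipschitzWith k F) (hF0 : ∀ t, 0 ≤ F t) {ρ : ℝ} (hρ : ρ < R)
    {η : Rn n → ℝ} (hη : Cutoff z ρ η) {φ : Rn n → ℝ}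
    (hφ : ∀ x, φ x = F (σ * v x) * η x ^ p) {b g : Rn n → Rn n → ℝ}
    (hb : ∀ x y, 0 ≤ b x y) (hg : ∀ x y, 0 ≤ g x y)
    (hN : ∀ᵐ x : Rn n, ∀ᵐ y : Rn n,
      g x y ≤ sg p (σ * v x - σ * v y) * (φ x - φ y) + b x y) :
    ∃ P Q : ℝ≥0∞, P ≠ ⊤ ∧ Q ≠ ⊤ ∧ Integrable (fun x => φ x * f x) ∧
      P.toReal - Q.toReal = σ * ∫ x, φ x * f x ∧
      (∫⁻ x, ∫⁻ y, ENNReal.ofReal (g x y) * J n s p x y) + ENNReal.ofReal (Λ ^ 2) * Q ≤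
        ENNReal.ofReal (Λ ^ 2) * P +
          ENNReal.ofReal (Λ ^ 4) * ∫⁻ x, ∫⁻ y, ENNReal.ofReal (b x y) * J n s p x y := by
  obtain ⟨hi, hif, heq⟩ := weak_test hn hs hs1 hp hΛ hK hΦ hfc hfs hu hv he hΩ hσ hF hF0 hρ hη hφ
  obtain ⟨a, ha⟩ : ∃ a : Rn n × Rn n → ℝ, a = fun z =>
    σ * (Φ (v z.1 - v z.2) * K z.1 z.2 * (φ z.1 - φ z.2)) := ⟨_, rfl⟩
  have hai : Integrable a := ha ▸ hi.const_mul σ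
  have hηm : Measurable η := hη.lip.choose_spec.continuous.measurable
  have hφm : Measurable φ := by
    rw [show φ = fun x => F (σ * v x) * η x ^ p from funext hφ]
    exact (hF.continuous.measurable.comp (hv.const_mul σ)).mul (hηm.pow_const p)
  have ham : Measurable a := by
    have hKm := hK.1
    have hΦm := hΦ.1.measurable
    rw [ha]
    exact (((hΦm.comp (by fun_prop)).mul hKm).mul (by fun_prop)).const_mul σ
  have h_int : ∫ z, a z = σ * ∫ x, φ x * f x := by
    rw [ha, integral_const_mul, heq]
  rw [integral_eq_lintegral_pos_part_sub_lintegral_neg_part hai] at h_int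
  have hP : ∀ c : Rn n × Rn n → ℝ, Measurable c →
      ∫⁻ z, ENNReal.ofReal (c z) = ∫⁻ x, ∫⁻ y, ENNReal.ofReal (c (x, y)) := by
    intro c hc
    rw [Measure.volume_eq_prod, lintegral_prod _ (by fun_prop)]
  refine ⟨∫⁻ z, ENNReal.ofReal (a z), ∫⁻ z, ENNReal.ofReal (-a z), ?_, ?_, hif, h_int, ?_⟩
  · exact (hai.lintegral_lt_top).ne
  · exact (hai.neg.lintegral_lt_top).ne
  · rw [hP a ham, hP (fun z => -a z) ham.neg, add_comm,
      ← lintegral_lintegral_const_mul _ ENNReal.ofReal_ne_top,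
      ← lintegral_lintegral_const_mul _ ENNReal.ofReal_ne_top,
      ← lintegral_lintegral_const_mul _ ENNReal.ofReal_ne_top,
      ← lintegral_lintegral_add_left (by exact (ham.neg.ennreal_ofReal).const_mul _),
      ← lintegral_lintegral_add_left (by exact (ham.ennreal_ofReal).const_mul _)]
    apply lintegral_mono_ae
    filter_upwards [hN] with x hx
    apply lintegral_mono_ae
    filter_upwards [hx] with y hy
    by_cases hxy : x = y
    · have h0 : J n s p x y = 0 := by
        have : (n : ℝ) + s * p ≠ 0 := by positivity
        rw [J, hxy, sub_self, norm_zero, Real.zero_rpow (neg_ne_zero.2 this), ENNReal.ofReal_zero]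
      have h1 : a (x, y) = 0 := by rw [ha, hxy]; simp
      simp [h0, h1]
    · obtain ⟨m, hm, hm', hme⟩ := PhiBounds.eq_mul_sg hΦ hp hΛ hσ (σ * v x - σ * v y)
      obtain ⟨l, hl, hl', hle⟩ := KernelBounds.eq_mul hK hΛ hxy
      have hσ2 : σ * (σ * v x - σ * v y) = v x - v y := by
        rcases hσ with rfl | rfl <;> ring
      rw [hσ2] at hme
      obtain ⟨j, hj⟩ : ∃ j : ℝ, j = ‖x - y‖ ^ (-((n : ℝ) + s * p)) := ⟨_, rfl⟩
      have hj0 : 0 ≤ j := hj ▸ Real.rpow_nonneg (norm_nonneg _) _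
      have h := form_pointwise hΛ hm hm' hl hl' hj0 (hb x y) (hg x y) hy
      have hax : a (x, y) = m * l * (sg p (σ * v x - σ * v y) * (φ x - φ y)) * j := by
        rw [ha]
        simp only
        rw [hle, ← hj]
        linear_combination l * j * (φ x - φ y) * hme
      rw [← hax] at h
      rw [J, ← hj, ← ENNReal.ofReal_mul (hg x y), ← ENNReal.ofReal_mul (hb x y),
        ← ENNReal.ofReal_mul (by positivity), ← ENNReal.ofReal_mul (by positivity),
        ← ENNReal.ofReal_mul (by positivity)]
      have hbj : 0 ≤ Λ ^ 4 * (b x y * j) := mul_nonneg (by positivity) (mul_nonneg (hb x y) hj0)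
      have hgj : 0 ≤ g x y * j := mul_nonneg (hg x y) hj0
      rcases le_total 0 (a (x, y)) with h0 | h0
      · rw [ENNReal.ofReal_of_nonpos (p := Λ ^ 2 * -a (x, y)) (by nlinarith [sq_nonneg Λ]), zero_add,
          ← ENNReal.ofReal_add (by positivity) hbj]
        exact ENNReal.ofReal_le_ofReal h
      · rw [ENNReal.ofReal_of_nonpos (p := Λ ^ 2 * a (x, y)) (by nlinarith [sq_nonneg Λ]), zero_add,
          ← ENNReal.ofReal_add (by nlinarith [sq_nonneg Λ]) hgj]
        exact ENNReal.ofReal_le_ofReal (by linarith)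

/-- Weak solutions with nonnegative data are sub- and supersolutions in the sense of `IsSub`. -/
theorem isSub_isSup_of_weakSol {Φ : ℝ → ℝ} {K : Rn n → Rn n → ℝ} {Ω : Set (Rn n)}
    {f g₀ u v : Rn n → ℝ}
    (hn : 2 ≤ n) (hs : 0 < s) (hs1 : s < 1) (hp : 1 < p) (hΛ : 1 ≤ Λ)
    (hK : KernelBounds n Λ s p K) (hΦ : PhiBounds Λ p Φ) (hfc : Continuous f)
    (hfs : HasCompactSupport f) (hf0 : ∀ x, 0 ≤ f x) (hu : WeakSol n Φ K s p Ω f g₀ u)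
    (hv : Measurable v) (he : v =ᵐ[volume] u) {z : Rn n} {R : ℝ} (hΩ : ball z R ⊆ Ω) :
    IsSub n s p (Λ ^ 4) z R v f (fun _ => 0) ∧ IsSup n s p (Λ ^ 4) z R v f := by
  have hΛ2 : (1 : ℝ) ≤ Λ ^ 2 := one_le_pow₀ hΛ
  have hΛ24 : ENNReal.ofReal (Λ ^ 2) ≤ ENNReal.ofReal (Λ ^ 4) :=
    ENNReal.ofReal_le_ofReal (pow_le_pow_right₀ hΛ (by norm_num))
  have hI : ∀ φ : Rn n → ℝ, (∀ x, 0 ≤ φ x) → Integrable (fun x => φ x * f x) →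
      ∫⁻ x, ENNReal.ofReal (f x * φ x) = ENNReal.ofReal (∫ x, φ x * f x) := by
    intro φ hφ0 hi
    rw [ofReal_integral_eq_lintegral_ofReal hi
      (Eventually.of_forall fun x => mul_nonneg (hφ0 x) (hf0 x))]
    simp only [mul_comm]
  have hI0 : ∀ φ : Rn n → ℝ, (∀ x, 0 ≤ φ x) → 0 ≤ ∫ x, φ x * f x := fun φ hφ0 =>
    integral_nonneg fun x => mul_nonneg (hφ0 x) (hf0 x)
  constructor
  · refine ⟨hv, ?_⟩
    intro F k hF hF0 ρ hρ η hη b g hb hg hN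
    have hφ0 : ∀ x, 0 ≤ F (v x) * η x ^ p := fun x =>
      mul_nonneg (hF0 _) (Real.rpow_nonneg (hη.nonneg x) _)
    obtain ⟨P, Q, hP, hQ, hi, hPQ, h⟩ := weak_core hn hs hs1 hp hΛ hK hΦ hfc hfs hu hv he hΩ
      (Or.inl rfl) hF hF0 hρ hη (φ := fun x => F (v x) * η x ^ p) (fun x => by rw [one_mul]) hb hg
      (by simpa only [one_mul] using hN)
    have hPe : P = Q + ENNReal.ofReal (∫ x, F (v x) * η x ^ p * f x) := by
      rw [← ENNReal.ofReal_toReal hP, ← ENNReal.ofReal_toReal hQ,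
        ← ENNReal.ofReal_add ENNReal.toReal_nonneg (hI0 _ hφ0)]
      congr 1; linarith
    rw [hPe, mul_add, add_right_comm, add_assoc] at h
    rw [add_comm] at h
    have h' := (ENNReal.add_le_add_iff_left
      (ENNReal.mul_ne_top ENNReal.ofReal_ne_top hQ)).1 (h.trans (le_of_eq (by ring)) :
        ENNReal.ofReal (Λ ^ 2) * Q + _ ≤ ENNReal.ofReal (Λ ^ 2) * Q + (ENNReal.ofReal (Λ ^ 2) *
          ENNReal.ofReal (∫ x, F (v x) * η x ^ p * f x) +
          ENNReal.ofReal (Λ ^ 4) * ∫⁻ x, ∫⁻ y, ENNReal.ofReal (b x y) * J n s p x y))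
    simp only [zero_mul, ENNReal.ofReal_zero, lintegral_const, add_zero]
    rw [hI _ hφ0 hi, mul_add, add_comm (ENNReal.ofReal (Λ ^ 4) * _)]
    exact h'.trans (add_le_add_left (mul_le_mul_left hΛ24 _) _)
  · refine ⟨hv.neg, ?_⟩
    intro F k hF hF0 ρ hρ η hη b g hb hg hN
    have hφ0 : ∀ x, 0 ≤ F (-v x) * η x ^ p := fun x =>
      mul_nonneg (hF0 _) (Real.rpow_nonneg (hη.nonneg x) _)
    obtain ⟨P, Q, hP, hQ, hi, hPQ, h⟩ := weak_core hn hs hs1 hp hΛ hK hΦ hfc hfs hu hv he hΩ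
      (Or.inr rfl) hF hF0 hρ hη (φ := fun x => F (-v x) * η x ^ p)
      (fun x => by rw [neg_one_mul]) hb hg (by simpa only [neg_one_mul] using hN)
    have hQe : Q = P + ENNReal.ofReal (∫ x, F (-v x) * η x ^ p * f x) := by
      rw [← ENNReal.ofReal_toReal hP, ← ENNReal.ofReal_toReal hQ,
        ← ENNReal.ofReal_add ENNReal.toReal_nonneg (hI0 _ hφ0)]
      congr 1; linarith
    rw [hQe, mul_add, add_left_comm] at h
    have h' := (ENNReal.add_le_add_iff_left
      (ENNReal.mul_ne_top ENNReal.ofReal_ne_top hP)).1 h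
    simp only [zero_mul, ENNReal.ofReal_zero, lintegral_const, add_zero]
    rw [hI _ hφ0 hi]
    refine le_trans (add_le_add_right ?_ _) h'
    exact le_mul_of_one_le_left' (by
      rw [← ENNReal.ofReal_one]; exact ENNReal.ofReal_le_ofReal hΛ2)

end WeakToSub

section Scaled

variable {n : ℕ} {s p β Q : ℝ}

lemma ae_le_of_small_ball (P : Par n s p β Q) {L T : ℝ} (hL : 0 < L) (hT : 0 ≤ T) :
    ∃ κ : ℝ, 0 < κ ∧ ∀ (z : Rn n) (R : ℝ) (w : Rn n → ℝ) (a d : ℝ), 0 < R → 0 < d →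
      IsSub n s p L z R w (fun _ => 0) (fun _ => 0) →
      ∫⁻ x in ball z R, ENNReal.ofReal (max (w x - a) 0 ^ Q) ≤
        ENNReal.ofReal (κ * (R ^ n * d ^ Q)) →
      ∫⁻ y in (ball z R)ᶜ, ENNReal.ofReal (max (w y - a) 0 ^ (p - 1)) * J n s p z y ≤
        ENNReal.ofReal (T * (R ^ (-(s * p)) * d ^ (p - 1))) →
      ∀ᵐ x, x ∈ ball z (3 / 4 * R) → w x ≤ a + d := by
  obtain ⟨κ, hκ, h⟩ := ae_le_of_small P hL hT
  refine ⟨κ, hκ, ?_⟩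
  intro z R w a d hR hd hw hI hTl
  have h1 := h (fun x => (w (z + R • x) - a) / d) (by
    have := hw.affine hR a hd
    simpa only [mul_zero] using this) ?_ ?_
  · rw [← ae_affine z hR]
    filter_upwards [h1] with x hx hxb
    rw [mul_comm, affine_mem_ball hR] at hxb
    have := hx hxb
    rw [div_le_iff₀ hd] at this
    linarith
  · rw [setLIntegral_affine z hR measurableSet_ball, affine_ball hR, mul_comm κ, mul_assoc,
      ENNReal.ofReal_mul (by positivity)] at hI
    have hI' := (ENNReal.mul_le_mul_iff_right (by simpa using pow_pos hR n)
      ENNReal.ofReal_ne_top).1 hI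
    have e : ∀ x, ENNReal.ofReal (max (w (z + R • x) - a) 0 ^ Q) =
        ENNReal.ofReal (d ^ Q) * ENNReal.ofReal (max ((w (z + R • x) - a) / d) 0 ^ Q) := by
      intro x
      rw [← ENNReal.ofReal_mul (by positivity), ← Real.mul_rpow hd.le (le_max_right _ _),
        mul_max_of_nonneg _ _ hd.le, mul_zero, mul_div_cancel₀ _ hd.ne']
    simp_rw [e] at hI'
    rw [lintegral_const_mul' _ _ ENNReal.ofReal_ne_top, ENNReal.ofReal_mul (by positivity)] at hI'
    exact (ENNReal.mul_le_mul_iff_right (by simpa using Real.rpow_pos_of_pos hd Q)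
      ENNReal.ofReal_ne_top).1 hI'
  · rw [lintegral_tail_affine w z hR a hd, mul_comm T,
      ENNReal.ofReal_mul (p := _ * _) (by positivity)] at hTl
    refine (ENNReal.mul_le_mul_iff_right ?_ ENNReal.ofReal_ne_top).1 hTl
    rw [Ne, ENNReal.ofReal_eq_zero, not_le]
    positivity

lemma setLIntegral_rescale (z : Rn n) {R r c : ℝ} (hR : 0 < R) (hc : 0 < c) (f : Rn n → ℝ)
    {M : ℝ} (h : ∫⁻ x in ball 0 r, ENNReal.ofReal (c⁻¹ * f (z + R • x)) ≤ ENNReal.ofReal M) :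
    ∫⁻ x in ball z (R * r), ENNReal.ofReal (f x) ≤ ENNReal.ofReal (R ^ n * (c * M)) := by
  have hset : {x | z + R • x ∈ ball z (R * r)} = ball (0 : Rn n) r := by
    ext x
    rw [mem_ofPred_eq]
    exact affine_mem_ball (z := z) (x := x) (r := r) hR
  have e : ∀ x, ENNReal.ofReal (f (z + R • x)) =
      ENNReal.ofReal c * ENNReal.ofReal (c⁻¹ * f (z + R • x)) := by
    intro x
    rw [← ENNReal.ofReal_mul hc.le, mul_inv_cancel_left₀ hc.ne']
  have hRn : 0 ≤ R ^ n := by positivity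
  rw [setLIntegral_affine z hR measurableSet_ball, hset, ENNReal.ofReal_mul hRn,
    ENNReal.ofReal_mul hc.le, lintegral_congr e, lintegral_const_mul' _ _ ENNReal.ofReal_ne_top]
  gcongr

lemma low_ball_of_forall (P : Par n s p β Q) {L : ℝ} (hL : 0 < L) :
    ∃ C : ℝ, 0 < C ∧ ∀ (z : Rn n) (R : ℝ) (u f : Rn n → ℝ) (k d : ℝ), 0 < R → 0 < d →
      IsSup n s p L z R u f → (∀ x ∈ ball z R, k ≤ u x) →
      ∫⁻ y in (ball z R)ᶜ, ENNReal.ofReal (max (k - u y) 0 ^ (p - 1)) * J n s p z y ≤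
        ENNReal.ofReal (R ^ (-(s * p)) * d ^ (p - 1)) →
      (∀ᵐ x, x ∈ ball z (R * (1 / 3)) → k + d ≤ u x) ∨
        (∫⁻ x in ball z (R * (1 / 2)), ENNReal.ofReal (u x - k) ≤ ENNReal.ofReal (C * (R ^ n * d)) ∧
        ∫⁻ x in ball z (R * (3 / 8)), ENNReal.ofReal (f x) ≤
          ENNReal.ofReal (C * (R ^ ((n : ℝ) - s * p) * d ^ (p - 1)))) := by
  obtain ⟨C, hC, h⟩ := low_unit P hL
  refine ⟨C, hC, ?_⟩
  intro z R v f k d hR hd hvs hvk hT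
  have hsub := IsSub.affine hvs hR (-k) hd
  have hN : NormSup n s p L (fun x => (v (z + R • x) - k) / d)
      (fun x => R ^ (s * p) / d ^ (p - 1) * f (z + R • x)) := by
    have e : ∀ x, (-v (z + R • x) - -k) / d = -((v (z + R • x) - k) / d) := fun x => by ring
    refine ⟨?_, ?_, ?_⟩
    · unfold IsSup
      simpa only [mul_zero, e] using hsub
    · intro x hx
      have : z + R • x ∈ ball z R := by
        have := affine_mem_ball (z := z) (x := x) (r := 1) hR
        rw [mul_one] at this
        exact this.2 hx
      exact div_nonneg (sub_nonneg.2 (hvk _ this)) hd.le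
    · have h1 := lintegral_tail_affine (n := n) (s := s) (p := p) (fun x => -v x) z hR (-k) hd
      simp only [e] at h1
      have e2 : ∀ x, -v x - -k = k - v x := fun x => by ring
      simp only [e2] at h1
      rw [h1] at hT
      rw [ENNReal.ofReal_one]
      refine (ENNReal.mul_le_mul_iff_right (a := ENNReal.ofReal (R ^ (-(s * p)) * d ^ (p - 1)))
        ?_ ENNReal.ofReal_ne_top).1 (by rwa [mul_one])
      rw [Ne, ENNReal.ofReal_eq_zero, not_le]
      positivity
  rcases h _ _ hN with h1 | ⟨h1, h2⟩
  · left
    rw [← ae_affine z hR]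
    filter_upwards [h1] with x hx hxb
    rw [affine_mem_ball hR] at hxb
    have := hx hxb
    rw [le_div_iff₀ hd] at this
    linarith
  · right
    constructor
    · have := setLIntegral_rescale z (r := 1 / 2) hR hd (fun x => v x - k) (M := C)
        (by simpa only [inv_mul_eq_div] using h1)
      exact this.trans (le_of_eq (by congr 1; ring))
    · have hdp := Real.rpow_pos_of_pos hd (p - 1)
      have hRp := Real.rpow_pos_of_pos hR (s * p)
      have := setLIntegral_rescale z (r := 3 / 8) (c := d ^ (p - 1) / R ^ (s * p)) hR
        (by positivity) f (M := C) (by rwa [inv_div])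
      refine this.trans (le_of_eq ?_)
      congr 1
      rw [Real.rpow_sub hR, Real.rpow_natCast]
      field_simp

open Classical in
lemma low_ball (P : Par n s p β Q) {L : ℝ} (hL : 0 < L) :
    ∃ C : ℝ, 0 < C ∧ ∀ (z : Rn n) (R : ℝ) (u f : Rn n → ℝ) (k d : ℝ), 0 < R → 0 < d →
      IsSup n s p L z R u f → (∀ᵐ x, x ∈ ball z R → k ≤ u x) →
      ∫⁻ y in (ball z R)ᶜ, ENNReal.ofReal (max (k - u y) 0 ^ (p - 1)) * J n s p z y ≤
        ENNReal.ofReal (R ^ (-(s * p)) * d ^ (p - 1)) →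
      (∀ᵐ x, x ∈ ball z (R * (1 / 3)) → k + d ≤ u x) ∨
        (∫⁻ x in ball z (R * (1 / 2)), ENNReal.ofReal (u x - k) ≤ ENNReal.ofReal (C * (R ^ n * d)) ∧
        ∫⁻ x in ball z (R * (3 / 8)), ENNReal.ofReal (f x) ≤
          ENNReal.ofReal (C * (R ^ ((n : ℝ) - s * p) * d ^ (p - 1)))) := by
  obtain ⟨C, hC, h⟩ := low_ball_of_forall P hL
  refine ⟨C, hC, ?_⟩
  intro z R u f k d hR hd hu huk hT
  have hum := hu.measurable
  obtain ⟨v, hv⟩ : ∃ v : Rn n → ℝ, v = (ball z R).piecewise (fun x => max (u x) k) u := ⟨_, rfl⟩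
  have hvm : Measurable v := by
    rw [hv]
    exact (hum.max measurable_const).piecewise measurableSet_ball hum
  have hvu : v =ᵐ[volume] u := by
    filter_upwards [huk] with x hx
    by_cases hxb : x ∈ ball z R
    · rw [hv, piecewise_eq_of_mem _ _ _ hxb, max_eq_left (hx hxb)]
    · rw [hv, piecewise_eq_of_notMem _ _ _ hxb]
  have hvk : ∀ x ∈ ball z R, k ≤ v x := by
    intro x hx
    rw [hv, piecewise_eq_of_mem _ _ _ hx]
    exact le_max_right _ _
  have hvs : IsSup n s p L z R v f := by
    refine IsSub.congr hu hvm.neg ?_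
    filter_upwards [hvu] with x hx
    rw [hx]
  rcases h z R v f k d hR hd hvs hvk (by
    refine (le_of_eq ?_).trans hT
    apply lintegral_congr_ae
    filter_upwards [ae_restrict_of_ae hvu] with x hx
    rw [hx]) with h1 | ⟨h1, h2⟩
  · left
    filter_upwards [h1, hvu] with x hx hxe hxb
    rw [← hxe]; exact hx hxb
  · refine Or.inr ⟨(le_of_eq ?_).trans h1, h2⟩
    apply lintegral_congr_ae
    filter_upwards [ae_restrict_of_ae hvu] with x hx
    rw [hx]

end Scaled

section LowStep

variable {n : ℕ} {s p β Q : ℝ}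

lemma ofReal_max_sub_rpow_le {γ : ℝ} (hγ : 0 ≤ γ) (k a b : ℝ) :
    ENNReal.ofReal (max (k - b) 0 ^ γ) ≤ ENNReal.ofReal (2 ^ γ) *
      (ENNReal.ofReal (max (k - a) 0 ^ γ) + ENNReal.ofReal (|b - a| ^ γ)) := by
  rw [← ENNReal.ofReal_add (by positivity) (by positivity), ← ENNReal.ofReal_mul (by positivity)]
  apply ENNReal.ofReal_le_ofReal
  refine le_trans (Real.rpow_le_rpow (le_max_right _ _) ?_ hγ)
    (add_rpow_le hγ (le_max_right _ _) (abs_nonneg _))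
  have h1 := le_max_left (k - a) 0
  have h2 := le_max_right (k - a) 0
  have h3 := neg_abs_le (b - a)
  have h4 := abs_nonneg (b - a)
  exact max_le (by linarith) (by linarith)

lemma tail_transfer (hp : 1 < p) {z : Rn n} {R r k : ℝ} {u v : Rn n → ℝ}
    (hu : Measurable u) (huk : ∀ᵐ x, x ∈ ball z R → k ≤ u x) {M : ℝ}
    (hM : 0 ≤ M)
    (hT : ∫⁻ y in (ball z R)ᶜ, ENNReal.ofReal (max (k - u y) 0 ^ (p - 1)) * J n s p z y ≤
      ENNReal.ofReal M)
    (hD : ∫⁻ y in (ball z r)ᶜ, ENNReal.ofReal (|v y - u y| ^ (p - 1)) * J n s p z y ≤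
      ENNReal.ofReal M) :
    ∫⁻ y in (ball z r)ᶜ, ENNReal.ofReal (max (k - v y) 0 ^ (p - 1)) * J n s p z y ≤
      ENNReal.ofReal (2 ^ p * M) := by
  have hp0 : 0 < p - 1 := by linarith
  have hm1 : Measurable fun y => ENNReal.ofReal (max (k - u y) 0 ^ (p - 1)) * J n s p z y := by
    fun_prop
  have hsub : ∫⁻ y in (ball z r)ᶜ, ENNReal.ofReal (max (k - u y) 0 ^ (p - 1)) * J n s p z y ≤
      ∫⁻ y in (ball z R)ᶜ, ENNReal.ofReal (max (k - u y) 0 ^ (p - 1)) * J n s p z y := by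
    rw [← lintegral_indicator measurableSet_ball.compl,
      ← lintegral_indicator measurableSet_ball.compl]
    apply lintegral_mono_ae
    filter_upwards [huk] with x hx
    by_cases hxb : x ∈ ball z R
    · have h0 : ENNReal.ofReal (max (k - u x) 0 ^ (p - 1)) * J n s p z x = 0 := by
        rw [max_eq_right (sub_nonpos.2 (hx hxb)), Real.zero_rpow hp0.ne', ENNReal.ofReal_zero,
          zero_mul]
      refine (indicator_le_self' (fun _ _ => zero_le) x).trans ?_
      beta_reduce
      rw [h0]
      exact zero_le
    · rw [indicator_of_mem (s := (ball z R)ᶜ) hxb]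
      exact indicator_le_self _ _ _
  calc _ ≤ ∫⁻ y in (ball z r)ᶜ, ENNReal.ofReal (2 ^ (p - 1)) *
        (ENNReal.ofReal (max (k - u y) 0 ^ (p - 1)) * J n s p z y +
          ENNReal.ofReal (|v y - u y| ^ (p - 1)) * J n s p z y) := by
        apply lintegral_mono
        intro y
        beta_reduce
        rw [← add_mul, ← mul_assoc]
        exact mul_le_mul_left (ofReal_max_sub_rpow_le hp0.le k (u y) (v y)) _
    _ = ENNReal.ofReal (2 ^ (p - 1)) *
        ((∫⁻ y in (ball z r)ᶜ, ENNReal.ofReal (max (k - u y) 0 ^ (p - 1)) * J n s p z y) +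
          ∫⁻ y in (ball z r)ᶜ, ENNReal.ofReal (|v y - u y| ^ (p - 1)) * J n s p z y) := by
        rw [lintegral_const_mul' _ _ ENNReal.ofReal_ne_top, lintegral_add_left hm1]
    _ ≤ ENNReal.ofReal (2 ^ (p - 1)) * (ENNReal.ofReal M + ENNReal.ofReal M) :=
        mul_le_mul_right (add_le_add (hsub.trans hT) hD) _
    _ = _ := by
        rw [← ENNReal.ofReal_add hM hM, ← ENNReal.ofReal_mul (by positivity)]
        congr 1
        rw [Real.rpow_sub_one (by norm_num)]
        ring

/-- One step of the lower bound for functions close to one bounded from below. -/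
lemma low_step (P : Par n s p β Q) {L : ℝ} (hL : 0 < L) :
    ∃ C κ : ℝ, 0 < C ∧ 0 < κ ∧ ∀ (z : Rn n) (R : ℝ) (u v f : Rn n → ℝ) (k d : ℝ), 0 < R → 0 < d →
      Measurable u → IsSup n s p L z R v f → (∀ᵐ x, x ∈ ball z R → k ≤ u x) →
      ∫⁻ y in (ball z R)ᶜ, ENNReal.ofReal (max (k - u y) 0 ^ (p - 1)) * J n s p z y ≤
        ENNReal.ofReal (R ^ (-(s * p)) * d ^ (p - 1)) →
      ∫⁻ x in ball z R, ENNReal.ofReal (|v x - u x| ^ Q) ≤ ENNReal.ofReal (κ * (R ^ n * d ^ Q)) →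
      ∫⁻ y in (ball z (3 / 4 * R))ᶜ, ENNReal.ofReal (|v y - u y| ^ (p - 1)) * J n s p z y ≤
        ENNReal.ofReal (R ^ (-(s * p)) * d ^ (p - 1)) →
      (∀ᵐ x, x ∈ ball z (R / 4) → k + d ≤ v x) ∨
        (∫⁻ x in ball z (R / 4), ENNReal.ofReal (v x - (k - d)) ≤
          ENNReal.ofReal (C * (R ^ n * d)) ∧
        ∫⁻ x in ball z (R / 4), ENNReal.ofReal (f x) ≤
          ENNReal.ofReal (C * (R ^ ((n : ℝ) - s * p) * d ^ (p - 1)))) := by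
  have hp := P.hp
  have hs := P.hs
  have hspn := P.hspn
  have hp0 : 0 < p - 1 := by linarith
  have hQ0 : 0 < Q := by linarith [P.hQ1]
  obtain ⟨κ, hκ, hsmall⟩ := ae_le_of_small_ball P hL (show (0 : ℝ) ≤ 2 ^ p by positivity)
  obtain ⟨C, hC, hlow⟩ := low_ball P hL
  obtain ⟨M, hM⟩ : ∃ M : ℝ, M = 2 ^ (p / (p - 1)) := ⟨_, rfl⟩
  have hM2 : 2 ≤ M := by
    rw [hM]
    have : (2 : ℝ) ^ (1 : ℝ) ≤ 2 ^ (p / (p - 1)) :=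
      Real.rpow_le_rpow_of_exponent_le (by norm_num) (by rw [le_div_iff₀ hp0]; linarith)
    simpa using this
  have hMp : M ^ (p - 1) = 2 ^ p := by
    rw [hM, ← Real.rpow_mul (by norm_num), div_mul_cancel₀ _ hp0.ne']
  refine ⟨C * M + C * 2 ^ p, κ, by positivity, hκ, ?_⟩
  intro z R u v f k d hR hd hu hv huk hT hI hD
  have hvm := hv.measurable
  have hR0 : 0 ≤ R ^ (-(s * p)) * d ^ (p - 1) := by positivity
  have h34 : 3 / 4 * R ≤ R := by linarith
  have hvk := hsmall z R (fun x => -v x) (-k) d hR hd (IsSub.drop hv) (by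
    refine (lintegral_mono_ae ?_).trans hI
    filter_upwards [ae_restrict_of_ae huk, ae_restrict_mem measurableSet_ball] with x hx hxb
    apply ENNReal.ofReal_le_ofReal
    apply Real.rpow_le_rpow (le_max_right _ _) _ hQ0.le
    have := hx hxb
    have := neg_abs_le (v x - u x)
    exact max_le (by linarith) (abs_nonneg _)) (by
    have := tail_transfer hp hu huk hR0 hT
      ((lintegral_mono_set (compl_subset_compl.2 (ball_subset_ball h34))).trans hD)
    have e : ∀ y, -v y - -k = k - v y := fun y => by ring
    simpa only [e] using this)
  have hvk' : ∀ᵐ x, x ∈ ball z (3 / 4 * R) → k - d ≤ v x := by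
    filter_upwards [hvk] with x hx hxb
    linarith [hx hxb]
  have hR' : 0 < 3 / 4 * R := by positivity
  have h4 : 3 / 4 * R * (1 / 3) = R / 4 := by ring
  have hb1 : R / 4 ≤ 3 / 4 * R * (1 / 2) := by linarith
  have hb2 : R / 4 ≤ 3 / 4 * R * (3 / 8) := by linarith
  have key := hlow z (3 / 4 * R) v f (k - d) (M * d) hR' (by positivity)
    (IsSub.mono hv (by rw [sub_self, norm_zero]; linarith)) hvk' (by
      refine (lintegral_mono fun y => ?_).trans
        ((tail_transfer hp hu huk hR0 hT hD).trans (ENNReal.ofReal_le_ofReal ?_))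
      · gcongr
        linarith
      · rw [Real.mul_rpow (by linarith) hd.le, hMp, Real.mul_rpow (by norm_num) hR.le]
        have : (1 : ℝ) ≤ (3 / 4) ^ (-(s * p)) :=
          Real.one_le_rpow_of_pos_of_le_one_of_nonpos (by norm_num) (by norm_num)
            (by have := mul_pos hs (by linarith : 0 < p); linarith)
        calc 2 ^ p * (R ^ (-(s * p)) * d ^ (p - 1))
            = 1 * (2 ^ p * (R ^ (-(s * p)) * d ^ (p - 1))) := (one_mul _).symm
          _ ≤ (3 / 4) ^ (-(s * p)) * (2 ^ p * (R ^ (-(s * p)) * d ^ (p - 1))) := by gcongr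
          _ = _ := by ring)
  rw [h4] at key
  rcases key with h1 | ⟨h1, h2⟩
  · left
    filter_upwards [h1] with x hx hxb
    have := hx hxb
    nlinarith
  · right
    constructor
    · refine (lintegral_mono_set (ball_subset_ball hb1)).trans (h1.trans
        (ENNReal.ofReal_le_ofReal ?_))
      have : (3 / 4 * R) ^ n ≤ R ^ n := pow_le_pow_left₀ (by positivity) h34 n
      calc C * ((3 / 4 * R) ^ n * (M * d)) ≤ C * (R ^ n * (M * d)) := by gcongr
        _ = C * M * (R ^ n * d) := by ring
        _ ≤ _ := by gcongr; linarith [show 0 < C * 2 ^ p by positivity]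
    · refine (lintegral_mono_set (ball_subset_ball hb2)).trans (h2.trans
        (ENNReal.ofReal_le_ofReal ?_))
      have : (3 / 4 * R) ^ ((n : ℝ) - s * p) ≤ R ^ ((n : ℝ) - s * p) :=
        Real.rpow_le_rpow (by positivity) h34 (by linarith)
      rw [Real.mul_rpow (by linarith) hd.le, hMp]
      calc C * ((3 / 4 * R) ^ ((n : ℝ) - s * p) * (2 ^ p * d ^ (p - 1)))
          ≤ C * (R ^ ((n : ℝ) - s * p) * (2 ^ p * d ^ (p - 1))) := by gcongr
        _ = C * 2 ^ p * (R ^ ((n : ℝ) - s * p) * d ^ (p - 1)) := by ring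
        _ ≤ _ := by gcongr; nlinarith

end LowStep

/-- `u` is a limit of functions `v j` with `(-Δ_p)^s v j ≈ f j` in `Ω`, where `f j → ν`. -/
structure Lim (n : ℕ) (s p Q L : ℝ) (Ω : Set (Rn n)) (ν : Measure (Rn n)) (u : Rn n → ℝ)
    (v f : ℕ → Rn n → ℝ) : Prop where
  meas : Measurable u
  sub : ∀ j z R, ball z R ⊆ Ω → IsSub n s p L z R (v j) (f j) (fun _ => 0)
  sup : ∀ j z R, ball z R ⊆ Ω → IsSup n s p L z R (v j) (f j)
  conv : ∀ z r, 0 < r → Tendsto (fun j => ∫⁻ x in ball z r, ENNReal.ofReal (|v j x - u x| ^ Q))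
    atTop (𝓝 0)
  tail_conv : ∀ z r, 0 < r → Tendsto (fun j => ∫⁻ y in (ball z r)ᶜ,
    ENNReal.ofReal (|v j y - u y| ^ (p - 1)) * J n s p z y) atTop (𝓝 0)
  fin : ∀ z r, 0 < r → ∫⁻ x in ball z r, ENNReal.ofReal (|u x| ^ Q) < ⊤
  tail_fin : ∀ z r, 0 < r →
    ∫⁻ y in (ball z r)ᶜ, ENNReal.ofReal (|u y| ^ (p - 1)) * J n s p z y < ⊤
  lower : ∀ z r, 0 < r → ball z r ⊆ Ω →
    ν (ball z r) ≤ liminf (fun j => ∫⁻ x in ball z r, ENNReal.ofReal (f j x)) atTop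
  upper : ∀ z r, 0 < r →
    limsup (fun j => ∫⁻ x in ball z r, ENNReal.ofReal (f j x)) atTop ≤ ν (closedBall z r)

section LowLimit

variable {n : ℕ} {s p β Q : ℝ}

lemma eventually_le_ofReal {F : ℕ → ℝ≥0∞} (hF : Tendsto F atTop (𝓝 0)) {c : ℝ} (hc : 0 < c) :
    ∀ᶠ j in atTop, F j ≤ ENNReal.ofReal c :=
  hF.eventually (eventually_le_nhds (ENNReal.ofReal_pos.2 hc))

/-- Lower bounds pass to `L^Q` limits. -/
lemma ae_le_of_frequently (hQ : 0 < Q) {S : Set (Rn n)} (hS : MeasurableSet S) {u : Rn n → ℝ}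
    {v : ℕ → Rn n → ℝ} (hu : Measurable u)
    (hc : Tendsto (fun j => ∫⁻ x in S, ENNReal.ofReal (|v j x - u x| ^ Q)) atTop (𝓝 0)) {k : ℝ}
    (h : ∃ᶠ j in atTop, ∀ᵐ x, x ∈ S → k ≤ v j x) : ∀ᵐ x, x ∈ S → k ≤ u x := by
  have h0 : ∫⁻ x in S, ENNReal.ofReal (max (k - u x) 0 ^ Q) = 0 := by
    apply le_antisymm _ zero_le
    refine ge_of_tendsto_of_frequently hc (h.mono fun j hj => ?_)
    apply lintegral_mono_ae
    filter_upwards [ae_restrict_of_ae hj, ae_restrict_mem hS] with x hx hxS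
    apply ENNReal.ofReal_le_ofReal
    apply Real.rpow_le_rpow (le_max_right _ _) _ hQ.le
    have := hx hxS
    have := le_abs_self (v j x - u x)
    exact max_le (by linarith) (abs_nonneg _)
  rw [lintegral_eq_zero_iff (by fun_prop)] at h0
  have h1 := (ae_restrict_iff' hS).1 h0
  filter_upwards [h1] with x hx hxS
  have h2 := hx hxS
  simp only [Pi.zero_apply, ENNReal.ofReal_eq_zero] at h2
  by_contra! hlt
  have : 0 < max (k - u x) 0 := lt_max_of_lt_left (by linarith)
  linarith [Real.rpow_pos_of_pos this Q]

lemma abs_le_add_rpow (hQ : 1 ≤ Q) {d : ℝ} (hd : 0 < d) (t : ℝ) :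
    |t| ≤ d + d / d ^ Q * |t| ^ Q := by
  have hdQ := Real.rpow_pos_of_pos hd Q
  rcases le_total |t| d with h | h
  · have : 0 ≤ d / d ^ Q * |t| ^ Q := by positivity
    linarith
  · have h1 : |t| / d ≤ (|t| / d) ^ Q := by
      have := Real.rpow_le_rpow_of_exponent_le ((one_le_div hd).2 h) hQ
      rwa [Real.rpow_one] at this
    rw [Real.div_rpow (abs_nonneg _) hd.le, div_le_iff₀ hd] at h1
    have : d / d ^ Q * |t| ^ Q = |t| ^ Q / d ^ Q * d := by ring
    linarith

lemma low_limit (P : Par n s p β Q) {L : ℝ} (hL : 0 < L) :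
    ∃ C : ℝ, 0 < C ∧ ∀ (Ω : Set (Rn n)) (ν : Measure (Rn n)) (u : Rn n → ℝ) (v f : ℕ → Rn n → ℝ),
      Lim n s p Q L Ω ν u v f → ∀ (z : Rn n) (R k d : ℝ), 0 < R → 0 < d → ball z R ⊆ Ω →
      (∀ᵐ x, x ∈ ball z R → k ≤ u x) →
      ∫⁻ y in (ball z R)ᶜ, ENNReal.ofReal (max (k - u y) 0 ^ (p - 1)) * J n s p z y ≤
        ENNReal.ofReal (R ^ (-(s * p)) * d ^ (p - 1)) →
      (∀ᵐ x, x ∈ ball z (R / 4) → k + d ≤ u x) ∨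
        (∫⁻ x in ball z (R / 4), ENNReal.ofReal (u x - k) ≤ ENNReal.ofReal (C * (R ^ n * d)) ∧
        ν (ball z (R / 4)) ≤ ENNReal.ofReal (C * (R ^ ((n : ℝ) - s * p) * d ^ (p - 1)))) := by
  obtain ⟨C, κ, hC, hκ, hstep⟩ := low_step P hL
  have hQ0 : 0 < Q := by linarith [P.hQ1]
  refine ⟨C + 1, by positivity, ?_⟩
  intro Ω ν u v f H z R k d hR hd hΩ huk hT
  have hR4 : 0 < R / 4 := by positivity
  have hRR : R / 4 ≤ R := by linarith
  have hb4 := ball_subset_ball (x := z) hRR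
  have hev := (eventually_le_ofReal (H.conv z R hR) (show 0 < κ * (R ^ n * d ^ Q) by positivity)).and
    (eventually_le_ofReal (H.tail_conv z (3 / 4 * R) (by positivity))
      (show 0 < R ^ (-(s * p)) * d ^ (p - 1) by positivity))
  by_cases hfr : ∃ᶠ j in atTop, ∀ᵐ x, x ∈ ball z (R / 4) → k + d ≤ v j x
  · exact Or.inl (ae_le_of_frequently hQ0 measurableSet_ball H.meas (H.conv z _ hR4) hfr)
  right
  rw [not_frequently] at hfr
  have hev2 : ∀ᶠ j in atTop, ∫⁻ x in ball z (R / 4), ENNReal.ofReal (v j x - (k - d)) ≤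
          ENNReal.ofReal (C * (R ^ n * d)) ∧
        ∫⁻ x in ball z (R / 4), ENNReal.ofReal (f j x) ≤
          ENNReal.ofReal (C * (R ^ ((n : ℝ) - s * p) * d ^ (p - 1))) := by
    filter_upwards [hev, hfr] with j hj hj'
    exact (hstep z R u (v j) (f j) k d hR hd H.meas (H.sup j z R hΩ) huk hT hj.1 hj.2).resolve_left
      hj'
  constructor
  · obtain ⟨j, ⟨hj1, -⟩, hj2⟩ := (hev2.and
      (eventually_le_ofReal (H.conv z R hR) (show 0 < R ^ n * d ^ Q by positivity))).exists
    have hvm : Measurable (v j) := (H.sub j z R hΩ).meas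
    have hum := H.meas
    have hdQ := Real.rpow_pos_of_pos hd Q
    calc ∫⁻ x in ball z (R / 4), ENNReal.ofReal (u x - k)
        ≤ ∫⁻ x in ball z (R / 4), (ENNReal.ofReal (v j x - (k - d)) +
          ENNReal.ofReal (d / d ^ Q) * ENNReal.ofReal (|v j x - u x| ^ Q)) := by
          apply lintegral_mono
          intro x
          beta_reduce
          rw [← ENNReal.ofReal_mul (by positivity)]
          refine le_trans (ENNReal.ofReal_le_ofReal ?_) ENNReal.ofReal_add_le
          have h1 := abs_le_add_rpow P.hQ1 hd (v j x - u x)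
          have h2 := neg_abs_le (v j x - u x)
          linarith
      _ = (∫⁻ x in ball z (R / 4), ENNReal.ofReal (v j x - (k - d))) +
          ENNReal.ofReal (d / d ^ Q) * ∫⁻ x in ball z (R / 4), ENNReal.ofReal (|v j x - u x| ^ Q) := by
          rw [← lintegral_const_mul' _ _ ENNReal.ofReal_ne_top]
          exact lintegral_add_left (by fun_prop) _
      _ ≤ ENNReal.ofReal (C * (R ^ n * d)) +
          ENNReal.ofReal (d / d ^ Q) * ENNReal.ofReal (R ^ n * d ^ Q) :=
          add_le_add hj1 (mul_le_mul_right ((lintegral_mono_set hb4).trans hj2) _)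
      _ ≤ _ := by
          rw [← ENNReal.ofReal_mul (by positivity), ← ENNReal.ofReal_add (by positivity)
            (by positivity)]
          apply ENNReal.ofReal_le_ofReal
          have e : d / d ^ Q * (R ^ n * d ^ Q) = R ^ n * d := by field_simp
          rw [e]
          linarith
  · refine (H.lower z _ hR4 (hb4.trans hΩ)).trans ?_
    refine (liminf_le_of_frequently_le' (hev2.mono fun j hj => hj.2).frequently).trans ?_
    apply ENNReal.ofReal_le_ofReal
    gcongr
    linarith

end LowLimit

section UpLimit

variable {n : ℕ} {s p β Q : ℝ}

lemma ofReal_abs_rpow_le {γ : ℝ} (hγ : 0 ≤ γ) (a b : ℝ) :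
    ENNReal.ofReal (|b| ^ γ) ≤ ENNReal.ofReal (2 ^ γ) *
      (ENNReal.ofReal (|a| ^ γ) + ENNReal.ofReal (|b - a| ^ γ)) := by
  rw [← ENNReal.ofReal_add (by positivity) (by positivity), ← ENNReal.ofReal_mul (by positivity)]
  apply ENNReal.ofReal_le_ofReal
  refine le_trans (Real.rpow_le_rpow (abs_nonneg _) ?_ hγ) (add_rpow_le hγ (abs_nonneg _)
    (abs_nonneg _))
  have := abs_add_le a (b - a)
  rwa [add_sub_cancel] at this

lemma lintegral_abs_rpow_transfer {γ : ℝ} (hγ : 0 ≤ γ) {S : Set (Rn n)} {u v : Rn n → ℝ}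
    {ω : Rn n → ℝ≥0∞} (hu : Measurable u) (hω : Measurable ω) {A B : ℝ} (hA : 0 ≤ A) (hB : 0 ≤ B)
    (h1 : ∫⁻ x in S, ENNReal.ofReal (|u x| ^ γ) * ω x ≤ ENNReal.ofReal A)
    (h2 : ∫⁻ x in S, ENNReal.ofReal (|v x - u x| ^ γ) * ω x ≤ ENNReal.ofReal B) :
    ∫⁻ x in S, ENNReal.ofReal (|v x| ^ γ) * ω x ≤ ENNReal.ofReal (2 ^ γ * (A + B)) := by
  calc _ ≤ ∫⁻ x in S, ENNReal.ofReal (2 ^ γ) *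
        (ENNReal.ofReal (|u x| ^ γ) * ω x + ENNReal.ofReal (|v x - u x| ^ γ) * ω x) := by
        apply lintegral_mono
        intro y
        beta_reduce
        rw [← add_mul, ← mul_assoc]
        exact mul_le_mul_left (ofReal_abs_rpow_le hγ (u y) (v y)) _
    _ = ENNReal.ofReal (2 ^ γ) * ((∫⁻ x in S, ENNReal.ofReal (|u x| ^ γ) * ω x) +
          ∫⁻ x in S, ENNReal.ofReal (|v x - u x| ^ γ) * ω x) := by
        rw [lintegral_const_mul' _ _ ENNReal.ofReal_ne_top]
        congr 1
        exact lintegral_add_left (by fun_prop) _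
    _ ≤ _ := by
        rw [ENNReal.ofReal_mul (by positivity), ENNReal.ofReal_add hA hB]
        gcongr

/-- The conclusion of the upper iteration for functions close to `u`. -/
lemma up_step (P : Par n s p β Q) {L : ℝ} (hL : 0 < L) :
    ∃ κ : ℝ, 0 < κ ∧ ∀ (z : Rn n) (R : ℝ) (u v f : Rn n → ℝ) (d : ℕ → ℝ) (N : ℕ), 0 < R →
      Measurable u → IsSub n s p L z R v f (fun _ => 0) → (∀ k, 0 < d k) →
      (∀ k, lam s p * d k ≤ d (k + 1)) →
      ∫⁻ x in ball z R, ENNReal.ofReal (|u x| ^ Q) ≤ ENNReal.ofReal (κ * (R ^ n * d 0 ^ Q)) →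
      ∫⁻ x in ball z R, ENNReal.ofReal (|v x - u x| ^ Q) ≤ ENNReal.ofReal (κ * (R ^ n * d 0 ^ Q)) →
      ∫⁻ y in (ball z R)ᶜ, ENNReal.ofReal (|u y| ^ (p - 1)) * J n s p z y ≤
        ENNReal.ofReal (R ^ (-(s * p)) * d 0 ^ (p - 1)) →
      ∫⁻ y in (ball z R)ᶜ, ENNReal.ofReal (|v y - u y| ^ (p - 1)) * J n s p z y ≤
        ENNReal.ofReal (R ^ (-(s * p)) * d 0 ^ (p - 1)) →
      (∀ k < N, ∫⁻ x in ball z (R / 2 ^ k), ENNReal.ofReal (f x) ≤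
        ENNReal.ofReal (2 * κ * ((R / 2 ^ k) ^ ((n : ℝ) - s * p) * d k ^ (p - 1)))) →
      volume (ball z (R / 2 ^ N) ∩ {x | d 0 + ∑ i ∈ Finset.range N, d i < v x}) ≤
        ENNReal.ofReal (omega n / 2 * (R / 2 ^ N) ^ n) := by
  have hp := P.hp
  have hp0 : 0 < p - 1 := by linarith
  have hQ0 : 0 < Q := by linarith [P.hQ1]
  have hω := omega_pos n
  obtain ⟨κ₀, hκ₀, hit⟩ := up_iter P hL (show (0 : ℝ) < 2 ^ p by positivity)
  obtain ⟨κ₁, hκ₁⟩ : ∃ κ₁ : ℝ, κ₁ = min κ₀ (omega n / 2) := ⟨_, rfl⟩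
  have h1 : 0 < κ₁ := by rw [hκ₁]; exact lt_min hκ₀ (by positivity)
  have h1a : κ₁ ≤ κ₀ := hκ₁ ▸ min_le_left _ _
  have h1b : κ₁ ≤ omega n / 2 := hκ₁ ▸ min_le_right _ _
  have h2Q : (1 : ℝ) ≤ 2 ^ Q := Real.one_le_rpow (by norm_num) hQ0.le
  refine ⟨κ₁ / (2 * 2 ^ Q), by positivity, ?_⟩
  intro z R u v f d N hR hu hv hd hdl hI hI' hT hT' hf
  have hd0 := hd 0
  have hvm := hv.meas
  obtain ⟨a, ha⟩ : ∃ a : ℕ → ℝ, a = fun k => d 0 + ∑ i ∈ Finset.range k, d i := ⟨_, rfl⟩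
  have ha0 : a 0 = d 0 := by rw [ha]; simp
  have haN : a N = d 0 + ∑ i ∈ Finset.range N, d i := by rw [ha]
  have key := hit z R v f κ₁ a d N hR h1 h1a hv hd hdl
    (fun k => by rw [ha]; simp only [Finset.sum_range_succ]; ring) ?_ ?_ ?_ N le_rfl
  · rw [← haN]
    refine (volume_le_of_posPow P hvm (hd N) key).trans (ENNReal.ofReal_le_ofReal ?_)
    gcongr
  · rw [ha0]
    have hdQ := Real.rpow_pos_of_pos hd0 Q
    obtain ⟨B, hB⟩ : ∃ B : ℝ, B = κ₁ / (2 * 2 ^ Q) * (R ^ n * d 0 ^ Q) := ⟨_, rfl⟩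
    have hB0 : 0 ≤ B := by rw [hB]; positivity
    rw [← hB] at hI hI'
    have h3 := lintegral_abs_rpow_transfer (S := ball z R) (v := v) (ω := fun _ => 1)
      (A := B) (B := B) hQ0.le hu measurable_const
      hB0 hB0 (by simpa only [mul_one] using hI) (by simpa only [mul_one] using hI')
    simp only [mul_one] at h3
    calc _ ≤ ∫⁻ x in ball z R, ENNReal.ofReal ((d 0 ^ Q)⁻¹) * ENNReal.ofReal (|v x| ^ Q) := by
          refine (setLIntegral_mono' (measurableSet_ball.inter (measurableSet_lt measurable_const
            hvm)) ?_).trans (lintegral_mono_set inter_subset_left)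
          rintro x ⟨-, hx⟩
          rw [mem_ofPred_eq] at hx
          rw [← ENNReal.ofReal_mul (by positivity)]
          apply ENNReal.ofReal_le_ofReal
          have e : 1 + (v x - d 0) / d 0 = v x / d 0 := by
            rw [one_add_div hd0.ne', add_sub_cancel]
          rw [e, Real.div_rpow (by linarith) hd0.le, div_eq_inv_mul, abs_of_pos (by linarith)]
      _ ≤ ENNReal.ofReal ((d 0 ^ Q)⁻¹) * ENNReal.ofReal (2 ^ Q * (B + B)) := by
          rw [lintegral_const_mul' _ _ ENNReal.ofReal_ne_top]
          exact mul_le_mul_right h3 _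
      _ ≤ _ := by
          rw [← ENNReal.ofReal_mul (by positivity)]
          apply ENNReal.ofReal_le_ofReal
          apply le_of_eq
          rw [hB]
          field_simp
          norm_num
  · have h3 := lintegral_abs_rpow_transfer hp0.le hu (by fun_prop) (by positivity)
      (by positivity) hT hT'
    refine (lintegral_mono fun y => ?_).trans (h3.trans (ENNReal.ofReal_le_ofReal ?_))
    · gcongr
      refine max_le ?_ (abs_nonneg _)
      linarith [le_abs_self (v y)]
    · apply le_of_eq
      rw [Real.rpow_sub_one (by norm_num) p]
      ring
  · intro k hk
    refine (hf k hk).trans (ENNReal.ofReal_le_ofReal ?_)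
    have := hd k
    gcongr
    have h4 : 2 * (κ₁ / (2 * 2 ^ Q)) = κ₁ / 2 ^ Q := by field_simp
    rw [h4]
    exact div_le_self h1.le h2Q

lemma up_limit (P : Par n s p β Q) {L : ℝ} (hL : 0 < L) :
    ∃ κ : ℝ, 0 < κ ∧ ∀ (Ω : Set (Rn n)) (ν : Measure (Rn n)) (u : Rn n → ℝ) (v f : ℕ → Rn n → ℝ),
      Lim n s p Q L Ω ν u v f → ∀ (z : Rn n) (R : ℝ) (d : ℕ → ℝ), 0 < R → ball z R ⊆ Ω →
      (∀ k, 0 < d k) → (∀ k, lam s p * d k ≤ d (k + 1)) →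
      ∫⁻ x in ball z R, ENNReal.ofReal (|u x| ^ Q) ≤ ENNReal.ofReal (κ * (R ^ n * d 0 ^ Q)) →
      ∫⁻ y in (ball z R)ᶜ, ENNReal.ofReal (|u y| ^ (p - 1)) * J n s p z y ≤
        ENNReal.ofReal (R ^ (-(s * p)) * d 0 ^ (p - 1)) →
      (∀ k, ν (closedBall z (R / 2 ^ k)) ≤
        ENNReal.ofReal (κ * ((R / 2 ^ k) ^ ((n : ℝ) - s * p) * d k ^ (p - 1)))) →
      ∀ N m, (∀ᵐ x, x ∈ ball z (R / 2 ^ N) → m ≤ u x) →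
        m ≤ d 0 + ∑ i ∈ Finset.range N, d i := by
  obtain ⟨κ, hκ, hstep⟩ := up_step P hL
  have hQ0 : 0 < Q := by linarith [P.hQ1]
  have hω := omega_pos n
  refine ⟨κ, hκ, ?_⟩
  intro Ω ν u v f H z R d hR hΩ hd hdl hI hT hν N m hm
  have hd0 := hd 0
  by_contra! hlt
  obtain ⟨a, ha⟩ : ∃ a : ℝ, a = d 0 + ∑ i ∈ Finset.range N, d i := ⟨_, rfl⟩
  rw [← ha] at hlt
  have hε : 0 < (m - a) ^ Q := Real.rpow_pos_of_pos (by linarith) Q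
  have hRN : 0 < R / 2 ^ N := by positivity
  have hf : ∀ᶠ j in atTop, ∀ k < N, ∫⁻ x in ball z (R / 2 ^ k), ENNReal.ofReal (f j x) ≤
        ENNReal.ofReal (2 * κ * ((R / 2 ^ k) ^ ((n : ℝ) - s * p) * d k ^ (p - 1))) := by
    have : ∀ᶠ j in atTop, ∀ k ∈ Finset.range N, ∫⁻ x in ball z (R / 2 ^ k),
        ENNReal.ofReal (f j x) ≤
        ENNReal.ofReal (2 * κ * ((R / 2 ^ k) ^ ((n : ℝ) - s * p) * d k ^ (p - 1))) := by
      rw [Filter.eventually_all_finset]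
      intro k _
      have hRk : 0 < R / 2 ^ k := by positivity
      have hdk := hd k
      have hX : 0 < κ * ((R / 2 ^ k) ^ ((n : ℝ) - s * p) * d k ^ (p - 1)) := by positivity
      refine (eventually_lt_of_limsup_lt (((H.upper z _ hRk).trans (hν k)).trans_lt
        ((ENNReal.ofReal_lt_ofReal_iff ?_).2 ?_))).mono fun j hj => hj.le
      · linarith
      · linarith
    exact this.mono fun j hj k hk => hj k (Finset.mem_range.2 hk)
  obtain ⟨j, ⟨⟨⟨hj1, hj2⟩, hj3⟩, hj4⟩⟩ := ((((eventually_le_ofReal (H.conv z R hR)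
    (show 0 < κ * (R ^ n * d 0 ^ Q) by positivity)).and
    (eventually_le_ofReal (H.tail_conv z R hR)
      (show 0 < R ^ (-(s * p)) * d 0 ^ (p - 1) by positivity))).and hf).and
    (eventually_le_ofReal (H.conv z _ hRN)
      (show 0 < (m - a) ^ Q * (omega n / 4 * (R / 2 ^ N) ^ n) by positivity))).exists
  have hv := H.sub j z R hΩ
  have hvm := hv.meas
  have hvol := hstep z R u (v j) (f j) d N hR H.meas hv hd hdl hI hj1 hT hj2 hj3
  rw [← ha] at hvol
  have hS : MeasurableSet {x | a < v j x} := measurableSet_lt measurable_const hvm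
  have hlow : ENNReal.ofReal ((m - a) ^ Q) * volume (ball z (R / 2 ^ N) \ {x | a < v j x}) ≤
      ENNReal.ofReal ((m - a) ^ Q * (omega n / 4 * (R / 2 ^ N) ^ n)) := by
    refine le_trans ?_ hj4
    rw [← setLIntegral_const (ball z (R / 2 ^ N) \ {x | a < v j x})]
    refine le_trans ?_ (lintegral_mono_set (show ball z (R / 2 ^ N) \ {x | a < v j x} ⊆
      ball z (R / 2 ^ N) from fun x hx => hx.1))
    apply lintegral_mono_ae
    filter_upwards [ae_restrict_of_ae hm, ae_restrict_mem (measurableSet_ball.diff hS)]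
      with x hx hxS
    apply ENNReal.ofReal_le_ofReal
    apply Real.rpow_le_rpow (by linarith) _ hQ0.le
    have h1 := hx hxS.1
    have h2 : v j x ≤ a := not_lt.1 hxS.2
    have := neg_abs_le (v j x - u x)
    linarith
  rw [ENNReal.ofReal_mul hε.le] at hlow
  have hlow' := (ENNReal.mul_le_mul_iff_right (by simpa using hε) ENNReal.ofReal_ne_top).1 hlow
  have htot := measure_inter_add_sdiff (μ := volume) (ball z (R / 2 ^ N)) hS
  have hle := add_le_add hvol hlow'
  rw [htot, volume_ball_eq P.hn z hRN.le, ← ENNReal.ofReal_add (by positivity) (by positivity),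
    ENNReal.ofReal_le_ofReal_iff (by positivity)] at hle
  have : 0 < omega n * (R / 2 ^ N) ^ n := by positivity
  linarith

end UpLimit

section Tail

variable {n : ℕ} {s p : ℝ}

/-- A contraction inequality for `γ`-th powers. -/
lemma exists_mul_rpow_add_le {γ A : ℝ} (K : ℝ) (hγ : 0 < γ) (hA : 0 < A) (hA1 : A < 1)
    (hK : 0 < K) : ∃ l C : ℝ, 0 < l ∧ l < 1 ∧ 0 < C ∧ ∀ d e : ℝ, 0 ≤ d → 0 ≤ e →
      A * d ^ γ + K * e ^ γ ≤ (l * d + C * e) ^ γ := by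
  obtain ⟨B, hB⟩ : ∃ B : ℝ, B = (A + 1) / 2 := ⟨_, rfl⟩
  have hB0 : 0 < B := by linarith
  have hAB : 0 < B - A := by linarith
  obtain ⟨M, hM⟩ : ∃ M : ℝ, M = A * (K / (B - A)) + K := ⟨_, rfl⟩
  have hM0 : 0 < M := by rw [hM]; positivity
  have hl : (B ^ (1 / γ)) ^ γ = B := by
    rw [← Real.rpow_mul hB0.le, one_div_mul_cancel hγ.ne', Real.rpow_one]
  have hC : (M ^ (1 / γ)) ^ γ = M := by
    rw [← Real.rpow_mul hM0.le, one_div_mul_cancel hγ.ne', Real.rpow_one]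
  refine ⟨B ^ (1 / γ), M ^ (1 / γ), by positivity,
    Real.rpow_lt_one hB0.le (by linarith) (by positivity), by positivity, ?_⟩
  intro d e hd he
  have hde := Real.rpow_nonneg hd γ
  have hee := Real.rpow_nonneg he γ
  have h1 : 0 ≤ B ^ (1 / γ) * d := by positivity
  have h2 : 0 ≤ M ^ (1 / γ) * e := by positivity
  rcases le_total (K * e ^ γ) ((B - A) * d ^ γ) with h | h
  · have h3 : (B ^ (1 / γ) * d) ^ γ ≤ (B ^ (1 / γ) * d + M ^ (1 / γ) * e) ^ γ :=
      Real.rpow_le_rpow h1 (by linarith) hγ.le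
    rw [Real.mul_rpow (by positivity) hd, hl] at h3
    linarith
  · have h3 : (M ^ (1 / γ) * e) ^ γ ≤ (B ^ (1 / γ) * d + M ^ (1 / γ) * e) ^ γ :=
      Real.rpow_le_rpow h2 (by linarith) hγ.le
    rw [Real.mul_rpow (by positivity) he, hC] at h3
    have h4 : d ^ γ ≤ K / (B - A) * e ^ γ := by
      rw [div_mul_eq_mul_div, le_div_iff₀ hAB]
      linarith
    have h5 := mul_le_mul_of_nonneg_left h4 hA.le
    have h6 : M * e ^ γ = A * (K / (B - A) * e ^ γ) + K * e ^ γ := by rw [hM]; ring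
    linarith

lemma exists_lintegral_compl_ball_J_le (hn : 2 ≤ n) (hs : 0 < s) (hs1 : s < 1) (hp : 0 < p) :
    ∃ C : ℝ, 0 < C ∧ ∀ (z : Rn n) (r : ℝ), 0 < r →
      ∫⁻ y in (ball z r)ᶜ, J n s p z y ≤ ENNReal.ofReal (C * r ^ (-(s * p))) := by
  obtain ⟨C, hC, h⟩ := lintegral_compl_J_le (n := n) hn hs hs1 hp
  refine ⟨C, hC, fun z r hr => ?_⟩
  have h1 := h 1 one_pos le_rfl
  rw [inv_one, Real.one_rpow, mul_one] at h1
  rw [← lintegral_indicator measurableSet_ball.compl, lintegral_affine z hr]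
  have e : ∀ x : Rn n, (ball z r)ᶜ.indicator (fun y => J n s p z y) (z + r • x) =
      ENNReal.ofReal (r ^ (-((n : ℝ) + s * p))) *
        {y : Rn n | 1 ≤ ‖y‖}.indicator (fun y => J n s p 0 y) x := by
    intro x
    have hm : z + r • x ∈ (ball z r)ᶜ ↔ x ∈ {y : Rn n | 1 ≤ ‖y‖} := by
      have := affine_mem_ball (z := z) (x := x) (r := 1) hr
      rw [mul_one] at this
      rw [mem_compl_iff, this, mem_ball_zero_iff, not_lt, mem_ofPred_eq]
    by_cases hx : x ∈ {y : Rn n | 1 ≤ ‖y‖}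
    · rw [indicator_of_mem hx, indicator_of_mem (hm.2 hx)]
      have := J_affine (s := s) (p := p) z 0 x hr
      rwa [smul_zero, add_zero] at this
    · rw [indicator_of_notMem hx, indicator_of_notMem (fun h => hx (hm.1 h)), mul_zero]
  simp_rw [e]
  rw [lintegral_const_mul' _ _ ENNReal.ofReal_ne_top, ← mul_assoc,
    ← ENNReal.ofReal_mul (by positivity), lintegral_indicator (measurableSet_norm_ge 1)]
  refine (mul_le_mul_right h1 _).trans ?_
  rw [← ENNReal.ofReal_mul (by positivity), ← Real.rpow_natCast, ← Real.rpow_add hr]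
  apply le_of_eq
  rw [mul_comm]
  congr 3
  ring

lemma add_rpow_le_add {γ δ : ℝ} (hγ : 0 ≤ γ) (hδ : 0 < δ) {a b : ℝ} (ha : 0 ≤ a) (hb : 0 ≤ b) :
    (a + b) ^ γ ≤ (1 + δ) ^ γ * a ^ γ + (1 + 1 / δ) ^ γ * b ^ γ := by
  have h1 := Real.rpow_nonneg ha γ
  have h2 := Real.rpow_nonneg hb γ
  rcases le_total b (δ * a) with h | h
  · have : (a + b) ^ γ ≤ ((1 + δ) * a) ^ γ := Real.rpow_le_rpow (by positivity) (by linarith) hγ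
    rw [Real.mul_rpow (by positivity) ha] at this
    have h3 : 0 ≤ (1 + 1 / δ) ^ γ * b ^ γ := by positivity
    linarith
  · have h4 : a ≤ 1 / δ * b := by
      rw [one_div, inv_mul_eq_div, le_div_iff₀ hδ]; linarith
    have : (a + b) ^ γ ≤ ((1 + 1 / δ) * b) ^ γ :=
      Real.rpow_le_rpow (by positivity) (by linarith) hγ
    rw [Real.mul_rpow (by positivity) hb] at this
    have h3 : 0 ≤ (1 + δ) ^ γ * a ^ γ := by positivity
    linarith

/-- Decay of the tail of `(m - u)₊` when passing to a smaller ball and a larger level. -/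
lemma tail_decay (hn : 2 ≤ n) (hs : 0 < s) (hs1 : s < 1) (hp : 1 < p) :
    ∃ l C : ℝ, 0 < l ∧ l < 1 ∧ 0 < C ∧ ∀ (z : Rn n) (r m d e : ℝ) (u : Rn n → ℝ), 0 < r →
      0 ≤ d → 0 ≤ e → (∀ᵐ x, x ∈ ball z r → m ≤ u x) →
      ∫⁻ y in (ball z r)ᶜ, ENNReal.ofReal (max (m - u y) 0 ^ (p - 1)) * J n s p z y ≤
        ENNReal.ofReal (r ^ (-(s * p)) * d ^ (p - 1)) →
      ∫⁻ y in (ball z (r / 4))ᶜ, ENNReal.ofReal (max (m + e - u y) 0 ^ (p - 1)) * J n s p z y ≤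
        ENNReal.ofReal ((r / 4) ^ (-(s * p)) * (l * d + C * e) ^ (p - 1)) := by
  obtain ⟨C₀, hC₀, hJ⟩ := exists_lintegral_compl_ball_J_le hn hs hs1 (by linarith : 0 < p)
  have hγ : 0 < p - 1 := by linarith
  have hsp : 0 < s * p := by positivity
  obtain ⟨δ, hδ, hδA⟩ : ∃ δ : ℝ, 0 < δ ∧ (1 + δ) ^ (p - 1) * 4 ^ (-(s * p)) < 1 := by
    have h4 : (1 : ℝ) < 4 ^ (s * p / (p - 1)) := Real.one_lt_rpow (by norm_num) (by positivity)
    refine ⟨(4 ^ (s * p / (p - 1)) - 1) / 2, by linarith, ?_⟩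
    have h5 : (1 + ((4 : ℝ) ^ (s * p / (p - 1)) - 1) / 2) ^ (p - 1) <
        ((4 : ℝ) ^ (s * p / (p - 1))) ^ (p - 1) :=
      Real.rpow_lt_rpow (by linarith) (by linarith) hγ
    rw [← Real.rpow_mul (by norm_num), div_mul_cancel₀ _ hγ.ne'] at h5
    rw [Real.rpow_neg (by norm_num), ← div_eq_mul_inv, div_lt_one (by positivity)]
    exact h5
  obtain ⟨l, C, hl, hl1, hC, hlC⟩ := exists_mul_rpow_add_le
    ((1 + 1 / δ) ^ (p - 1) * C₀) hγ (by positivity) hδA (by positivity)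
  refine ⟨l, C, hl, hl1, hC, ?_⟩
  intro z r m d e u hr hd he hm hT
  have hr4 : 0 < r / 4 := by positivity
  have hJm : Measurable fun y => J n s p z y := by fun_prop
  have key : ∀ᵐ y, (ball z (r / 4))ᶜ.indicator
      (fun y => ENNReal.ofReal (max (m + e - u y) 0 ^ (p - 1)) * J n s p z y) y ≤
      ENNReal.ofReal ((1 + δ) ^ (p - 1)) * (ball z r)ᶜ.indicator
        (fun y => ENNReal.ofReal (max (m - u y) 0 ^ (p - 1)) * J n s p z y) y +
      ENNReal.ofReal ((1 + 1 / δ) ^ (p - 1) * e ^ (p - 1)) *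
        (ball z (r / 4))ᶜ.indicator (fun y => J n s p z y) y := by
    filter_upwards [hm] with y hy
    by_cases h4 : y ∈ (ball z (r / 4))ᶜ
    swap
    · rw [indicator_of_notMem h4]; exact zero_le
    rw [indicator_of_mem h4, indicator_of_mem h4]
    have hb : ENNReal.ofReal (max (m + e - u y) 0 ^ (p - 1)) ≤
        ENNReal.ofReal ((1 + δ) ^ (p - 1)) * ENNReal.ofReal (max (m - u y) 0 ^ (p - 1)) +
        ENNReal.ofReal ((1 + 1 / δ) ^ (p - 1) * e ^ (p - 1)) := by
      rw [← ENNReal.ofReal_mul (by positivity), ← ENNReal.ofReal_add (by positivity)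
        (by positivity)]
      apply ENNReal.ofReal_le_ofReal
      refine le_trans (Real.rpow_le_rpow (le_max_right _ _) ?_ hγ.le)
        (add_rpow_le_add hγ.le hδ (le_max_right _ _) he)
      have h1 := le_max_left (m - u y) 0
      have h2 := le_max_right (m - u y) 0
      exact max_le (by linarith) (by linarith)
    by_cases h1 : y ∈ (ball z r)ᶜ
    · rw [indicator_of_mem h1, ← mul_assoc, ← add_mul]
      exact mul_le_mul_left hb _
    · have h2 := hy (not_not.1 h1)
      rw [indicator_of_notMem h1, mul_zero, zero_add]
      rw [max_eq_right (by linarith : m - u y ≤ 0), Real.zero_rpow hγ.ne', ENNReal.ofReal_zero,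
        mul_zero, zero_add] at hb
      exact mul_le_mul_left hb _
  rw [← lintegral_indicator measurableSet_ball.compl]
  refine (lintegral_mono_ae key).trans ?_
  rw [lintegral_add_right _ (by
      exact (hJm.indicator measurableSet_ball.compl).const_mul _),
    lintegral_const_mul' _ _ ENNReal.ofReal_ne_top, lintegral_const_mul' _ _ ENNReal.ofReal_ne_top,
    lintegral_indicator measurableSet_ball.compl, lintegral_indicator measurableSet_ball.compl]
  refine (add_le_add (mul_le_mul_right hT _) (mul_le_mul_right (hJ z _ hr4) _)).trans ?_
  rw [← ENNReal.ofReal_mul (by positivity), ← ENNReal.ofReal_mul (by positivity),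
    ← ENNReal.ofReal_add (by positivity) (by positivity)]
  apply ENNReal.ofReal_le_ofReal
  have h4 : r ^ (-(s * p)) = (r / 4) ^ (-(s * p)) * 4 ^ (-(s * p)) := by
    rw [← Real.mul_rpow (by positivity) (by norm_num), div_mul_cancel₀ _ (by norm_num)]
  rw [h4]
  have := mul_le_mul_of_nonneg_left (hlC d e hd he)
    (show 0 ≤ (r / 4) ^ (-(s * p)) by positivity)
  refine le_trans (le_of_eq ?_) this
  ring

end Tail

lemma exists_maximal_ae_le {α : Type*} [MeasurableSpace α] {μ : Measure α} [NeZero μ] {u : α → ℝ}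
    {k : ℝ} (hk : ∀ᵐ x ∂μ, k ≤ u x) :
    ∃ m : ℝ, k ≤ m ∧ (∀ᵐ x ∂μ, m ≤ u x) ∧ ∀ t : ℝ, (∀ᵐ x ∂μ, t ≤ u x) → t ≤ m := by
  have hbdd : IsBoundedUnder (· ≥ ·) (ae μ) u := ⟨k, by simpa using hk⟩
  have hfreq : ∃ M : ℝ, ∃ᵐ x ∂μ, u x ≤ M := by
    by_contra! h
    have h1 : ∀ᵐ x ∂μ, ∀ N : ℕ, (N : ℝ) < u x := by
      rw [ae_all_iff]
      intro N
      simpa using h N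
    obtain ⟨x, hx⟩ := h1.exists
    obtain ⟨N, hN⟩ := exists_nat_gt (u x)
    linarith [hx N]
  have hmax : ∀ t : ℝ, (∀ᵐ x ∂μ, t ≤ u x) → t ≤ essInf u μ := by
    obtain ⟨M, hM⟩ := hfreq
    intro t ht
    refine le_liminf_of_le ⟨M, fun a ha => ?_⟩ ht
    obtain ⟨x, hx, hx'⟩ := (hM.and_eventually (eventually_map.1 ha)).exists
    exact hx'.le.trans hx
  exact ⟨essInf u μ, hmax k hk, ae_essInf_le hbdd, hmax⟩

section Levels

variable {n : ℕ} {s p β Q : ℝ}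

lemma sum_range_recursion {l C : ℝ} (hl1 : l < 1) {m d : ℕ → ℝ} (hm : m 0 = 0)
    (hd : ∀ i, d (i + 1) = l * d i + C * (m (i + 1) - m i)) (N : ℕ) :
    ∑ i ∈ Finset.range N, d i + d N / (1 - l) = (d 0 + C * m N) / (1 - l) := by
  have h1 : 1 - l ≠ 0 := by linarith
  induction N with
  | zero => simp [hm]
  | succ N ih =>
    rw [Finset.sum_range_succ, hd N]
    field_simp at ih ⊢
    linarith

lemma exists_maximal_levels {u : Rn n → ℝ} {z : Rn n} {R : ℝ} (hR : 0 < R)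
    (hu : ∀ᵐ x, x ∈ ball z R → 0 ≤ u x) :
    ∃ m : ℕ → ℝ, m 0 = 0 ∧ (∀ i, m i ≤ m (i + 1)) ∧
      (∀ i, ∀ᵐ x, x ∈ ball z (R / 4 ^ i) → m i ≤ u x) ∧
      ∀ i t, (∀ᵐ x, x ∈ ball z (R / 4 ^ (i + 1)) → t ≤ u x) → t ≤ m (i + 1) := by
  have hsub : ∀ i j : ℕ, i ≤ j → ball z (R / 4 ^ j) ⊆ ball z (R / 4 ^ i) := fun i j hij =>
    ball_subset_ball (by gcongr; norm_num)
  have h0 : ∀ i : ℕ, ball z (R / 4 ^ i) ⊆ ball z R := fun i => by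
    simpa using hsub 0 i (Nat.zero_le i)
  have hex : ∀ i : ℕ, ∃ m : ℝ, 0 ≤ m ∧ (∀ᵐ x, x ∈ ball z (R / 4 ^ i) → m ≤ u x) ∧
      ∀ t : ℝ, (∀ᵐ x, x ∈ ball z (R / 4 ^ i) → t ≤ u x) → t ≤ m := by
    intro i
    have : NeZero (volume.restrict (ball z (R / 4 ^ i))) := by
      refine ⟨fun h => ?_⟩
      rw [Measure.restrict_eq_zero] at h
      exact (measure_ball_pos volume z (show 0 < R / 4 ^ i by positivity)).ne' h
    obtain ⟨m, h1, h2, h3⟩ := exists_maximal_ae_le (μ := volume.restrict (ball z (R / 4 ^ i)))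
      (u := u) (k := 0) ((ae_restrict_iff' measurableSet_ball).2
        (hu.mono fun x hx hxS => hx (h0 i hxS)))
    exact ⟨m, h1, (ae_restrict_iff' measurableSet_ball).1 h2,
      fun t ht => h3 t ((ae_restrict_iff' measurableSet_ball).2 ht)⟩
  choose M hM0 hM hMmax using hex
  have hm : ∀ i : ℕ, ∀ᵐ x, x ∈ ball z (R / 4 ^ i) →
      (fun i => if i = 0 then 0 else M i) i ≤ u x := by
    intro i
    rcases i with _ | i
    · simpa using hu
    · simpa using hM (i + 1)
  refine ⟨fun i => if i = 0 then 0 else M i, by simp, fun i => ?_, hm, fun i t ht => ?_⟩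
  · have := hMmax (i + 1) _ ((hm i).mono fun x hx hxS => hx (hsub i (i + 1) (by omega) hxS))
    simpa using this
  · simpa using hMmax (i + 1) t ht

lemma exists_levels (P : Par n s p β Q) {L : ℝ} (hL : 0 < L) :
    ∃ C : ℝ, 0 < C ∧ ∀ (Ω : Set (Rn n)) (ν : Measure (Rn n)) (u : Rn n → ℝ) (v f : ℕ → Rn n → ℝ),
      Lim n s p Q L Ω ν u v f → ∀ (z : Rn n) (R d₀ : ℝ), 0 < R → ball z R ⊆ Ω → 0 ≤ d₀ →
      (∀ᵐ x, x ∈ ball z R → 0 ≤ u x) →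
      ∫⁻ y in (ball z R)ᶜ, ENNReal.ofReal (max (-u y) 0 ^ (p - 1)) * J n s p z y ≤
        ENNReal.ofReal (R ^ (-(s * p)) * d₀ ^ (p - 1)) →
      ∃ m D : ℕ → ℝ, Monotone m ∧ (∀ i, 0 ≤ D i) ∧
        (∀ i, ∀ᵐ x, x ∈ ball z (R / 4 ^ i) → m i ≤ u x) ∧
        (∀ i, ∫⁻ x in ball z (R / 4 ^ (i + 1)), ENNReal.ofReal (u x - m i) ≤
          ENNReal.ofReal (C * ((R / 4 ^ i) ^ n * D i))) ∧
        (∀ i, ν (ball z (R / 4 ^ (i + 1))) ≤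
          ENNReal.ofReal (C * ((R / 4 ^ i) ^ ((n : ℝ) - s * p) * D i ^ (p - 1)))) ∧
        ∀ N, ∑ i ∈ Finset.range N, D i ≤ C * (m N + d₀) := by
  obtain ⟨C₀, hC₀, hlow⟩ := low_limit P hL
  obtain ⟨l, C₁, hl, hl1, hC₁, htail⟩ := tail_decay P.hn P.hs P.hs1 P.hp
  have hγ : 0 < p - 1 := by linarith [P.hp]
  have h1l : 0 < 1 - l := by linarith
  obtain ⟨C₂, hC₂⟩ : ∃ C₂ : ℝ, C₂ = (1 + C₁) / (1 - l) + 1 := ⟨_, rfl⟩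
  have hC₂0 : 0 < C₂ := by rw [hC₂]; positivity
  refine ⟨max C₀ C₂, lt_max_of_lt_left hC₀, ?_⟩
  intro Ω ν u v f H z R d₀ hR hΩ hd₀ hu hT
  obtain ⟨m, hm0, hmono, hm, hmax⟩ := exists_maximal_levels hR hu
  have hM : Monotone m := monotone_nat_of_le_succ hmono
  obtain ⟨d, hd0, hd⟩ : ∃ d : ℕ → ℝ, d 0 = d₀ ∧
      ∀ i, d (i + 1) = l * d i + C₁ * (m (i + 1) - m i) :=
    ⟨fun i => Nat.rec d₀ (fun i x => l * x + C₁ * (m (i + 1) - m i)) i, rfl, fun i => rfl⟩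
  have he : ∀ i, 0 ≤ m (i + 1) - m i := fun i => sub_nonneg.2 (hmono i)
  have hdn : ∀ i, 0 ≤ d i := by
    intro i
    induction i with
    | zero => rwa [hd0]
    | succ i ih =>
      rw [hd]
      have := he i
      positivity
  have hTi : ∀ i, ∫⁻ y in (ball z (R / 4 ^ i))ᶜ,
      ENNReal.ofReal (max (m i - u y) 0 ^ (p - 1)) * J n s p z y ≤
      ENNReal.ofReal ((R / 4 ^ i) ^ (-(s * p)) * d i ^ (p - 1)) := by
    intro i
    induction i with
    | zero => simpa only [hm0, hd0, zero_sub, pow_zero, div_one] using hT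
    | succ i ih =>
      have := htail z (R / 4 ^ i) (m i) (d i) (m (i + 1) - m i) u (by positivity) (hdn i) (he i)
        (hm i) ih
      rwa [add_sub_cancel, ← hd i, div_div, ← pow_succ] at this
  have halt : ∀ i, ∀ t : ℝ, m (i + 1) - m i + d i < t →
      ∫⁻ x in ball z (R / 4 ^ (i + 1)), ENNReal.ofReal (u x - m i) ≤
        ENNReal.ofReal (C₀ * ((R / 4 ^ i) ^ n * t)) ∧
      ν (ball z (R / 4 ^ (i + 1))) ≤
        ENNReal.ofReal (C₀ * ((R / 4 ^ i) ^ ((n : ℝ) - s * p) * t ^ (p - 1))) := by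
    intro i t ht
    have h1 := he i
    have h2 := hdn i
    have hball : ball z (R / 4 ^ i) ⊆ Ω := (ball_subset_ball
      (div_le_self hR.le (one_le_pow₀ (by norm_num)))).trans hΩ
    have := hlow Ω ν u v f H z (R / 4 ^ i) (m i) t (by positivity) (by linarith) hball (hm i)
      ((hTi i).trans (ENNReal.ofReal_le_ofReal (by gcongr; linarith)))
    rw [div_div, ← pow_succ] at this
    refine this.resolve_left fun h => ?_
    have := hmax i _ h
    linarith
  refine ⟨m, fun i => m (i + 1) - m i + d i, hM, fun i => add_nonneg (he i) (hdn i), hm, ?_, ?_, ?_⟩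
  · intro i
    have h1 := he i
    have h2 := hdn i
    refine le_trans ?_ (ENNReal.ofReal_le_ofReal
      (mul_le_mul_of_nonneg_right (le_max_left C₀ C₂) (by positivity)))
    have hc : Tendsto (fun t : ℝ => ENNReal.ofReal (C₀ * ((R / 4 ^ i) ^ n * t)))
        (𝓝[>] (m (i + 1) - m i + d i))
        (𝓝 (ENNReal.ofReal (C₀ * ((R / 4 ^ i) ^ n * (m (i + 1) - m i + d i))))) := by
      have : Continuous fun t : ℝ => ENNReal.ofReal (C₀ * ((R / 4 ^ i) ^ n * t)) :=
        ENNReal.continuous_ofReal.comp (by fun_prop)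
      exact this.continuousWithinAt.tendsto
    exact ge_of_tendsto hc (eventually_mem_nhdsWithin.mono fun t ht => (halt i t ht).1)
  · intro i
    have h1 := he i
    have h2 := hdn i
    refine le_trans ?_ (ENNReal.ofReal_le_ofReal
      (mul_le_mul_of_nonneg_right (le_max_left C₀ C₂) (by positivity)))
    have hc : Tendsto (fun t : ℝ => ENNReal.ofReal
          (C₀ * ((R / 4 ^ i) ^ ((n : ℝ) - s * p) * t ^ (p - 1))))
        (𝓝[>] (m (i + 1) - m i + d i))
        (𝓝 (ENNReal.ofReal (C₀ * ((R / 4 ^ i) ^ ((n : ℝ) - s * p) *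
          (m (i + 1) - m i + d i) ^ (p - 1))))) := by
      have : Continuous fun t : ℝ => ENNReal.ofReal
          (C₀ * ((R / 4 ^ i) ^ ((n : ℝ) - s * p) * t ^ (p - 1))) :=
        ENNReal.continuous_ofReal.comp (continuous_const.mul (continuous_const.mul
          (Real.continuous_rpow_const hγ.le)))
      exact this.continuousWithinAt.tendsto
    exact ge_of_tendsto hc (eventually_mem_nhdsWithin.mono fun t ht => (halt i t ht).2)
  · intro N
    have hmN : 0 ≤ m N := hm0 ▸ hM (Nat.zero_le N)
    have h3 := sum_range_recursion hl1 hm0 hd N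
    have h4 : 0 ≤ d N / (1 - l) := div_nonneg (hdn N) h1l.le
    rw [Finset.sum_add_distrib, Finset.sum_range_sub, hm0, sub_zero]
    refine le_trans ?_ (mul_le_mul_of_nonneg_right (le_max_right C₀ C₂) (by positivity))
    have h5 : (d 0 + C₁ * m N) / (1 - l) ≤ (1 + C₁) / (1 - l) * (m N + d₀) := by
      rw [div_mul_eq_mul_div, hd0]
      apply div_le_div_of_nonneg_right _ h1l.le
      nlinarith [mul_nonneg hC₁.le hd₀]
    rw [hC₂, add_mul]
    linarith

end Levels

section Averages

variable {n : ℕ} {s p : ℝ}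

lemma ballAvg_sub_eq (hn : 2 ≤ n) {u : Rn n → ℝ} {z : Rn n} {t : ℝ} (ht : 0 < t) (a : ℝ)
    (hu : IntegrableOn u (ball z t)) :
    ballAvg n u z t - a = (omega n * t ^ n)⁻¹ * ∫ x in ball z t, (u x - a) := by
  have hω := omega_pos n
  have hv : volume.real (ball z t) = omega n * t ^ n := by
    rw [Measure.real, volume_ball_eq hn z ht.le, ENNReal.toReal_ofReal (by positivity)]
  have hc : IntegrableOn (fun _ : Rn n => a) (ball z t) :=
    integrableOn_const measure_ball_lt_top.ne
  rw [integral_sub hu hc, setIntegral_const, ballAvg, setAverage_eq, hv, smul_eq_mul, smul_eq_mul,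
    mul_sub, ← mul_assoc _ _ a, inv_mul_cancel₀ (by positivity), one_mul]

lemma le_ballAvg (hn : 2 ≤ n) {u : Rn n → ℝ} {z : Rn n} {t a : ℝ} (ht : 0 < t)
    (hu : IntegrableOn u (ball z t)) (ha : ∀ᵐ x, x ∈ ball z t → a ≤ u x) :
    a ≤ ballAvg n u z t := by
  have hω := omega_pos n
  have h := ballAvg_sub_eq hn ht a hu
  have h1 : 0 ≤ ∫ x in ball z t, (u x - a) :=
    integral_nonneg_of_ae ((ae_restrict_iff' measurableSet_ball).2
      (ha.mono fun x hx hxS => sub_nonneg.2 (hx hxS)))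
  have h2 : 0 ≤ (omega n * t ^ n)⁻¹ * ∫ x in ball z t, (u x - a) := by positivity
  linarith

lemma ballAvg_le (hn : 2 ≤ n) {u : Rn n → ℝ} {z : Rn n} {t a X : ℝ} (ht : 0 < t) (hX : 0 ≤ X)
    (hu : IntegrableOn u (ball z t)) (ha : ∀ᵐ x, x ∈ ball z t → a ≤ u x)
    (h : ∫⁻ x in ball z t, ENNReal.ofReal (u x - a) ≤ ENNReal.ofReal X) :
    ballAvg n u z t ≤ a + X / (omega n * t ^ n) := by
  have hω := omega_pos n
  have h0 := ballAvg_sub_eq hn ht a hu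
  have h1 : ∫ x in ball z t, (u x - a) ≤ X := by
    rw [integral_eq_lintegral_of_nonneg_ae ((ae_restrict_iff' measurableSet_ball).2
      (ha.mono fun x hx hxS => sub_nonneg.2 (hx hxS)))
      (hu.aestronglyMeasurable.sub aestronglyMeasurable_const)]
    exact ENNReal.toReal_le_of_le_ofReal hX h
  have h2 : (omega n * t ^ n)⁻¹ * ∫ x in ball z t, (u x - a) ≤ (omega n * t ^ n)⁻¹ * X :=
    mul_le_mul_of_nonneg_left h1 (by positivity)
  rw [div_eq_inv_mul]
  linarith

/-- The dyadic scale of a small radius. -/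
lemma exists_scale {R : ℝ} (hR : 0 < R) :
    ∃ ι : ℝ → ℕ, Tendsto ι (𝓝[>] 0) atTop ∧
      ∀ t, 0 < t → t ≤ R → R / 4 ^ (ι t + 1) < t ∧ t ≤ R / 4 ^ ι t := by
  have h : ∀ t, ∃ i : ℕ, 0 < t → t ≤ R → R / 4 ^ (i + 1) < t ∧ t ≤ R / 4 ^ i := by
    intro t
    by_cases ht : 0 < t ∧ t ≤ R
    · obtain ⟨i, h1, h2⟩ := exists_nat_pow_near_of_lt_one (div_pos ht.1 hR)
        ((div_le_one hR).2 ht.2) (show (0 : ℝ) < 1 / 4 by norm_num) (by norm_num)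
      refine ⟨i, fun _ _ => ⟨?_, ?_⟩⟩
      · rw [lt_div_iff₀ hR] at h1
        rw [one_div, inv_pow] at h1
        rwa [div_eq_inv_mul]
      · rw [div_le_iff₀ hR] at h2
        rw [one_div, inv_pow] at h2
        rwa [div_eq_inv_mul]
    · exact ⟨0, fun h1 h2 => absurd ⟨h1, h2⟩ ht⟩
  choose ι hι using h
  refine ⟨ι, ?_, hι⟩
  rw [Filter.tendsto_atTop]
  intro I
  have hI : 0 < R / 4 ^ I := by positivity
  filter_upwards [Ioo_mem_nhdsGT hI] with t ht
  by_contra! hlt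
  have h1 := (hι t ht.1 (ht.2.le.trans (div_le_self hR.le (one_le_pow₀ (by norm_num))))).1
  have h2 : R / 4 ^ I ≤ R / 4 ^ (ι t + 1) := by
    gcongr
    · norm_num
    · omega
  linarith [ht.2]

/-- Summable control of the density of `ν` bounds the Wolff potential. -/
lemma wolff_le (hp : 1 < p) (hspn : s * p < n) {C : ℝ} (hC : 0 < C) :
    ∃ C' : ℝ, 0 < C' ∧ ∀ (ν : Measure (Rn n)) (z : Rn n) (R S : ℝ) (D : ℕ → ℝ), 0 < R →
      (∀ i, 0 ≤ D i) → (∀ N, ∑ i ∈ Finset.range N, D i ≤ S) →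
      (∀ i, ν (ball z (R / 4 ^ (i + 1))) ≤
        ENNReal.ofReal (C * ((R / 4 ^ i) ^ ((n : ℝ) - s * p) * D i ^ (p - 1)))) →
      wolff n s p ν z (R / 4) ≤ ENNReal.ofReal (C' * S) := by
  have hγ : 0 < p - 1 := by linarith
  have hq : 0 < (n : ℝ) - s * p := by linarith
  obtain ⟨B, hB⟩ : ∃ B : ℝ, B = C * 16 ^ ((n : ℝ) - s * p) := ⟨_, rfl⟩
  have hB0 : 0 < B := by rw [hB]; positivity
  refine ⟨B ^ (1 / (p - 1)) * 4, by positivity, ?_⟩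
  intro ν z R S D hR hD hS hν
  have hcov : Ioc 0 (R / 4) ⊆ ⋃ i : ℕ, Ioc (R / 4 ^ (i + 2)) (R / 4 ^ (i + 1)) := by
    obtain ⟨ι, -, hι⟩ := exists_scale (show 0 < R / 4 by positivity)
    intro t ht
    have := hι t ht.1 ht.2
    rw [div_div, div_div, ← pow_succ', ← pow_succ'] at this
    exact mem_iUnion.2 ⟨ι t, this⟩
  have hpiece : ∀ i : ℕ, ∫⁻ ρ in Ioc (R / 4 ^ (i + 2)) (R / 4 ^ (i + 1)),
      (ν (ball z ρ) / ENNReal.ofReal (ρ ^ ((n : ℝ) - s * p))) ^ (1 / (p - 1)) /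
        ENNReal.ofReal ρ ≤ ENNReal.ofReal (B ^ (1 / (p - 1)) * 4 * D i) := by
    intro i
    obtain ⟨a, ha⟩ : ∃ a : ℝ, a = R / 4 ^ (i + 2) := ⟨_, rfl⟩
    have ha0 : 0 < a := by rw [ha]; positivity
    have h1 : R / 4 ^ (i + 1) = 4 * a := by rw [ha]; field_simp; ring
    have h2 : R / 4 ^ i = 16 * a := by rw [ha]; field_simp; ring
    have hνi := hν i
    rw [h1, h2] at hνi
    rw [← ha, h1]
    have hDi := hD i
    calc _ ≤ ∫⁻ ρ in Ioc a (4 * a), ENNReal.ofReal (B ^ (1 / (p - 1)) * D i / a) := by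
          apply setLIntegral_mono' measurableSet_Ioc
          rintro ρ ⟨hρ1, hρ2⟩
          have h3 : ν (ball z ρ) / ENNReal.ofReal (ρ ^ ((n : ℝ) - s * p)) ≤
              ENNReal.ofReal (B * D i ^ (p - 1)) := by
            rw [ENNReal.div_le_iff (by
              rw [Ne, ENNReal.ofReal_eq_zero, not_le]; exact Real.rpow_pos_of_pos (ha0.trans hρ1) _)
              ENNReal.ofReal_ne_top,
              ← ENNReal.ofReal_mul (by positivity)]
            refine (measure_mono (ball_subset_ball hρ2)).trans
              (hνi.trans (ENNReal.ofReal_le_ofReal ?_))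
            rw [Real.mul_rpow (by norm_num) ha0.le, hB]
            have h4 : a ^ ((n : ℝ) - s * p) ≤ ρ ^ ((n : ℝ) - s * p) :=
              Real.rpow_le_rpow ha0.le hρ1.le hq.le
            calc _ = C * 16 ^ ((n : ℝ) - s * p) * D i ^ (p - 1) * a ^ ((n : ℝ) - s * p) := by ring
              _ ≤ _ := mul_le_mul_of_nonneg_left h4 (by positivity)
          have h5 := ENNReal.rpow_le_rpow h3 (show 0 ≤ 1 / (p - 1) by positivity)
          rw [ENNReal.ofReal_rpow_of_nonneg (by positivity) (by positivity),
            Real.mul_rpow (by positivity) (by positivity), ← Real.rpow_mul hDi,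
            mul_one_div_cancel hγ.ne', Real.rpow_one] at h5
          rw [ENNReal.ofReal_div_of_pos ha0]
          exact ENNReal.div_le_div h5 (ENNReal.ofReal_le_ofReal hρ1.le)
      _ ≤ _ := by
          rw [setLIntegral_const, Real.volume_Ioc, ← ENNReal.ofReal_mul (by positivity)]
          apply ENNReal.ofReal_le_ofReal
          have : B ^ (1 / (p - 1)) * D i / a * (4 * a - a) = B ^ (1 / (p - 1)) * D i * 3 := by
            field_simp; ring
          rw [this]
          have : 0 ≤ B ^ (1 / (p - 1)) * D i := by positivity
          linarith
  refine (lintegral_mono_set hcov).trans ((lintegral_iUnion_le _ _).trans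
    ((ENNReal.tsum_le_tsum hpiece).trans (ENNReal.tsum_le_of_sum_range_le fun N => ?_)))
  rw [← ENNReal.ofReal_sum_of_nonneg fun i _ => mul_nonneg (by positivity) (hD i), ← Finset.mul_sum]
  exact ENNReal.ofReal_le_ofReal (mul_le_mul_of_nonneg_left (hS N) (by positivity))

/-- The Wolff potential controls a dyadic sum of densities of `ν`. -/
lemma tsum_density_le_wolff (hp : 1 < p) (hspn : s * p < n) :
    ∃ C : ℝ, 0 < C ∧ ∀ (ν : Measure (Rn n)) (z : Rn n) (R : ℝ), 0 < R →
      ∑' k : ℕ, (ν (closedBall z (R / 2 ^ (k + 1))) /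
        ENNReal.ofReal ((R / 2 ^ (k + 1)) ^ ((n : ℝ) - s * p))) ^ (1 / (p - 1)) ≤
        ENNReal.ofReal C * wolff n s p ν z R := by
  have hγ : 0 < p - 1 := by linarith
  have hq : 0 < (n : ℝ) - s * p := by linarith
  obtain ⟨B, hB⟩ : ∃ B : ℝ, B = (2 : ℝ) ^ ((n : ℝ) - s * p) := ⟨_, rfl⟩
  have hB0 : 0 < B := by rw [hB]; positivity
  refine ⟨B ^ (1 / (p - 1)) * 2, by positivity, ?_⟩
  intro ν z R hR
  have hpiece : ∀ k : ℕ, (ν (closedBall z (R / 2 ^ (k + 1))) /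
        ENNReal.ofReal ((R / 2 ^ (k + 1)) ^ ((n : ℝ) - s * p))) ^ (1 / (p - 1)) ≤
      ENNReal.ofReal (B ^ (1 / (p - 1)) * 2) * ∫⁻ ρ in Ioc (R / 2 ^ (k + 1)) (R / 2 ^ k),
      (ν (ball z ρ) / ENNReal.ofReal (ρ ^ ((n : ℝ) - s * p))) ^ (1 / (p - 1)) /
        ENNReal.ofReal ρ := by
    intro k
    obtain ⟨a, ha⟩ : ∃ a : ℝ, a = R / 2 ^ (k + 1) := ⟨_, rfl⟩
    have ha0 : 0 < a := by rw [ha]; positivity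
    have h1 : R / 2 ^ k = 2 * a := by rw [ha]; field_simp; ring
    rw [← ha, h1]
    have haq : 0 < a ^ ((n : ℝ) - s * p) := by positivity
    obtain ⟨W, hW⟩ : ∃ W : ℝ≥0∞, W = (ν (closedBall z a) /
        ENNReal.ofReal (B * a ^ ((n : ℝ) - s * p))) ^ (1 / (p - 1)) := ⟨_, rfl⟩
    have hlow : ∀ ρ ∈ Ioc a (2 * a), W / ENNReal.ofReal (2 * a) ≤
        (ν (ball z ρ) / ENNReal.ofReal (ρ ^ ((n : ℝ) - s * p))) ^ (1 / (p - 1)) /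
        ENNReal.ofReal ρ := by
      rintro ρ ⟨hρ1, hρ2⟩
      have hρ : 0 < ρ := ha0.trans hρ1
      rw [hW]
      apply ENNReal.div_le_div _ (ENNReal.ofReal_le_ofReal hρ2)
      apply ENNReal.rpow_le_rpow _ (by positivity)
      apply ENNReal.div_le_div (measure_mono (closedBall_subset_ball hρ1))
      apply ENNReal.ofReal_le_ofReal
      rw [hB, ← Real.mul_rpow (by norm_num) ha0.le]
      exact Real.rpow_le_rpow hρ.le hρ2 hq.le
    calc _ = ENNReal.ofReal (B ^ (1 / (p - 1))) * W := by
          rw [hW, ← ENNReal.ofReal_rpow_of_nonneg hB0.le (by positivity),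
            ← ENNReal.mul_rpow_of_nonneg _ _ (by positivity), ENNReal.ofReal_mul hB0.le,
            ← mul_div_assoc, ENNReal.mul_div_mul_left _ _ (ENNReal.ofReal_pos.2 hB0).ne'
              ENNReal.ofReal_ne_top]
      _ = ENNReal.ofReal (B ^ (1 / (p - 1)) * 2) *
          ∫⁻ ρ in Ioc a (2 * a), W / ENNReal.ofReal (2 * a) := by
          have h2 : (2 : ℝ) * a - a = a := by ring
          rw [setLIntegral_const, Real.volume_Ioc, h2, ENNReal.ofReal_mul (by positivity),
            mul_assoc]
          congr 1
          rw [mul_left_comm, ← ENNReal.ofReal_mul (by norm_num), ENNReal.div_mul_cancel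
            (ENNReal.ofReal_pos.2 (by positivity)).ne' ENNReal.ofReal_ne_top]
      _ ≤ _ := mul_le_mul_right (setLIntegral_mono' measurableSet_Ioc hlow) _
  refine (ENNReal.tsum_le_tsum hpiece).trans ?_
  rw [ENNReal.tsum_mul_left]
  refine mul_le_mul_right ?_ _
  have hanti : Antitone fun k : ℕ => R / 2 ^ k := antitone_nat_of_succ_le fun k => by
    gcongr
    · norm_num
    · omega
  have hdisj : Pairwise (Function.onFun Disjoint fun k : ℕ => Ioc (R / 2 ^ (k + 1)) (R / 2 ^ k)) :=
    hanti.pairwise_disjoint_on_Ioc_succ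
  rw [← lintegral_iUnion (fun k => measurableSet_Ioc) hdisj]
  refine lintegral_mono_set (iUnion_subset fun k => Ioc_subset_Ioc (by positivity) ?_)
  exact div_le_self hR.le (one_le_pow₀ (by norm_num))

end Averages

section PreciseRep

variable {n : ℕ} {s p β Q L : ℝ} {Ω : Set (Rn n)} {ν : Measure (Rn n)} {u : Rn n → ℝ}
  {v f : ℕ → Rn n → ℝ}

lemma Lim.integrableOn (hQ : 1 ≤ Q) (H : Lim n s p Q L Ω ν u v f) (z : Rn n) {t : ℝ} (ht : 0 < t) :
    IntegrableOn u (ball z t) := by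
  refine ⟨H.meas.aestronglyMeasurable, ?_⟩
  rw [hasFiniteIntegral_iff_norm]
  have h1 : ∀ x, ENNReal.ofReal ‖u x‖ ≤ 1 + ENNReal.ofReal (|u x| ^ Q) := by
    intro x
    rw [← ENNReal.ofReal_one, ← ENNReal.ofReal_add zero_le_one (by positivity)]
    apply ENNReal.ofReal_le_ofReal
    have := abs_le_add_rpow hQ one_pos (u x)
    simpa using this
  refine (lintegral_mono h1).trans_lt ?_
  rw [lintegral_add_left measurable_const, setLIntegral_one]
  exact ENNReal.add_lt_top.2 ⟨measure_ball_lt_top, H.fin z t ht⟩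

lemma exists_large_rpow {γ c A : ℝ} (hγ : 0 < γ) (hc : 0 < c) :
    ∀ᶠ d : ℝ in atTop, A ≤ c * d ^ γ :=
  ((tendsto_rpow_atTop hγ).const_mul_atTop hc).eventually_ge_atTop A

/-- If the Wolff potential is finite, then the essential infima of `u` stay bounded. -/
lemma ae_le_bound_of_wolff_lt_top (P : Par n s p β Q) (hL : 0 < L) [IsFiniteMeasure ν]
    (H : Lim n s p Q L Ω ν u v f) {z : Rn n} {R : ℝ} (hR : 0 < R) (hΩ : ball z R ⊆ Ω)
    (hW : wolff n s p ν z R < ⊤) :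
    ∃ M : ℝ, ∀ (N : ℕ) (m : ℝ), (∀ᵐ x, x ∈ ball z (R / 2 ^ N) → m ≤ u x) → m ≤ M := by
  obtain ⟨κ, hκ, hup⟩ := up_limit P hL
  have hγ : 0 < p - 1 := by linarith [P.hp]
  have hQ0 : 0 < Q := by linarith [P.hQ1]
  have hlam : 0 < lam s p := lam_pos
  have hlam1 := lam_lt_one P
  obtain ⟨C, hC, hsum⟩ := tsum_density_le_wolff (n := n) P.hp P.hspn
  obtain ⟨E, hE⟩ : ∃ E : ℕ → ℝ≥0∞, E = fun k => (ν (closedBall z (R / 2 ^ k)) /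
        ENNReal.ofReal ((R / 2 ^ k) ^ ((n : ℝ) - s * p))) ^ (1 / (p - 1)) := ⟨_, rfl⟩
  have hq : ∀ k : ℕ, 0 < (R / 2 ^ k) ^ ((n : ℝ) - s * p) := fun k => by positivity
  have hEfin : ∀ k, E k ≠ ⊤ := by
    intro k
    rw [hE]
    refine ENNReal.rpow_ne_top_of_nonneg (by positivity) ?_
    exact ENNReal.div_ne_top (measure_ne_top _ _) (ENNReal.ofReal_pos.2 (hq k)).ne'
  have hEsum : ∑' k, E (k + 1) ≠ ⊤ := by
    have := hsum ν z R hR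
    rw [hE]
    exact (this.trans_lt (ENNReal.mul_lt_top ENNReal.ofReal_lt_top hW)).ne
  obtain ⟨c, hc⟩ : ∃ c : ℝ, c = κ ^ (1 / (p - 1)) := ⟨_, rfl⟩
  have hc0 : 0 < c := by rw [hc]; positivity
  have hcκ : c ^ (p - 1) = κ := by
    rw [hc, ← Real.rpow_mul hκ.le, one_div_mul_cancel hγ.ne', Real.rpow_one]
  obtain ⟨e, he⟩ : ∃ e : ℕ → ℝ, e = fun k => (E k).toReal / c := ⟨_, rfl⟩
  have he0 : ∀ k, 0 ≤ e k := fun k => by rw [he]; positivity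
  have hνe : ∀ k, ν (closedBall z (R / 2 ^ k)) ≤
      ENNReal.ofReal (κ * ((R / 2 ^ k) ^ ((n : ℝ) - s * p) * e k ^ (p - 1))) := by
    intro k
    have h1 : E k = ENNReal.ofReal (c * e k) := by
      rw [he]
      simp only
      rw [mul_div_cancel₀ _ hc0.ne', ENNReal.ofReal_toReal (hEfin k)]
    have h2 : E k ^ (p - 1) = ν (closedBall z (R / 2 ^ k)) /
        ENNReal.ofReal ((R / 2 ^ k) ^ ((n : ℝ) - s * p)) := by
      rw [hE]
      simp only
      rw [← ENNReal.rpow_mul, one_div_mul_cancel hγ.ne', ENNReal.rpow_one]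
    have hek := he0 k
    rw [h1, ENNReal.ofReal_rpow_of_nonneg (by positivity) hγ.le, Real.mul_rpow hc0.le hek, hcκ,
      ENNReal.eq_div_iff (ENNReal.ofReal_pos.2 (hq k)).ne' ENNReal.ofReal_ne_top,
      ← ENNReal.ofReal_mul (hq k).le] at h2
    rw [← h2]
    exact ENNReal.ofReal_le_ofReal (le_of_eq (by ring))
  have hes : Summable fun k => e (k + 1) := by
    rw [he]
    exact (ENNReal.summable_toReal hEsum).div_const c
  have hfin := H.fin z R hR
  have htf := H.tail_fin z R hR
  obtain ⟨d₀, ⟨⟨hd1, hd2⟩, hd3⟩, hd4⟩ := (((exists_large_rpow (A := (∫⁻ x in ball z R,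
    ENNReal.ofReal (|u x| ^ Q)).toReal) hQ0 (show 0 < κ * R ^ n by positivity)).and
    (exists_large_rpow (A := (∫⁻ y in (ball z R)ᶜ, ENNReal.ofReal (|u y| ^ (p - 1)) *
      J n s p z y).toReal) hγ (show 0 < R ^ (-(s * p)) by positivity))).and
    (eventually_ge_atTop (e 0))).and (eventually_gt_atTop 0) |>.exists
  obtain ⟨d, hd0, hd⟩ : ∃ d : ℕ → ℝ, d 0 = d₀ ∧ ∀ k, d (k + 1) = lam s p * d k + e (k + 1) :=
    ⟨fun i => Nat.rec d₀ (fun k x => lam s p * x + e (k + 1)) i, rfl, fun i => rfl⟩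
  have hdpos : ∀ k, 0 < d k := by
    intro k
    induction k with
    | zero => rwa [hd0]
    | succ k ih =>
      rw [hd]
      have := he0 (k + 1)
      positivity
  have hde : ∀ k, e k ≤ d k := by
    intro k
    rcases k with _ | k
    · rwa [hd0]
    · rw [hd]
      have := hdpos k
      have : 0 ≤ lam s p * d k := by positivity
      linarith
  refine ⟨d₀ + (d₀ + ∑' k, e (k + 1)) / (1 - lam s p), fun N m hm => ?_⟩
  have h1 := hup Ω ν u v f H z R d hR hΩ hdpos (fun k => by rw [hd]; linarith [he0 (k + 1)])
    (by
      rw [hd0, ← mul_assoc, ← ENNReal.ofReal_toReal hfin.ne]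
      exact ENNReal.ofReal_le_ofReal hd1)
    (by
      rw [hd0, ← ENNReal.ofReal_toReal htf.ne]
      exact ENNReal.ofReal_le_ofReal hd2)
    (fun k => (hνe k).trans (ENNReal.ofReal_le_ofReal (by
      have := he0 k
      have := hde k
      gcongr)))
    N m hm
  have h2 := sum_range_recursion (C := 1) (d := d) (m := fun i => ∑ j ∈ Finset.range i, e (j + 1)) hlam1
    (by simp) (fun i => by rw [hd, Finset.sum_range_succ]; ring) N
  have h3 : 0 ≤ d N / (1 - lam s p) := div_nonneg (hdpos N).le (by linarith)
  have h4 : (d 0 + 1 * ∑ j ∈ Finset.range N, e (j + 1)) / (1 - lam s p) ≤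
      (d₀ + ∑' k, e (k + 1)) / (1 - lam s p) := by
    apply div_le_div_of_nonneg_right _ (by linarith)
    rw [one_mul, hd0]
    linarith [hes.sum_le_tsum (Finset.range N) fun i _ => he0 (i + 1)]
  rw [hd0] at h1
  linarith

lemma tailFn_eq (w : Rn n → ℝ) (z : Rn n) (r : ℝ) :
    tailFn n s p w z r = (ENNReal.ofReal (r ^ (s * p)) *
      ∫⁻ y in (ball z r)ᶜ, ENNReal.ofReal (|w y| ^ (p - 1)) * J n s p z y) ^ (1 / (p - 1)) := by
  unfold tailFn J
  congr 2
  apply lintegral_congr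
  intro y
  rw [← ENNReal.ofReal_mul (by positivity), Real.rpow_neg (norm_nonneg _), div_eq_mul_inv,
    norm_sub_rev]

/-- The precise representative of `u` exists and is controlled from below by the Wolff
potential. -/
lemma precise_rep (P : Par n s p β Q) {L : ℝ} (hL : 0 < L) :
    ∃ C : ℝ, 0 < C ∧ ∀ (Ω : Set (Rn n)) (ν : Measure (Rn n)) [IsFiniteMeasure ν] (u : Rn n → ℝ)
      (v f : ℕ → Rn n → ℝ), Lim n s p Q L Ω ν u v f → ∀ (z : Rn n) (R : ℝ), 0 < R →
      ball z R ⊆ Ω → (∀ᵐ x, x ∈ ball z R → 0 ≤ u x) →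
      (∃ l : ℝ, Tendsto (fun t => ballAvg n u z t) (𝓝[>] 0) (𝓝 l) ∧
        wolff n s p ν z (R / 4) < ⊤ ∧ wolff n s p ν z (R / 4) ≤ ENNReal.ofReal (C * l) +
          ENNReal.ofReal C * tailFn n s p (fun x => max (-u x) 0) z R) ∨
      (Tendsto (fun t => ballAvg n u z t) (𝓝[>] 0) atTop ∧ wolff n s p ν z (R / 4) = ⊤) := by
  obtain ⟨C, hC, hlev⟩ := exists_levels P hL
  obtain ⟨C', hC', hwolff⟩ := wolff_le (n := n) P.hp P.hspn hC
  have hγ : 0 < p - 1 := by linarith [P.hp]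
  have hω := omega_pos n
  refine ⟨C' * C, by positivity, ?_⟩
  intro Ω ν _ u v f H z R hR hΩ hu
  obtain ⟨T, hT⟩ : ∃ T : ℝ≥0∞, T = tailFn n s p (fun x => max (-u x) 0) z R := ⟨_, rfl⟩
  have hI : ∫⁻ y in (ball z R)ᶜ, ENNReal.ofReal (max (-u y) 0 ^ (p - 1)) * J n s p z y < ⊤ := by
    refine (lintegral_mono fun y => ?_).trans_lt (H.tail_fin z R hR)
    gcongr
    exact max_le (neg_le_abs _) (abs_nonneg _)
  have hT' : T ^ (p - 1) = ENNReal.ofReal (R ^ (s * p)) *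
      ∫⁻ y in (ball z R)ᶜ, ENNReal.ofReal (max (-u y) 0 ^ (p - 1)) * J n s p z y := by
    rw [hT, tailFn_eq, ← ENNReal.rpow_mul, one_div_mul_cancel hγ.ne', ENNReal.rpow_one]
    simp_rw [abs_of_nonneg (le_max_right (-u _) 0)]
  have hTfin : T ≠ ⊤ := by
    intro h
    rw [h, ENNReal.top_rpow_of_pos hγ] at hT'
    exact (ENNReal.mul_lt_top ENNReal.ofReal_lt_top hI).ne hT'.symm
  have hTt : ENNReal.ofReal T.toReal = T := ENNReal.ofReal_toReal hTfin
  have hbase : ∫⁻ y in (ball z R)ᶜ, ENNReal.ofReal (max (-u y) 0 ^ (p - 1)) * J n s p z y ≤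
      ENNReal.ofReal (R ^ (-(s * p)) * T.toReal ^ (p - 1)) := by
    rw [ENNReal.ofReal_mul (by positivity), ← ENNReal.ofReal_rpow_of_nonneg ENNReal.toReal_nonneg
      hγ.le, hTt, hT', ← mul_assoc, ← ENNReal.ofReal_mul (by positivity), ← Real.rpow_add hR,
      neg_add_cancel, Real.rpow_zero, ENNReal.ofReal_one, one_mul]
  obtain ⟨m, D, hm, hD, hmu, h_int, hν, hsum⟩ :=
    hlev Ω ν u v f H z R T.toReal hR hΩ ENNReal.toReal_nonneg hu hbase
  obtain ⟨ι, hι, hscale⟩ := exists_scale (show 0 < R / 4 by positivity)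
  have havg : ∀ᶠ t in 𝓝[>] (0 : ℝ), m (ι t + 1) ≤ ballAvg n u z t ∧
      ballAvg n u z t ≤ m (ι t) + C * 16 ^ n / omega n * D (ι t) := by
    filter_upwards [Ioc_mem_nhdsGT (show 0 < R / 4 by positivity)] with t ht
    obtain ⟨h1, h2⟩ := hscale t ht.1 ht.2
    generalize ι t = i at h1 h2
    rw [div_div, ← pow_succ'] at h1 h2
    have ht0 := ht.1
    have hDi := hD i
    have hsub : ball z t ⊆ ball z (R / 4 ^ (i + 1)) := ball_subset_ball h2
    have hsub' : ball z (R / 4 ^ (i + 1)) ⊆ ball z (R / 4 ^ i) :=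
      ball_subset_ball (by gcongr <;> simp)
    have hi := H.integrableOn P.hQ1 z ht0
    refine ⟨le_ballAvg P.hn ht0 hi ((hmu (i + 1)).mono fun x hx hxS => hx (hsub hxS)), ?_⟩
    refine (ballAvg_le P.hn ht0 (by positivity) hi
      ((hmu i).mono fun x hx hxS => hx (hsub' (hsub hxS)))
      ((lintegral_mono_set hsub).trans (h_int i))).trans ?_
    have h3 : R / 4 ^ i ≤ 16 * t := by
      have : R / 4 ^ i = 16 * (R / 4 ^ (i + 1 + 1)) := by field_simp; ring
      linarith
    have h4 : (R / 4 ^ i) ^ n ≤ 16 ^ n * t ^ n := by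
      rw [← mul_pow]
      exact pow_le_pow_left₀ (by positivity) h3 n
    have h5 : C * ((R / 4 ^ i) ^ n * D i) / (omega n * t ^ n) ≤ C * 16 ^ n / omega n * D i := by
      rw [div_le_iff₀ (by positivity)]
      have : C * 16 ^ n / omega n * D i * (omega n * t ^ n) = C * ((16 ^ n * t ^ n) * D i) := by
        field_simp
      rw [this]
      gcongr
    linarith
  by_cases hb : BddAbove (range m)
  · left
    have hml := tendsto_atTop_ciSup hm hb
    have hle : ∀ N, m N ≤ ⨆ i, m i := fun N => le_ciSup hb N
    generalize (⨆ i, m i) = l at hml hle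
    have hS : ∀ N, ∑ i ∈ Finset.range N, D i ≤ C * (l + T.toReal) := fun N =>
      (hsum N).trans (mul_le_mul_of_nonneg_left (by linarith [hle N]) hC.le)
    have hD0 : Tendsto D atTop (𝓝 0) :=
      (summable_of_sum_range_le hD hS).tendsto_atTop_zero
    refine ⟨l, ?_, (hwolff ν z R _ D hR hD hS hν).trans_lt ENNReal.ofReal_lt_top, ?_⟩
    · refine tendsto_of_tendsto_of_tendsto_of_le_of_le'
        (((tendsto_add_atTop_iff_nat 1).2 hml).comp hι)
        (?_ : Tendsto (fun t => m (ι t) + C * 16 ^ n / omega n * D (ι t)) _ _)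
        (havg.mono fun t ht => ht.1) (havg.mono fun t ht => ht.2)
      have := (hml.add (hD0.const_mul (C * 16 ^ n / omega n))).comp hι
      rw [mul_zero, add_zero] at this
      exact this
    · refine (hwolff ν z R _ D hR hD hS hν).trans ?_
      have h1 : ENNReal.ofReal (C' * C) * T = ENNReal.ofReal (C' * C * T.toReal) := by
        rw [ENNReal.ofReal_mul (p := C' * C) (by positivity), hTt]
      have h2 : C' * (C * (l + T.toReal)) = C' * C * l + C' * C * T.toReal := by ring
      rw [← hT, h1, h2]
      exact ENNReal.ofReal_add_le
  · right
    have hmt : Tendsto m atTop atTop := tendsto_atTop_atTop_of_monotone hm fun b => by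
      by_contra! h
      exact hb ⟨b, by rintro _ ⟨i, rfl⟩; exact (h i).le⟩
    refine ⟨tendsto_atTop_mono' _ (havg.mono fun t ht => ht.1)
      (((tendsto_add_atTop_iff_nat 1).2 hmt).comp hι), ?_⟩
    by_contra hW
    obtain ⟨M, hM⟩ := ae_le_bound_of_wolff_lt_top P hL H (show 0 < R / 4 by positivity)
      ((ball_subset_ball (by linarith)).trans hΩ) (lt_top_iff_ne_top.2 hW)
    obtain ⟨i, hi⟩ := (((tendsto_add_atTop_iff_nat 1).2 hmt).eventually_gt_atTop M).exists
    refine hi.not_ge (hM (2 * i) _ ?_)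
    have : R / 4 / 2 ^ (2 * i) = R / 4 ^ (i + 1) := by
      rw [pow_mul, show (2 : ℝ) ^ 2 = 4 by norm_num, div_div, ← pow_succ']
    rw [this]
    exact hmu (i + 1)

end PreciseRep

section SOLA

variable {n : ℕ} {s p Q Λ : ℝ}

lemma negPart_eq_zero {μ : SignedMeasure (Rn n)} (hμ : ∀ A, MeasurableSet A → 0 ≤ μ A) :
    μ.toJordanDecomposition.negPart = 0 := by
  obtain ⟨i, hi₁, -, hi₃, -, hneg⟩ := μ.toJordanDecomposition_spec
  ext A hA
  rw [hneg, SignedMeasure.toMeasureOfLEZero_apply _ _ _ hA]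
  simpa [← NNReal.coe_eq_zero] using
    le_antisymm ((VectorMeasure.nonpos_of_restrict_le_zero _
      (VectorMeasure.restrict_le_zero_subset _ hi₁.compl inter_subset_left hi₃)))
      (hμ _ (hi₁.compl.inter hA))

/-- Local lower semicontinuity of the mass of the approximating data. -/
lemma measure_ball_le_liminf {Ω : Set (Rn n)} {μ : SignedMeasure (Rn n)} {f : ℕ → Rn n → ℝ}
    (hμ : ∀ A, MeasurableSet A → 0 ≤ μ A) (hfc : ∀ j, Continuous (f j))
    (hf0 : ∀ j x, 0 ≤ f j x)
    (hconv : ∀ φ : Rn n → ℝ, Continuous φ → HasCompactSupport φ → tsupport φ ⊆ Ω →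
      Tendsto (fun j => ∫ x : Rn n, φ x * f j x) atTop (𝓝 (sintegral n μ φ)))
    {z : Rn n} {r : ℝ} (hΩ : ball z r ⊆ Ω) :
    μ.totalVariation (ball z r) ≤
      liminf (fun j => ∫⁻ x in ball z r, ENNReal.ofReal (f j x)) atTop := by
  have hneg := negPart_eq_zero hμ
  have hpos : μ.totalVariation = μ.toJordanDecomposition.posPart := by
    rw [SignedMeasure.totalVariation, hneg, add_zero]
  rw [isOpen_ball.measure_eq_iSup_isCompact]
  refine iSup₂_le fun k hk => iSup_le fun hkc => ?_
  obtain ⟨φ, hφ1, hφc, hφs, hφ⟩ := exists_continuousMap_one_of_isCompact_subset_isOpen hkc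
    isOpen_ball hk
  have h_int : sintegral n μ φ = ∫ x, φ x ∂μ.totalVariation := by
    rw [sintegral, hneg, hpos, integral_zero_measure, sub_zero]
  have h1 := hconv φ φ.continuous hφc (hφs.trans hΩ)
  rw [h_int] at h1
  have h2 : μ.totalVariation k ≤ ENNReal.ofReal (∫ x, φ x ∂μ.totalVariation) := by
    rw [ofReal_integral_eq_lintegral_ofReal (φ.continuous.integrable_of_hasCompactSupport hφc)
      (ae_of_all _ fun x => (hφ x).1), ← setLIntegral_one]
    refine (setLIntegral_mono' hkc.measurableSet fun x hx => ?_).trans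
      (setLIntegral_le_lintegral _ _)
    simp [hφ1 hx]
  refine h2.trans ?_
  rw [← (ENNReal.tendsto_ofReal h1).liminf_eq]
  refine liminf_le_liminf (Eventually.of_forall fun j => ?_)
  have hi : Integrable fun x => φ x * f j x :=
    (φ.continuous.mul (hfc j)).integrable_of_hasCompactSupport (HasCompactSupport.mul_right hφc)
  rw [ofReal_integral_eq_lintegral_ofReal hi
    (ae_of_all _ fun x => mul_nonneg (hφ x).1 (hf0 j x)), ← lintegral_indicator measurableSet_ball]
  refine lintegral_mono fun x => ?_
  by_cases hx : x ∈ ball z r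
  · rw [indicator_of_mem hx]
    exact ENNReal.ofReal_le_ofReal (mul_le_of_le_one_left (hf0 j x) (hφ x).2)
  · have : φ x = 0 := image_eq_zero_of_notMem_tsupport fun h => hx (hφs h)
    simp [this]

/-- On bounded sets, convergence in `L^Q` implies convergence in `L^γ` for `γ ≤ Q`. -/
lemma tendsto_lintegral_rpow_of_le {γ : ℝ} (hγ : 0 < γ) (hγQ : γ ≤ Q) {S : Set (Rn n)}
    (hS : volume S < ⊤) {w : ℕ → Rn n → ℝ}
    (h : Tendsto (fun j => ∫⁻ x in S, ENNReal.ofReal (|w j x| ^ Q)) atTop (𝓝 0)) :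
    Tendsto (fun j => ∫⁻ x in S, ENNReal.ofReal (|w j x| ^ γ)) atTop (𝓝 0) := by
  rw [ENNReal.tendsto_nhds_zero]
  intro ε hε
  obtain ⟨d, hd, hdε⟩ := ENNReal.exists_nnreal_pos_mul_lt
    (ENNReal.add_lt_top.2 ⟨hS, ENNReal.one_lt_top⟩).ne hε.ne'
  obtain ⟨c, hc⟩ : ∃ c : ℝ, c = d / (d : ℝ) ^ (Q / γ) := ⟨_, rfl⟩
  have hd' : (0 : ℝ) < d := hd
  have hc0 : 0 < c := by rw [hc]; positivity
  have hpt : ∀ t : ℝ, ENNReal.ofReal (|t| ^ γ) ≤ d + ENNReal.ofReal c * ENNReal.ofReal (|t| ^ Q) := by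
    intro t
    have h1 := abs_le_add_rpow ((one_le_div hγ).2 hγQ) hd' (|t| ^ γ)
    rw [abs_of_nonneg (by positivity), ← Real.rpow_mul (abs_nonneg _), mul_div_cancel₀ _ hγ.ne',
      ← hc] at h1
    rw [← ENNReal.ofReal_mul hc0.le, ← ENNReal.ofReal_coe_nnreal (p := d),
      ← ENNReal.ofReal_add hd'.le (by positivity)]
    exact ENNReal.ofReal_le_ofReal h1
  have h2 : Tendsto (fun j => ENNReal.ofReal c * ∫⁻ x in S, ENNReal.ofReal (|w j x| ^ Q)) atTop
      (𝓝 0) := by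
    have := ENNReal.Tendsto.const_mul h (Or.inr (ENNReal.ofReal_ne_top (r := c)))
    rwa [mul_zero] at this
  filter_upwards [h2.eventually (eventually_le_nhds (ENNReal.coe_pos.2 hd))] with j hj
  refine le_trans ?_ hdε.le
  calc ∫⁻ x in S, ENNReal.ofReal (|w j x| ^ γ)
      ≤ ∫⁻ x in S, (d + ENNReal.ofReal c * ENNReal.ofReal (|w j x| ^ Q)) :=
        lintegral_mono fun x => hpt _
    _ = d * volume S + ENNReal.ofReal c * ∫⁻ x in S, ENNReal.ofReal (|w j x| ^ Q) := by
        rw [lintegral_add_left measurable_const, setLIntegral_const,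
          lintegral_const_mul' _ _ ENNReal.ofReal_ne_top]
    _ ≤ d * volume S + d := by gcongr
    _ = d * (volume S + 1) := by rw [mul_add, mul_one]

lemma J_le_of_notMem_ball (hsp : 0 ≤ s * p) {z y : Rn n} {r : ℝ} (hr : 0 < r)
    (hy : y ∈ (ball z r)ᶜ) : J n s p z y ≤ ENNReal.ofReal (r ^ (-((n : ℝ) + s * p))) := by
  have h : r ≤ ‖z - y‖ := by
    rw [mem_compl_iff, mem_ball, not_lt, dist_comm, dist_eq_norm] at hy
    exact hy
  exact ENNReal.ofReal_le_ofReal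
    (Real.rpow_le_rpow_of_nonpos hr h (neg_nonpos.2 (by positivity)))

lemma tendsto_lintegral_of_tendsto_tailFn (hp : 1 < p) {w : ℕ → Rn n → ℝ} {z : Rn n} {r : ℝ}
    (hr : 0 < r) (h : Tendsto (fun j => tailFn n s p (w j) z r) atTop (𝓝 0)) :
    Tendsto (fun j => ∫⁻ y in (ball z r)ᶜ, ENNReal.ofReal (|w j y| ^ (p - 1)) * J n s p z y) atTop
      (𝓝 0) := by
  have hγ : 0 < p - 1 := by linarith
  have h1 : ∀ j, ∫⁻ y in (ball z r)ᶜ, ENNReal.ofReal (|w j y| ^ (p - 1)) * J n s p z y =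
      ENNReal.ofReal (r ^ (-(s * p))) * tailFn n s p (w j) z r ^ (p - 1) := by
    intro j
    rw [tailFn_eq, ← ENNReal.rpow_mul, one_div_mul_cancel hγ.ne', ENNReal.rpow_one, ← mul_assoc,
      ← ENNReal.ofReal_mul (by positivity), ← Real.rpow_add hr, neg_add_cancel, Real.rpow_zero,
      ENNReal.ofReal_one, one_mul]
  simp_rw [h1]
  have h2 := (ENNReal.continuous_rpow_const (y := p - 1)).continuousAt.tendsto.comp h
  have h3 := ENNReal.Tendsto.const_mul h2
    (Or.inr (ENNReal.ofReal_ne_top (r := r ^ (-(s * p)))))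
  rwa [ENNReal.zero_rpow_of_pos hγ, mul_zero] at h3

/-- Convergence of tails, from local convergence and convergence of the exterior data. -/
lemma tendsto_tail (hp : 1 < p) (hs : 0 < s) (hQ : p - 1 ≤ Q) {Ω : Set (Rn n)}
    (hΩ : Bornology.IsBounded Ω) {w e : ℕ → Rn n → ℝ}
    (hw : ∀ z r, 0 < r →
      Tendsto (fun j => ∫⁻ x in ball z r, ENNReal.ofReal (|w j x| ^ Q)) atTop (𝓝 0))
    (he : ∀ z r, 0 < r → Tendsto (fun j => tailFn n s p (e j) z r) atTop (𝓝 0))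
    (hwe : ∀ j, ∀ᵐ x, x ∉ Ω → w j x = e j x) (z : Rn n) {r : ℝ} (hr : 0 < r) :
    Tendsto (fun j => ∫⁻ y in (ball z r)ᶜ, ENNReal.ofReal (|w j y| ^ (p - 1)) * J n s p z y) atTop
      (𝓝 0) := by
  obtain ⟨ρ, hρ0, hρ⟩ := hΩ.subset_ball_lt 0 z
  have h1 := tendsto_lintegral_of_tendsto_tailFn hp hρ0 (he z ρ hρ0)
  have h2 := tendsto_lintegral_rpow_of_le (by linarith : 0 < p - 1) hQ measure_ball_lt_top
    (hw z ρ hρ0)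
  have h3 := (ENNReal.Tendsto.const_mul h2
    (Or.inr (ENNReal.ofReal_ne_top (r := r ^ (-((n : ℝ) + s * p)))))).add h1
  rw [mul_zero, add_zero] at h3
  refine tendsto_of_tendsto_of_tendsto_of_le_of_le tendsto_const_nhds h3 (fun _ => zero_le)
    fun j => ?_
  have h4 : (ball z r)ᶜ ⊆ ((ball z r)ᶜ ∩ ball z ρ) ∪ (ball z ρ)ᶜ := fun x hx => by
    by_cases h : x ∈ ball z ρ
    · exact Or.inl ⟨hx, h⟩
    · exact Or.inr h
  refine (lintegral_mono_set h4).trans ((lintegral_union_le _ _ _).trans (add_le_add ?_ ?_))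
  · rw [← lintegral_const_mul' _ _ ENNReal.ofReal_ne_top]
    refine (setLIntegral_mono' (measurableSet_ball.compl.inter measurableSet_ball)
      fun x hx => ?_).trans (lintegral_mono_set inter_subset_right)
    rw [mul_comm]
    gcongr
    exact J_le_of_notMem_ball (by positivity) hr hx.1
  · refine lintegral_mono_ae ((ae_restrict_iff' measurableSet_ball.compl).2 ?_)
    filter_upwards [hwe j] with x hx hxρ
    rw [hx fun h => hxρ (hρ h)]

lemma ofReal_abs_rpow_le_one_add {γ : ℝ} (hγ : 0 ≤ γ) (hγp : γ ≤ p) (t : ℝ) :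
    ENNReal.ofReal (|t| ^ γ) ≤ 1 + ENNReal.ofReal (|t| ^ p) := by
  rw [← ENNReal.ofReal_one, ← ENNReal.ofReal_add zero_le_one (by positivity)]
  apply ENNReal.ofReal_le_ofReal
  rcases le_total |t| 1 with h | h
  · have := Real.rpow_le_one (abs_nonneg t) h hγ
    have := Real.rpow_nonneg (abs_nonneg t) p
    linarith
  · have := Real.rpow_le_rpow_of_exponent_le h hγp
    linarith

lemma lintegral_rpow_mul_lt_top {γ : ℝ} (hγ : 0 ≤ γ) (hγp : γ ≤ p) {v : Rn n → ℝ}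
    (hv : ∫⁻ x, ENNReal.ofReal (|v x| ^ p) < ⊤) {S : Set (Rn n)} (hS : MeasurableSet S)
    {k : Rn n → ℝ≥0∞} (hkm : Measurable k) (hk : ∫⁻ x in S, k x < ⊤) {c : ℝ≥0∞} (hc : c ≠ ⊤)
    (hkc : ∀ x ∈ S, k x ≤ c) :
    ∫⁻ x in S, ENNReal.ofReal (|v x| ^ γ) * k x < ⊤ := by
  calc ∫⁻ x in S, ENNReal.ofReal (|v x| ^ γ) * k x
      ≤ ∫⁻ x in S, (k x + c * ENNReal.ofReal (|v x| ^ p)) := by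
        refine setLIntegral_mono' hS fun x hx => ?_
        calc ENNReal.ofReal (|v x| ^ γ) * k x ≤ (1 + ENNReal.ofReal (|v x| ^ p)) * k x := by
              gcongr
              exact ofReal_abs_rpow_le_one_add hγ hγp _
          _ = k x + k x * ENNReal.ofReal (|v x| ^ p) := by ring
          _ ≤ k x + c * ENNReal.ofReal (|v x| ^ p) := by
              gcongr
              exact hkc x hx
    _ = (∫⁻ x in S, k x) + c * ∫⁻ x in S, ENNReal.ofReal (|v x| ^ p) := by
        rw [lintegral_add_left hkm, lintegral_const_mul' _ _ hc]
    _ < ⊤ := ENNReal.add_lt_top.2 ⟨hk, ENNReal.mul_lt_top hc.lt_top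
        ((setLIntegral_le_lintegral _ _).trans_lt hv)⟩

lemma lintegral_rpow_mul_lt_top_of_tendsto {γ : ℝ} (hγ : 0 ≤ γ) (hγp : γ ≤ p) {u : Rn n → ℝ}
    {v : ℕ → Rn n → ℝ} (hvm : ∀ j, Measurable (v j))
    (hv : ∀ j, ∫⁻ x, ENNReal.ofReal (|v j x| ^ p) < ⊤) {S : Set (Rn n)} (hS : MeasurableSet S)
    {k : Rn n → ℝ≥0∞} (hkm : Measurable k) (hk : ∫⁻ x in S, k x < ⊤) {c : ℝ≥0∞} (hc : c ≠ ⊤)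
    (hkc : ∀ x ∈ S, k x ≤ c)
    (hconv : Tendsto (fun j => ∫⁻ x in S, ENNReal.ofReal (|v j x - u x| ^ γ) * k x) atTop (𝓝 0)) :
    ∫⁻ x in S, ENNReal.ofReal (|u x| ^ γ) * k x < ⊤ := by
  obtain ⟨j, hj⟩ := (hconv.eventually (eventually_lt_nhds ENNReal.zero_lt_top)).exists
  have hvj := hvm j
  calc ∫⁻ x in S, ENNReal.ofReal (|u x| ^ γ) * k x
      ≤ ∫⁻ x in S, ENNReal.ofReal (2 ^ γ) * (ENNReal.ofReal (|v j x| ^ γ) * k x +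
          ENNReal.ofReal (|v j x - u x| ^ γ) * k x) := by
        refine lintegral_mono fun x => ?_
        beta_reduce
        rw [← add_mul, ← mul_assoc, abs_sub_comm (v j x)]
        gcongr
        exact ofReal_abs_rpow_le hγ _ _
    _ = ENNReal.ofReal (2 ^ γ) * ((∫⁻ x in S, ENNReal.ofReal (|v j x| ^ γ) * k x) +
          ∫⁻ x in S, ENNReal.ofReal (|v j x - u x| ^ γ) * k x) := by
        rw [lintegral_const_mul' _ _ ENNReal.ofReal_ne_top]
        congr 1
        exact lintegral_add_left (by fun_prop) _
    _ < ⊤ := ENNReal.mul_lt_top ENNReal.ofReal_lt_top (ENNReal.add_lt_top.2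
        ⟨lintegral_rpow_mul_lt_top hγ hγp (hv j) hS hkm hk hc hkc, hj⟩)

lemma exists_lim (hn : 2 ≤ n) (hs : 0 < s) (hs1 : s < 1) (hp : 1 < p) (hΛ : 1 ≤ Λ)
    (hQ : qStar p ≤ Q) (hQ' : Q < qBar n s p) {Φ : ℝ → ℝ} {K : Rn n → Rn n → ℝ} {Ω : Set (Rn n)}
    {μ : SignedMeasure (Rn n)} {g u : Rn n → ℝ} {uj μj gj : ℕ → Rn n → ℝ}
    (hK : KernelBounds n Λ s p K) (hΦ : PhiBounds Λ p Φ) (hΩ : Bornology.IsBounded Ω)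
    (hμ : ∀ A, MeasurableSet A → 0 ≤ μ A) (hext : ∀ᵐ x : Rn n, x ∉ Ω → u x = g x)
    (H : SOLAApprox n Φ K s p Ω μ g u uj μj gj) (hμj : ∀ j x, 0 ≤ μj j x) :
    ∃ (w : Rn n → ℝ) (v : ℕ → Rn n → ℝ), w =ᵐ[volume] u ∧
      Lim n s p Q (Λ ^ 4) Ω μ.totalVariation w v μj := by
  obtain ⟨hμs, -, hsol, hae, hLq, hweak, hmass, hg⟩ := H
  have hQ1 : 1 ≤ Q := (le_max_left _ _).trans hQ
  have hQp1 : p - 1 ≤ Q := (le_max_right _ _).trans hQ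
  have hQp : Q ≤ p := hQ'.le.trans (min_le_right _ _)
  have hsp : 0 ≤ s * p := by positivity
  have hjm : ∀ j, AEMeasurable (uj j) := fun j => by
    have := (hsol j).1.1
    rwa [Measure.restrict_univ] at this
  have hum : AEMeasurable u := aemeasurable_of_tendsto_metrizable_ae atTop hjm hae
  obtain ⟨w, hw⟩ : ∃ w, w = hum.mk u := ⟨_, rfl⟩
  obtain ⟨v, hv⟩ : ∃ v : ℕ → Rn n → ℝ, v = fun j => (hjm j).mk (uj j) := ⟨_, rfl⟩
  have hwm : Measurable w := hw ▸ hum.measurable_mk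
  have hwu : w =ᵐ[volume] u := hw ▸ hum.ae_eq_mk.symm
  have hvm : ∀ j, Measurable (v j) := fun j => hv ▸ (hjm j).measurable_mk
  have hvu : ∀ j, v j =ᵐ[volume] uj j := fun j => hv ▸ (hjm j).ae_eq_mk.symm
  clear hw hv
  have hvp : ∀ j, ∫⁻ x, ENNReal.ofReal (|v j x| ^ p) < ⊤ := fun j => by
    have := (hsol j).1.2.1
    rw [Measure.restrict_univ] at this
    rwa [lintegral_congr_ae ((hvu j).mono fun x hx => by rw [hx])]
  have hconv : ∀ z r, 0 < r → Tendsto (fun j => ∫⁻ x in ball z r,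
      ENNReal.ofReal (|v j x - w x| ^ Q)) atTop (𝓝 0) := fun z r hr => by
    refine (hLq Q hQ hQ' z r hr).congr fun j => lintegral_congr_ae (ae_restrict_of_ae ?_)
    filter_upwards [hvu j, hwu] with x h1 h2
    rw [h1, h2]
  have htail : ∀ z r, 0 < r → Tendsto (fun j => ∫⁻ y in (ball z r)ᶜ,
      ENNReal.ofReal (|v j y - w y| ^ (p - 1)) * J n s p z y) atTop (𝓝 0) := fun z r hr => by
    refine tendsto_tail hp hs hQp1 hΩ (w := fun j x => v j x - w x)
      (e := fun j x => gj j x - g x) hconv (fun z r hr => (hg z r hr).2) (fun j => ?_) z hr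
    filter_upwards [hvu j, hwu, hext, (hsol j).2.1] with x h1 h2 h3 h4 hx
    rw [h1, h2, h3 hx, h4 hx]
  refine ⟨w, v, hwu, hwm, fun j z R h => ?_, fun j z R h => ?_, hconv, htail, fun z r hr => ?_,
    fun z r hr => ?_, fun z r _ h => ?_, fun z r hr => ?_⟩
  · exact (isSub_isSup_of_weakSol hn hs hs1 hp hΛ hK hΦ (hμs j).1.continuous (hμs j).2 (hμj j)
      (hsol j) (hvm j) (hvu j) h).1
  · exact (isSub_isSup_of_weakSol hn hs hs1 hp hΛ hK hΦ (hμs j).1.continuous (hμs j).2 (hμj j)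
      (hsol j) (hvm j) (hvu j) h).2
  · have := lintegral_rpow_mul_lt_top_of_tendsto (by linarith) hQp hvm hvp
      (measurableSet_ball (x := z) (ε := r)) (k := fun _ => 1) measurable_const
      (by rw [setLIntegral_one]; exact measure_ball_lt_top) ENNReal.one_ne_top
      (fun _ _ => le_rfl) (by simpa only [mul_one] using hconv z r hr)
    simpa only [mul_one] using this
  · obtain ⟨C, -, hC⟩ := exists_lintegral_compl_ball_J_le (n := n) hn hs hs1 (by linarith : 0 < p)
    exact lintegral_rpow_mul_lt_top_of_tendsto (by linarith) (by linarith) hvm hvp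
      measurableSet_ball.compl (measurable_J_comp n s p measurable_const measurable_id)
      ((hC z r hr).trans_lt ENNReal.ofReal_lt_top) ENNReal.ofReal_ne_top
      (fun y hy => J_le_of_notMem_ball hsp hr hy) (htail z r hr)
  · exact measure_ball_le_liminf hμ (fun j => (hμs j).1.continuous) hμj hweak h
  · have := hmass z r hr
    simp_rw [abs_of_nonneg (hμj _ _)] at this
    exact this

end SOLA

/-- Admissible exponents `β` and `Q` exist. -/
lemma exists_par {n : ℕ} {s p : ℝ} (hn : 2 ≤ n) (hs : 0 < s) (hs1 : s < 1)
    (hp : 2 - s / (n : ℝ) < p) (hpn : p < (n : ℝ) / s) :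
    ∃ β Q : ℝ, Par n s p β Q ∧ qStar p ≤ Q ∧ Q < qBar n s p := by
  have hn2 : (2 : ℝ) ≤ n := by exact_mod_cast hn
  have hn0 : (0 : ℝ) < n := by linarith
  have hspn : s * p < n := by rwa [lt_div_iff₀ hs, mul_comm] at hpn
  have hpn' : (2 * n - s : ℝ) < n * p := by
    have h : 2 - s / (n : ℝ) = (2 * n - s) / n := by field_simp
    rw [h, div_lt_iff₀ hn0] at hp
    linarith
  have hp1 : 1 < p := by
    by_contra! h
    nlinarith [mul_le_mul_of_nonneg_left h hn0.le]
  have hns : 0 < (n : ℝ) - s := by linarith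
  have hsp : 0 < s * p := by positivity
  have hc : Continuous fun β : ℝ => max 1 (β * (p - 1)) := by fun_prop
  have h1 : ∀ᶠ β : ℝ in 𝓝 1, max 1 (β * (p - 1)) * (n - s * p) < (p - β) * n := by
    refine ContinuousAt.eventually_lt (by fun_prop) (by fun_prop) ?_
    rw [one_mul]
    rcases max_choice 1 (p - 1) with h | h <;> rw [h]
    · nlinarith
    · nlinarith [mul_pos (sub_pos.2 hp1) hsp]
  have h2 : ∀ᶠ β : ℝ in 𝓝 1, max 1 (β * (p - 1)) < qBar n s p := by
    refine ContinuousAt.eventually_lt (by fun_prop) continuousAt_const ?_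
    rw [one_mul]
    refine max_lt (lt_min ?_ hp1) (lt_min ?_ (by linarith))
    · rw [lt_div_iff₀ hns]
      linarith
    · rw [lt_div_iff₀ hns]
      nlinarith
  have h3 : ∀ᶠ β : ℝ in 𝓝 1, β < p := eventually_lt_nhds hp1
  obtain ⟨β, ⟨⟨hβ1, hβ2⟩, hβ3⟩, hβ⟩ :=
    (((h1.and h2).and h3).filter_mono nhdsWithin_le_nhds |>.and (self_mem_nhdsWithin (s := Ioi (1 : ℝ)))).exists
  have hββ : p - 1 ≤ β * (p - 1) := le_mul_of_one_le_left (by linarith) (le_of_lt hβ)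
  exact ⟨β, max 1 (β * (p - 1)),
    ⟨hn, hs, hs1, hp1, hspn, hβ, hβ3, le_max_left _ _, hββ.trans (le_max_right _ _),
      le_max_right _ _, hβ1⟩, max_le_max le_rfl hββ, hβ2⟩

lemma ballAvg_congr {n : ℕ} {w u : Rn n → ℝ} (h : w =ᵐ[volume] u) (z : Rn n) (t : ℝ) :
    ballAvg n w z t = ballAvg n u z t :=
  average_congr (ae_restrict_of_ae h)

lemma tailFn_congr {n : ℕ} {s p : ℝ} {w u : Rn n → ℝ} (h : w =ᵐ[volume] u) (z : Rn n) (r : ℝ) :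
    tailFn n s p w z r = tailFn n s p u z r := by
  unfold tailFn
  congr 2
  exact lintegral_congr_ae (ae_restrict_of_ae (h.mono fun x hx => by beta_reduce; rw [hx]))

end NonlocalWolff

open NonlocalWolff

/-- Theorem 1.3, Potential lower bound and fine properties. -/
theorem potential_lower_bound
    (n : ℕ) (s p Λ : ℝ)
    (hn : 2 ≤ n) (hs : 0 < s) (hs1 : s < 1) (hp : 2 - s / (n : ℝ) < p)
    (hpn : p < (n : ℝ) / s) (hΛ : 1 ≤ Λ) :
    ∃ c : ℝ, 0 < c ∧
      ∀ (Φ : ℝ → ℝ) (K : Rn n → Rn n → ℝ) (Ω : Set (Rn n))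
        (μ : MeasureTheory.SignedMeasure (Rn n)) (g u : Rn n → ℝ) (x₀ : Rn n) (r : ℝ),
        KernelBounds n Λ s p K → PhiBounds Λ p Φ →
        IsOpen Ω → Bornology.IsBounded Ω → BoundaryDatum n s p g →
        -- μ is a nonnegative measure
        (∀ A : Set (Rn n), MeasurableSet A → 0 ≤ μ A) →
        -- u is a SOLA whose approximating data μ_j are nonnegative functions
        (∀ h q : ℝ, 0 < h → h < s → qStar p ≤ q → q < qBar n s p → memWsp n h q Ω u) →
        (∀ φ : Rn n → ℝ, IsTestFun n Ω φ → nonlocalForm n Φ K u φ = sintegral n μ φ) →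
        (∀ᵐ x : Rn n, x ∉ Ω → u x = g x) →
        (∃ uj μj gj : ℕ → Rn n → ℝ,
          SOLAApprox n Φ K s p Ω μ g u uj μj gj ∧ ∀ j x, 0 ≤ μj j x) →
        0 < r → ball x₀ r ⊆ Ω →
        -- u nonnegative in B_r(x₀)
        (∀ᵐ x : Rn n, x ∈ ball x₀ r → 0 ≤ u x) →
        -- finite Wolff potential: lower bound via the precise representative
        (wolff n s p μ.totalVariation x₀ (r / 8) < ⊤ →
          ∃ L : ℝ,
            Tendsto (fun ρ => ballAvg n u x₀ ρ) (𝓝[>] (0 : ℝ)) (𝓝 L) ∧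
            wolff n s p μ.totalVariation x₀ (r / 8) ≤
              ENNReal.ofReal (c * L) +
                ENNReal.ofReal c *
                  tailFn n s p (fun x => max (-u x) 0) x₀ (r / 2)) ∧
        -- infinite Wolff potential: the averages blow up
        (wolff n s p μ.totalVariation x₀ (r / 8) = ⊤ →
          Tendsto (fun t => ballAvg n u x₀ t) (𝓝[>] (0 : ℝ)) atTop) ∧
        -- consequently, every point of B_r(x₀) is a Lebesgue point of u
        (∀ y ∈ ball x₀ r,
          (∃ L : ℝ, Tendsto (fun t => ballAvg n u y t) (𝓝[>] (0 : ℝ)) (𝓝 L)) ∨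
            Tendsto (fun t => ballAvg n u y t) (𝓝[>] (0 : ℝ)) atTop) := by
  obtain ⟨β, Q, P, hQ, hQ'⟩ := exists_par hn hs hs1 hp hpn
  obtain ⟨c, hc, hrep⟩ := precise_rep P (show 0 < Λ ^ 4 by positivity)
  refine ⟨c, hc, ?_⟩
  rintro Φ K Ω μ g u x₀ r hK hΦ - hΩ - hμ - - hext ⟨uj, μj, gj, happ, hμj⟩ hr hB hu
  obtain ⟨w, v, hwu, H⟩ := exists_lim hn hs hs1 P.hp hΛ hQ hQ' hK hΦ hΩ hμ hext happ hμj
  have key := fun (y : Rn n) (R : ℝ) (hR : 0 < R) (hy : ball y R ⊆ ball x₀ r) =>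
    hrep Ω μ.totalVariation w v μj H y R hR (hy.trans hB)
      (by filter_upwards [hu, hwu] with x h1 h2 h3 using h2 ▸ h1 (hy h3))
  have htail : tailFn n s p (fun x => max (-w x) 0) x₀ (r / 2) =
      tailFn n s p (fun x => max (-u x) 0) x₀ (r / 2) :=
    tailFn_congr (hwu.mono fun x hx => by rw [hx]) _ _
  simp_rw [ballAvg_congr hwu] at key
  have hx₀ := key x₀ (r / 2) (by linarith) (ball_subset_ball (by linarith))
  rw [htail, div_div, show (2 : ℝ) * 4 = 8 by norm_num] at hx₀
  refine ⟨fun hW => ?_, fun hW => ?_, fun y hy => ?_⟩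
  · rcases hx₀ with ⟨l, h1, -, h2⟩ | ⟨-, h⟩
    · exact ⟨l, h1, h2⟩
    · exact absurd h hW.ne
  · rcases hx₀ with ⟨l, -, h, -⟩ | ⟨h, -⟩
    · exact absurd hW h.ne
    · exact h
  · rw [mem_ball] at hy
    rcases key y (r - dist y x₀) (by linarith) (ball_subset_ball' (by linarith)) with
      ⟨l, h, -⟩ | ⟨h, -⟩
    · exact Or.inl ⟨l, h⟩
    · exact Or.inr h
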